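/- Let $1<c<3$ with $c\neq 2$, let $0<\mu<1$, let $\delta>0$ be sufficiently small and let $A>0$ be fixed. Then for all sufficiently large $X$, all real $t$ with $|t|\le X^{2/3-c-\delta}$, and all $Q$ with $X(\log X)^{-A}\le Q\le X$, one has $\sum_{q\le Q}\sum_{\substack{a=1\\(a,q)=1}}^{q}\Big|\sum_{\substack{\mu X<n\le X\\ n\equiv a\pmod q}}\Lambda(n)e(tn^{c})-\frac{1}{\varphi(q)}\int_{\mu X}^{X}e(ty^{c})\,dy\Big|^{2}\ll XQ\log X$, with the implied constant depending only on $c,\mu,\delta,A$. -/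

import Mathlib

open Finset

/-- `e(x) = e^{2πix}`. -/
noncomputable def e (x : ℝ) : ℂ := Complex.exp (2 * Real.pi * Complex.I * x)

lemma norm_e (x : ℝ) : ‖e x‖ = 1 := by
  unfold e
  rw [show (2 * Real.pi * Complex.I * x : ℂ) = ((2 * Real.pi * x : ℝ) : ℂ) * Complex.I by
    push_cast; ring]
  exact Complex.norm_exp_ofReal_mul_I _

lemma e_add (x y : ℝ) : e (x + y) = e x * e y := by
  unfold e
  rw [← Complex.exp_add]; congr 1; push_cast; ring

lemma e_zero : e 0 = 1 := by simp [e]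

lemma e_int (k : ℤ) : e k = 1 := by
  unfold e
  rw [Complex.exp_eq_one_iff]
  exact ⟨k, by push_cast; ring⟩

lemma e_neg (x : ℝ) : e (-x) = (starRingEnd ℂ) (e x) := by
  unfold e
  rw [← Complex.exp_conj]; congr 1; simp [map_ofNat]

lemma e_mul_conj (x y : ℝ) : e x * (starRingEnd ℂ) (e y) = e (x - y) := by
  rw [← e_neg, ← e_add, sub_eq_add_neg]

lemma hasDerivAt_e (a x : ℝ) :
    HasDerivAt (fun y : ℝ => e (a * y)) (2 * Real.pi * Complex.I * a * e (a * x)) x := by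
  unfold e
  have h : HasDerivAt (fun y : ℝ => (2 * Real.pi * Complex.I * (a * y : ℝ) : ℂ))
      (2 * Real.pi * Complex.I * a) x := by
    have := (Complex.ofRealCLM.hasDerivAt (x := x)).const_mul (2 * Real.pi * Complex.I * a : ℂ)
    refine (this.congr_of_eventuallyEq ?_).congr_deriv ?_
    · filter_upwards with y
      simp; ring
    · simp
  have := h.cexp
  refine this.congr_deriv ?_
  ring

lemma continuous_e : Continuous e := by
  unfold e; fun_prop

/-- Exponential polynomial with coefficients `a` supported on `s`. -/
noncomputable def expSum (s : Finset ℕ) (a : ℕ → ℂ) (x : ℝ) : ℂ := ∑ n ∈ s, a n * e ((n : ℝ) * x)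

lemma hasDerivAt_expSum (s : Finset ℕ) (a : ℕ → ℂ) (x : ℝ) :
    HasDerivAt (expSum s a) (expSum s (fun n : ℕ => 2 * Real.pi * Complex.I * n * a n) x) x := by
  unfold expSum
  refine (HasDerivAt.fun_sum (fun (n : ℕ) _ => ((hasDerivAt_e (n : ℝ) x).const_mul (a n)))).congr_deriv ?_
  refine Finset.sum_congr rfl fun n _ => ?_
  push_cast; ring

lemma continuous_expSum (s : Finset ℕ) (a : ℕ → ℂ) : Continuous (expSum s a) := by
  unfold expSum
  exact continuous_finsetSum _ fun n _ => continuous_const.mul (continuous_e.comp (by fun_prop))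

lemma integral_e_int_mul (k : ℤ) : ∫ x in (0 : ℝ)..2, e (k * x) = if k = 0 then 2 else 0 := by
  split_ifs with h
  · subst h; simp [e_zero]
  · have hk : (2 * Real.pi * Complex.I * (k : ℝ) : ℂ) ≠ 0 := by
      simp [Real.pi_ne_zero, Complex.I_ne_zero, h]
    have hd : ∀ x ∈ Set.uIcc (0 : ℝ) 2, HasDerivAt
        (fun y : ℝ => (2 * Real.pi * Complex.I * (k : ℝ) : ℂ)⁻¹ * e (k * y)) (e (k * x)) x := by
      intro x _
      refine ((hasDerivAt_e (k : ℝ) x).const_mul _).congr_deriv ?_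
      rw [← mul_assoc, inv_mul_cancel₀ hk, one_mul]
    rw [intervalIntegral.integral_eq_sub_of_hasDerivAt hd
      ((continuous_e.comp (by fun_prop)).intervalIntegrable _ _)]
    have h2 : e ((k : ℝ) * 2) = 1 := by
      have := e_int (k * 2); push_cast at this; exact this
    rw [h2, mul_zero, e_zero]; ring

lemma integral_norm_sq_expSum (s : Finset ℕ) (a : ℕ → ℂ) :
    ∫ x in (0 : ℝ)..2, ‖expSum s a x‖ ^ 2 = 2 * ∑ n ∈ s, ‖a n‖ ^ 2 := by
  have key : ∀ x : ℝ, ((‖expSum s a x‖ ^ 2 : ℝ) : ℂ)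
      = ∑ n ∈ s, ∑ m ∈ s, a n * (starRingEnd ℂ) (a m) * e (((n : ℤ) - (m : ℤ) : ℤ) * x) := by
    intro x
    rw [← Complex.normSq_eq_norm_sq, ← Complex.mul_conj]
    unfold expSum
    rw [map_sum, Finset.sum_mul_sum]
    refine Finset.sum_congr rfl fun n _ => Finset.sum_congr rfl fun m _ => ?_
    rw [map_mul, show (((n : ℤ) - (m : ℤ) : ℤ) : ℝ) * x = n * x - m * x by push_cast; ring,
      ← e_mul_conj]
    ring
  have h1 : ((∫ x in (0 : ℝ)..2, ‖expSum s a x‖ ^ 2 : ℝ) : ℂ)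
      = ((2 * ∑ n ∈ s, ‖a n‖ ^ 2 : ℝ) : ℂ) := by
    rw [← intervalIntegral.integral_ofReal]
    simp_rw [key]
    rw [intervalIntegral.integral_finsetSum]
    · rw [Complex.ofReal_mul, Complex.ofReal_sum, Finset.mul_sum]
      refine Finset.sum_congr rfl fun n hn => ?_
      rw [intervalIntegral.integral_finsetSum]
      · have hi : ∀ m ∈ s, ∫ x in (0 : ℝ)..2, a n * (starRingEnd ℂ) (a m) *
            e (((n : ℤ) - (m : ℤ) : ℤ) * x) = a n * (starRingEnd ℂ) (a m) *
            (if (n : ℤ) - (m : ℤ) = 0 then 2 else 0) := fun m _ => by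
          rw [intervalIntegral.integral_const_mul, integral_e_int_mul]
        rw [Finset.sum_congr rfl hi, Finset.sum_eq_single n]
        · simp [Complex.mul_conj, Complex.normSq_eq_norm_sq]; ring
        · intro m _ hm
          rw [if_neg (by omega)]; simp
        · intro h; exact absurd hn h
      · intro m _
        exact (continuous_const.mul (continuous_e.comp (by fun_prop))).intervalIntegrable _ _
    · intro n _
      exact (continuous_finsetSum _ fun m _ =>
        continuous_const.mul (continuous_e.comp (by fun_prop))).intervalIntegrable _ _
  exact_mod_cast h1

/-- Gallagher's inequality on one interval. -/
lemma gallagher_point {f f' : ℝ → ℂ} (hf : ∀ x, HasDerivAt f (f' x) x) (hf' : Continuous f')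
    (α δ : ℝ) (hδ : 0 < δ) :
    δ * ‖f α‖ ≤ ∫ x in (α - δ / 2)..(α + δ / 2), (‖f x‖ + δ * ‖f' x‖) := by
  have hfc : Continuous f := continuous_iff_continuousAt.2 fun x => (hf x).continuousAt
  set u := α - δ / 2
  set v := α + δ / 2
  have huv : u ≤ v := by simp only [u, v]; linarith
  have hpt : ∀ x ∈ Set.Icc u v, ‖f α‖ ≤ ‖f x‖ + ∫ y in u..v, ‖f' y‖ := by
    intro x hx
    have h1 : f α - f x = ∫ y in x..α, f' y :=
      (intervalIntegral.integral_eq_sub_of_hasDerivAt (fun y _ => hf y)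
        (hf'.intervalIntegrable _ _)).symm
    have h2 : ‖∫ y in x..α, f' y‖ ≤ ∫ y in u..v, ‖f' y‖ := by
      refine (intervalIntegral.norm_integral_le_abs_integral_norm).trans ?_
      rw [intervalIntegral.abs_integral_eq_abs_integral_uIoc,
        abs_of_nonneg (MeasureTheory.integral_nonneg fun _ => norm_nonneg _),
        intervalIntegral.integral_of_le huv]
      refine MeasureTheory.setIntegral_mono_set (hf'.norm.integrableOn_Ioc)
        (Filter.Eventually.of_forall fun _ => norm_nonneg _) (Filter.Eventually.of_forall ?_)
      intro y hy
      have hα : α ∈ Set.Icc u v := ⟨by simp only [u]; linarith, by simp only [v]; linarith⟩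
      replace hy : min x α < y ∧ y ≤ max x α := hy
      exact ⟨lt_of_le_of_lt (le_min hx.1 hα.1) hy.1, hy.2.trans (max_le hx.2 hα.2)⟩
    calc ‖f α‖ = ‖f x + (f α - f x)‖ := by congr 1; ring
      _ ≤ ‖f x‖ + ‖f α - f x‖ := norm_add_le _ _
      _ ≤ _ := by rw [h1]; linarith
  have hinteg : ∫ x in u..v, ‖f α‖ ≤ ∫ x in u..v, (‖f x‖ + ∫ y in u..v, ‖f' y‖) :=
    intervalIntegral.integral_mono_on huv (by simp) ((hfc.norm.add continuous_const).intervalIntegrable _ _)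
      hpt
  have hvu : v - u = δ := by simp only [u, v]; ring
  rw [intervalIntegral.integral_const, intervalIntegral.integral_add (hfc.norm.intervalIntegrable _ _)
    (by simp), intervalIntegral.integral_const, hvu, smul_eq_mul, smul_eq_mul] at hinteg
  rw [intervalIntegral.integral_add (hfc.norm.intervalIntegrable _ _)
    ((by fun_prop : Continuous fun x => δ * ‖f' x‖).intervalIntegrable _ _), intervalIntegral.integral_const_mul]
  exact hinteg

/-- Reduced fractions with denominators at most `D`. -/
def fareyPairs (D : ℕ) : Finset (ℕ × ℕ) :=
  (Icc 1 D ×ˢ Icc 1 D).filter (fun p => p.2 ≤ p.1 ∧ Nat.Coprime p.2 p.1)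

lemma farey_spacing {D : ℕ} {p r : ℕ × ℕ} (hp : p ∈ fareyPairs D) (hr : r ∈ fareyPairs D)
    (hne : p ≠ r) : 1 / (D : ℝ) ^ 2 ≤ |(p.2 : ℝ) / p.1 - (r.2 : ℝ) / r.1| := by
  simp only [fareyPairs, mem_filter, mem_product, mem_Icc] at hp hr
  have hp1 : (0 : ℝ) < p.1 := by exact_mod_cast hp.1.1.1
  have hr1 : (0 : ℝ) < r.1 := by exact_mod_cast hr.1.1.1
  have hpD : (p.1 : ℝ) ≤ D := by exact_mod_cast hp.1.1.2
  have hrD : (r.1 : ℝ) ≤ D := by exact_mod_cast hr.1.1.2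
  have hdiff : (p.2 : ℤ) * r.1 - r.2 * p.1 ≠ 0 := by
    intro h
    have h' : p.2 * r.1 = r.2 * p.1 := by zify; linarith
    apply hne
    have h1 : p.1 ∣ r.1 := by
      refine (Nat.Coprime.dvd_of_dvd_mul_left hp.2.2.symm ?_)
      exact ⟨r.2, by rw [h']; ring⟩
    have h2 : r.1 ∣ p.1 := by
      refine (Nat.Coprime.dvd_of_dvd_mul_left hr.2.2.symm ?_)
      exact ⟨p.2, by rw [← h']; ring⟩
    have h3 := Nat.dvd_antisymm h1 h2
    have h4 : p.2 = r.2 := by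
      rw [← h3] at h'
      exact Nat.eq_of_mul_eq_mul_right hp.1.1.1 h'
    exact Prod.ext h3 h4
  have h1 : (1 : ℝ) ≤ |(p.2 : ℝ) * r.1 - r.2 * p.1| := by
    have := Int.one_le_abs hdiff
    exact_mod_cast this
  have : (p.2 : ℝ) / p.1 - (r.2 : ℝ) / r.1 = ((p.2 : ℝ) * r.1 - r.2 * p.1) / (p.1 * r.1) := by
    field_simp
  rw [this, abs_div, abs_of_pos (mul_pos hp1 hr1)]
  apply div_le_div₀ (by positivity) h1 (by positivity)
  nlinarith

lemma farey_sum_integral_le (D : ℕ) (F : ℝ → ℝ) (hF : Continuous F) (hF0 : ∀ x, 0 ≤ F x) :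
    ∑ p ∈ fareyPairs D, ∫ x in ((p.2 : ℝ) / p.1 - 1 / (D : ℝ) ^ 2 / 2)..
      ((p.2 : ℝ) / p.1 + 1 / (D : ℝ) ^ 2 / 2), F x ≤ ∫ x in (0 : ℝ)..2, F x := by
  have hle : ∀ p : ℕ × ℕ, ((p.2 : ℝ) / p.1 - 1 / (D : ℝ) ^ 2 / 2) ≤
      ((p.2 : ℝ) / p.1 + 1 / (D : ℝ) ^ 2 / 2) := by
    intro p; have : 0 ≤ 1 / (D : ℝ) ^ 2 / 2 := by positivity
    linarith
  simp_rw [intervalIntegral.integral_of_le (hle _)]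
  rw [intervalIntegral.integral_of_le (by norm_num : (0 : ℝ) ≤ 2),
    ← MeasureTheory.integral_biUnion_finset (fareyPairs D) (fun _ _ => measurableSet_Ioc) ?_
      (fun _ _ => hF.integrableOn_Ioc)]
  · refine MeasureTheory.setIntegral_mono_set hF.integrableOn_Ioc
      (Filter.Eventually.of_forall hF0) (Filter.Eventually.of_forall ?_)
    intro x hx
    replace hx := Set.mem_iUnion₂.1 hx
    obtain ⟨p, hp, hx⟩ := hx
    simp only [fareyPairs, mem_filter, mem_product, mem_Icc] at hp
    have hD1 : (1 : ℝ) ≤ D := by exact_mod_cast hp.1.1.1.trans hp.1.1.2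
    have hp1 : (1 : ℝ) ≤ p.1 := by exact_mod_cast hp.1.1.1
    have hp2 : (1 : ℝ) ≤ p.2 := by exact_mod_cast hp.1.2.1
    have hpD : (p.1 : ℝ) ≤ D := by exact_mod_cast hp.1.1.2
    have hp21 : (p.2 : ℝ) ≤ p.1 := by exact_mod_cast hp.2.1
    have a1 : 1 / (D : ℝ) ≤ (p.2 : ℝ) / p.1 := div_le_div₀ (by positivity) hp2 (by positivity) hpD
    have a2 : (p.2 : ℝ) / p.1 ≤ 1 := (div_le_one (by positivity)).2 hp21
    have a3 : 1 / (D : ℝ) ^ 2 ≤ 1 / D := by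
      apply div_le_div₀ (by positivity) le_rfl (by positivity); nlinarith
    have a4 : 1 / (D : ℝ) ≤ 1 := (div_le_one (by positivity)).2 hD1
    have a5 : 0 < 1 / (D : ℝ) := by positivity
    exact ⟨by have := hx.1; linarith, by have := hx.2; linarith⟩
  · intro p hp r hr hne
    have := farey_spacing (Finset.mem_coe.1 hp) (Finset.mem_coe.1 hr) hne
    rw [Function.onFun, Set.disjoint_left]
    intro x hx1 hx2
    rw [le_abs'] at this
    rcases this with h | h
    · have := hx1.2; have := hx2.1; linarith
    · have := hx2.2; have := hx1.1; linarith

/-- The additive large sieve inequality over Farey fractions. -/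
theorem large_sieve_farey (D N : ℕ) (s : Finset ℕ) (hs : ∀ n ∈ s, n ≤ N) (hN : 1 ≤ N)
    (a : ℕ → ℂ) :
    ∑ p ∈ fareyPairs D, ‖expSum s a ((p.2 : ℝ) / p.1)‖ ^ 2
      ≤ 100 * ((D : ℝ) ^ 2 + N) * ∑ n ∈ s, ‖a n‖ ^ 2 := by
  rcases Nat.eq_zero_or_pos D with rfl | hD
  · simp [fareyPairs]; positivity
  have hD0 : (0 : ℝ) < D := by exact_mod_cast hD
  have hN0 : (0 : ℝ) < N := by exact_mod_cast hN
  set b : ℕ → ℂ := fun n => 2 * Real.pi * Complex.I * n * a n with hb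
  set δ : ℝ := 1 / (D : ℝ) ^ 2 with hδ
  have hδ0 : 0 < δ := by positivity
  have hca := continuous_expSum s a
  have hcb := continuous_expSum s b
  set f : ℝ → ℂ := fun x => expSum s a x ^ 2
  set f' : ℝ → ℂ := fun x => 2 * expSum s a x * expSum s b x
  have hf : ∀ x, HasDerivAt f (f' x) x := by
    intro x
    refine ((hasDerivAt_expSum s a x).pow 2).congr_deriv ?_
    simp [f', b]
  have hf' : Continuous f' := (continuous_const.mul (continuous_expSum s a)).mul (continuous_expSum s b)
  have hfc : Continuous f := (continuous_expSum s a).pow 2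
  set F : ℝ → ℝ := fun x => ‖f x‖ + δ * ‖f' x‖
  have hFc : Continuous F := hfc.norm.add (continuous_const.mul hf'.norm)
  have hF0 : ∀ x, 0 ≤ F x := fun x => by positivity
  have h1 : δ * ∑ p ∈ fareyPairs D, ‖expSum s a ((p.2 : ℝ) / p.1)‖ ^ 2 ≤ ∫ x in (0 : ℝ)..2, F x := by
    refine le_trans ?_ (farey_sum_integral_le D F hFc hF0)
    rw [Finset.mul_sum]
    refine Finset.sum_le_sum fun p _ => ?_
    have := gallagher_point hf hf' ((p.2 : ℝ) / p.1) δ hδ0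
    rw [show ‖f ((p.2 : ℝ) / p.1)‖ = ‖expSum s a ((p.2 : ℝ) / p.1)‖ ^ 2 from norm_pow _ _] at this
    exact this
  have hbs : ∑ n ∈ s, ‖b n‖ ^ 2 ≤ 40 * (N : ℝ) ^ 2 * ∑ n ∈ s, ‖a n‖ ^ 2 := by
    rw [Finset.mul_sum]
    refine Finset.sum_le_sum fun n hn => ?_
    have hn' : (n : ℝ) ≤ N := by exact_mod_cast hs n hn
    have : ‖b n‖ = 2 * Real.pi * n * ‖a n‖ := by
      simp [hb, abs_of_pos Real.pi_pos]
    rw [this, mul_pow]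
    refine mul_le_mul_of_nonneg_right ?_ (by positivity)
    have hpi : Real.pi ^ 2 ≤ 10 := by nlinarith [Real.pi_lt_d2, Real.pi_pos]
    have hnn : (n : ℝ) ^ 2 ≤ (N : ℝ) ^ 2 := by gcongr
    calc (2 * Real.pi * n) ^ 2 = 4 * Real.pi ^ 2 * (n : ℝ) ^ 2 := by ring
      _ ≤ 4 * 10 * (N : ℝ) ^ 2 := by gcongr
      _ = _ := by ring
  have h2 : ∫ x in (0 : ℝ)..2, F x
      ≤ ∫ x in (0 : ℝ)..2, ((1 + δ * N) * ‖expSum s a x‖ ^ 2 + δ / N * ‖expSum s b x‖ ^ 2) := by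
    refine intervalIntegral.integral_mono_on (by norm_num) (hFc.intervalIntegrable _ _) ?_ ?_
    · refine Continuous.intervalIntegrable ?_ _ _
      exact (continuous_const.mul ((continuous_expSum s a).norm.pow 2)).add
        (continuous_const.mul ((continuous_expSum s b).norm.pow 2))
    · intro x _
      simp only [F, f, f', norm_pow, norm_mul]
      set A := ‖expSum s a x‖
      set B := ‖expSum s b x‖
      have : 2 * A * B ≤ N * A ^ 2 + 1 / N * B ^ 2 := by
        have h := sq_nonneg (N * A - B)
        have : N * A ^ 2 + 1 / N * B ^ 2 - 2 * A * B = (N * A - B) ^ 2 / N := by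
          field_simp; ring
        have : 0 ≤ (N * A - B) ^ 2 / N := by positivity
        linarith
      have h3 := mul_le_mul_of_nonneg_left this hδ0.le
      simp only [Complex.norm_ofNat]
      calc A ^ 2 + δ * (2 * A * B) ≤ A ^ 2 + δ * (N * A ^ 2 + 1 / N * B ^ 2) := by linarith
        _ = _ := by ring
  rw [intervalIntegral.integral_add (f := fun x => (1 + δ * N) * ‖expSum s a x‖ ^ 2)
      (g := fun x => δ / N * ‖expSum s b x‖ ^ 2)
      (Continuous.intervalIntegrable (by fun_prop) _ _)
      (Continuous.intervalIntegrable (by fun_prop) _ _),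
    intervalIntegral.integral_const_mul, intervalIntegral.integral_const_mul,
    integral_norm_sq_expSum, integral_norm_sq_expSum] at h2
  set Z := ∑ n ∈ s, ‖a n‖ ^ 2
  have hZ : 0 ≤ Z := Finset.sum_nonneg fun _ _ => by positivity
  have h4 : δ / N * (2 * ∑ n ∈ s, ‖b n‖ ^ 2) ≤ 80 * δ * N * Z := by
    calc δ / N * (2 * ∑ n ∈ s, ‖b n‖ ^ 2) ≤ δ / N * (2 * (40 * (N : ℝ) ^ 2 * Z)) := by gcongr
      _ = _ := by field_simp; ring
  have h5 : δ * ∑ p ∈ fareyPairs D, ‖expSum s a ((p.2 : ℝ) / p.1)‖ ^ 2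
      ≤ δ * (100 * ((D : ℝ) ^ 2 + N) * Z) := by
    have hδD : δ * (D : ℝ) ^ 2 = 1 := by rw [hδ]; field_simp
    have : δ * (100 * ((D : ℝ) ^ 2 + N) * Z) = 100 * Z * (δ * (D : ℝ) ^ 2) + 100 * δ * N * Z := by ring
    rw [this, hδD]
    have h6 : 0 ≤ δ * N * Z := by positivity
    nlinarith
  exact le_of_mul_le_mul_left h5 hδ0

/-- The solution `c` of `c * (e θ - 1) = 1`. -/
noncomputable def invExpSubOne (θ : ℝ) : ℂ :=
  ⟨-(1 / 2), -(1 / 2) * (Real.cos (Real.pi * θ) / Real.sin (Real.pi * θ))⟩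

lemma e_eq_mk (θ : ℝ) : e θ = ⟨1 - 2 * Real.sin (Real.pi * θ) ^ 2,
    2 * Real.sin (Real.pi * θ) * Real.cos (Real.pi * θ)⟩ := by
  unfold e
  rw [show (2 * Real.pi * Complex.I * θ : ℂ) = ((2 * (Real.pi * θ) : ℝ) : ℂ) * Complex.I by
    push_cast; ring]
  apply Complex.ext
  · rw [Complex.exp_ofReal_mul_I_re, Real.cos_two_mul]
    have := Real.sin_sq_add_cos_sq (Real.pi * θ)
    simp only; linarith
  · rw [Complex.exp_ofReal_mul_I_im, Real.sin_two_mul]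

lemma invExpSubOne_mul {θ : ℝ} (h : Real.sin (Real.pi * θ) ≠ 0) :
    invExpSubOne θ * (e θ - 1) = 1 := by
  rw [e_eq_mk]
  unfold invExpSubOne
  have h2 := Real.sin_sq_add_cos_sq (Real.pi * θ)
  apply Complex.ext
  · simp only [Complex.mul_re, Complex.sub_re, Complex.one_re, Complex.sub_im, Complex.one_im]
    field_simp
    linear_combination 2 * Real.sin (Real.pi * θ) * h2
  · simp only [Complex.mul_im, Complex.sub_re, Complex.one_re, Complex.sub_im, Complex.one_im]
    field_simp
    ring

lemma two_mul_le_sin_pi_mul {θ η : ℝ} (h0 : 0 < η) (h1 : η ≤ θ) (h2 : θ ≤ 1 - η) :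
    2 * η ≤ Real.sin (Real.pi * θ) := by
  have hpi := Real.pi_pos
  rcases le_total θ (1 / 2) with h | h
  · have := Real.mul_le_sin (x := Real.pi * θ) (by nlinarith) (by nlinarith)
    have h3 : 2 / Real.pi * (Real.pi * θ) = 2 * θ := by field_simp
    linarith
  · have := Real.mul_le_sin (x := Real.pi * (1 - θ)) (by nlinarith) (by nlinarith)
    have h3 : 2 / Real.pi * (Real.pi * (1 - θ)) = 2 * (1 - θ) := by field_simp
    rw [show Real.pi * (1 - θ) = Real.pi - Real.pi * θ by ring, Real.sin_pi_sub] at this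
    rw [show Real.pi * (1 - θ) = Real.pi - Real.pi * θ by ring] at h3
    linarith

lemma cot_sub_nonneg {θ φ η : ℝ} (h0 : 0 < η) (h1 : η ≤ θ) (h2 : θ ≤ φ) (h3 : φ ≤ 1 - η) :
    0 ≤ Real.cos (Real.pi * θ) / Real.sin (Real.pi * θ)
      - Real.cos (Real.pi * φ) / Real.sin (Real.pi * φ) := by
  have s1 := two_mul_le_sin_pi_mul h0 h1 (h2.trans h3)
  have s2 := two_mul_le_sin_pi_mul h0 (h1.trans h2) h3
  rw [div_sub_div _ _ (by linarith) (by linarith)]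
  have : Real.cos (Real.pi * θ) * Real.sin (Real.pi * φ)
      - Real.sin (Real.pi * θ) * Real.cos (Real.pi * φ) = Real.sin (Real.pi * (φ - θ)) := by
    rw [mul_sub, Real.sin_sub]; ring
  rw [this]
  apply div_nonneg
  · apply Real.sin_nonneg_of_nonneg_of_le_pi
    · have := Real.pi_pos; nlinarith
    · have := Real.pi_pos; nlinarith
  · apply mul_nonneg <;> linarith

lemma abs_cot_le {θ η : ℝ} (h0 : 0 < η) (h1 : η ≤ θ) (h2 : θ ≤ 1 - η) :
    |Real.cos (Real.pi * θ) / Real.sin (Real.pi * θ)| ≤ 1 / (2 * η) := by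
  have s1 := two_mul_le_sin_pi_mul h0 h1 h2
  rw [abs_div]
  apply div_le_div₀ zero_le_one (Real.abs_cos_le_one _) (by linarith)
  rw [abs_of_pos (by linarith)]; exact s1

lemma norm_invExpSubOne_le {θ η : ℝ} (h0 : 0 < η) (h1 : η ≤ θ) (h2 : θ ≤ 1 - η) :
    ‖invExpSubOne θ‖ ≤ 1 / (2 * η) := by
  have hη : η ≤ 1 / 2 := by linarith
  refine (Complex.norm_le_abs_re_add_abs_im _).trans ?_
  unfold invExpSubOne
  simp only [abs_neg, abs_mul]
  have := abs_cot_le h0 h1 h2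
  have h4 : (1 : ℝ) ≤ 1 / (2 * η) := by rw [le_div_iff₀ (by linarith)]; linarith
  rw [abs_of_pos (by norm_num : (0 : ℝ) < 1 / 2)]
  linarith

lemma norm_invExpSubOne_sub {θ φ η : ℝ} (h0 : 0 < η) (h1 : η ≤ θ) (h2 : θ ≤ φ) (h3 : φ ≤ 1 - η) :
    ‖invExpSubOne φ - invExpSubOne θ‖ = (1 / 2) * (Real.cos (Real.pi * θ) / Real.sin (Real.pi * θ)
      - Real.cos (Real.pi * φ) / Real.sin (Real.pi * φ)) := by
  have : invExpSubOne φ - invExpSubOne θ =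
      (((1 / 2) * (Real.cos (Real.pi * θ) / Real.sin (Real.pi * θ)
      - Real.cos (Real.pi * φ) / Real.sin (Real.pi * φ)) : ℝ) : ℂ) * Complex.I := by
    unfold invExpSubOne
    apply Complex.ext <;> simp [-Complex.ofReal_mul, -Complex.ofReal_sub]
    ring
  rw [this, norm_mul, Complex.norm_I, mul_one, Complex.norm_real, Real.norm_eq_abs, abs_of_nonneg]
  exact mul_nonneg (by norm_num) (cot_sub_nonneg h0 h1 h2 h3)

/-- The Kuzmin–Landau inequality. -/
lemma kuzmin_landau_range (x : ℕ → ℝ) (N : ℕ) (m : ℤ) (η : ℝ) (h0 : 0 < η)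
    (hx : ∀ n < N, m + η ≤ x (n + 1) - x n ∧ x (n + 1) - x n ≤ m + 1 - η)
    (hmono : ∀ n, n + 1 < N → x (n + 1) - x n ≤ x (n + 2) - x (n + 1)) :
    ‖∑ n ∈ range N, e (x n)‖ ≤ 2 / η := by
  rcases N with _ | N
  · simp; positivity
  set θ : ℕ → ℝ := fun n => x (n + 1) - x n - m with hθ
  have hθ1 : ∀ n < N + 1, η ≤ θ n ∧ θ n ≤ 1 - η := fun n hn => by
    have := hx n hn; simp only [hθ]; constructor <;> linarith
  have hθm : ∀ n, n + 1 < N + 1 → θ n ≤ θ (n + 1) := fun n hn => by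
    have := hmono n hn; simp only [hθ]; rw [show n + 1 + 1 = n + 2 by rfl]; linarith
  have hE : ∀ n < N + 1, e (x n) = invExpSubOne (θ n) * (e (x (n + 1)) - e (x n)) := by
    intro n hn
    have h1 : e (x (n + 1)) = e (x n) * e (θ n) := by
      rw [← e_add]
      have : x (n + 1) = x n + θ n + (m : ℝ) := by simp only [hθ]; ring
      rw [this, e_add (x n + θ n), e_int, mul_one]
    have hs := two_mul_le_sin_pi_mul h0 (hθ1 n hn).1 (hθ1 n hn).2
    have h2 := invExpSubOne_mul (θ := θ n) (by linarith)
    rw [h1]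
    calc e (x n) = (invExpSubOne (θ n) * (e (θ n) - 1)) * e (x n) := by rw [h2, one_mul]
      _ = _ := by ring
  set κ : ℕ → ℝ := fun n => Real.cos (Real.pi * θ n) / Real.sin (Real.pi * θ n) with hκ
  have key : ∀ M, M < N + 1 → ‖∑ n ∈ range (M + 1), e (x n) - invExpSubOne (θ M) * e (x (M + 1))‖
      ≤ 1 / (2 * η) + (1 / 2) * (κ 0 - κ M) := by
    intro M
    induction M with
    | zero =>
      intro h
      rw [zero_add, sum_range_one, hE 0 h]
      rw [show invExpSubOne (θ 0) * (e (x (0 + 1)) - e (x 0)) - invExpSubOne (θ 0) * e (x 1)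
        = -(invExpSubOne (θ 0) * e (x 0)) by ring]
      rw [norm_neg, norm_mul, norm_e, mul_one]
      have := norm_invExpSubOne_le h0 (hθ1 0 h).1 (hθ1 0 h).2
      simpa using this
    | succ M ih =>
      intro h
      have ih' := ih (by omega)
      rw [sum_range_succ, hE (M + 1) h]
      have h3 := norm_invExpSubOne_sub h0 (hθ1 M (by omega)).1 (hθm M (by omega)) (hθ1 (M + 1) h).2
      calc _ = ‖(∑ n ∈ range (M + 1), e (x n) - invExpSubOne (θ M) * e (x (M + 1)))
            - (invExpSubOne (θ (M + 1)) - invExpSubOne (θ M)) * e (x (M + 1))‖ := by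
            congr 1; ring
        _ ≤ _ := norm_sub_le _ _
        _ ≤ (1 / (2 * η) + (1 / 2) * (κ 0 - κ M)) + (1 / 2) * (κ M - κ (M + 1)) := by
            rw [norm_mul, norm_e, mul_one, h3]
            linarith
        _ = _ := by ring
  have hk := key N (by omega)
  have c1 := abs_cot_le h0 (hθ1 0 (by omega)).1 (hθ1 0 (by omega)).2
  have c2 := abs_cot_le h0 (hθ1 N (by omega)).1 (hθ1 N (by omega)).2
  have c3 := norm_invExpSubOne_le h0 (hθ1 N (by omega)).1 (hθ1 N (by omega)).2
  have c4 := (abs_le.1 c1).2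
  have c5 := (abs_le.1 c2).1
  have h5 : ‖∑ n ∈ range (N + 1), e (x n)‖ ≤
      ‖∑ n ∈ range (N + 1), e (x n) - invExpSubOne (θ N) * e (x (N + 1))‖ + ‖invExpSubOne (θ N)‖ := by
    have := norm_add_le (∑ n ∈ range (N + 1), e (x n) - invExpSubOne (θ N) * e (x (N + 1)))
      (invExpSubOne (θ N) * e (x (N + 1)))
    rw [sub_add_cancel, norm_mul, norm_e, mul_one] at this
    exact this
  have h6 : 2 / η = 4 * (1 / (2 * η)) := by field_simp; norm_num
  have h7 : 0 < 1 / (2 * η) := by positivity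
  simp only [hκ] at hk
  rw [h6]; linarith

lemma kuzmin_landau (x : ℕ → ℝ) (a b : ℕ) (m : ℤ) (η : ℝ) (h0 : 0 < η)
    (hx : ∀ n, a ≤ n → n < b → m + η ≤ x (n + 1) - x n ∧ x (n + 1) - x n ≤ m + 1 - η)
    (hmono : ∀ n, a ≤ n → n + 1 < b → x (n + 1) - x n ≤ x (n + 2) - x (n + 1)) :
    ‖∑ n ∈ Ico a b, e (x n)‖ ≤ 2 / η := by
  rw [sum_Ico_eq_sum_range]
  refine kuzmin_landau_range (fun n => x (a + n)) (b - a) m η h0 ?_ ?_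
  · intro n hn; exact hx (a + n) (by omega) (by omega)
  · intro n hn; exact hmono (a + n) (by omega) (by omega)

lemma eq_Ico_of_convex (S : Finset ℕ) (hS : ∀ u ∈ S, ∀ v ∈ S, ∀ w, u ≤ w → w ≤ v → w ∈ S) :
    ∃ a b, S = Ico a b := by
  rcases S.eq_empty_or_nonempty with h | h
  · exact ⟨0, 0, by simp [h]⟩
  · refine ⟨S.min' h, S.max' h + 1, ?_⟩
    ext w
    rw [mem_Ico, Nat.lt_succ_iff]
    exact ⟨fun hw => ⟨S.min'_le w hw, S.le_max' w hw⟩,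
      fun hw => hS _ (S.min'_mem h) _ (S.max'_mem h) w hw.1 hw.2⟩

/-- Van der Corput's second derivative test, for sequences with positive second differences. -/
theorem second_difference_test (x : ℕ → ℝ) (a b : ℕ) (l h : ℝ) (hl : 0 < l) (hh : 1 ≤ h)
    (hx : ∀ n, a ≤ n → n < b → l ≤ (x (n + 2) - x (n + 1)) - (x (n + 1) - x n) ∧
      (x (n + 2) - x (n + 1)) - (x (n + 1) - x n) ≤ h * l) :
    ‖∑ n ∈ Ico a b, e (x n)‖ ≤ 10 * h * (((b - a : ℕ) : ℝ) * √l + 1 / √l) := by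
  set N : ℝ := ((b - a : ℕ) : ℝ) with hN
  have hN0 : 0 ≤ N := Nat.cast_nonneg _
  set η := √l with hη
  have hη0 : 0 < η := Real.sqrt_pos.2 hl
  have hηl : η * η = l := Real.mul_self_sqrt hl.le
  have triv : ‖∑ n ∈ Ico a b, e (x n)‖ ≤ N := by
    refine (norm_sum_le _ _).trans ?_
    simp [norm_e, hN]
  have hR : 0 ≤ 1 / η := by positivity
  rcases le_or_gt (1 / 2) η with hbig | hsmall
  · refine triv.trans ?_
    have : 0 ≤ N * η := by positivity
    nlinarith [mul_nonneg hN0 (sub_nonneg.2 hbig)]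
  rcases Nat.lt_or_ge a b with hab | hab
  swap
  · rw [Ico_eq_empty_of_le hab]; simp; positivity
  set D : ℕ → ℝ := fun n => x (n + 1) - x n with hD
  have step : ∀ n, a ≤ n → n < b → l ≤ D (n + 1) - D n ∧ D (n + 1) - D n ≤ h * l := by
    intro n h1 h2; exact hx n h1 h2
  have grow : ∀ u v, a ≤ u → u ≤ v → v < b →
      l * ((v : ℝ) - u) ≤ D v - D u ∧ D v - D u ≤ h * l * ((v : ℝ) - u) := by
    intro u v hu huv
    induction v, huv using Nat.le_induction with
    | base => intro _; simp
    | succ v huv ih =>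
      intro hv
      have := ih (by omega)
      have hs := step v (by omega) (by omega)
      push_cast
      constructor <;> nlinarith
  have mono : ∀ u v, a ≤ u → u ≤ v → v < b → D u ≤ D v := by
    intro u v hu huv hv
    have := (grow u v hu huv hv).1
    have h2 : (0 : ℝ) ≤ (v : ℝ) - u := sub_nonneg.2 (by exact_mod_cast huv)
    nlinarith
  have cardb : ∀ S : Finset ℕ, S ⊆ Ico a b → ∀ p q : ℝ, (∀ n ∈ S, p ≤ D n ∧ D n ≤ q) → p ≤ q →
      (S.card : ℝ) ≤ (q - p) / l + 1 := by
    intro S hS p q hpq hle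
    rcases S.eq_empty_or_nonempty with h | h
    · subst h
      have := div_nonneg (sub_nonneg.2 hle) hl.le
      simp; linarith
    have hm := mem_Ico.1 (hS (S.min'_mem h))
    have hM := mem_Ico.1 (hS (S.max'_mem h))
    have hmM : S.min' h ≤ S.max' h := S.min'_le _ (S.max'_mem h)
    have hg := (grow _ _ hm.1 hmM hM.2).1
    have c1 : S.card ≤ S.max' h + 1 - S.min' h := by
      rw [← Nat.card_Ico]
      refine card_le_card fun w hw => ?_
      rw [mem_Ico, Nat.lt_succ_iff]
      exact ⟨S.min'_le w hw, S.le_max' w hw⟩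
    have c2 : (S.card : ℝ) ≤ (S.max' h : ℝ) - S.min' h + 1 := by
      have : S.card + S.min' h ≤ S.max' h + 1 := by omega
      have : ((S.card + S.min' h : ℕ) : ℝ) ≤ ((S.max' h + 1 : ℕ) : ℝ) := by exact_mod_cast this
      push_cast at this; linarith
    have c3 := (hpq _ (S.min'_mem h)).1
    have c4 := (hpq _ (S.max'_mem h)).2
    have : (S.max' h : ℝ) - S.min' h ≤ (q - p) / l := by
      rw [le_div_iff₀ hl]; linarith
    linarith
  have inner : ∀ ν : ℤ, ‖∑ n ∈ (Ico a b).filter (fun n => ⌊D n⌋ = ν), e (x n)‖ ≤ 5 / η := by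
    intro ν
    set S := (Ico a b).filter (fun n => ⌊D n⌋ = ν) with hS
    have hSm : ∀ n ∈ S, (a ≤ n ∧ n < b) ∧ (ν : ℝ) ≤ D n ∧ D n < ν + 1 := by
      intro n hn
      rw [hS, mem_filter, mem_Ico, Int.floor_eq_iff] at hn
      exact hn
    have hsplit : ∑ n ∈ S, e (x n) = ∑ n ∈ S.filter (fun n => D n < ν + η), e (x n)
        + (∑ n ∈ (S.filter (fun n => ¬ D n < ν + η)).filter (fun n => ν + 1 - η < D n), e (x n)
        + ∑ n ∈ (S.filter (fun n => ¬ D n < ν + η)).filter (fun n => ¬ ν + 1 - η < D n), e (x n)) := by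
      rw [sum_filter_add_sum_filter_not, sum_filter_add_sum_filter_not]
    have hcl : (η / l) = 1 / η := by rw [← hηl]; field_simp
    have b1 : ‖∑ n ∈ S.filter (fun n => D n < ν + η), e (x n)‖ ≤ 1 / η + 1 := by
      refine (norm_sum_le _ _).trans ?_
      simp only [norm_e, sum_const, nsmul_eq_mul, mul_one]
      have := cardb (S.filter (fun n => D n < ν + η))
        ((filter_subset _ _).trans (filter_subset _ _)) ν (ν + η)
        (fun n hn => ⟨(hSm n (mem_filter.1 hn).1).2.1, (mem_filter.1 hn).2.le⟩) (by linarith)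
      rwa [add_sub_cancel_left, hcl] at this
    have b2 : ‖∑ n ∈ (S.filter (fun n => ¬ D n < ν + η)).filter (fun n => ν + 1 - η < D n),
        e (x n)‖ ≤ 1 / η + 1 := by
      refine (norm_sum_le _ _).trans ?_
      simp only [norm_e, sum_const, nsmul_eq_mul, mul_one]
      have := cardb ((S.filter (fun n => ¬ D n < ν + η)).filter (fun n => ν + 1 - η < D n))
        ((filter_subset _ _).trans ((filter_subset _ _).trans (filter_subset _ _)))
        (ν + 1 - η) (ν + 1) (fun n hn => ⟨(mem_filter.1 hn).2.le,
          (hSm n (mem_filter.1 (mem_filter.1 hn).1).1).2.2.le⟩) (by linarith)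
      rwa [sub_sub_cancel, hcl] at this
    have b3 : ‖∑ n ∈ (S.filter (fun n => ¬ D n < ν + η)).filter (fun n => ¬ ν + 1 - η < D n),
        e (x n)‖ ≤ 2 / η := by
      have hmem : ∀ n, n ∈ (S.filter (fun n => ¬ D n < ν + η)).filter (fun n => ¬ ν + 1 - η < D n)
          ↔ (a ≤ n ∧ n < b) ∧ ν + η ≤ D n ∧ D n ≤ ν + 1 - η := by
        intro n
        simp only [hS, mem_filter, mem_Ico, Int.floor_eq_iff, not_lt]
        constructor
        · rintro ⟨⟨⟨h1, h2, h3⟩, h4⟩, h5⟩; exact ⟨h1, h4, h5⟩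
        · rintro ⟨h1, h4, h5⟩; exact ⟨⟨⟨h1, by linarith, by linarith⟩, h4⟩, h5⟩
      obtain ⟨a', b', hab'⟩ := eq_Ico_of_convex
        ((S.filter (fun n => ¬ D n < ν + η)).filter (fun n => ¬ ν + 1 - η < D n)) (by
          intro u hu v hv w huw hwv
          rw [hmem] at hu hv ⊢
          refine ⟨⟨hu.1.1.trans huw, lt_of_le_of_lt hwv hv.1.2⟩, ?_, ?_⟩
          · exact hu.2.1.trans (mono u w hu.1.1 huw (lt_of_le_of_lt hwv hv.1.2))
          · exact (mono w v (hu.1.1.trans huw) hwv hv.1.2).trans hv.2.2)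
      rw [hab']
      have hmem' : ∀ n, a' ≤ n → n < b' → (a ≤ n ∧ n < b) ∧ ν + η ≤ D n ∧ D n ≤ ν + 1 - η := by
        intro n h1 h2
        rw [← hmem, hab', mem_Ico]; exact ⟨h1, h2⟩
      refine kuzmin_landau x a' b' ν η hη0 (fun n h1 h2 => (hmem' n h1 h2).2) ?_
      intro n h1 h2
      have := hmem' n h1 (by omega)
      have := hmem' (n + 1) (by omega) h2
      exact mono n (n + 1) (by tauto) (by omega) (by tauto)
    rw [hsplit]
    refine (norm_add_le _ _).trans ?_
    have := norm_add_le (∑ n ∈ (S.filter (fun n => ¬ D n < ν + η)).filter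
      (fun n => ν + 1 - η < D n), e (x n)) (∑ n ∈ (S.filter (fun n => ¬ D n < ν + η)).filter
      (fun n => ¬ ν + 1 - η < D n), e (x n))
    have h2 : 1 + 1 ≤ 1 / η := by rw [le_div_iff₀ hη0]; linarith
    have h5 : 5 / η = 5 * (1 / η) := by ring
    have h6 : 2 / η = 2 * (1 / η) := by ring
    rw [h5]; rw [h6] at b3
    linarith
  have hmaps : ∀ n ∈ Ico a b, ⌊D n⌋ ∈ Icc ⌊D a⌋ ⌊D (b - 1)⌋ := by
    intro n hn
    rw [mem_Ico] at hn
    rw [mem_Icc]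
    exact ⟨Int.floor_mono (mono a n le_rfl hn.1 hn.2),
      Int.floor_mono (mono n (b - 1) hn.1 (by omega) (by omega))⟩
  rw [← sum_fiberwise_of_maps_to hmaps]
  refine (norm_sum_le _ _).trans ((sum_le_sum fun ν _ => inner ν).trans ?_)
  rw [sum_const, nsmul_eq_mul, Int.card_Icc]
  have hcnt : ((⌊D (b - 1)⌋ + 1 - ⌊D a⌋).toNat : ℝ) ≤ h * l * N + 2 := by
    have g := (grow a (b - 1) le_rfl (by omega) (by omega)).2
    have f1 := Int.floor_le (D (b - 1))
    have f2 := Int.lt_floor_add_one (D a)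
    have f0 : ⌊D a⌋ ≤ ⌊D (b - 1)⌋ := Int.floor_mono (mono a (b - 1) le_rfl (by omega) (by omega))
    have : ((⌊D (b - 1)⌋ + 1 - ⌊D a⌋).toNat : ℝ) = ((⌊D (b - 1)⌋ + 1 - ⌊D a⌋ : ℤ) : ℝ) := by
      rw [← Int.cast_natCast, Int.toNat_of_nonneg (by linarith)]
    rw [this]; push_cast
    have hb1 : ((b - 1 : ℕ) : ℝ) - a ≤ N := by
      rw [hN, ← Nat.cast_sub (by omega)]; exact_mod_cast by omega
    have : h * l * (((b - 1 : ℕ) : ℝ) - a) ≤ h * l * N := by gcongr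
    linarith
  calc ((⌊D (b - 1)⌋ + 1 - ⌊D a⌋).toNat : ℝ) * (5 / η) ≤ (h * l * N + 2) * (5 / η) := by gcongr
    _ = 5 * h * (N * η) + 10 * (1 / η) := by rw [← hηl]; field_simp; ring
    _ ≤ 10 * h * (N * η + 1 / η) := by
      have : 0 ≤ N * η := by positivity
      nlinarith [mul_nonneg (sub_nonneg.2 hh) hR, mul_nonneg (sub_nonneg.2 hh) this]

/-- Van der Corput's second derivative test, negative second differences. -/
theorem second_difference_test_neg (x : ℕ → ℝ) (a b : ℕ) (l h : ℝ) (hl : 0 < l) (hh : 1 ≤ h)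
    (hx : ∀ n, a ≤ n → n < b → l ≤ -((x (n + 2) - x (n + 1)) - (x (n + 1) - x n)) ∧
      -((x (n + 2) - x (n + 1)) - (x (n + 1) - x n)) ≤ h * l) :
    ‖∑ n ∈ Ico a b, e (x n)‖ ≤ 10 * h * (((b - a : ℕ) : ℝ) * √l + 1 / √l) := by
  have := second_difference_test (fun n => -x n) a b l h hl hh (fun n h1 h2 => by
    have := hx n h1 h2
    constructor <;> linarith)
  have h2 : ∑ n ∈ Ico a b, e (-x n) = (starRingEnd ℂ) (∑ n ∈ Ico a b, e (x n)) := by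
    rw [map_sum]; exact sum_congr rfl fun n _ => e_neg _
  rwa [h2, RCLike.norm_conj] at this

lemma rpow_second_difference {c : ℝ} {n : ℝ} (hn : 0 < n) :
    ∃ z ∈ Set.Ioo n (n + 2), ((n + 2) ^ c - (n + 1) ^ c) - ((n + 1) ^ c - n ^ c)
      = c * (c - 1) * z ^ (c - 2) := by
  have hd : ∀ y : ℝ, 0 < y → HasDerivAt (fun y : ℝ => y ^ c) (c * y ^ (c - 1)) y :=
    fun y hy => Real.hasDerivAt_rpow_const (Or.inl hy.ne')
  have hd2 : ∀ y : ℝ, 0 < y → HasDerivAt (fun y : ℝ => c * y ^ (c - 1))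
      (c * ((c - 1) * y ^ (c - 1 - 1))) y :=
    fun y hy => (Real.hasDerivAt_rpow_const (Or.inl hy.ne')).const_mul c
  have hg : ∀ y : ℝ, 0 < y → HasDerivAt (fun y : ℝ => (y + 1) ^ c - y ^ c)
      (c * (y + 1) ^ (c - 1) - c * y ^ (c - 1)) y := fun y hy =>
    ((hd (y + 1) (by linarith)).comp_add_const y 1).sub (hd y hy)
  obtain ⟨ξ, hξ, h1⟩ := exists_hasDerivAt_eq_slope (fun y : ℝ => (y + 1) ^ c - y ^ c)
    (fun y => c * (y + 1) ^ (c - 1) - c * y ^ (c - 1)) (by linarith : n < n + 1)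
    (fun y hy => (hg y (by linarith [hy.1])).continuousAt.continuousWithinAt)
    (fun y hy => hg y (by linarith [hy.1]))
  obtain ⟨z, hz, h2⟩ := exists_hasDerivAt_eq_slope (fun y : ℝ => c * y ^ (c - 1))
    (fun y => c * ((c - 1) * y ^ (c - 1 - 1))) (by linarith : ξ < ξ + 1)
    (fun y hy => (hd2 y (by linarith [hy.1, hξ.1])).continuousAt.continuousWithinAt)
    (fun y hy => hd2 y (by linarith [hy.1, hξ.1]))
  refine ⟨z, ⟨by linarith [hz.1, hξ.1], by linarith [hz.2, hξ.2]⟩, ?_⟩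
  simp only [add_sub_cancel_left, div_one] at h1 h2
  rw [show n + 2 = n + 1 + 1 by ring, ← h1, ← h2]
  rw [show c - 2 = c - 1 - 1 by ring]; ring

lemma rpow_bounds_of_mem {r K R z : ℝ} (hr : |r| ≤ 1) (hK : 0 < K) (h1 : K ≤ z)
    (h2 : z ≤ R * K) : K ^ r / R ≤ z ^ r ∧ z ^ r ≤ R * K ^ r := by
  have hz : 0 < z := hK.trans_le h1
  have hzK : z ^ r = (z / K) ^ r * K ^ r := by
    rw [Real.div_rpow hz.le hK.le]
    have := (Real.rpow_pos_of_pos hK r).ne'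
    field_simp
  have q1 : 1 ≤ z / K := (one_le_div hK).2 h1
  have q2 : z / K ≤ R := (div_le_iff₀ hK).2 h2
  have hKr := Real.rpow_pos_of_pos hK r
  obtain ⟨r1, r2⟩ := abs_le.1 hr
  have up : (z / K) ^ r ≤ R := by
    calc (z / K) ^ r ≤ (z / K) ^ (1 : ℝ) := Real.rpow_le_rpow_of_exponent_le q1 r2
      _ ≤ R := by rwa [Real.rpow_one]
  have lo : 1 / R ≤ (z / K) ^ r := by
    calc 1 / R ≤ 1 / (z / K) := one_div_le_one_div_of_le (by linarith) q2
      _ = (z / K) ^ (-1 : ℝ) := by rw [Real.rpow_neg_one, one_div]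
      _ ≤ _ := Real.rpow_le_rpow_of_exponent_le q1 r1
  rw [hzK]
  constructor
  · calc K ^ r / R = 1 / R * K ^ r := by ring
      _ ≤ _ := by gcongr
  · gcongr

/-- Exponential sums with phase `β y ^ c + α y`. -/
theorem monomial_phase_bound {c : ℝ} (hc1 : 1 < c) (hc3 : c < 3) {R : ℝ} (hR : 1 ≤ R) :
    ∃ C > 0, ∀ (β α K : ℝ) (a b : ℕ), β ≠ 0 → 0 < K → K ≤ a → (b : ℝ) + 1 ≤ R * K →
      ‖∑ n ∈ Ico a b, e (β * (n : ℝ) ^ c + α * n)‖ ≤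
        C * (√(|β| * K ^ c) + K / √(|β| * K ^ c)) := by
  set κ := c * (c - 1) / R with hκ
  have hcc : 0 < c * (c - 1) := mul_pos (by linarith) (by linarith)
  have hκ0 : 0 < κ := by positivity
  have hs0 : 0 < √κ := Real.sqrt_pos.2 hκ0
  refine ⟨10 * R ^ 2 * (R * √κ + 1 / √κ), by positivity, ?_⟩
  intro β α K a b hβ hK ha hb
  have hβ0 : 0 < |β| := abs_pos.2 hβ
  set l := |β| * (c * (c - 1)) * K ^ (c - 2) / R with hl
  have hKc := Real.rpow_pos_of_pos hK (c - 2)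
  have hl0 : 0 < l := by positivity
  set V := |β| * K ^ c with hV
  have hV0 : 0 < V := mul_pos hβ0 (Real.rpow_pos_of_pos hK c)
  have hsV : 0 < √V := Real.sqrt_pos.2 hV0
  have hlV : l = κ * (V / K ^ 2) := by
    rw [hl, hκ, hV, Real.rpow_sub hK, Real.rpow_two]; field_simp
  have hsl : √l = √κ * (√V / K) := by
    rw [hlV, Real.sqrt_mul hκ0.le, Real.sqrt_div hV0.le, Real.sqrt_sq hK.le]
  have hsd : ∀ n : ℕ, a ≤ n → n < b → ∃ s : ℝ, l ≤ |β| * s ∧ |β| * s ≤ R ^ 2 * l ∧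
      ((((n + 2 : ℕ) : ℝ) ^ c - ((n + 1 : ℕ) : ℝ) ^ c) - (((n + 1 : ℕ) : ℝ) ^ c - (n : ℝ) ^ c)) = s := by
    intro n h1 h2
    have hnK : K ≤ n := ha.trans (by exact_mod_cast h1)
    have hn2 : (n : ℝ) + 2 ≤ R * K := by
      have : ((n + 1 : ℕ) : ℝ) ≤ b := by exact_mod_cast h2
      push_cast at this; linarith
    obtain ⟨z, hz, h3⟩ := rpow_second_difference (c := c) (hK.trans_le hnK)
    obtain ⟨z1, z2⟩ := rpow_bounds_of_mem (r := c - 2) (R := R) (z := z) (by rw [abs_le]; constructor <;> linarith)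
      hK (by linarith [hz.1]) (by linarith [hz.2])
    refine ⟨c * (c - 1) * z ^ (c - 2), ?_, ?_, by push_cast; exact h3⟩
    · calc l = |β| * (c * (c - 1) * (K ^ (c - 2) / R)) := by rw [hl]; ring
        _ ≤ _ := by gcongr
    · calc |β| * (c * (c - 1) * z ^ (c - 2)) ≤ |β| * (c * (c - 1) * (R * K ^ (c - 2))) := by gcongr
        _ = R ^ 2 * l := by rw [hl]; field_simp
  have main : ‖∑ n ∈ Ico a b, e (β * (n : ℝ) ^ c + α * n)‖ ≤
      10 * R ^ 2 * (((b - a : ℕ) : ℝ) * √l + 1 / √l) := by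
    rcases lt_or_gt_of_ne hβ with hneg | hpos
    · refine second_difference_test_neg (fun n => β * (n : ℝ) ^ c + α * n) a b l (R ^ 2) hl0
        (one_le_pow₀ hR) ?_
      intro n h1 h2
      obtain ⟨s, s1, s2, s3⟩ := hsd n h1 h2
      rw [abs_of_neg hneg] at s1 s2
      have : -((β * ((n + 2 : ℕ) : ℝ) ^ c + α * (n + 2 : ℕ) - (β * ((n + 1 : ℕ) : ℝ) ^ c + α * (n + 1 : ℕ)))
          - (β * ((n + 1 : ℕ) : ℝ) ^ c + α * (n + 1 : ℕ) - (β * (n : ℝ) ^ c + α * n))) = -β * s := by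
        rw [← s3]; push_cast; ring
      simp only [this]; exact ⟨s1, s2⟩
    · refine second_difference_test (fun n => β * (n : ℝ) ^ c + α * n) a b l (R ^ 2) hl0
        (one_le_pow₀ hR) ?_
      intro n h1 h2
      obtain ⟨s, s1, s2, s3⟩ := hsd n h1 h2
      rw [abs_of_pos hpos] at s1 s2
      have : ((β * ((n + 2 : ℕ) : ℝ) ^ c + α * (n + 2 : ℕ) - (β * ((n + 1 : ℕ) : ℝ) ^ c + α * (n + 1 : ℕ)))
          - (β * ((n + 1 : ℕ) : ℝ) ^ c + α * (n + 1 : ℕ) - (β * (n : ℝ) ^ c + α * n))) = β * s := by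
        rw [← s3]; push_cast; ring
      simp only [this]; exact ⟨s1, s2⟩
  refine main.trans ?_
  have hba : ((b - a : ℕ) : ℝ) ≤ R * K := by
    have : ((b - a : ℕ) : ℝ) ≤ b := by exact_mod_cast Nat.sub_le b a
    linarith
  have t1 : ((b - a : ℕ) : ℝ) * √l ≤ R * √κ * √V := by
    calc ((b - a : ℕ) : ℝ) * √l ≤ R * K * √l := by gcongr
      _ = _ := by rw [hsl]; field_simp
  have t2 : 1 / √l = 1 / √κ * (K / √V) := by rw [hsl]; field_simp
  have p1 : 0 < 1 / √κ := by positivity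
  have p2 : 0 < K / √V := by positivity
  have p3 : 0 < R * √κ := by positivity
  calc 10 * R ^ 2 * (((b - a : ℕ) : ℝ) * √l + 1 / √l)
      ≤ 10 * R ^ 2 * (R * √κ * √V + 1 / √κ * (K / √V)) := by rw [t2]; gcongr
    _ ≤ 10 * R ^ 2 * ((R * √κ + 1 / √κ) * (√V + K / √V)) := by
      gcongr
      nlinarith [mul_pos p1 hsV, mul_pos p3 p2]
    _ = _ := by ring

/-- Partial summation against a monotone weight. -/
lemma norm_sum_monotone_mul_le (w : ℕ → ℝ) (z : ℕ → ℂ) (a b : ℕ) (hab : a ≤ b) (B : ℝ)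
    (hB : ∀ b', a ≤ b' → b' ≤ b → ‖∑ n ∈ Ico a b', z n‖ ≤ B)
    (hw : ∀ n, a ≤ n → n < b → w n ≤ w (n + 1)) (hw0 : 0 ≤ w a) :
    ‖∑ n ∈ Ico a b, (w n : ℂ) * z n‖ ≤ 2 * w b * B := by
  have hB0 : 0 ≤ B := (norm_nonneg _).trans (hB a le_rfl hab)
  have key : ‖∑ n ∈ Ico a b, (w n : ℂ) * z n - w b * ∑ n ∈ Ico a b, z n‖ ≤ (w b - w a) * B
      ∧ w a ≤ w b := by
    induction b, hab using Nat.le_induction with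
    | base => simp
    | succ b hab ih =>
      obtain ⟨ih1, ih2⟩ := ih (fun b' h1 h2 => hB b' h1 (by omega)) (fun n h1 h2 => hw n h1 (by omega))
      have hwb := hw b hab (by omega)
      refine ⟨?_, ih2.trans hwb⟩
      rw [sum_Ico_succ_top hab]
      have hS := hB (b + 1) (by omega) le_rfl
      calc _ = ‖(∑ n ∈ Ico a b, (w n : ℂ) * z n - w b * ∑ n ∈ Ico a b, z n)
            - ((w (b + 1) - w b : ℝ) : ℂ) * ∑ n ∈ Ico a (b + 1), z n‖ := by
            rw [sum_Ico_succ_top hab]; congr 1; push_cast; ring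
        _ ≤ (w b - w a) * B + (w (b + 1) - w b) * B := by
            refine (norm_sub_le _ _).trans (add_le_add ih1 ?_)
            rw [norm_mul, Complex.norm_real, Real.norm_eq_abs, abs_of_nonneg (by linarith)]
            exact mul_le_mul_of_nonneg_left hS (by linarith)
        _ = _ := by ring
  have h1 : ‖(w b : ℂ) * ∑ n ∈ Ico a b, z n‖ ≤ w b * B := by
    rw [norm_mul, Complex.norm_real, Real.norm_eq_abs, abs_of_nonneg (by linarith [key.2])]
    exact mul_le_mul_of_nonneg_left (hB b hab le_rfl) (by linarith [key.2])
  have h2 := norm_add_le (∑ n ∈ Ico a b, (w n : ℂ) * z n - w b * ∑ n ∈ Ico a b, z n)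
    ((w b : ℂ) * ∑ n ∈ Ico a b, z n)
  rw [sub_add_cancel] at h2
  nlinarith [key.1]

lemma sum_inv_sqrt_le (M : ℕ) : ∑ h ∈ Icc 1 M, 1 / √(h : ℝ) ≤ 2 * √(M : ℝ) := by
  induction M with
  | zero => simp
  | succ M ih =>
    rw [sum_Icc_succ_top (by omega)]
    have h1 : 0 < √((M + 1 : ℕ) : ℝ) := Real.sqrt_pos.2 (by positivity)
    have h2 : 0 ≤ √(M : ℝ) := Real.sqrt_nonneg _
    have h3 : √((M + 1 : ℕ) : ℝ) ^ 2 = M + 1 := by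
      rw [Real.sq_sqrt (by positivity)]; push_cast; ring
    have h4 : √(M : ℝ) ^ 2 = M := Real.sq_sqrt (by positivity)
    have : 1 / √((M + 1 : ℕ) : ℝ) ≤ 2 * √((M + 1 : ℕ) : ℝ) - 2 * √(M : ℝ) := by
      rw [div_le_iff₀ h1]
      nlinarith [sq_nonneg (√((M + 1 : ℕ) : ℝ) - √(M : ℝ))]
    linarith

lemma sum_inv_sqrt_dist_le (M m₁ : ℕ) (S : Finset ℕ) (hS : S ⊆ Ico M (2 * M)) (hm : m₁ ∈ Ico M (2 * M)) :
    ∑ m ∈ S.filter (fun m => m ≠ m₁), 1 / √|(m₁ : ℝ) - m| ≤ 4 * √(M : ℝ) := by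
  have hpos : ∀ h : ℕ, 0 ≤ 1 / √(h : ℝ) := fun h => by positivity
  rw [mem_Ico] at hm
  have e1 : S.filter (fun m => m ≠ m₁) = S.filter (fun m => m < m₁) ∪ S.filter (fun m => m₁ < m) := by
    ext m; simp only [mem_filter, mem_union]
    constructor
    · rintro ⟨h1, h2⟩; rcases lt_or_gt_of_ne h2 with h | h
      · exact Or.inl ⟨h1, h⟩
      · exact Or.inr ⟨h1, h⟩
    · rintro (⟨h1, h2⟩ | ⟨h1, h2⟩) <;> exact ⟨h1, by omega⟩
  have hdis : Disjoint (S.filter (fun m => m < m₁)) (S.filter (fun m => m₁ < m)) := by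
    rw [disjoint_left]; intro m h1 h2
    simp only [mem_filter] at h1 h2; omega
  rw [e1, sum_union hdis]
  have p1 : ∑ m ∈ S.filter (fun m => m < m₁), 1 / √|(m₁ : ℝ) - m| ≤ 2 * √(M : ℝ) := by
    refine le_trans (le_of_eq ?_) ((sum_le_sum_of_subset_of_nonneg (s :=
      (S.filter (fun m => m < m₁)).image (fun m => m₁ - m)) ?_ fun h _ _ => hpos h).trans (sum_inv_sqrt_le M))
    · rw [sum_image]
      · refine sum_congr rfl fun m hm' => ?_
        have := (mem_filter.1 hm').2
        rw [Nat.cast_sub this.le, abs_of_nonneg (sub_nonneg.2 (by exact_mod_cast this.le))]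
      · intro x hx y hy hxy
        simp only [coe_filter, Set.mem_ofPred_eq] at hx hy hxy
        omega
    · intro h hh
      obtain ⟨m, hm', rfl⟩ := mem_image.1 hh
      have h2 := mem_filter.1 hm'
      have h3 := mem_Ico.1 (hS h2.1)
      rw [mem_Icc]; omega
  have p2 : ∑ m ∈ S.filter (fun m => m₁ < m), 1 / √|(m₁ : ℝ) - m| ≤ 2 * √(M : ℝ) := by
    refine le_trans (le_of_eq ?_) ((sum_le_sum_of_subset_of_nonneg (s :=
      (S.filter (fun m => m₁ < m)).image (fun m => m - m₁)) ?_ fun h _ _ => hpos h).trans (sum_inv_sqrt_le M))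
    · rw [sum_image]
      · refine sum_congr rfl fun m hm' => ?_
        have := (mem_filter.1 hm').2
        rw [Nat.cast_sub this.le, abs_sub_comm, abs_of_nonneg (sub_nonneg.2 (by exact_mod_cast this.le))]
      · intro x hx y hy hxy
        simp only [coe_filter, Set.mem_ofPred_eq] at hx hy hxy
        omega
    · intro h hh
      obtain ⟨m, hm', rfl⟩ := mem_image.1 hh
      have h2 := mem_filter.1 hm'
      have h3 := mem_Ico.1 (hS h2.1)
      rw [mem_Icc]; omega
  linarith

/-- The bilinear form `∑_{N₀ < mk ≤ N₁} f(m) g(k) z(mk)`. -/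
noncomputable def bilinearSum (N₀ N₁ : ℕ) (f g : ℕ → ℝ) (z : ℕ → ℂ) : ℂ :=
  ∑ m ∈ Icc 1 N₁, ∑ k ∈ Icc 1 N₁, if N₀ < m * k ∧ m * k ≤ N₁ then (f m : ℂ) * g k * z (m * k) else 0

lemma bilinearSum_comm (N₀ N₁ : ℕ) (f g : ℕ → ℝ) (z : ℕ → ℂ) :
    bilinearSum N₀ N₁ f g z = bilinearSum N₀ N₁ g f z := by
  unfold bilinearSum
  rw [sum_comm]
  refine sum_congr rfl fun k _ => sum_congr rfl fun m _ => ?_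
  rw [mul_comm m k, mul_comm (f m : ℂ)]

lemma bilinearSum_add_left (N₀ N₁ : ℕ) (f f' g : ℕ → ℝ) (z : ℕ → ℂ) :
    bilinearSum N₀ N₁ (fun m => f m + f' m) g z = bilinearSum N₀ N₁ f g z + bilinearSum N₀ N₁ f' g z := by
  unfold bilinearSum
  simp_rw [← sum_add_distrib]
  refine sum_congr rfl fun m _ => sum_congr rfl fun k _ => ?_
  split_ifs
  · push_cast; ring
  · simp

lemma sum_mul_eq_bilinearSum (F G : ArithmeticFunction ℝ) (z : ℕ → ℂ) (N₀ N₁ : ℕ) :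
    ∑ n ∈ Ioc N₀ N₁, ((F * G) n : ℂ) * z n = bilinearSum N₀ N₁ F G z := by
  unfold bilinearSum
  rw [← sum_product', ← sum_filter]
  have h1 : ∀ n ∈ Ioc N₀ N₁, ((F * G) n : ℂ) * z n =
      ∑ p ∈ ((Icc 1 N₁ ×ˢ Icc 1 N₁).filter fun p => N₀ < p.1 * p.2 ∧ p.1 * p.2 ≤ N₁).filter
        (fun p => p.1 * p.2 = n), (F p.1 : ℂ) * G p.2 * z (p.1 * p.2) := by
    intro n hn
    rw [mem_Ioc] at hn
    rw [ArithmeticFunction.mul_apply]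
    push_cast
    rw [sum_mul]
    have hset : n.divisorsAntidiagonal = ((Icc 1 N₁ ×ˢ Icc 1 N₁).filter
        fun p => N₀ < p.1 * p.2 ∧ p.1 * p.2 ≤ N₁).filter (fun p => p.1 * p.2 = n) := by
      ext ⟨x, y⟩
      simp only [Nat.mem_divisorsAntidiagonal, mem_filter, mem_product, mem_Icc]
      constructor
      · rintro ⟨rfl, h⟩
        have hx : 0 < x := Nat.pos_of_ne_zero (by rintro rfl; simp at h)
        have hy : 0 < y := Nat.pos_of_ne_zero (by rintro rfl; simp at h)
        exact ⟨⟨⟨⟨hx, le_trans (Nat.le_mul_of_pos_right x hy) hn.2⟩,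
          ⟨hy, le_trans (Nat.le_mul_of_pos_left y hx) hn.2⟩⟩, hn⟩, rfl⟩
      · rintro ⟨⟨-, h⟩, h2⟩
        exact ⟨h2, by omega⟩
    rw [hset]
    refine sum_congr rfl fun p hp => ?_
    rw [(mem_filter.1 hp).2]
  rw [sum_congr rfl h1]
  exact sum_fiberwise_of_maps_to (fun p hp => by rw [mem_Ioc]; exact (mem_filter.1 hp).2) _

lemma inner_sum_eq_Ioc (N₀ N₁ m : ℕ) (hm : 0 < m) (w : ℕ → ℂ) :
    (∑ k ∈ Icc 1 N₁, if N₀ < m * k ∧ m * k ≤ N₁ then w k else 0) = ∑ k ∈ Ioc (N₀ / m) (N₁ / m), w k := by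
  rw [← sum_filter]
  refine sum_congr ?_ fun _ _ => rfl
  ext k
  simp only [mem_filter, mem_Icc, mem_Ioc, Nat.div_lt_iff_lt_mul hm, Nat.le_div_iff_mul_le hm,
    mul_comm m k]
  constructor
  · rintro ⟨-, h⟩; exact h
  · intro h
    refine ⟨⟨?_, le_trans (Nat.le_mul_of_pos_right k hm) h.2⟩, h⟩
    rcases Nat.eq_zero_or_pos k with rfl | hk
    · simp at h
    · exact hk

/-- The part of an arithmetic function supported on `n ≤ U`. -/
noncomputable def lowPart (f : ArithmeticFunction ℝ) (U : ℕ) : ArithmeticFunction ℝ :=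
  ⟨fun n => if n ≤ U then f n else 0, by simp⟩

/-- The part of an arithmetic function supported on `n > U`. -/
noncomputable def highPart (f : ArithmeticFunction ℝ) (U : ℕ) : ArithmeticFunction ℝ :=
  ⟨fun n => if n ≤ U then 0 else f n, by simp⟩

lemma lowPart_apply (f : ArithmeticFunction ℝ) (U n : ℕ) :
    lowPart f U n = if n ≤ U then f n else 0 := rfl

lemma highPart_apply (f : ArithmeticFunction ℝ) (U n : ℕ) :
    highPart f U n = if n ≤ U then 0 else f n := rfl

lemma lowPart_add_highPart (f : ArithmeticFunction ℝ) (U : ℕ) : lowPart f U + highPart f U = f := by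
  ext n
  rw [ArithmeticFunction.add_apply, lowPart_apply, highPart_apply]
  split_ifs <;> simp

open ArithmeticFunction in
/-- Vaughan's identity. -/
theorem vaughan_identity (U : ℕ) :
    highPart vonMangoldt U = lowPart (moebius : ArithmeticFunction ℝ) U * log
      - lowPart (moebius : ArithmeticFunction ℝ) U * lowPart vonMangoldt U * (zeta : ArithmeticFunction ℝ)
      + highPart (moebius : ArithmeticFunction ℝ) U * (highPart vonMangoldt U * (zeta : ArithmeticFunction ℝ)) := by
  have h1 := lowPart_add_highPart vonMangoldt U
  have h2 := lowPart_add_highPart (moebius : ArithmeticFunction ℝ) U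
  have h3 : vonMangoldt * (zeta : ArithmeticFunction ℝ) = log := vonMangoldt_mul_zeta
  have h4 : (moebius : ArithmeticFunction ℝ) * (zeta : ArithmeticFunction ℝ) = 1 :=
    coe_moebius_mul_coe_zeta
  generalize lowPart vonMangoldt U = a at *
  generalize highPart vonMangoldt U = b at *
  generalize lowPart (moebius : ArithmeticFunction ℝ) U = u at *
  generalize highPart (moebius : ArithmeticFunction ℝ) U = v at *
  generalize (zeta : ArithmeticFunction ℝ) = Z at *
  rw [← h3, ← h1]
  rw [← h2] at h4
  linear_combination (-b) * h4

open ArithmeticFunction in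
lemma abs_highPart_moebius_le (U n : ℕ) : |highPart (moebius : ArithmeticFunction ℝ) U n| ≤ 1 := by
  rw [highPart_apply]
  split_ifs
  · simp
  · rw [ArithmeticFunction.intCoe_apply]; exact_mod_cast abs_moebius_le_one

open ArithmeticFunction in
lemma abs_lowPart_moebius_le (U n : ℕ) : |lowPart (moebius : ArithmeticFunction ℝ) U n| ≤ 1 := by
  rw [lowPart_apply]
  split_ifs
  · rw [ArithmeticFunction.intCoe_apply]; exact_mod_cast abs_moebius_le_one
  · simp

open ArithmeticFunction in
lemma highPart_vonMangoldt_mul_zeta_bounds (U n : ℕ) :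
    |(highPart vonMangoldt U * (zeta : ArithmeticFunction ℝ)) n| ≤ Real.log n := by
  rw [mul_comm, coe_zeta_mul_apply, ← vonMangoldt_sum]
  refine (abs_sum_le_sum_abs _ _).trans (sum_le_sum fun i _ => ?_)
  rw [highPart_apply]
  split_ifs
  · simp
  · rw [abs_of_nonneg vonMangoldt_nonneg]

open ArithmeticFunction in
lemma highPart_vonMangoldt_mul_zeta_eq_zero {U n : ℕ} (h : n ≤ U) :
    (highPart vonMangoldt U * (zeta : ArithmeticFunction ℝ)) n = 0 := by
  rw [mul_comm, coe_zeta_mul_apply]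
  refine sum_eq_zero fun i hi => ?_
  rw [highPart_apply, if_pos ((Nat.divisor_le hi).trans h)]

open ArithmeticFunction in
lemma lowPart_mul_lowPart_bounds (U n : ℕ) :
    |(lowPart (moebius : ArithmeticFunction ℝ) U * lowPart vonMangoldt U) n| ≤ Real.log n := by
  rw [mul_apply, ← vonMangoldt_sum, Nat.sum_divisorsAntidiagonal'
    (f := fun x y => lowPart (moebius : ArithmeticFunction ℝ) U x * lowPart vonMangoldt U y)]
  refine (abs_sum_le_sum_abs _ _).trans (sum_le_sum fun i _ => ?_)
  rw [abs_mul]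
  refine (mul_le_of_le_one_left (abs_nonneg _) (abs_lowPart_moebius_le _ _)).trans ?_
  rw [lowPart_apply]
  split_ifs
  · rw [abs_of_nonneg vonMangoldt_nonneg]
  · simp

open ArithmeticFunction in
lemma lowPart_mul_lowPart_eq_zero {U n : ℕ} (h : U * U < n) :
    (lowPart (moebius : ArithmeticFunction ℝ) U * lowPart vonMangoldt U) n = 0 := by
  rw [mul_apply]
  refine sum_eq_zero fun p hp => ?_
  rw [lowPart_apply, lowPart_apply]
  split_ifs with h1 h2
  · have := (Nat.mem_divisorsAntidiagonal.1 hp).1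
    have := Nat.mul_le_mul h1 h2
    omega
  all_goals simp

/-- Correlation sums of the phase `t n ^ c + α n` along two dilations. -/
lemma correlation_bound {c : ℝ} (hc1 : 1 < c) (hc3 : c < 3) {R : ℝ} (hR : 1 ≤ R) :
    ∃ C > 0, ∀ (t α : ℝ) (N₀ N₁ M m₁ m₂ : ℕ), t ≠ 0 → 1 ≤ M → 2 * M ≤ N₀ → (N₁ : ℝ) ≤ R * N₀ →
      m₁ ∈ Ico M (2 * M) → m₂ ∈ Ico M (2 * M) → m₁ ≠ m₂ →
      ‖∑ k ∈ (Icc 1 (N₁ / M)).filter (fun k => (N₀ < m₁ * k ∧ m₁ * k ≤ N₁) ∧ (N₀ < m₂ * k ∧ m₂ * k ≤ N₁)),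
        e (t * ((m₁ : ℝ) ^ c - (m₂ : ℝ) ^ c) * (k : ℝ) ^ c + α * ((m₁ : ℝ) - m₂) * k)‖ ≤
      C * (√(|t| * (N₀ : ℝ) ^ c) + N₀ / √M / √(|t| * (N₀ : ℝ) ^ c) * (1 / √|(m₁ : ℝ) - m₂|)) := by
  obtain ⟨C, hC, H⟩ := monomial_phase_bound hc1 hc3 (R := 4 * R) (by linarith)
  refine ⟨2 * C, by positivity, ?_⟩
  intro t α N₀ N₁ M m₁ m₂ ht hM hMN hN hm₁ hm₂ hne
  rw [mem_Ico] at hm₁ hm₂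
  have hM0 : (0 : ℝ) < M := by exact_mod_cast hM
  have hN0 : (0 : ℝ) < N₀ := by exact_mod_cast (by omega : 0 < N₀)
  have ht0 : 0 < |t| := abs_pos.2 ht
  set T := |t| * (N₀ : ℝ) ^ c with hT
  have hT0 : 0 < T := by positivity
  have hset : (Icc 1 (N₁ / M)).filter (fun k => (N₀ < m₁ * k ∧ m₁ * k ≤ N₁) ∧ (N₀ < m₂ * k ∧ m₂ * k ≤ N₁))
      = Ico (max (N₀ / m₁) (N₀ / m₂) + 1) (min (N₁ / m₁) (N₁ / m₂) + 1) := by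
    ext k
    have hp1 : 0 < m₁ := by omega
    have hp2 : 0 < m₂ := by omega
    simp only [mem_filter, mem_Icc, mem_Ico, Nat.add_one_le_iff, Nat.lt_add_one_iff, max_lt_iff, le_min_iff,
      Nat.div_lt_iff_lt_mul hp1, Nat.le_div_iff_mul_le hp1, Nat.div_lt_iff_lt_mul hp2,
      Nat.le_div_iff_mul_le hp2, Nat.le_div_iff_mul_le (by omega : 0 < M), mul_comm m₁, mul_comm m₂]
    constructor
    · rintro ⟨-, h⟩; exact ⟨⟨h.1.1, h.2.1⟩, h.1.2, h.2.2⟩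
    · intro h
      refine ⟨⟨?_, (Nat.mul_le_mul_left k hm₁.1).trans h.2.1⟩, ⟨h.1.1, h.2.1⟩, h.1.2, h.2.2⟩
      rcases Nat.eq_zero_or_pos k with rfl | hk
      · simp at h
      · exact hk
  rw [hset]
  set β := t * ((m₁ : ℝ) ^ c - (m₂ : ℝ) ^ c) with hβ
  set K : ℝ := N₀ / (2 * M) with hK
  have hK0 : 0 < K := by positivity
  have hK1 : 1 ≤ K := by
    rw [hK, le_div_iff₀ (by positivity)]; exact_mod_cast (by omega : 1 * (2 * M) ≤ N₀)
  have hD : (0 : ℝ) < |(m₁ : ℝ) - m₂| := abs_pos.2 (sub_ne_zero.2 (by exact_mod_cast hne))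
  -- size of the difference of powers
  have key : ∀ x y : ℕ, M ≤ x → x < y → y < 2 * M →
      ((y : ℝ) - x) * (M : ℝ) ^ (c - 1) ≤ (y : ℝ) ^ c - (x : ℝ) ^ c ∧
      (y : ℝ) ^ c - (x : ℝ) ^ c ≤ (2 * M : ℝ) ^ c := by
    intro x y hx hxy hy
    have hx0 : (0 : ℝ) < x := hM0.trans_le (by exact_mod_cast hx)
    have hxy' : (x : ℝ) < y := by exact_mod_cast hxy
    have e1 : (y : ℝ) ^ c = y ^ (c - 1) * y := by
      rw [← Real.rpow_add_one (by linarith)]; congr 1; ring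
    have e2 : (x : ℝ) ^ c = x ^ (c - 1) * x := by
      rw [← Real.rpow_add_one (by linarith)]; congr 1; ring
    have h1 : (x : ℝ) ^ (c - 1) ≤ y ^ (c - 1) :=
      Real.rpow_le_rpow hx0.le hxy'.le (by linarith)
    have h2 : (M : ℝ) ^ (c - 1) ≤ y ^ (c - 1) :=
      Real.rpow_le_rpow hM0.le (by exact_mod_cast hx.trans hxy.le) (by linarith)
    constructor
    · rw [e1, e2]
      nlinarith
    · have := Real.rpow_le_rpow (z := c) (by positivity) (show (y : ℝ) ≤ 2 * M by exact_mod_cast hy.le)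
        (by linarith)
      have := Real.rpow_pos_of_pos hx0 c
      linarith
  have key2 : |(m₁ : ℝ) - m₂| * (M : ℝ) ^ (c - 1) ≤ |(m₁ : ℝ) ^ c - (m₂ : ℝ) ^ c| ∧
      |(m₁ : ℝ) ^ c - (m₂ : ℝ) ^ c| ≤ (2 * M : ℝ) ^ c := by
    have hMc := Real.rpow_pos_of_pos hM0 (c - 1)
    rcases lt_or_gt_of_ne hne with h | h
    · have := key m₁ m₂ hm₁.1 h hm₂.2
      have h' : (m₁ : ℝ) < m₂ := by exact_mod_cast h
      have h3 : 0 ≤ (m₂ : ℝ) ^ c - (m₁ : ℝ) ^ c := le_trans (by nlinarith) this.1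
      rw [abs_sub_comm, abs_of_nonneg (by linarith), abs_sub_comm ((m₁ : ℝ) ^ c), abs_of_nonneg h3]
      exact this
    · have := key m₂ m₁ hm₂.1 h hm₁.2
      have h' : (m₂ : ℝ) < m₁ := by exact_mod_cast h
      have h3 : 0 ≤ (m₁ : ℝ) ^ c - (m₂ : ℝ) ^ c := le_trans (by nlinarith) this.1
      rw [abs_of_nonneg (by linarith), abs_of_nonneg h3]
      exact this
  have hβ0 : β ≠ 0 := by
    have : 0 < |(m₁ : ℝ) ^ c - (m₂ : ℝ) ^ c| :=
      lt_of_lt_of_le (mul_pos hD (Real.rpow_pos_of_pos hM0 _)) key2.1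
    exact mul_ne_zero ht (abs_pos.1 this)
  have hKc : (2 * M : ℝ) ^ c * K ^ c = (N₀ : ℝ) ^ c := by
    rw [← Real.mul_rpow (by positivity) hK0.le, hK]; congr 1; field_simp
  have hKcpos := Real.rpow_pos_of_pos hK0 c
  have hVub : |β| * K ^ c ≤ T := by
    rw [hβ, abs_mul, hT, ← hKc, mul_assoc]
    gcongr; exact key2.2
  have hVlb : T * |(m₁ : ℝ) - m₂| / (8 * M) ≤ |β| * K ^ c := by
    have h8 : (2 * M : ℝ) ^ c ≤ 8 * M * (M : ℝ) ^ (c - 1) := by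
      rw [Real.mul_rpow (by norm_num) hM0.le, mul_assoc, ← Real.rpow_one_add' hM0.le (by linarith)]
      rw [show 1 + (c - 1) = c by ring]
      gcongr
      calc (2 : ℝ) ^ c ≤ 2 ^ (3 : ℝ) := Real.rpow_le_rpow_of_exponent_le (by norm_num) hc3.le
        _ = 8 := by norm_num
    rw [div_le_iff₀ (by positivity), hβ, abs_mul, hT, ← hKc]
    calc |t| * ((2 * M : ℝ) ^ c * K ^ c) * |(m₁ : ℝ) - m₂|
        ≤ |t| * ((8 * M * (M : ℝ) ^ (c - 1)) * K ^ c) * |(m₁ : ℝ) - m₂| := by gcongr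
      _ = |t| * (|(m₁ : ℝ) - m₂| * (M : ℝ) ^ (c - 1)) * K ^ c * (8 * M) := by ring
      _ ≤ _ := by gcongr; exact key2.1
  have hV0 : 0 < |β| * K ^ c := mul_pos (abs_pos.2 hβ0) hKcpos
  have hb : ((min (N₁ / m₁) (N₁ / m₂) + 1 : ℕ) : ℝ) + 1 ≤ 4 * R * K := by
    have h1 : ((min (N₁ / m₁) (N₁ / m₂) : ℕ) : ℝ) ≤ N₁ / M := by
      calc ((min (N₁ / m₁) (N₁ / m₂) : ℕ) : ℝ) ≤ ((N₁ / m₁ : ℕ) : ℝ) := by exact_mod_cast min_le_left _ _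
        _ ≤ (N₁ : ℝ) / m₁ := Nat.cast_div_le
        _ ≤ N₁ / M := by gcongr; exact hm₁.1
    have h2 : (N₁ : ℝ) / M ≤ 2 * R * K := by
      rw [hK, div_le_iff₀ hM0]
      calc (N₁ : ℝ) ≤ R * N₀ := hN
        _ = 2 * R * (N₀ / (2 * M)) * M := by field_simp
    push_cast at h1 ⊢
    nlinarith
  have ha : K ≤ ((max (N₀ / m₁) (N₀ / m₂) + 1 : ℕ) : ℝ) := by
    calc K ≤ (N₀ : ℝ) / m₁ := by
          rw [hK]; gcongr
          · exact_mod_cast (by omega : 0 < m₁)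
          · exact_mod_cast hm₁.2.le
      _ ≤ ((N₀ / m₁ : ℕ) : ℝ) + 1 := by
          rw [div_le_iff₀ (by exact_mod_cast (by omega : 0 < m₁))]
          have := Nat.lt_div_mul_add (a := N₀) (b := m₁) (by omega)
          have h3 : N₀ ≤ (N₀ / m₁ + 1) * m₁ := by rw [add_mul]; omega
          exact_mod_cast h3
      _ ≤ _ := by
        push_cast
        gcongr
        exact le_max_left _ _
  refine (H β (α * ((m₁ : ℝ) - m₂)) K _ _ hβ0 hK0 ha hb).trans ?_
  have s1 : √(|β| * K ^ c) ≤ √T := Real.sqrt_le_sqrt hVub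
  have s2 : K / √(|β| * K ^ c) ≤ 2 * (N₀ / √M / √T * (1 / √|(m₁ : ℝ) - m₂|)) := by
    have h1 : √(T * |(m₁ : ℝ) - m₂| / (8 * M)) ≤ √(|β| * K ^ c) := Real.sqrt_le_sqrt hVlb
    have h8 : √8 ≤ 4 := by rw [Real.sqrt_le_left (by norm_num)]; norm_num
    have hTs : 0 < √T := Real.sqrt_pos.2 hT0
    have hDs : 0 < √|(m₁ : ℝ) - m₂| := Real.sqrt_pos.2 hD
    have hMs : 0 < √(M : ℝ) := Real.sqrt_pos.2 hM0
    calc K / √(|β| * K ^ c) ≤ K / √(T * |(m₁ : ℝ) - m₂| / (8 * M)) := by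
          gcongr
      _ = √8 * (N₀ / √M / √T * (1 / √|(m₁ : ℝ) - m₂|)) / 2 := by
          rw [Real.sqrt_div (by positivity), Real.sqrt_mul hT0.le, hK]
          field_simp
          rw [mul_comm (M : ℝ) 8, Real.sqrt_mul (by norm_num), mul_assoc, Real.mul_self_sqrt hM0.le, mul_comm]
      _ ≤ 4 * (N₀ / √M / √T * (1 / √|(m₁ : ℝ) - m₂|)) / 2 := by gcongr
      _ = _ := by ring
  have : 0 ≤ √T := Real.sqrt_nonneg _
  calc C * (√(|β| * K ^ c) + K / √(|β| * K ^ c)) ≤ C * (√T + 2 * (N₀ / √M / √T * (1 / √|(m₁ : ℝ) - m₂|))) := by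
        gcongr
    _ ≤ _ := by nlinarith

/-- Expanding a square of a bilinear sum after Cauchy–Schwarz. -/
lemma norm_bilinear_sq_le (S J : Finset ℕ) (P : ℕ → ℕ → Prop) [∀ m k, Decidable (P m k)]
    (f g : ℕ → ℝ) (z : ℕ → ℕ → ℂ) (A B : ℝ) (hA : 0 ≤ A) (hf : ∀ m ∈ S, |f m| ≤ A)
    (hg : ∀ k ∈ J, |g k| ≤ B) :
    ‖∑ m ∈ S, ∑ k ∈ J, if P m k then (f m : ℂ) * g k * z m k else 0‖ ^ 2 ≤
      #J * B ^ 2 * (A ^ 2 * ∑ m₁ ∈ S, ∑ m₂ ∈ S,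
        ‖∑ k ∈ J.filter (fun k => P m₁ k ∧ P m₂ k), z m₁ k * (starRingEnd ℂ) (z m₂ k)‖) := by
  set w : ℕ → ℕ → ℂ := fun m k => if P m k then (f m : ℂ) * z m k else 0 with hw
  have h1 : (∑ m ∈ S, ∑ k ∈ J, if P m k then (f m : ℂ) * g k * z m k else 0) =
      ∑ k ∈ J, (g k : ℂ) * ∑ m ∈ S, w m k := by
    rw [sum_comm]
    refine sum_congr rfl fun k _ => ?_
    rw [mul_sum]
    refine sum_congr rfl fun m _ => ?_
    simp only [hw]; split_ifs
    · ring
    · simp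
  have h2 : ‖∑ k ∈ J, (g k : ℂ) * ∑ m ∈ S, w m k‖ ^ 2 ≤ #J * B ^ 2 * ∑ k ∈ J, ‖∑ m ∈ S, w m k‖ ^ 2 := by
    calc ‖∑ k ∈ J, (g k : ℂ) * ∑ m ∈ S, w m k‖ ^ 2 ≤ (∑ k ∈ J, |g k| * ‖∑ m ∈ S, w m k‖) ^ 2 := by
          gcongr
          refine (norm_sum_le _ _).trans (le_of_eq (sum_congr rfl fun k _ => ?_))
          rw [norm_mul, Complex.norm_real, Real.norm_eq_abs]
      _ ≤ (∑ k ∈ J, |g k| ^ 2) * ∑ k ∈ J, ‖∑ m ∈ S, w m k‖ ^ 2 := sum_mul_sq_le_sq_mul_sq _ _ _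
      _ ≤ (∑ k ∈ J, B ^ 2) * ∑ k ∈ J, ‖∑ m ∈ S, w m k‖ ^ 2 := by
          gcongr with k hk
          exact hg k hk
      _ = _ := by rw [sum_const, nsmul_eq_mul]
  rw [h1]
  refine h2.trans ?_
  refine mul_le_mul_of_nonneg_left ?_ (by positivity)
  have h3 : ((∑ k ∈ J, ‖∑ m ∈ S, w m k‖ ^ 2 : ℝ) : ℂ) =
      ∑ m₁ ∈ S, ∑ m₂ ∈ S, (f m₁ : ℂ) * f m₂ *
        ∑ k ∈ J.filter (fun k => P m₁ k ∧ P m₂ k), z m₁ k * (starRingEnd ℂ) (z m₂ k) := by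
    push_cast
    have : ∀ k ∈ J, (‖∑ m ∈ S, w m k‖ : ℂ) ^ 2 = ∑ m₁ ∈ S, ∑ m₂ ∈ S, w m₁ k * (starRingEnd ℂ) (w m₂ k) := by
      intro k _
      rw [← Complex.mul_conj', map_sum, sum_mul_sum]
    rw [sum_congr rfl this, sum_comm]
    refine sum_congr rfl fun m₁ _ => ?_
    rw [sum_comm]
    refine sum_congr rfl fun m₂ _ => ?_
    rw [sum_filter, mul_sum]
    refine sum_congr rfl fun k _ => ?_
    simp only [hw]
    by_cases a1 : P m₁ k <;> by_cases a2 : P m₂ k <;> simp [a1, a2]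
    ring
  have h4 : ∑ k ∈ J, ‖∑ m ∈ S, w m k‖ ^ 2 = ‖((∑ k ∈ J, ‖∑ m ∈ S, w m k‖ ^ 2 : ℝ) : ℂ)‖ := by
    rw [Complex.norm_real, Real.norm_of_nonneg]; positivity
  rw [h4, h3, mul_sum]
  refine (norm_sum_le _ _).trans (sum_le_sum fun m₁ hm₁ => ?_)
  rw [mul_sum]
  refine (norm_sum_le _ _).trans (sum_le_sum fun m₂ hm₂ => ?_)
  rw [norm_mul, norm_mul, Complex.norm_real, Complex.norm_real, Real.norm_eq_abs, Real.norm_eq_abs, sq]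
  gcongr
  exacts [hf _ hm₁, hf _ hm₂]

/-- A dyadic block of a type II sum. -/
lemma type_two_block {c : ℝ} (hc1 : 1 < c) (hc3 : c < 3) {R : ℝ} (hR : 1 ≤ R) :
    ∃ C > 0, ∀ (t α : ℝ) (N₀ N₁ M : ℕ) (f g : ℕ → ℝ) (A B : ℝ), t ≠ 0 → 1 ≤ M → 2 * M ≤ N₀ →
      (N₁ : ℝ) ≤ R * N₀ → 0 ≤ A → 0 ≤ B →
      (∀ m, m ≤ N₁ → |f m| ≤ A) → (∀ k, k ≤ N₁ → |g k| ≤ B) → 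
      ‖∑ m ∈ (Icc 1 N₁).filter (fun m => M ≤ m ∧ m < 2 * M), ∑ k ∈ Icc 1 N₁,
        if N₀ < m * k ∧ m * k ≤ N₁ then
          (f m : ℂ) * g k * e (t * ((m * k : ℕ) : ℝ) ^ c + α * ((m * k : ℕ) : ℝ)) else 0‖ ^ 2 ≤
      C * (A * B) ^ 2 * N₀ * (N₀ / M + M * √(|t| * (N₀ : ℝ) ^ c) + N₀ / √(|t| * (N₀ : ℝ) ^ c)) := by
  obtain ⟨C, hC, H⟩ := correlation_bound hc1 hc3 hR
  refine ⟨R * (R + 4 * C), by positivity, ?_⟩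
  intro t α N₀ N₁ M f g A B ht hM hMN hN hA hB hf hg
  have hM0 : (0 : ℝ) < M := by exact_mod_cast hM
  have hN0 : (0 : ℝ) < N₀ := by exact_mod_cast (by omega : 0 < N₀)
  set T := |t| * (N₀ : ℝ) ^ c with hT
  have hT0 : 0 < T := mul_pos (abs_pos.2 ht) (Real.rpow_pos_of_pos hN0 c)
  have hTs : 0 < √T := Real.sqrt_pos.2 hT0
  set S := (Icc 1 N₁).filter (fun m => M ≤ m ∧ m < 2 * M) with hS
  set J := Icc 1 (N₁ / M) with hJ
  have hSsub : S ⊆ Ico M (2 * M) := fun m hm => mem_Ico.2 (mem_filter.1 hm).2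
  have hred : (∑ m ∈ S, ∑ k ∈ Icc 1 N₁,
        if N₀ < m * k ∧ m * k ≤ N₁ then
          (f m : ℂ) * g k * e (t * ((m * k : ℕ) : ℝ) ^ c + α * ((m * k : ℕ) : ℝ)) else 0) =
      ∑ m ∈ S, ∑ k ∈ J, if N₀ < m * k ∧ m * k ≤ N₁ then
          (f m : ℂ) * g k * e (t * ((m * k : ℕ) : ℝ) ^ c + α * ((m * k : ℕ) : ℝ)) else 0 := by
    refine sum_congr rfl fun m hm => (sum_subset ?_ ?_).symm
    · exact Icc_subset_Icc_right (Nat.div_le_self _ _)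
    · intro k hk hk'
      rw [if_neg]
      rintro ⟨-, h⟩
      apply hk'
      rw [hJ, mem_Icc]
      refine ⟨(mem_Icc.1 hk).1, ?_⟩
      rw [Nat.le_div_iff_mul_le (by omega), mul_comm]
      exact (Nat.mul_le_mul_right k (mem_filter.1 hm).2.1).trans h
  rw [hred]
  refine (norm_bilinear_sq_le S J (fun m k => N₀ < m * k ∧ m * k ≤ N₁) f g _ A B hA ?_ ?_).trans ?_
  · intro m hm; exact hf m (mem_Icc.1 (mem_filter.1 hm).1).2
  · intro k hk; exact hg k ((mem_Icc.1 hk).2.trans (Nat.div_le_self _ _))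
  have hJc : (#J : ℝ) ≤ R * N₀ / M := by
    rw [hJ, Nat.card_Icc, Nat.add_sub_cancel]
    calc ((N₁ / M : ℕ) : ℝ) ≤ (N₁ : ℝ) / M := Nat.cast_div_le
      _ ≤ _ := by gcongr
  have hSc : (#S : ℝ) ≤ M := by
    have := card_le_card hSsub
    rw [Nat.card_Ico] at this
    exact_mod_cast (by omega : #S ≤ M)
  have hcorr : ∀ m₁ ∈ S, ∀ m₂ ∈ S, m₂ ≠ m₁ →
      ‖∑ k ∈ J.filter (fun k => (N₀ < m₁ * k ∧ m₁ * k ≤ N₁) ∧ (N₀ < m₂ * k ∧ m₂ * k ≤ N₁)),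
        e (t * ((m₁ * k : ℕ) : ℝ) ^ c + α * ((m₁ * k : ℕ) : ℝ)) *
          (starRingEnd ℂ) (e (t * ((m₂ * k : ℕ) : ℝ) ^ c + α * ((m₂ * k : ℕ) : ℝ)))‖ ≤
      C * (√T + N₀ / √M / √T * (1 / √|(m₁ : ℝ) - m₂|)) := by
    intro m₁ h₁ m₂ h₂ hne
    refine le_trans (le_of_eq ?_) (H t α N₀ N₁ M m₁ m₂ ht hM hMN hN (hSsub h₁) (hSsub h₂) hne.symm)
    congr 1
    refine sum_congr rfl fun k _ => ?_
    rw [e_mul_conj]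
    congr 1
    push_cast
    rw [Real.mul_rpow (by positivity) (by positivity), Real.mul_rpow (by positivity) (by positivity)]
    ring
  have hrow : ∀ m₁ ∈ S, ∑ m₂ ∈ S,
      ‖∑ k ∈ J.filter (fun k => (N₀ < m₁ * k ∧ m₁ * k ≤ N₁) ∧ (N₀ < m₂ * k ∧ m₂ * k ≤ N₁)),
        e (t * ((m₁ * k : ℕ) : ℝ) ^ c + α * ((m₁ * k : ℕ) : ℝ)) *
          (starRingEnd ℂ) (e (t * ((m₂ * k : ℕ) : ℝ) ^ c + α * ((m₂ * k : ℕ) : ℝ)))‖ ≤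
      R * N₀ / M + C * (M * √T + 4 * (N₀ / √T)) := by
    intro m₁ h₁
    rw [← add_sum_erase S _ h₁]
    refine add_le_add ?_ ?_
    · refine (norm_sum_le _ _).trans ?_
      simp only [norm_mul, RCLike.norm_conj, norm_e, mul_one, sum_const, nsmul_eq_mul]
      refine le_trans ?_ hJc
      exact_mod_cast card_filter_le _ _
    · have hMs : 0 < √(M : ℝ) := Real.sqrt_pos.2 hM0
      calc _ ≤ ∑ m₂ ∈ S.erase m₁, C * (√T + N₀ / √M / √T * (1 / √|(m₁ : ℝ) - m₂|)) :=
            sum_le_sum fun m₂ h₂ => hcorr m₁ h₁ m₂ (mem_of_mem_erase h₂) (ne_of_mem_erase h₂)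
        _ = C * (#(S.erase m₁) * √T + N₀ / √M / √T * ∑ m₂ ∈ S.erase m₁, 1 / √|(m₁ : ℝ) - m₂|) := by
            rw [← mul_sum, sum_add_distrib, ← mul_sum, sum_const, nsmul_eq_mul]
        _ ≤ C * (M * √T + N₀ / √M / √T * (4 * √M)) := by
            gcongr
            · exact (card_le_card (erase_subset _ _)).trans (by exact_mod_cast hSc)
            · have := sum_inv_sqrt_dist_le M m₁ S hSsub (hSsub h₁)
              rwa [filter_ne'] at this
        _ = _ := by field_simp
  calc _ ≤ R * N₀ / M * B ^ 2 * (A ^ 2 * ∑ m₁ ∈ S, (R * N₀ / M + C * (M * √T + 4 * (N₀ / √T)))) := by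
        gcongr with m₁ h₁
        exact hrow m₁ h₁
    _ = R * N₀ / M * B ^ 2 * (A ^ 2 * (#S * (R * N₀ / M + C * (M * √T + 4 * (N₀ / √T))))) := by
        rw [sum_const, nsmul_eq_mul]
    _ ≤ R * N₀ / M * B ^ 2 * (A ^ 2 * (M * (R * N₀ / M + C * (M * √T + 4 * (N₀ / √T))))) := by
        gcongr
    _ = R * (A * B) ^ 2 * N₀ * (R * (N₀ / M) + C * (M * √T) + 4 * C * (N₀ / √T)) := by
        field_simp
        ring
    _ ≤ R * (A * B) ^ 2 * N₀ * ((R + 4 * C) * (N₀ / M) + (R + 4 * C) * (M * √T) + (R + 4 * C) * (N₀ / √T)) := by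
        gcongr <;> linarith
    _ = _ := by ring

lemma natLog_two_add_one_le (N : ℕ) : ((Nat.log 2 N + 1 : ℕ) : ℝ) ≤ 2 * (1 + Real.log N) := by
  have h1 : (Nat.log 2 N : ℝ) ≤ Real.logb 2 N := Real.natLog_le_logb N 2
  have h2 : 0 ≤ Real.log N := Real.log_natCast_nonneg N
  have h3 := Real.log_two_gt_d9
  have h4 : Real.logb 2 N ≤ 2 * Real.log N := by
    rw [Real.logb, div_le_iff₀ (by linarith)]; nlinarith
  push_cast; linarith

lemma type_two_bound {c : ℝ} (hc1 : 1 < c) (hc3 : c < 3) {R : ℝ} (hR : 1 ≤ R) :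
    ∃ C > 0, ∀ (t α : ℝ) (N₀ N₁ U : ℕ) (f g : ℕ → ℝ) (A B : ℝ), t ≠ 0 → 1 ≤ U → 4 * R ≤ N₀ →
      (N₁ : ℝ) ≤ R * N₀ → (U : ℝ) ^ 6 ≤ |t| * (N₀ : ℝ) ^ c → |t| * (N₀ : ℝ) ^ c * (U : ℝ) ^ 6 ≤ N₀ →
      0 ≤ A → 0 ≤ B → (∀ m, m ≤ N₁ → |f m| ≤ A) → (∀ k, k ≤ N₁ → |g k| ≤ B) →
      (∀ m, f m ≠ 0 → U < m ∧ m * m ≤ N₁) →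
      ‖bilinearSum N₀ N₁ f g (fun n => e (t * (n : ℝ) ^ c + α * n))‖ ≤
        C * (1 + Real.log N₁) * (A * B) * N₀ / √U := by
  obtain ⟨C, hC, H⟩ := type_two_block hc1 hc3 hR
  refine ⟨2 * √(C * (3 + R)), by positivity, ?_⟩
  intro t α N₀ N₁ U f g A B ht hU hN0R hN hTl hTu hA hB hf hg hsupp
  have hN0 : (0 : ℝ) < N₀ := by linarith
  set T := |t| * (N₀ : ℝ) ^ c with hT
  have hT0 : 0 < T := mul_pos (abs_pos.2 ht) (Real.rpow_pos_of_pos hN0 c)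
  have hU1 : (1 : ℝ) ≤ U := by exact_mod_cast hU
  have hUs : 0 < √(U : ℝ) := Real.sqrt_pos.2 (by linarith)
  have hsT : (U : ℝ) ^ 3 ≤ √T := Real.le_sqrt_of_sq_le (by calc ((U : ℝ) ^ 3) ^ 2 = U ^ 6 := by ring
                                                              _ ≤ T := hTl)
  have hblock : ∀ j : ℕ, ‖∑ m ∈ (Icc 1 N₁).filter (fun m => Nat.log 2 m = j), ∑ k ∈ Icc 1 N₁,
        if N₀ < m * k ∧ m * k ≤ N₁ then
          (f m : ℂ) * g k * e (t * ((m * k : ℕ) : ℝ) ^ c + α * ((m * k : ℕ) : ℝ)) else 0‖ ≤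
      √(C * (3 + R)) * (A * B) * N₀ / √U := by
    intro j
    have hfil : (Icc 1 N₁).filter (fun m => Nat.log 2 m = j) =
        (Icc 1 N₁).filter (fun m => 2 ^ j ≤ m ∧ m < 2 * 2 ^ j) := by
      refine filter_congr fun m hm => ?_
      rw [Nat.log_eq_iff (Or.inr ⟨by norm_num, by have := (mem_Icc.1 hm).1; omega⟩), pow_succ']
    rw [hfil]
    set M := 2 ^ j with hM
    by_cases hz : ∃ m, M ≤ m ∧ m < 2 * M ∧ f m ≠ 0
    · obtain ⟨m, hm1, hm2, hm3⟩ := hz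
      obtain ⟨s1, s2⟩ := hsupp m hm3
      have hM1 : 1 ≤ M := Nat.one_le_two_pow
      have hM0 : (1 : ℝ) ≤ M := by exact_mod_cast hM1
      have hUM : (U : ℝ) ≤ 2 * M := by exact_mod_cast (by omega : U ≤ 2 * M)
      have hMM : (M : ℝ) * M ≤ R * N₀ := by
        refine le_trans ?_ hN
        exact_mod_cast (Nat.mul_le_mul hm1 hm1).trans s2
      have h2M : 2 * M ≤ N₀ := by
        have : (2 * M : ℝ) ≤ N₀ := by
          refine abs_le_of_sq_le_sq' ?_ hN0.le |>.2
          nlinarith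
        exact_mod_cast this
      have hb := H t α N₀ N₁ M f g A B ht hM1 h2M hN hA hB hf hg
      have hlast : (N₀ : ℝ) / M + M * √T + N₀ / √T ≤ (3 + R) * (N₀ / U) := by
        have hU0 : (0 : ℝ) < U := by linarith
        have a1 : (N₀ : ℝ) / M ≤ 2 * (N₀ / U) := by
          rw [div_le_iff₀ (by linarith)]
          calc (N₀ : ℝ) = N₀ / U * U := by field_simp
            _ ≤ N₀ / U * (2 * M) := by gcongr
            _ = _ := by ring
        have a3 : (N₀ : ℝ) / √T ≤ N₀ / U := by
          gcongr
          refine le_trans ?_ hsT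
          exact le_self_pow₀ hU1 (by norm_num)
        have a2 : M * √T ≤ R * (N₀ / U) := by
          refine abs_le_of_sq_le_sq' ?_ (by positivity) |>.2
          rw [mul_pow, Real.sq_sqrt hT0.le, mul_pow, div_pow, mul_div_assoc', le_div_iff₀ (by positivity)]
          calc (M : ℝ) ^ 2 * T * U ^ 2 = (M * M) * (T * U ^ 2) := by ring
            _ ≤ (R * N₀) * (T * U ^ 6) := by
              gcongr
              norm_num
            _ ≤ (R * N₀) * N₀ := by gcongr
            _ ≤ (R * R * N₀) * N₀ := by
              gcongr
              nlinarith
            _ = _ := by ring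
        linarith
      refine abs_le_of_sq_le_sq' ?_ (by positivity) |>.2
      refine hb.trans ?_
      calc C * (A * B) ^ 2 * N₀ * ((N₀ : ℝ) / M + M * √T + N₀ / √T)
          ≤ C * (A * B) ^ 2 * N₀ * ((3 + R) * (N₀ / U)) := by gcongr
        _ = (√(C * (3 + R)) * (A * B) * N₀ / √U) ^ 2 := by
          have : (√(C * (3 + R)) * (A * B) * N₀ / √U) ^ 2 =
              √(C * (3 + R)) ^ 2 * (A * B) ^ 2 * (N₀ : ℝ) ^ 2 / √(U : ℝ) ^ 2 := by ring
          rw [this, Real.sq_sqrt (by positivity), Real.sq_sqrt (by positivity)]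
          ring
    · push Not at hz
      rw [sum_eq_zero, norm_zero]
      · positivity
      · intro m hm
        rw [mem_filter] at hm
        refine sum_eq_zero fun k _ => ?_
        rw [hz m hm.2.1 hm.2.2]; simp
  unfold bilinearSum
  rw [← sum_fiberwise_of_maps_to (s := Icc 1 N₁) (t := range (Nat.log 2 N₁ + 1)) (g := Nat.log 2)
    (fun m hm => by
      rw [mem_range, Nat.lt_add_one_iff]; exact Nat.log_mono_right (mem_Icc.1 hm).2)]
  refine (norm_sum_le _ _).trans ((sum_le_sum fun j _ => hblock j).trans ?_)
  rw [sum_const, card_range, nsmul_eq_mul]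
  calc _ ≤ 2 * (1 + Real.log N₁) * (√(C * (3 + R)) * (A * B) * N₀ / √U) := by
        gcongr; exact natLog_two_add_one_le N₁
    _ = _ := by ring

/-- Sums over arithmetic progressions of step `m` in `(N₀, N₁]`. -/
lemma type_one_inner {c : ℝ} (hc1 : 1 < c) (hc3 : c < 3) {R : ℝ} (hR : 1 ≤ R) :
    ∃ C > 0, ∀ (t α : ℝ) (N₀ N₁ U m b : ℕ), t ≠ 0 → 1 ≤ U → 1 ≤ m → m ≤ N₀ → 
      (N₁ : ℝ) ≤ R * N₀ → (U : ℝ) ^ 6 ≤ |t| * (N₀ : ℝ) ^ c → |t| * (N₀ : ℝ) ^ c * (U : ℝ) ^ 6 ≤ N₀ →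
      b ≤ N₁ / m → 
      ‖∑ k ∈ Ioc (N₀ / m) b, e (t * ((m * k : ℕ) : ℝ) ^ c + α * ((m * k : ℕ) : ℝ))‖ ≤
        C * N₀ / (U : ℝ) ^ 3 := by
  obtain ⟨C, hC, H⟩ := monomial_phase_bound hc1 hc3 (R := 3 * R) (by linarith)
  refine ⟨2 * C, by positivity, ?_⟩
  intro t α N₀ N₁ U m b ht hU hm hmN hN hTl hTu hb
  have hN0 : (1 : ℝ) ≤ N₀ := by exact_mod_cast hm.trans hmN
  have hm0 : (1 : ℝ) ≤ m := by exact_mod_cast hm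
  set T := |t| * (N₀ : ℝ) ^ c with hT
  have hT0 : 0 < T := mul_pos (abs_pos.2 ht) (Real.rpow_pos_of_pos (by linarith) c)
  have hU1 : (1 : ℝ) ≤ U := by exact_mod_cast hU
  have hsT : (U : ℝ) ^ 3 ≤ √T := Real.le_sqrt_of_sq_le (by calc ((U : ℝ) ^ 3) ^ 2 = U ^ 6 := by ring
                                                              _ ≤ T := hTl)
  have hmc : (0 : ℝ) < (m : ℝ) ^ c := Real.rpow_pos_of_pos (by linarith) c
  have hK1 : 1 ≤ (N₀ : ℝ) / m := by
    rw [le_div_iff₀ (by linarith), one_mul]; exact_mod_cast hmN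
  have hβ : |t * (m : ℝ) ^ c| * ((N₀ : ℝ) / m) ^ c = T := by
    rw [abs_mul, abs_of_pos hmc, mul_assoc, ← Real.mul_rpow (by positivity) (by positivity), hT]
    congr 2; field_simp
  have hsum : ∑ k ∈ Ioc (N₀ / m) b, e (t * ((m * k : ℕ) : ℝ) ^ c + α * ((m * k : ℕ) : ℝ)) =
      ∑ k ∈ Ico (N₀ / m + 1) (b + 1), e (t * (m : ℝ) ^ c * (k : ℝ) ^ c + α * m * k) := by
    refine sum_congr ?_ fun k _ => ?_
    · ext k; simp only [mem_Ioc, mem_Ico]; omega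
    · congr 1
      push_cast
      rw [Real.mul_rpow (by positivity) (by positivity)]; ring
  rw [hsum]
  refine (H (t * (m : ℝ) ^ c) (α * m) ((N₀ : ℝ) / m) _ _ (mul_ne_zero ht hmc.ne') (by positivity)
    ?_ ?_).trans ?_
  · rw [div_le_iff₀ (by linarith)]
    have := Nat.lt_div_mul_add (a := N₀) (b := m) (by omega)
    have h3 : N₀ ≤ (N₀ / m + 1) * m := by rw [add_mul]; omega
    exact_mod_cast h3
  · have h1 : (b : ℝ) ≤ R * (N₀ / m) := by
      calc (b : ℝ) ≤ ((N₁ / m : ℕ) : ℝ) := by exact_mod_cast hb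
        _ ≤ (N₁ : ℝ) / m := Nat.cast_div_le
        _ ≤ (R * N₀) / m := by gcongr
        _ = _ := by ring
    push_cast
    nlinarith
  · rw [hβ]
    have a1 : √T ≤ N₀ / (U : ℝ) ^ 3 := by
      refine Real.sqrt_le_left (by positivity) |>.2 ?_
      rw [div_pow, le_div_iff₀ (by positivity)]
      calc T * ((U : ℝ) ^ 3) ^ 2 = T * (U : ℝ) ^ 6 := by ring
        _ ≤ (N₀ : ℝ) := hTu
        _ ≤ (N₀ : ℝ) ^ 2 := by nlinarith
    have a2 : (N₀ : ℝ) / m / √T ≤ N₀ / (U : ℝ) ^ 3 := by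
      calc (N₀ : ℝ) / m / √T ≤ N₀ / 1 / (U : ℝ) ^ 3 := by gcongr
        _ = _ := by rw [div_one]
    calc C * (√T + (N₀ : ℝ) / m / √T) ≤ C * (N₀ / (U : ℝ) ^ 3 + N₀ / (U : ℝ) ^ 3) := by gcongr
      _ = _ := by ring

lemma bilinearSum_eq (N₀ N₁ : ℕ) (f g : ℕ → ℝ) (z : ℕ → ℂ) :
    bilinearSum N₀ N₁ f g z =
      ∑ m ∈ Icc 1 N₁, (f m : ℂ) * ∑ k ∈ Ioc (N₀ / m) (N₁ / m), (g k : ℂ) * z (m * k) := by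
  refine sum_congr rfl fun m hm => ?_
  rw [inner_sum_eq_Ioc N₀ N₁ m (mem_Icc.1 hm).1, mul_sum]
  exact sum_congr rfl fun k _ => mul_assoc _ _ _

lemma log_natCast_add_one_le (N : ℕ) : Real.log ((N : ℝ) + 1) ≤ 1 + Real.log N := by
  rcases Nat.eq_zero_or_pos N with rfl | h
  · simp
  · have h1 : (1 : ℝ) ≤ N := by exact_mod_cast h
    calc Real.log ((N : ℝ) + 1) ≤ Real.log (2 * N) := Real.log_le_log (by linarith) (by linarith)
      _ = Real.log 2 + Real.log N := Real.log_mul (by norm_num) (by linarith)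
      _ ≤ _ := by have := Real.log_two_lt_d9; linarith

lemma norm_sum_le_of_support (N₁ V : ℕ) (f : ℕ → ℝ) (S : ℕ → ℂ) (A B : ℝ) (hA : 0 ≤ A) (hB : 0 ≤ B)
    (hf : ∀ m ∈ Icc 1 N₁, |f m| ≤ A) (hf0 : ∀ m, V < m → f m = 0)
    (hS : ∀ m, 1 ≤ m → m ≤ V → ‖S m‖ ≤ B) :
    ‖∑ m ∈ Icc 1 N₁, (f m : ℂ) * S m‖ ≤ V * (A * B) := by
  rw [← sum_filter_add_sum_filter_not (Icc 1 N₁) (fun m => m ≤ V)]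
  rw [sum_eq_zero (s := (Icc 1 N₁).filter fun m => ¬ m ≤ V), add_zero]
  · refine (norm_sum_le _ _).trans ?_
    refine (sum_le_card_nsmul _ _ (A * B) ?_).trans ?_
    · intro m hm
      rw [mem_filter] at hm
      rw [norm_mul, Complex.norm_real, Real.norm_eq_abs]
      exact mul_le_mul (hf m hm.1) (hS m (mem_Icc.1 hm.1).1 hm.2) (norm_nonneg _) hA
    · rw [nsmul_eq_mul]
      have hc : #((Icc 1 N₁).filter fun m => m ≤ V) ≤ V := by
        calc _ ≤ #(Icc 1 V) := card_le_card fun m hm => by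
              rw [mem_filter, mem_Icc] at hm
              rw [mem_Icc]; exact ⟨hm.1.1, hm.2⟩
          _ = V := by rw [Nat.card_Icc, Nat.add_sub_cancel]
      have : 0 ≤ A * B := by positivity
      gcongr
  · intro m hm
    rw [mem_filter, not_le] at hm
    rw [hf0 m hm.2]; simp

lemma type_two_full {c : ℝ} (hc1 : 1 < c) (hc3 : c < 3) {R : ℝ} (hR : 1 ≤ R) :
    ∃ C > 0, ∀ (t α : ℝ) (N₀ N₁ U : ℕ) (f g : ℕ → ℝ) (A B : ℝ), t ≠ 0 → 1 ≤ U → 4 * R ≤ N₀ →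
      (N₁ : ℝ) ≤ R * N₀ → (U : ℝ) ^ 6 ≤ |t| * (N₀ : ℝ) ^ c → |t| * (N₀ : ℝ) ^ c * (U : ℝ) ^ 6 ≤ N₀ →
      0 ≤ A → 0 ≤ B → (∀ m, m ≤ N₁ → |f m| ≤ A) → (∀ k, k ≤ N₁ → |g k| ≤ B) →
      (∀ m, m ≤ U → f m = 0) → (∀ m, m ≤ U → g m = 0) →
      ‖bilinearSum N₀ N₁ f g (fun n => e (t * (n : ℝ) ^ c + α * n))‖ ≤
        C * (1 + Real.log N₁) * (A * B) * N₀ / √U := by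
  obtain ⟨C, hC, H⟩ := type_two_bound hc1 hc3 hR
  refine ⟨2 * C, by positivity, ?_⟩
  intro t α N₀ N₁ U f g A B ht hU hN0R hN hTl hTu hA hB hf hg hf0 hg0
  set z : ℕ → ℂ := fun n => e (t * (n : ℝ) ^ c + α * n) with hz
  set f1 : ℕ → ℝ := fun m => if m * m ≤ N₁ then f m else 0 with hf1
  set f2 : ℕ → ℝ := fun m => if m * m ≤ N₁ then 0 else f m with hf2
  set g1 : ℕ → ℝ := fun m => if m * m ≤ N₁ then g m else 0 with hg1
  have hsplit : bilinearSum N₀ N₁ f g z = bilinearSum N₀ N₁ f1 g z + bilinearSum N₀ N₁ g1 f2 z := by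
    have h1 : f = fun m => f1 m + f2 m := by
      funext m; simp only [hf1, hf2]; split_ifs <;> simp
    have h2 : bilinearSum N₀ N₁ f2 g z = bilinearSum N₀ N₁ g1 f2 z := by
      rw [bilinearSum_comm]
      refine sum_congr rfl fun m _ => sum_congr rfl fun k _ => ?_
      split_ifs with h
      · simp only [hf2, hg1]
        by_cases hk : k * k ≤ N₁
        · simp [hk]
        · have : m * m ≤ N₁ := by
            by_contra hm
            push Not at hk hm
            have : m < k := by
              by_contra h'
              push Not at h'
              have := Nat.mul_le_mul_right k h'
              omega
            have := Nat.mul_le_mul_left m this.le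
            omega
          rw [if_pos this]
      · rfl
    conv_lhs => rw [h1]
    rw [bilinearSum_add_left, h2]
  have b1 : ∀ f' : ℕ → ℝ, ∀ m, |if m * m ≤ N₁ then f' m else 0| ≤ |f' m| := by
    intro f' m; split_ifs <;> simp
  have b2 : ∀ f' : ℕ → ℝ, ∀ m, |if m * m ≤ N₁ then 0 else f' m| ≤ |f' m| := by
    intro f' m; split_ifs <;> simp
  have key : ∀ f' : ℕ → ℝ, (∀ m, m ≤ U → f' m = 0) → ∀ m, (if m * m ≤ N₁ then f' m else 0) ≠ 0 →
      U < m ∧ m * m ≤ N₁ := by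
    intro f' h0 m hm
    split_ifs at hm with h
    · exact ⟨by by_contra h'; exact hm (h0 m (not_lt.1 h')), h⟩
    · exact absurd rfl hm
  have e1 := H t α N₀ N₁ U f1 g A B ht hU hN0R hN hTl hTu hA hB (fun m hm => (b1 f m).trans (hf m hm)) hg
    (key f hf0)
  have e2 := H t α N₀ N₁ U g1 f2 B A ht hU hN0R hN hTl hTu hB hA (fun m hm => (b1 g m).trans (hg m hm))
    (fun m hm => (b2 f m).trans (hf m hm)) (key g hg0)
  rw [hsplit]
  refine (norm_add_le _ _).trans ((add_le_add e1 e2).trans (le_of_eq ?_))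
  ring

open ArithmeticFunction in
/-- Exponential sums over primes with phase `t n ^ c + α n`, in the range where `t N ^ c` is
moderately large. -/
theorem prime_exp_sum_bound {c : ℝ} (hc1 : 1 < c) (hc3 : c < 3) {R : ℝ} (hR : 1 ≤ R) :
    ∃ C > 0, ∀ (t α : ℝ) (N₀ N₁ U : ℕ), t ≠ 0 → 1 ≤ U → N₀ < N₁ → 4 * R ≤ N₀ →
      (N₁ : ℝ) ≤ R * N₀ → (U : ℝ) ^ 6 ≤ |t| * (N₀ : ℝ) ^ c → |t| * (N₀ : ℝ) ^ c * (U : ℝ) ^ 6 ≤ N₀ →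
      ‖∑ n ∈ Ioc N₀ N₁, (vonMangoldt n : ℂ) * e (t * (n : ℝ) ^ c + α * n)‖ ≤
        C * (1 + Real.log N₁) ^ 2 * N₀ / √U := by
  obtain ⟨C1, hC1, H1⟩ := type_one_inner hc1 hc3 hR
  obtain ⟨C2, hC2, H2⟩ := type_two_full hc1 hc3 hR
  refine ⟨3 * C1 + C2, by positivity, ?_⟩
  intro t α N₀ N₁ U ht hU hN01 hN0R hN hTl hTu
  set z : ℕ → ℂ := fun n => e (t * (n : ℝ) ^ c + α * n) with hz
  have hU1 : (1 : ℝ) ≤ U := by exact_mod_cast hU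
  have hN0 : (0 : ℝ) < N₀ := by linarith
  have hUN : U * U ≤ N₀ := by
    have : (U : ℝ) * U ≤ N₀ := by
      calc (U : ℝ) * U = U ^ 2 := by ring
        _ ≤ U ^ 12 := by gcongr; norm_num
        _ = U ^ 6 * U ^ 6 := by ring
        _ ≤ |t| * (N₀ : ℝ) ^ c * (U : ℝ) ^ 6 := by gcongr
        _ ≤ _ := hTu
    exact_mod_cast this
  have hUN' : U ≤ N₀ := (Nat.le_mul_self U).trans hUN
  set L := 1 + Real.log N₁ with hL
  have hlog0 : 0 ≤ Real.log N₁ := Real.log_natCast_nonneg N₁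
  have hlogle : ∀ m : ℕ, m ≤ N₁ → Real.log m ≤ L := by
    intro m hm
    rcases Nat.eq_zero_or_pos m with rfl | h
    · simp only [Nat.cast_zero, Real.log_zero]; linarith
    · have : Real.log m ≤ Real.log N₁ := Real.log_le_log (by exact_mod_cast h) (by exact_mod_cast hm)
      linarith
  set Z := C1 * N₀ / (U : ℝ) ^ 3 with hZ
  have hZ0 : 0 ≤ Z := by positivity
  have hsum : ∑ n ∈ Ioc N₀ N₁, (vonMangoldt n : ℂ) * z n =
      bilinearSum N₀ N₁ (lowPart (moebius : ArithmeticFunction ℝ) U) log z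
      - bilinearSum N₀ N₁ (lowPart (moebius : ArithmeticFunction ℝ) U * lowPart vonMangoldt U : ArithmeticFunction ℝ)
          (zeta : ArithmeticFunction ℝ) z
      + bilinearSum N₀ N₁ (highPart (moebius : ArithmeticFunction ℝ) U)
        (highPart vonMangoldt U * (zeta : ArithmeticFunction ℝ) : ArithmeticFunction ℝ) z := by
    rw [← sum_mul_eq_bilinearSum, ← sum_mul_eq_bilinearSum, ← sum_mul_eq_bilinearSum, ← sum_sub_distrib,
      ← sum_add_distrib]
    refine sum_congr rfl fun n hn => ?_
    have h1 : vonMangoldt n = highPart vonMangoldt U n := by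
      rw [highPart_apply, if_neg]; have := (mem_Ioc.1 hn).1; omega
    have h2 := congrArg (fun F : ArithmeticFunction ℝ => F n) (vaughan_identity U)
    rw [h1, h2, sub_eq_add_neg, ArithmeticFunction.add_apply,
      ArithmeticFunction.add_apply, ArithmeticFunction.neg_apply]
    push_cast; ring
  have hz_inner : ∀ m b : ℕ, 1 ≤ m → m ≤ N₀ → b ≤ N₁ / m → ‖∑ k ∈ Ioc (N₀ / m) b, z (m * k)‖ ≤ Z :=
    fun m b h1 h2 h3 => H1 t α N₀ N₁ U m b ht hU h1 h2 hN hTl hTu h3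
  have S1 : ‖bilinearSum N₀ N₁ (lowPart (moebius : ArithmeticFunction ℝ) U) log z‖ ≤ U * (1 * (2 * L * Z)) := by
    rw [bilinearSum_eq]
    refine norm_sum_le_of_support N₁ U _ _ 1 (2 * L * Z) zero_le_one (by positivity)
      (fun m _ => abs_lowPart_moebius_le U m) (fun m hm => by rw [lowPart_apply, if_neg (by omega)]) ?_
    intro m hm1 hm2
    have hI : Ioc (N₀ / m) (N₁ / m) = Ico (N₀ / m + 1) (N₁ / m + 1) := by
      ext k; simp only [mem_Ioc, mem_Ico, Nat.lt_add_one_iff, Nat.add_one_le_iff]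
    rw [hI]
    simp only [log_apply]
    refine (norm_sum_monotone_mul_le (fun k => Real.log k) (fun k => z (m * k)) _ _
      (Nat.succ_le_succ (Nat.div_le_div_right hN01.le)) Z ?_ ?_ (Real.log_natCast_nonneg _)).trans ?_
    · intro b' hb1 hb2
      obtain ⟨b, rfl⟩ : ∃ b, b' = b + 1 := ⟨b' - 1, (Nat.sub_add_cancel (Nat.one_le_of_lt hb1)).symm⟩
      have : Ico (N₀ / m + 1) (b + 1) = Ioc (N₀ / m) b := by
        ext k; simp only [mem_Ioc, mem_Ico, Nat.lt_add_one_iff, Nat.add_one_le_iff]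
      rw [this]
      exact hz_inner m _ hm1 (hm2.trans hUN') (Nat.le_of_succ_le_succ hb2)
    · intro n hn _
      exact Real.log_le_log (by exact_mod_cast Nat.lt_of_lt_of_le (Nat.succ_pos _) hn) (by exact_mod_cast Nat.le_succ n)
    · have : Real.log ((N₁ / m + 1 : ℕ) : ℝ) ≤ L := by
        refine le_trans ?_ (log_natCast_add_one_le N₁)
        refine Real.log_le_log (by positivity) ?_
        exact_mod_cast Nat.add_le_add_right (Nat.div_le_self N₁ m) 1
      gcongr
  have S2 : ‖bilinearSum N₀ N₁ (lowPart (moebius : ArithmeticFunction ℝ) U * lowPart vonMangoldt U : ArithmeticFunction ℝ)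
          (zeta : ArithmeticFunction ℝ) z‖ ≤ (U * U : ℕ) * (L * Z) := by
    rw [bilinearSum_eq]
    refine norm_sum_le_of_support N₁ (U * U) _ _ L Z (by positivity) hZ0
      (fun m hm => (lowPart_mul_lowPart_bounds U m).trans (hlogle m (mem_Icc.1 hm).2))
      (fun m hm => lowPart_mul_lowPart_eq_zero hm) ?_
    intro m hm1 hm2
    refine le_trans (le_of_eq ?_) (hz_inner m (N₁ / m) hm1 (hm2.trans hUN) le_rfl)
    congr 1
    refine sum_congr rfl fun k hk => ?_
    have : k ≠ 0 := Nat.ne_of_gt (Nat.zero_lt_of_lt (mem_Ioc.1 hk).1)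
    simp [ArithmeticFunction.natCoe_apply, zeta_apply, this]
  have S3 := H2 t α N₀ N₁ U (highPart (moebius : ArithmeticFunction ℝ) U)
    (highPart vonMangoldt U * (zeta : ArithmeticFunction ℝ) : ArithmeticFunction ℝ) 1 L ht hU hN0R hN hTl hTu
    zero_le_one (by positivity) (fun m _ => abs_highPart_moebius_le U m)
    (fun m hm => (highPart_vonMangoldt_mul_zeta_bounds U m).trans (hlogle m hm))
    (fun m hm => by rw [highPart_apply, if_pos hm]) (fun m hm => highPart_vonMangoldt_mul_zeta_eq_zero hm)
  have hUs : √(U : ℝ) ≤ U := Real.sqrt_le_left (by linarith) |>.2 (by nlinarith)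
  have hUs0 : 0 < √(U : ℝ) := Real.sqrt_pos.2 (by linarith)
  have hL1 : 1 ≤ L := by linarith
  have hZU : (U : ℝ) * U * Z ≤ C1 * N₀ / √U := by
    calc (U : ℝ) * U * Z = C1 * N₀ / U := by rw [hZ]; field_simp
      _ ≤ _ := by gcongr
  have hZU' : (U : ℝ) * Z ≤ C1 * N₀ / √U := by
    refine le_trans ?_ hZU
    have : 0 ≤ U * Z := by positivity
    nlinarith
  rw [hsum]
  refine (norm_add_le _ _).trans ((add_le_add ((norm_sub_le _ _).trans (add_le_add S1 S2)) S3).trans ?_)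
  push_cast
  have hW : 0 ≤ C1 * N₀ / √U := by positivity
  have hLL : L ≤ L ^ 2 := by nlinarith
  calc (U : ℝ) * (1 * (2 * L * Z)) + U * U * (L * Z) + C2 * L * (1 * L) * N₀ / √U
      = 2 * L * (U * Z) + L * (U * U * Z) + C2 * L ^ 2 * N₀ / √U := by ring
    _ ≤ 2 * L * (C1 * N₀ / √U) + L * (C1 * N₀ / √U) + C2 * L ^ 2 * N₀ / √U := by gcongr
    _ = 3 * (L * (C1 * N₀ / √U)) + C2 * L ^ 2 * N₀ / √U := by ring
    _ ≤ 3 * (L ^ 2 * (C1 * N₀ / √U)) + C2 * L ^ 2 * N₀ / √U := by gcongr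
    _ = _ := by ring

/-- The remainder of the partial sums of `f` beyond `N`, after removing the main term `ρ`. -/
noncomputable def tailRemainder (f : ℕ → ℂ) (ρ : ℂ) (N : ℕ) (t : ℝ) : ℂ :=
  if (N : ℝ) < t then ∑ k ∈ Ioc N ⌊t⌋₊, f k - ρ * (t - N) else 0

theorem measurable_tailRemainder (f : ℕ → ℂ) (ρ : ℂ) (N : ℕ) :
    Measurable (tailRemainder f ρ N) := by
  unfold tailRemainder
  refine Measurable.ite (measurableSet_lt measurable_const measurable_id) ?_ measurable_const
  refine Measurable.sub ?_ (by fun_prop)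
  exact (measurable_from_top (f := fun n : ℕ => ∑ k ∈ Ioc N n, f k)).comp Nat.measurable_floor

theorem norm_tailRemainder_le {f : ℕ → ℂ} {ρ : ℂ} {K : ℝ} {N : ℕ} (hK : 0 ≤ K) (hρ : ‖ρ‖ ≤ 1)
    (hf : ∀ M, N ≤ M → ‖∑ k ∈ Ioc N M, f k - ρ * ((M : ℂ) - N)‖ ≤ K) (t : ℝ) :
    ‖tailRemainder f ρ N t‖ ≤ K + 1 := by
  unfold tailRemainder
  split_ifs with h
  · have ht : (0 : ℝ) ≤ t := (Nat.cast_nonneg N).trans h.le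
    have hN : N ≤ ⌊t⌋₊ := Nat.le_floor h.le
    have h1 : ∑ k ∈ Ioc N ⌊t⌋₊, f k - ρ * (t - N)
        = (∑ k ∈ Ioc N ⌊t⌋₊, f k - ρ * ((⌊t⌋₊ : ℂ) - N)) - ρ * ((t - ⌊t⌋₊ : ℝ) : ℂ) := by
      push_cast; ring
    rw [h1]
    refine (norm_sub_le _ _).trans (add_le_add (hf _ hN) ?_)
    rw [norm_mul, Complex.norm_real, Real.norm_eq_abs,
      abs_of_nonneg (by linarith [Nat.floor_le ht])]
    have := Nat.lt_floor_add_one t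
    calc ‖ρ‖ * (t - ⌊t⌋₊) ≤ 1 * 1 := by
          apply mul_le_mul hρ (by linarith) (by linarith [Nat.floor_le ht]) (by norm_num)
      _ = 1 := by norm_num
  · simp; linarith

section
variable {f : ℕ → ℂ} {ρ : ℂ} {K : ℝ} {N : ℕ}

theorem differentiableAt_mellin_tailRemainder (hN : 1 ≤ N) (hK : 0 ≤ K) (hρ : ‖ρ‖ ≤ 1)
    (hf : ∀ M, N ≤ M → ‖∑ k ∈ Ioc N M, f k - ρ * ((M : ℂ) - N)‖ ≤ K) {s : ℂ} (hs : s.re < 0) :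
    MellinConvergent (tailRemainder f ρ N) s ∧
      DifferentiableAt ℂ (mellin (tailRemainder f ρ N)) s := by
  have hb := norm_tailRemainder_le hK hρ hf
  have hloc : MeasureTheory.LocallyIntegrableOn (tailRemainder f ρ N) (Set.Ioi 0) := by
    refine MeasureTheory.LocallyIntegrable.locallyIntegrableOn ?_ _
    refine (MeasureTheory.locallyIntegrable_const (K + 1)).mono
      (measurable_tailRemainder f ρ N).aestronglyMeasurable ?_
    exact Filter.Eventually.of_forall fun x => (hb x).trans (le_abs_self _)
  have htop : tailRemainder f ρ N =O[Filter.atTop] fun t : ℝ => t ^ (-(0:ℝ)) := by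
    refine Asymptotics.IsBigO.of_bound (K + 1) (Filter.Eventually.of_forall fun x => ?_)
    simpa using hb x
  have hbot : tailRemainder f ρ N =O[nhdsWithin 0 (Set.Ioi 0)]
      fun t : ℝ => t ^ (-(s.re - 1)) := by
    refine Asymptotics.IsBigO.of_bound 1 ?_
    have : ∀ᶠ x : ℝ in nhdsWithin 0 (Set.Ioi 0), x < 1 :=
      nhdsWithin_le_nhds (Iio_mem_nhds (by norm_num))
    filter_upwards [this] with x hx
    have : ¬ (N : ℝ) < x := by
      have : (1 : ℝ) ≤ N := by exact_mod_cast hN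
      linarith
    simp only [tailRemainder, this, if_false, norm_zero]
    positivity
  exact ⟨mellinConvergent_of_isBigO_rpow hloc htop hs hbot (by linarith),
    mellin_differentiableAt_of_isBigO_rpow hloc htop hs hbot (by linarith)⟩

theorem norm_mellin_tailRemainder_le (hN : 1 ≤ N) (hK : 0 ≤ K) (hρ : ‖ρ‖ ≤ 1)
    (hf : ∀ M, N ≤ M → ‖∑ k ∈ Ioc N M, f k - ρ * ((M : ℂ) - N)‖ ≤ K) {s : ℂ} (hs : 0 < s.re) :
    ‖mellin (tailRemainder f ρ N) (-s)‖ ≤ (K + 1) * ((N : ℝ) ^ (-s.re) / s.re) := by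
  have hb := norm_tailRemainder_le hK hρ hf
  have hN0 : (0 : ℝ) < N := by exact_mod_cast hN
  have hinteg : MeasureTheory.IntegrableOn (fun t : ℝ => (K + 1) * t ^ (-s.re - 1)) (Set.Ioi (N:ℝ)) :=
    (integrableOn_Ioi_rpow_of_lt (by linarith) hN0).const_mul _
  have h1 : mellin (tailRemainder f ρ N) (-s)
      = ∫ t in Set.Ioi (N:ℝ), (t : ℂ) ^ (-s - 1) • tailRemainder f ρ N t := by
    unfold mellin
    refine MeasureTheory.setIntegral_eq_of_subset_of_forall_sdiff_eq_zero measurableSet_Ioi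
      (Set.Ioi_subset_Ioi hN0.le) ?_
    intro x hx
    have : ¬ (N : ℝ) < x := fun h => hx.2 h
    simp [tailRemainder, this]
  rw [h1]
  have h2 := MeasureTheory.norm_integral_le_of_norm_le (μ := MeasureTheory.volume.restrict
    (Set.Ioi (N:ℝ))) (f := fun t : ℝ => (t : ℂ) ^ (-s - 1) • tailRemainder f ρ N t) hinteg (by
      filter_upwards [MeasureTheory.ae_restrict_mem measurableSet_Ioi] with x hx
      have hx0 : 0 < x := hN0.trans hx
      rw [norm_smul, Complex.norm_cpow_eq_rpow_re_of_pos hx0, mul_comm]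
      have : (-s - 1).re = -s.re - 1 := by simp
      rw [this]
      exact mul_le_mul_of_nonneg_right (hb x) (by positivity))
  refine h2.trans (le_of_eq ?_)
  rw [MeasureTheory.integral_const_mul, integral_Ioi_rpow_of_lt (by linarith) hN0]
  congr 1
  have : -s.re - 1 + 1 = -s.re := by ring
  rw [this, neg_div_neg_eq]

theorem LSeries_eq_sum_add_mellin (hN : 1 ≤ N) (hK : 0 ≤ K) (hρ : ‖ρ‖ ≤ 1)
    (hf : ∀ M, N ≤ M → ‖∑ k ∈ Ioc N M, f k - ρ * ((M : ℂ) - N)‖ ≤ K) (hf1 : ∀ n, ‖f n‖ ≤ 1)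
    {s : ℂ} (hs : 1 < s.re) :
    LSeries f s = ∑ n ∈ Icc 1 N, f n * (n : ℂ) ^ (-s) + ρ * (N : ℂ) ^ (1 - s) / (s - 1)
      + s * mellin (tailRemainder f ρ N) (-s) := by
  have hN0 : (0 : ℝ) < N := by exact_mod_cast hN
  have hsum : LSeriesSummable f s :=
    LSeriesSummable_of_bounded_of_one_lt_re (m := 1) (fun n _ => hf1 n) hs
  set g : ℕ → ℂ := fun n => if N < n then f n else 0 with hg
  set h : ℕ → ℂ := fun n => if N < n then 0 else f n with hh
  have hfgh : f = h + g := by ext n; simp only [hg, hh, Pi.add_apply]; split_ifs <;> simp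
  have hg1 : ∀ n, ‖g n‖ ≤ 1 := by
    intro n; simp only [hg]; split_ifs
    · exact hf1 n
    · simp
  have hh1 : ∀ n, ‖h n‖ ≤ 1 := by
    intro n; simp only [hh]; split_ifs
    · simp
    · exact hf1 n
  have hgs : LSeriesSummable g s :=
    LSeriesSummable_of_bounded_of_one_lt_re (m := 1) (fun n _ => hg1 n) hs
  have hhs : LSeriesSummable h s :=
    LSeriesSummable_of_bounded_of_one_lt_re (m := 1) (fun n _ => hh1 n) hs
  have hL : LSeries f s = LSeries h s + LSeries g s := by
    rw [hfgh]; exact LSeries_add hhs hgs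
  have hLh : LSeries h s = ∑ n ∈ Icc 1 N, f n * (n : ℂ) ^ (-s) := by
    unfold LSeries
    rw [tsum_eq_sum (s := Icc 1 N)]
    · refine Finset.sum_congr rfl fun n hn => ?_
      rw [Finset.mem_Icc] at hn
      rw [LSeries.term_of_ne_zero (by omega)]
      simp only [hh, if_neg (not_lt.2 hn.2)]
      rw [Complex.cpow_neg, div_eq_mul_inv]
    · intro n hn
      rcases Nat.eq_zero_or_pos n with rfl | hn0
      · simp
      · rw [LSeries.term_of_ne_zero (by omega)]
        have : N < n := by
          by_contra hc; exact hn (Finset.mem_Icc.2 ⟨hn0, not_lt.1 hc⟩)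
        simp [hh, this]
  have hO : (fun n => ∑ k ∈ Icc 1 n, g k) =O[Filter.atTop] fun n : ℕ => (n : ℝ) ^ (1 : ℝ) := by
    refine Asymptotics.IsBigO.of_bound 1 (Filter.Eventually.of_forall fun n => ?_)
    rw [Real.rpow_one, one_mul, Real.norm_natCast]
    calc ‖∑ k ∈ Icc 1 n, g k‖ ≤ ∑ k ∈ Icc 1 n, ‖g k‖ := norm_sum_le _ _
      _ ≤ ∑ k ∈ Icc 1 n, (1 : ℝ) := Finset.sum_le_sum fun k _ => hg1 k
      _ = n := by simp
  have hLg := LSeries_eq_mul_integral g zero_le_one hs hgs hO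
  have hs1 : s - 1 ≠ 0 := by
    intro h0; have : s = 1 := sub_eq_zero.1 h0; rw [this] at hs; simp at hs
  have hs0 : s ≠ 0 := by
    intro h0; rw [h0] at hs; simp at hs; linarith
  -- the partial sums of `g`
  have hsumg : ∀ t : ℝ, (N : ℝ) < t →
      ∑ k ∈ Icc 1 ⌊t⌋₊, g k = tailRemainder f ρ N t + ρ * (t - N) := by
    intro t ht
    simp only [tailRemainder, if_pos ht, hg]
    rw [← Finset.sum_filter]
    have : (Icc 1 ⌊t⌋₊).filter (fun k => N < k) = Ioc N ⌊t⌋₊ := by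
      ext k; simp only [Finset.mem_filter, Finset.mem_Icc, Finset.mem_Ioc]; omega
    rw [this]; ring
  have hsumg0 : ∀ t : ℝ, t ≤ N → ∑ k ∈ Icc 1 ⌊t⌋₊, g k = 0 := by
    intro t ht
    refine Finset.sum_eq_zero fun k hk => ?_
    rw [Finset.mem_Icc] at hk
    have : k ≤ N := hk.2.trans (Nat.floor_le_of_le ht)
    simp [hg, not_lt.2 this]
  have hsub : ∫ t in Set.Ioi (1:ℝ), (∑ k ∈ Icc 1 ⌊t⌋₊, g k) * (t:ℂ) ^ (-(s + 1))
      = ∫ t in Set.Ioi (N:ℝ), (∑ k ∈ Icc 1 ⌊t⌋₊, g k) * (t:ℂ) ^ (-(s + 1)) := by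
    refine MeasureTheory.setIntegral_eq_of_subset_of_forall_sdiff_eq_zero measurableSet_Ioi
      (Set.Ioi_subset_Ioi (by exact_mod_cast hN)) ?_
    intro x hx
    rw [hsumg0 x (not_lt.1 fun h => hx.2 h), zero_mul]
  have hmel : mellin (tailRemainder f ρ N) (-s)
      = ∫ t in Set.Ioi (N:ℝ), (t : ℂ) ^ (-s - 1) • tailRemainder f ρ N t := by
    unfold mellin
    refine MeasureTheory.setIntegral_eq_of_subset_of_forall_sdiff_eq_zero measurableSet_Ioi
      (Set.Ioi_subset_Ioi hN0.le) ?_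
    intro x hx
    have : ¬ (N : ℝ) < x := fun h => hx.2 h
    simp [tailRemainder, this]
  have hconv : MeasureTheory.IntegrableOn
      (fun t : ℝ => (t : ℂ) ^ (-s - 1) • tailRemainder f ρ N t) (Set.Ioi (N:ℝ)) :=
    MeasureTheory.IntegrableOn.mono_set
      (differentiableAt_mellin_tailRemainder hN hK hρ hf (s := -s) (by simp; linarith)).1
      (Set.Ioi_subset_Ioi hN0.le)
  have hi1 : MeasureTheory.IntegrableOn (fun t : ℝ => (t : ℂ) ^ (-s)) (Set.Ioi (N:ℝ)) :=
    integrableOn_Ioi_cpow_of_lt (by simp; linarith) hN0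
  have hi2 : MeasureTheory.IntegrableOn (fun t : ℝ => (t : ℂ) ^ (-s - 1)) (Set.Ioi (N:ℝ)) :=
    integrableOn_Ioi_cpow_of_lt (by simp; linarith) hN0
  have hmain : ∫ t in Set.Ioi (N:ℝ), (∑ k ∈ Icc 1 ⌊t⌋₊, g k) * (t:ℂ) ^ (-(s + 1))
      = mellin (tailRemainder f ρ N) (-s)
        + ρ * ((∫ t in Set.Ioi (N:ℝ), (t : ℂ) ^ (-s))
          - N * ∫ t in Set.Ioi (N:ℝ), (t : ℂ) ^ (-s - 1)) := by
    rw [hmel, ← MeasureTheory.integral_const_mul, ← MeasureTheory.integral_sub hi1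
      (hi2.const_mul _), ← MeasureTheory.integral_const_mul, ← MeasureTheory.integral_add hconv
      (MeasureTheory.Integrable.const_mul (f := fun t : ℝ => (t : ℂ) ^ (-s) - N * (t : ℂ) ^ (-s - 1))
        (hi1.sub (hi2.const_mul _)) ρ)]
    refine MeasureTheory.setIntegral_congr_fun measurableSet_Ioi fun t ht => ?_
    have ht0 : (t : ℂ) ≠ 0 := by
      have : (0:ℝ) < t := hN0.trans ht
      exact_mod_cast this.ne'
    rw [hsumg t ht]
    have e1 : (t : ℂ) ^ (-s) = t * (t : ℂ) ^ (-s - 1) := by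
      rw [Complex.cpow_sub _ _ ht0, Complex.cpow_one]; field_simp
    have e2 : -(s + 1) = -s - 1 := by ring
    rw [e1, e2, smul_eq_mul]; ring
  rw [hL, hLh, hLg, hsub, hmain, integral_Ioi_cpow_of_lt (by simp; linarith) hN0,
    integral_Ioi_cpow_of_lt (by simp; linarith) hN0]
  have hNc : ((N : ℝ) : ℂ) ≠ 0 := by exact_mod_cast hN0.ne'
  have hNc' : (N : ℂ) ≠ 0 := by exact_mod_cast hN0.ne'
  have e3 : -s - 1 + 1 = -s := by ring
  have e4 : -s + 1 = 1 - s := by ring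
  have e5 : (N : ℂ) ^ (-s) = (N:ℂ) ^ (1 - s) / N := by
    rw [← e4, Complex.cpow_add _ _ hNc', Complex.cpow_one]; field_simp
  rw [e3, e4]
  push_cast
  rw [e5]
  have : 1 - s ≠ 0 := by intro h; apply hs1; linear_combination -h
  field_simp
  ring

/-- Approximation of the analytic continuation of a Dirichlet series by a partial sum. -/
theorem norm_sub_partial_sum_le (hN : 1 ≤ N) (hK : 0 ≤ K) (hρ : ‖ρ‖ ≤ 1)
    (hf : ∀ M, N ≤ M → ‖∑ k ∈ Ioc N M, f k - ρ * ((M : ℂ) - N)‖ ≤ K) (hf1 : ∀ n, ‖f n‖ ≤ 1)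
    {G : ℂ → ℂ} (hG : Differentiable ℂ G)
    (hGL : ∀ s : ℂ, 1 < s.re → G s = (s - 1) * LSeries f s) {s : ℂ} (hs : 0 < s.re) :
    ‖G s - ((s - 1) * ∑ n ∈ Icc 1 N, f n * (n : ℂ) ^ (-s) + ρ * (N : ℂ) ^ (1 - s))‖
      ≤ ‖s - 1‖ * ‖s‖ * ((K + 1) * ((N : ℝ) ^ (-s.re) / s.re)) := by
  have hNc' : (N : ℂ) ≠ 0 := by
    have : N ≠ 0 := by omega
    exact_mod_cast this
  set R : ℂ → ℂ := fun s => (s - 1) * ∑ n ∈ Icc 1 N, f n * (n : ℂ) ^ (-s) + ρ * (N : ℂ) ^ (1 - s)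
    + (s - 1) * s * mellin (tailRemainder f ρ N) (-s) with hR
  have hRd : DifferentiableOn ℂ R {s : ℂ | 0 < s.re} := by
    intro z hz
    have hz' : 0 < z.re := hz
    refine DifferentiableAt.differentiableWithinAt ?_
    have h1 : DifferentiableAt ℂ (fun s : ℂ => ∑ n ∈ Icc 1 N, f n * (n : ℂ) ^ (-s)) z := by
      refine DifferentiableAt.fun_sum fun n hn => ?_
      have : (n : ℂ) ≠ 0 := by
        have := (Finset.mem_Icc.1 hn).1
        have : n ≠ 0 := by omega
        exact_mod_cast this
      exact (differentiableAt_id.neg.const_cpow (Or.inl this)).const_mul _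
    have h2 : DifferentiableAt ℂ (fun s : ℂ => (N : ℂ) ^ (1 - s)) z :=
      ((differentiableAt_const _).sub differentiableAt_id).const_cpow (Or.inl hNc')
    have h3 : DifferentiableAt ℂ (fun s : ℂ => mellin (tailRemainder f ρ N) (-s)) z := by
      have h4 := (differentiableAt_mellin_tailRemainder hN hK hρ hf (s := -z) (by simpa using hz')).2
      exact DifferentiableAt.comp (g := mellin (tailRemainder f ρ N)) (f := fun s : ℂ => -s) z h4
        differentiableAt_id.neg
    have hid : DifferentiableAt ℂ (fun s : ℂ => s) z := differentiableAt_id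
    exact (((hid.sub_const 1).mul h1).add (h2.const_mul ρ)).add (((hid.sub_const 1).mul hid).mul h3)
  have hopen : IsOpen {s : ℂ | 0 < s.re} := isOpen_lt continuous_const Complex.continuous_re
  have hconv : IsPreconnected {s : ℂ | 0 < s.re} := (convex_halfSpace_re_gt 0).isPreconnected
  have heq : Set.EqOn G R {s : ℂ | 0 < s.re} := by
    refine AnalyticOnNhd.eqOn_of_preconnected_of_eventuallyEq
      (hG.differentiableOn.analyticOnNhd hopen) (hRd.analyticOnNhd hopen) hconv
      (z₀ := 2) (by simp) ?_
    have : {s : ℂ | 1 < s.re} ∈ nhds (2:ℂ) :=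
      (isOpen_lt continuous_const Complex.continuous_re).mem_nhds (by simp)
    filter_upwards [this] with z hz
    have hz' : 1 < z.re := hz
    have hz1 : z - 1 ≠ 0 := by
      intro h0; have : z = 1 := sub_eq_zero.1 h0; rw [this] at hz'; simp at hz'
    rw [hGL z hz', LSeries_eq_sum_add_mellin hN hK hρ hf hf1 hz', hR]
    field_simp
  rw [heq hs, hR]
  simp only [add_sub_cancel_left]
  rw [norm_mul, norm_mul]
  exact mul_le_mul_of_nonneg_left (norm_mellin_tailRemainder_le hN hK hρ hf hs) (by positivity)

end

section
variable {q : ℕ} [NeZero q]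

/-- The mean value of a Dirichlet character over a period. -/
noncomputable def charMean (χ : DirichletCharacter ℂ q) : ℂ := (∑ a : ZMod q, χ a) / q

theorem charMean_eq_zero {χ : DirichletCharacter ℂ q} (hχ : χ ≠ 1) : charMean χ = 0 := by
  rw [charMean, MulChar.sum_eq_zero_of_ne_one hχ, zero_div]

theorem norm_charMean_le (χ : DirichletCharacter ℂ q) : ‖charMean χ‖ ≤ 1 := by
  have hq : (0 : ℝ) < q := by exact_mod_cast NeZero.pos q
  rw [charMean, norm_div, Complex.norm_natCast, div_le_one hq]
  calc ‖∑ a : ZMod q, χ a‖ ≤ ∑ a : ZMod q, ‖χ a‖ := norm_sum_le _ _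
    _ ≤ ∑ _a : ZMod q, (1 : ℝ) := Finset.sum_le_sum fun a _ => χ.norm_le_one a
    _ = q := by simp [ZMod.card]

theorem sum_Ioc_period (f : ZMod q → ℂ) (N : ℕ) :
    ∑ k ∈ Ioc N (N + q), f (k : ZMod q) = ∑ a : ZMod q, f a := by
  have hinj : Set.InjOn (fun k : ℕ => (k : ZMod q)) (Ioc N (N + q)) := by
    intro a ha b hb hab
    simp only [Finset.coe_Ioc, Set.mem_Ioc] at ha hb
    have h := (ZMod.natCast_eq_natCast_iff a b q).1 hab
    rcases le_total a b with hle | hle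
    · have := (Nat.modEq_iff_dvd' hle).1 h
      have h2 := Nat.eq_zero_of_dvd_of_lt this (by omega)
      omega
    · have := (Nat.modEq_iff_dvd' hle).1 h.symm
      have h2 := Nat.eq_zero_of_dvd_of_lt this (by omega)
      omega
  have himg : (Ioc N (N + q)).image (fun k : ℕ => (k : ZMod q)) = Finset.univ := by
    apply Finset.eq_univ_of_card
    rw [Finset.card_image_of_injOn hinj]
    simp [ZMod.card]
  rw [← himg, Finset.sum_image hinj]

theorem norm_char_sum_sub_le (χ : DirichletCharacter ℂ q) (N M : ℕ) (hNM : N ≤ M) :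
    ‖∑ k ∈ Ioc N M, χ k - charMean χ * ((M : ℂ) - N)‖ ≤ 2 * q := by
  induction M using Nat.strong_induction_on with
  | _ M ih =>
    by_cases h : M < N + q
    · refine (norm_sub_le _ _).trans ?_
      have hc : ((M - N : ℕ) : ℝ) ≤ q := by exact_mod_cast (by omega : M - N ≤ q)
      have h1 : ‖∑ k ∈ Ioc N M, χ k‖ ≤ q := by
        calc ‖∑ k ∈ Ioc N M, χ k‖ ≤ ∑ k ∈ Ioc N M, ‖χ k‖ := norm_sum_le _ _
          _ ≤ ∑ _k ∈ Ioc N M, (1 : ℝ) := Finset.sum_le_sum fun a _ => χ.norm_le_one _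
          _ = ((M - N : ℕ) : ℝ) := by simp
          _ ≤ q := hc
      have h2 : ‖charMean χ * ((M : ℂ) - N)‖ ≤ q := by
        rw [norm_mul, ← Nat.cast_sub hNM, Complex.norm_natCast]
        calc _ ≤ 1 * ((M - N : ℕ) : ℝ) :=
              mul_le_mul_of_nonneg_right (norm_charMean_le χ) (Nat.cast_nonneg _)
          _ ≤ q := by rw [one_mul]; exact hc
      linarith
    · push Not at h
      have hq := NeZero.pos q
      have h1 := ih (M - q) (by omega) (by omega)
      have h2 : ∑ k ∈ Ioc N M, χ k = ∑ k ∈ Ioc N (M - q), χ k + ∑ a : ZMod q, χ a := by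
        rw [← sum_Ioc_period (fun a => χ a) (M - q), Nat.sub_add_cancel (by omega)]
        exact (Finset.sum_Ioc_consecutive _ (by omega) (by omega)).symm
      have hq0 : (q : ℂ) ≠ 0 := by exact_mod_cast hq.ne'
      have h3 : ∑ k ∈ Ioc N M, χ k - charMean χ * ((M : ℂ) - N)
          = ∑ k ∈ Ioc N (M - q), χ k - charMean χ * (((M - q : ℕ) : ℂ) - N) := by
        rw [h2, Nat.cast_sub (by omega), charMean]; field_simp; ring
      rw [h3]; exact h1

/-- The `L`-function of a Dirichlet character, with its possible pole at `1` removed. -/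
noncomputable def regL (χ : DirichletCharacter ℂ q) (s : ℂ) : ℂ :=
  if χ = 1 then DirichletCharacter.LFunctionTrivChar₁ q s / (s + 1)
  else DirichletCharacter.LFunction χ s

theorem regL_of_ne {χ : DirichletCharacter ℂ q} (hχ : χ ≠ 1) (s : ℂ) :
    regL χ s = DirichletCharacter.LFunction χ s := if_neg hχ

theorem regL_one (s : ℂ) : regL (1 : DirichletCharacter ℂ q) s
    = DirichletCharacter.LFunctionTrivChar₁ q s / (s + 1) := if_pos rfl

theorem regL_one_of_ne {s : ℂ} (hs : s ≠ 1) : regL (1 : DirichletCharacter ℂ q) s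
    = (s - 1) / (s + 1) * DirichletCharacter.LFunction (1 : DirichletCharacter ℂ q) s := by
  rw [regL_one, DirichletCharacter.LFunctionTrivChar₁, Function.update_of_ne hs]
  ring

theorem differentiableAt_regL (χ : DirichletCharacter ℂ q) {s : ℂ} (hs : 0 < s.re) :
    DifferentiableAt ℂ (regL χ) s := by
  by_cases hχ : χ = 1
  · subst hχ
    have : regL (1 : DirichletCharacter ℂ q)
        = fun s => DirichletCharacter.LFunctionTrivChar₁ q s / (s + 1) := by
      ext s; exact regL_one s
    rw [this]
    refine (DirichletCharacter.differentiable_LFunctionTrivChar₁ q s).div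
      (differentiableAt_id.add_const 1) ?_
    intro h0
    have := congrArg Complex.re h0
    simp at this; linarith
  · have : regL χ = DirichletCharacter.LFunction χ := by ext s; exact regL_of_ne hχ s
    rw [this]
    exact DirichletCharacter.differentiable_LFunction hχ s

theorem LFunction_approx_of_ne_one {χ : DirichletCharacter ℂ q} (hχ : χ ≠ 1) {N : ℕ} (hN : 1 ≤ N)
    {s : ℂ} (hs : 0 < s.re) :
    ‖DirichletCharacter.LFunction χ s - ∑ n ∈ Icc 1 N, χ n * (n : ℂ) ^ (-s)‖
      ≤ ‖s‖ * ((2 * q + 1) * ((N : ℝ) ^ (-s.re) / s.re)) := by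
  have hd := DirichletCharacter.differentiable_LFunction hχ
  have key : ∀ z : ℂ, 0 < z.re → z ≠ 1 →
      ‖DirichletCharacter.LFunction χ z - ∑ n ∈ Icc 1 N, χ n * (n : ℂ) ^ (-z)‖
      ≤ ‖z‖ * ((2 * q + 1) * ((N : ℝ) ^ (-z.re) / z.re)) := by
    intro z hz hz1
    have h := norm_sub_partial_sum_le (f := fun n : ℕ => χ n) (ρ := 0) (K := 2 * q) hN (by positivity)
      (by simp) (fun M hM => by simpa [charMean_eq_zero hχ] using norm_char_sum_sub_le χ N M hM)
      (fun n => χ.norm_le_one _) (G := fun s => (s - 1) * DirichletCharacter.LFunction χ s)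
      ((differentiable_id.sub_const 1).mul hd)
      (fun s hs => by simp only [DirichletCharacter.LFunction_eq_LSeries χ hs]) hz
    simp only [zero_mul, add_zero] at h
    rw [← mul_sub, norm_mul, mul_assoc] at h
    exact le_of_mul_le_mul_left h (norm_pos_iff.2 (sub_ne_zero.2 hz1))
  by_cases hs1 : s = 1
  · subst hs1
    have hne : ∀ n ∈ Icc 1 N, (n : ℂ) ≠ 0 := by
      intro n hn
      have := (Finset.mem_Icc.1 hn).1
      have : n ≠ 0 := by omega
      exact_mod_cast this
    have hc1 : ContinuousAt (fun z : ℂ => ‖DirichletCharacter.LFunction χ z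
        - ∑ n ∈ Icc 1 N, χ n * (n : ℂ) ^ (-z)‖) 1 := by
      refine (ContinuousAt.sub hd.continuous.continuousAt ?_).norm
      refine tendsto_finsetSum _ fun n hn => ?_
      exact (continuousAt_const.mul (continuousAt_id.neg.const_cpow (Or.inl (hne n hn))))
    have hN0 : (N : ℝ) ≠ 0 := by positivity
    have hc2 : ContinuousAt (fun z : ℂ => ‖z‖ * ((2 * q + 1) * ((N : ℝ) ^ (-z.re) / z.re))) 1 := by
      refine continuousAt_id.norm.mul (continuousAt_const.mul (ContinuousAt.div ?_ ?_ (by simp)))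
      · exact continuousAt_const.rpow (Complex.continuous_re.continuousAt.neg) (Or.inl hN0)
      · exact Complex.continuous_re.continuousAt
    have hlim1 := hc1.tendsto.mono_left (nhdsWithin_le_nhds (s := {1}ᶜ))
    have hlim2 := hc2.tendsto.mono_left (nhdsWithin_le_nhds (s := {1}ᶜ))
    refine le_of_tendsto_of_tendsto hlim1 hlim2 ?_
    have : {z : ℂ | 0 < z.re} ∈ nhdsWithin (1:ℂ) {1}ᶜ := nhdsWithin_le_nhds
      ((isOpen_lt continuous_const Complex.continuous_re).mem_nhds (by simp))
    filter_upwards [this, self_mem_nhdsWithin] with z hz hz1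
    exact key z hz hz1
  · exact key s hs hs1

theorem LFunctionTrivChar₁_approx {N : ℕ} (hN : 1 ≤ N) {s : ℂ} (hs : 0 < s.re) :
    ‖DirichletCharacter.LFunctionTrivChar₁ q s
      - ((s - 1) * ∑ n ∈ Icc 1 N, (1 : DirichletCharacter ℂ q) n * (n : ℂ) ^ (-s)
        + charMean (1 : DirichletCharacter ℂ q) * (N : ℂ) ^ (1 - s))‖
      ≤ ‖s - 1‖ * ‖s‖ * ((2 * q + 1) * ((N : ℝ) ^ (-s.re) / s.re)) := by
  refine norm_sub_partial_sum_le (f := fun n : ℕ => (1 : DirichletCharacter ℂ q) n) hN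
    (by positivity) (norm_charMean_le _)
    (fun M hM => norm_char_sum_sub_le 1 N M hM)
    (fun n => DirichletCharacter.norm_le_one _ _)
    (DirichletCharacter.differentiable_LFunctionTrivChar₁ q) ?_ hs
  intro s hs
  have hs1 : s ≠ 1 := by rintro rfl; simp at hs
  rw [DirichletCharacter.LFunctionTrivChar₁, Function.update_of_ne hs1, ← DirichletCharacter.LFunction_eq_LSeries _ hs]

end

/-- Partial sums of `n^{-s}` near the line `Re s = 1`. -/
theorem norm_char_partial_sum_le {q : ℕ} (χ : DirichletCharacter ℂ q) {N : ℕ} (hN : 1 ≤ N) {ε : ℝ}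
    (hε : 0 < ε) {s : ℂ} (hs : 1 - ε ≤ s.re) :
    ‖∑ n ∈ Icc 1 N, χ n * (n : ℂ) ^ (-s)‖ ≤ (1 + 1 / ε) * (N : ℝ) ^ (2 * ε) := by
  have hN0 : (1 : ℝ) ≤ N := by exact_mod_cast hN
  calc ‖∑ n ∈ Icc 1 N, χ n * (n : ℂ) ^ (-s)‖
      ≤ ∑ n ∈ Icc 1 N, ‖χ n * (n : ℂ) ^ (-s)‖ := norm_sum_le _ _
    _ ≤ ∑ n ∈ Icc 1 N, (N : ℝ) ^ ε * (n : ℝ)⁻¹ := by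
        refine Finset.sum_le_sum fun n hn => ?_
        rw [Finset.mem_Icc] at hn
        have hn0 : (1 : ℝ) ≤ n := by exact_mod_cast hn.1
        have hnN : (n : ℝ) ≤ N := by exact_mod_cast hn.2
        rw [norm_mul, Complex.norm_natCast_cpow_of_pos hn.1, Complex.neg_re]
        calc ‖χ n‖ * (n : ℝ) ^ (-s.re) ≤ 1 * (n : ℝ) ^ (ε + -1) := by
              apply mul_le_mul (χ.norm_le_one _) _ (by positivity) (by norm_num)
              exact Real.rpow_le_rpow_of_exponent_le hn0 (by linarith)
          _ = (n : ℝ) ^ ε * (n : ℝ)⁻¹ := by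
              rw [one_mul, Real.rpow_add (by linarith), Real.rpow_neg_one]
          _ ≤ _ := by gcongr
    _ = (N : ℝ) ^ ε * ∑ n ∈ Icc 1 N, (n : ℝ)⁻¹ := by rw [Finset.mul_sum]
    _ ≤ (N : ℝ) ^ ε * (1 + Real.log N) := by
        gcongr
        have := harmonic_le_one_add_log N
        rw [harmonic_eq_sum_Icc] at this
        push_cast at this
        exact this
    _ ≤ (N : ℝ) ^ ε * ((1 + 1 / ε) * (N : ℝ) ^ ε) := by
        gcongr
        have h1 := Real.log_le_rpow_div (x := N) (by linarith) hε
        have h2 : (1 : ℝ) ≤ (N : ℝ) ^ ε := Real.one_le_rpow hN0 hε.le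
        calc 1 + Real.log N ≤ (N : ℝ) ^ ε + (N : ℝ) ^ ε / ε := by linarith
          _ = _ := by ring
    _ = _ := by rw [two_mul, Real.rpow_add (by linarith)]; ring

section
variable {q : ℕ} [NeZero q]

end

/-- The analytic conductor. -/
noncomputable def anCond (q : ℕ) (t : ℝ) : ℝ := q * (|t| + 2)

theorem two_le_anCond {q : ℕ} (hq : 1 ≤ q) (t : ℝ) : 2 ≤ anCond q t := by
  have : (1 : ℝ) ≤ q := by exact_mod_cast hq
  unfold anCond; nlinarith [abs_nonneg t]

/-- Upper bound for `L`-functions close to the line `Re s = 1`. -/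
theorem regL_upper {ε : ℝ} (hε : 0 < ε) (hε4 : ε ≤ 1 / 4) :
    ∃ C > 0, ∀ (q : ℕ) [NeZero q] (χ : DirichletCharacter ℂ q) (s : ℂ), 1 - ε ≤ s.re → s.re ≤ 3 →
      ‖regL χ s‖ ≤ C * anCond q s.im ^ (2 * ε) := by
  refine ⟨1 + 1 / ε + 1 + 60, by positivity, ?_⟩
  intro q _ χ s hs1 hs3
  have hq : 1 ≤ q := NeZero.one_le
  have hqr : (1 : ℝ) ≤ q := by exact_mod_cast hq
  have hD2 := two_le_anCond hq s.im
  set D := anCond q s.im with hD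
  set N := ⌊D⌋₊ with hN
  have hN1 : 1 ≤ N := Nat.le_floor (by push_cast; linarith)
  have hND : (N : ℝ) ≤ D := Nat.floor_le (by linarith)
  have hDN : D ≤ 2 * N := by
    have := Nat.lt_floor_add_one D
    have h1 : (1 : ℝ) ≤ N := by exact_mod_cast hN1
    linarith
  have hN0 : (1 : ℝ) ≤ N := by exact_mod_cast hN1
  have hre : 0 < s.re := by linarith
  have hpow : (N : ℝ) ^ (2 * ε) ≤ D ^ (2 * ε) := by gcongr
  have hsn : ‖s‖ ≤ 3 * (|s.im| + 2) := by
    have := Complex.norm_le_abs_re_add_abs_im s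
    rw [abs_of_pos hre] at this
    linarith [abs_nonneg s.im]
  have hsum := norm_char_partial_sum_le χ hN1 hε hs1
  have herr : ‖s‖ * ((2 * q + 1) * ((N : ℝ) ^ (-s.re) / s.re)) ≤ 60 * D ^ (2 * ε) := by
    have h1 : (N : ℝ) ^ (-s.re) ≤ (N : ℝ)⁻¹ * (N : ℝ) ^ (2 * ε) := by
      rw [← Real.rpow_neg_one, ← Real.rpow_add (by linarith)]
      exact Real.rpow_le_rpow_of_exponent_le hN0 (by linarith)
    have h2 : (N : ℝ) ^ (-s.re) / s.re ≤ (N : ℝ)⁻¹ * (N : ℝ) ^ (2 * ε) * 2 := by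
      rw [div_le_iff₀ hre]
      have : 0 ≤ (N : ℝ)⁻¹ * (N : ℝ) ^ (2 * ε) := by positivity
      nlinarith
    have h3 : (N : ℝ)⁻¹ ≤ 2 * D⁻¹ := by
      rw [← div_eq_mul_inv, le_div_iff₀ (by linarith), inv_mul_le_iff₀ (by linarith)]
      linarith
    calc ‖s‖ * ((2 * q + 1) * ((N : ℝ) ^ (-s.re) / s.re))
        ≤ (3 * (|s.im| + 2)) * ((3 * q) * ((2 * D⁻¹) * D ^ (2 * ε) * 2)) := by
          gcongr
          · linarith
          · refine h2.trans ?_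
            gcongr
      _ = 36 * (D * D⁻¹) * D ^ (2 * ε) := by rw [hD]; unfold anCond; ring
      _ = 36 * D ^ (2 * ε) := by rw [mul_inv_cancel₀ (by linarith)]; ring
      _ ≤ _ := by gcongr; norm_num
  by_cases hχ : χ = 1
  · subst hχ
    have hs1n : ‖s - 1‖ ≤ ‖s + 1‖ := by
      refine (sq_le_sq₀ (norm_nonneg _) (norm_nonneg _)).1 ?_
      rw [Complex.sq_norm, Complex.sq_norm, Complex.normSq_apply, Complex.normSq_apply]
      simp; nlinarith
    have hs1p : 1 ≤ ‖s + 1‖ := by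
      have := Complex.abs_re_le_norm (s + 1)
      simp at this
      rw [abs_of_pos (by linarith)] at this
      linarith
    have h := LFunctionTrivChar₁_approx (q := q) hN1 hre
    set S := ∑ n ∈ Icc 1 N, (1 : DirichletCharacter ℂ q) n * (n : ℂ) ^ (-s)
    have hρ : ‖charMean (1 : DirichletCharacter ℂ q) * (N : ℂ) ^ (1 - s)‖ ≤ D ^ (2 * ε) := by
      rw [norm_mul, Complex.norm_natCast_cpow_of_pos hN1]
      calc _ ≤ 1 * (N : ℝ) ^ (2 * ε) := by
            apply mul_le_mul (norm_charMean_le _) _ (by positivity) (by norm_num)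
            refine Real.rpow_le_rpow_of_exponent_le hN0 ?_
            simp; linarith
        _ ≤ _ := by rw [one_mul]; exact hpow
    rw [regL_one, norm_div, div_le_iff₀ (by linarith)]
    have h4 : ‖DirichletCharacter.LFunctionTrivChar₁ q s‖
        ≤ ‖s - 1‖ * ‖s‖ * ((2 * q + 1) * ((N : ℝ) ^ (-s.re) / s.re))
          + (‖s - 1‖ * ‖S‖ + ‖charMean (1 : DirichletCharacter ℂ q) * (N : ℂ) ^ (1 - s)‖) := by
      have h5 := norm_le_norm_add_norm_sub' (DirichletCharacter.LFunctionTrivChar₁ q s)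
        ((s - 1) * S + charMean (1 : DirichletCharacter ℂ q) * (N : ℂ) ^ (1 - s))
      have h6 := norm_add_le ((s - 1) * S) (charMean (1 : DirichletCharacter ℂ q) * (N : ℂ) ^ (1 - s))
      rw [norm_mul] at h6
      linarith
    have hE0 : 0 ≤ ‖s‖ * ((2 * q + 1) * ((N : ℝ) ^ (-s.re) / s.re)) := by positivity
    have hDp : 0 ≤ D ^ (2 * ε) := by positivity
    calc ‖DirichletCharacter.LFunctionTrivChar₁ q s‖ ≤ _ := h4
      _ ≤ ‖s + 1‖ * (60 * D ^ (2 * ε)) + (‖s + 1‖ * ((1 + 1 / ε) * D ^ (2 * ε))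
            + ‖s + 1‖ * D ^ (2 * ε)) := by
          rw [mul_assoc]
          gcongr
          · exact hsum.trans (by gcongr)
          · refine hρ.trans ?_
            nlinarith
      _ = _ := by ring
  · rw [regL_of_ne hχ]
    have h := LFunction_approx_of_ne_one hχ hN1 hre
    have h5 := norm_le_norm_add_norm_sub' (DirichletCharacter.LFunction χ s)
        (∑ n ∈ Icc 1 N, χ n * (n : ℂ) ^ (-s))
    have hDp : 0 ≤ D ^ (2 * ε) := by positivity
    have : (1 + 1 / ε) * (N : ℝ) ^ (2 * ε) ≤ (1 + 1 / ε) * D ^ (2 * ε) := by gcongr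
    calc _ ≤ (1 + 1 / ε) * D ^ (2 * ε) + 60 * D ^ (2 * ε) := by linarith
      _ ≤ _ := by nlinarith

/-- Crude bound in a disc around `2`. -/
theorem LFunction_crude {q : ℕ} [NeZero q] {χ : DirichletCharacter ℂ q} (hχ : χ ≠ 1) {s : ℂ}
    (hs : s ∈ Metric.closedBall (2:ℂ) (3 / 2)) : ‖DirichletCharacter.LFunction χ s‖ ≤ 30 * q := by
  have hqr : (1 : ℝ) ≤ q := by exact_mod_cast NeZero.one_le
  rw [mem_closedBall_iff_norm] at hs
  have hre : 1 / 2 ≤ s.re := by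
    have := (Complex.abs_re_le_norm (s - 2)).trans hs
    rw [abs_le] at this
    simp at this; linarith
  have hsn : ‖s‖ ≤ 7 / 2 := by
    have := norm_add_le (s - 2) 2
    simp at this; linarith
  have h := LFunction_approx_of_ne_one hχ le_rfl (show 0 < s.re by linarith)
  have h5 := norm_le_norm_add_norm_sub' (DirichletCharacter.LFunction χ s)
        (∑ n ∈ (Icc 1 1 : Finset ℕ), χ n * (n : ℂ) ^ (-s))
  have h6 : ‖∑ n ∈ (Icc 1 1 : Finset ℕ), χ n * (n : ℂ) ^ (-s)‖ ≤ 1 := by simp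
  have h7 : ‖s‖ * ((2 * q + 1) * (((1 : ℕ) : ℝ) ^ (-s.re) / s.re)) ≤ 7 / 2 * ((3 * q) * 2) := by
    gcongr
    · linarith
    · rw [Nat.cast_one, Real.one_rpow, div_le_iff₀ (by linarith)]; linarith
  linarith

theorem LFunctionTrivChar₁_crude {s : ℂ} (hs : s ∈ Metric.closedBall (2:ℂ) (3 / 2)) :
    ‖DirichletCharacter.LFunctionTrivChar₁ 1 s‖ ≤ 60 := by
  rw [mem_closedBall_iff_norm] at hs
  have hre : 1 / 2 ≤ s.re := by
    have := (Complex.abs_re_le_norm (s - 2)).trans hs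
    rw [abs_le] at this
    simp at this; linarith
  have hsn : ‖s‖ ≤ 7 / 2 := by
    have := norm_add_le (s - 2) 2
    simp at this; linarith
  have hsn1 : ‖s - 1‖ ≤ 5 / 2 := by
    have := norm_add_le (s - 2) 1
    simp at this
    have h2 : s - 2 + 1 = s - 1 := by ring
    rw [h2] at this; linarith
  have h := LFunctionTrivChar₁_approx (q := 1) le_rfl (show 0 < s.re by linarith)
  have h5 := norm_le_norm_add_norm_sub' (DirichletCharacter.LFunctionTrivChar₁ 1 s)
    ((s - 1) * ∑ n ∈ (Icc 1 1 : Finset ℕ), (1 : DirichletCharacter ℂ 1) n * (n : ℂ) ^ (-s)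
      + charMean (1 : DirichletCharacter ℂ 1) * ((1 : ℕ) : ℂ) ^ (1 - s))
  have h6 : ‖(s - 1) * ∑ n ∈ (Icc 1 1 : Finset ℕ), (1 : DirichletCharacter ℂ 1) n * (n : ℂ) ^ (-s)
      + charMean (1 : DirichletCharacter ℂ 1) * ((1 : ℕ) : ℂ) ^ (1 - s)‖ ≤ 5 / 2 * 1 + 1 * 1 := by
    refine (norm_add_le _ _).trans (add_le_add ?_ ?_)
    · rw [norm_mul]; gcongr
      simp only [Finset.Icc_self, Finset.sum_singleton, Nat.cast_one, Complex.one_cpow, mul_one]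
      exact DirichletCharacter.norm_le_one _ _
    · rw [norm_mul]
      refine mul_le_mul (norm_charMean_le _) (by simp) (by positivity) (by norm_num)
  have h7 : ‖s - 1‖ * ‖s‖ * ((2 * (1 : ℕ) + 1) * (((1 : ℕ) : ℝ) ^ (-s.re) / s.re))
      ≤ 5 / 2 * (7 / 2) * (3 * 2) := by
    gcongr
    · norm_num
    · rw [Nat.cast_one, Real.one_rpow, div_le_iff₀ (by linarith)]; linarith
  have h8 := h.trans h7
  exact (h5.trans (add_le_add h6 h8)).trans (by norm_num)

section
open scoped ComplexOrder
open LSeries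

theorem iteratedDeriv_const_div_sub_one (c : ℂ) (m : ℕ) :
    iteratedDeriv m (fun s : ℂ => c * (s - 1)⁻¹) 2 = c * ((-1) ^ m * (m.factorial : ℂ)) := by
  rw [iteratedDeriv_const_mul_field, iteratedDeriv_comp_sub_const m (fun z : ℂ => z⁻¹) 1]
  have : iteratedDeriv m (fun z : ℂ => z⁻¹) = deriv^[m] Inv.inv := iteratedDeriv_eq_iterate
  simp only [this]
  rw [iter_deriv_inv]
  norm_num

theorem one_le_re_LSeries {r : ℕ → ℂ} (h0 : 0 ≤ r) (h1 : 1 ≤ r 1)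
    (hs : LSeriesSummable r 2) : 1 ≤ (LSeries r 2).re := by
  have h2 := Complex.hasSum_re hs.hasSum
  have h3 : (LSeries.term r 2 1).re ≤ (LSeries r 2).re := by
    refine le_hasSum h2 1 fun j _ => ?_
    have := LSeries.term_nonneg (h0 j) 2
    exact (Complex.le_def.1 (by simpa using this)).1
  have h4 : (1:ℝ) ≤ (LSeries.term r 2 1).re := by
    rw [LSeries.term_of_ne_zero one_ne_zero]
    simpa using (Complex.le_def.1 h1).1
  exact h4.trans h3

/-- Estermann's lower bound for the residue of a Dirichlet series with nonnegative coefficients. -/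
theorem estermann_lower_bound {r : ℕ → ℂ} (h0 : 0 ≤ r) (h1 : 1 ≤ r 1)
    (habs : abscissaOfAbsConv r ≤ 1) {P : ℂ → ℂ} (hP : Differentiable ℂ P)
    (hPL : ∀ s : ℂ, 1 < s.re → P s = (s - 1) * LSeries r s) {K : ℝ} (hK : 1 ≤ K)
    (hPK : ∀ s ∈ Metric.closedBall (2:ℂ) (3 / 2), ‖P s‖ ≤ K) {β : ℝ} (hβ : 7 / 8 ≤ β) (hβ1 : β < 1)
    (hPβ : 0 ≤ (P β).re) :
    (1 - β) / 4 * (32 * K) ^ (-(4 * (1 - β))) ≤ (P 1).re := by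
  set lam := P 1 with hlam
  have habs2 : abscissaOfAbsConv r < ((2:ℂ).re : EReal) := by
    refine habs.trans_lt ?_
    simp only [Complex.re_ofNat]
    exact_mod_cast (by norm_num : (1:ℝ) < 2)
  have hmem1 : (1:ℂ) ∈ Metric.closedBall (2:ℂ) (3 / 2) := by
    rw [mem_closedBall_iff_norm]; norm_num
  set E : ℂ → ℂ := dslope P 1 with hE
  have hEd : Differentiable ℂ E := by
    rw [← differentiableOn_univ]
    exact (Complex.differentiableOn_dslope Filter.univ_mem).2 hP.differentiableOn
  have hEeq : ∀ s : ℂ, s ≠ 1 → E s = (P s - lam) * (s - 1)⁻¹ := by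
    intro s hs
    rw [hE, dslope_of_ne _ hs, slope_def_field, div_eq_mul_inv]
  have hEK : ∀ z ∈ Metric.sphere (2:ℂ) (3 / 2), ‖E z‖ ≤ 4 * K := by
    intro z hz
    have hz' : ‖z - 2‖ = 3 / 2 := mem_sphere_iff_norm.1 hz
    have h2 : 1 / 2 ≤ ‖z - 1‖ := by
      have := norm_sub_norm_le (z - 2) (-1)
      have h3 : z - 2 - -1 = z - 1 := by ring
      rw [h3] at this
      simp at this; linarith
    have hz1 : z ≠ 1 := by rintro rfl; simp at h2; linarith
    rw [hEeq z hz1, norm_mul, norm_inv]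
    have h3 := norm_sub_le (P z) lam
    have h4 := hPK z (Metric.sphere_subset_closedBall hz)
    have h5 := hPK 1 hmem1
    have h6 : ‖z - 1‖⁻¹ ≤ 2 := by
      rw [inv_le_comm₀ (by linarith) (by norm_num)]; linarith
    calc _ ≤ (2 * K) * 2 := by
          gcongr
          linarith
      _ = _ := by ring
  have hcauchy := fun m => Complex.norm_iteratedDeriv_le_of_forall_mem_sphere_norm_le m
    (by norm_num : (0:ℝ) < 3 / 2) (hEd.diffContOnCl (s := Metric.ball (2:ℂ) (3 / 2))) hEK
  -- derivatives at `2`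
  have hderiv : ∀ m, iteratedDeriv m E 2 = iteratedDeriv m (LSeries r) 2
      - lam * ((-1) ^ m * (m.factorial : ℂ)) := by
    intro m
    have hev : E =ᶠ[nhds 2] fun s => LSeries r s - lam * (s - 1)⁻¹ := by
      have : {s : ℂ | 1 < s.re} ∈ nhds (2:ℂ) :=
        (isOpen_lt continuous_const Complex.continuous_re).mem_nhds (by simp)
      filter_upwards [this] with s hs
      have hs' : 1 < s.re := hs
      have hs1 : s ≠ 1 := by rintro rfl; simp at hs'
      have hs2 : s - 1 ≠ 0 := sub_ne_zero.2 hs1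
      rw [hEeq s hs1, hPL s hs']
      field_simp
    rw [hev.iteratedDeriv_eq m]
    have hd1 : ContDiffAt ℂ m (LSeries r) 2 :=
      ((LSeries_analyticOnNhd r) 2 habs2).contDiffAt
    have hd2 : ContDiffAt ℂ m (fun s : ℂ => lam * (s - 1)⁻¹) 2 := by
      refine contDiffAt_const.mul (ContDiffAt.inv (contDiffAt_id.sub contDiffAt_const) ?_)
      norm_num
    rw [iteratedDeriv_fun_sub hd1 hd2, iteratedDeriv_const_div_sub_one]
  set x : ℝ := 2 - β with hx
  have hx1 : 1 < x := by rw [hx]; linarith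
  have hx98 : x ≤ 9 / 8 := by rw [hx]; linarith
  set a : ℕ → ℂ := fun m => ((m.factorial : ℂ))⁻¹ • (((β : ℂ) - 2) ^ m • iteratedDeriv m E 2) with ha
  have hsum : HasSum a (E β) := Complex.hasSum_taylorSeries_of_entire hEd 2 β
  have hanorm : ∀ m, ‖a m‖ ≤ 4 * K * (3 / 4) ^ m := by
    intro m
    have hm : (0:ℝ) < m.factorial := by exact_mod_cast m.factorial_pos
    have hb2 : ‖(β : ℂ) - 2‖ = x := by
      have : (β : ℂ) - 2 = ((-x : ℝ) : ℂ) := by rw [hx]; push_cast; ring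
      rw [this, Complex.norm_real, Real.norm_eq_abs, abs_neg, abs_of_pos (by linarith)]
    rw [ha]
    simp only [smul_eq_mul, norm_mul, norm_inv, norm_pow, Complex.norm_natCast, hb2]
    calc ((m.factorial : ℝ))⁻¹ * (x ^ m * ‖iteratedDeriv m E 2‖)
        ≤ ((m.factorial : ℝ))⁻¹ * ((9 / 8) ^ m * (m.factorial * (4 * K) / (3 / 2) ^ m)) := by
          gcongr
          exact hcauchy m
      _ = 4 * K * ((9 / 8) ^ m / (3 / 2) ^ m) := by field_simp
      _ = _ := by rw [← div_pow]; norm_num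
  have halow : ∀ m, (if m = 0 then 1 else 0) - lam.re * x ^ m ≤ (a m).re := by
    intro m
    have hm : (m.factorial : ℂ) ≠ 0 := by exact_mod_cast m.factorial_ne_zero
    set b := (m.factorial : ℂ)⁻¹ * ((-1) ^ m * iteratedDeriv m (LSeries r) 2) with hb
    have hae : a m = b * ((x ^ m : ℝ) : ℂ) - lam * ((x ^ m : ℝ) : ℂ) := by
      have : (β : ℂ) - 2 = (-1) * (x : ℂ) := by rw [hx]; push_cast; ring
      have hone : ((-1 : ℂ)) ^ m * (-1) ^ m = 1 := by rw [← mul_pow]; norm_num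
      simp only [ha, hb, smul_eq_mul, this, hderiv, mul_pow]
      push_cast
      have : (m.factorial : ℂ)⁻¹ * ((-1) ^ m * (x : ℂ) ^ m * (iteratedDeriv m (LSeries r) 2
          - lam * ((-1) ^ m * (m.factorial : ℂ))))
        = (m.factorial : ℂ)⁻¹ * ((-1) ^ m * iteratedDeriv m (LSeries r) 2) * (x : ℂ) ^ m
          - lam * (x : ℂ) ^ m * ((-1) ^ m * (-1) ^ m) * ((m.factorial : ℂ)⁻¹ * m.factorial) := by
        ring
      rw [this, hone, inv_mul_cancel₀ hm]; ring
    have hb0 : 0 ≤ b := by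
      refine mul_nonneg ?_ ?_
      · have : (0:ℝ) ≤ ((m.factorial : ℝ))⁻¹ := by positivity
        have h2 : (m.factorial : ℂ)⁻¹ = (((m.factorial : ℝ))⁻¹ : ℝ) := by push_cast; rfl
        rw [h2]; exact Complex.zero_le_real.2 this
      · have := LSeries.iteratedDeriv_alternating h0 (x := 2) (by simpa using habs2) m
        simpa using this
    have hbre : 0 ≤ b.re := (Complex.le_def.1 hb0).1
    rw [hae, Complex.sub_re, Complex.re_mul_ofReal, Complex.re_mul_ofReal]
    split_ifs with h
    · subst h
      have : 1 ≤ b.re := by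
        have := one_le_re_LSeries h0 h1 (LSeriesSummable_of_abscissaOfAbsConv_lt_re habs2)
        simpa [hb] using this
      simp only [pow_zero, mul_one]
      linarith
    · have : 0 ≤ b.re * x ^ m := by positivity
      linarith
  -- choice of the cut-off
  set M := ⌈4 * Real.log (32 * K)⌉₊ with hM
  have hlogK : 0 < Real.log (32 * K) := Real.log_pos (by linarith)
  have hM1 : 4 * Real.log (32 * K) ≤ M := Nat.le_ceil _
  have hM2 : (M : ℝ) ≤ 4 * Real.log (32 * K) + 1 := (Nat.ceil_lt_add_one (by positivity)).le
  have hMpos : 0 < M := Nat.ceil_pos.2 (by positivity)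
  have h34 : (3 / 4 : ℝ) ^ M ≤ (32 * K)⁻¹ := by
    rw [← Real.rpow_natCast, ← Real.exp_log (by norm_num : (0:ℝ) < 3 / 4), ← Real.exp_mul,
      ← Real.exp_log (by linarith : 0 < 32 * K), ← Real.exp_neg, Real.exp_le_exp]
    have h43 : Real.log (3 / 4) ≤ - (1 / 4) := by
      have := Real.log_le_sub_one_of_pos (by norm_num : (0:ℝ) < 3 / 4)
      linarith
    have : (0:ℝ) ≤ M := Nat.cast_nonneg _
    nlinarith
  have htail : ‖∑' m, a (m + M)‖ ≤ 1 / 2 := by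
    have hg : HasSum (fun m : ℕ => 4 * K * (3 / 4 : ℝ) ^ M * (3 / 4 : ℝ) ^ m)
        (4 * K * (3 / 4 : ℝ) ^ M * (1 - 3 / 4)⁻¹) :=
      (hasSum_geometric_of_lt_one (by norm_num) (by norm_num)).mul_left _
    refine (tsum_of_norm_bounded hg fun m => ?_).trans ?_
    · refine (hanorm _).trans (le_of_eq ?_)
      rw [pow_add]; ring
    · calc 4 * K * (3 / 4 : ℝ) ^ M * (1 - 3 / 4)⁻¹ = 16 * K * (3 / 4) ^ M := by ring
        _ ≤ 16 * K * (32 * K)⁻¹ := by gcongr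
        _ = 1 / 2 := by field_simp; norm_num
  have hEsplit : (E β).re = ∑ m ∈ range M, (a m).re + (∑' m, a (m + M)).re := by
    rw [← hsum.tsum_eq, ← hsum.summable.sum_add_tsum_nat_add M, Complex.add_re, Complex.re_sum]
  have hElow : 1 - lam.re * ∑ m ∈ range M, x ^ m - 1 / 2 ≤ (E β).re := by
    rw [hEsplit]
    have h2 : -(1 / 2) ≤ (∑' m, a (m + M)).re :=
      (abs_le.1 ((Complex.abs_re_le_norm _).trans htail)).1
    have h3 := Finset.sum_le_sum fun m (_ : m ∈ range M) => halow m
    rw [Finset.sum_sub_distrib, Finset.sum_ite_eq' (range M) 0 (fun _ => (1:ℝ)),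
      if_pos (Finset.mem_range.2 hMpos), ← Finset.mul_sum] at h3
    linarith
  have hEup : (E β).re * (1 - β) ≤ lam.re := by
    have hβne : (β : ℂ) ≠ 1 := by exact_mod_cast hβ1.ne
    have h2 : E β * ((1 - β : ℝ) : ℂ) = lam - P β := by
      rw [hEeq _ hβne]
      have : (β : ℂ) - 1 ≠ 0 := sub_ne_zero.2 hβne
      push_cast
      field_simp
      ring
    have := congrArg Complex.re h2
    rw [Complex.re_mul_ofReal, Complex.sub_re] at this
    linarith
  have hgeom : (∑ m ∈ range M, x ^ m) * (1 - β) = x ^ M - 1 := by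
    rw [geom_sum_eq hx1.ne', hx]
    have : (2 - β - 1) ≠ 0 := by linarith
    field_simp
    ring
  have hfin : (1 - β) / 2 ≤ lam.re * x ^ M := by
    have := mul_le_mul_of_nonneg_right hElow (by linarith : 0 ≤ 1 - β)
    have h2 : lam.re * ((∑ m ∈ range M, x ^ m) * (1 - β)) = lam.re * (x ^ M - 1) := by rw [hgeom]
    linear_combination this + hEup + h2
  have hxM : x ^ M ≤ 2 * (32 * K) ^ (4 * (1 - β)) := by
    have h2 : x ≤ Real.exp (1 - β) := by
      have := Real.add_one_le_exp (1 - β); rw [hx]; linarith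
    calc x ^ M ≤ Real.exp (1 - β) ^ M := by gcongr
      _ = Real.exp ((1 - β) * M) := by rw [← Real.exp_nat_mul]; ring_nf
      _ ≤ Real.exp (1 / 8 + (1 - β) * (4 * Real.log (32 * K))) := by
          apply Real.exp_le_exp.2; nlinarith
      _ = Real.exp (1 / 8) * (32 * K) ^ (4 * (1 - β)) := by
          rw [Real.exp_add, Real.rpow_def_of_pos (by linarith)]; ring_nf
      _ ≤ _ := by
          gcongr
          have : Real.exp (1 / 8) ≤ Real.exp (Real.log 2) := by
            apply Real.exp_le_exp.2
            linarith [Real.log_two_gt_d9]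
          rwa [Real.exp_log (by norm_num)] at this
  have hlam0 : 0 < lam.re := by
    by_contra hc
    push Not at hc
    have : lam.re * x ^ M ≤ 0 := mul_nonpos_of_nonpos_of_nonneg hc (by positivity)
    linarith
  have hpp : 0 < (32 * K) ^ (4 * (1 - β)) := Real.rpow_pos_of_pos (by linarith) _
  rw [Real.rpow_neg (by linarith), ← div_eq_mul_inv, div_le_iff₀ hpp]
  have := mul_le_mul_of_nonneg_left hxM hlam0.le
  linarith

end

section
open scoped ComplexOrder
open LSeries

/-- Multiplication of an arithmetic function by the logarithm. -/
noncomputable def arithLog (f : ArithmeticFunction ℂ) : ArithmeticFunction ℂ :=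
  toArithmeticFunction fun n => Complex.log n * f n

theorem arithLog_apply (f : ArithmeticFunction ℂ) (n : ℕ) : arithLog f n = Complex.log n * f n := by
  rcases eq_or_ne n 0 with rfl | hn
  · simp
  · simp [arithLog, toArithmeticFunction, hn]

theorem arithLog_mul (f g : ArithmeticFunction ℂ) :
    arithLog (f * g) = arithLog f * g + f * arithLog g := by
  ext n
  rw [arithLog_apply, ArithmeticFunction.add_apply, ArithmeticFunction.mul_apply,
    ArithmeticFunction.mul_apply, ArithmeticFunction.mul_apply, Finset.mul_sum,
    ← Finset.sum_add_distrib]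
  refine Finset.sum_congr rfl fun x hx => ?_
  obtain ⟨hx1, hx2⟩ := Nat.mem_divisorsAntidiagonal.1 hx
  have h1 : x.1 ≠ 0 := fun h => hx2 (by rw [← hx1, h, zero_mul])
  have h2 : x.2 ≠ 0 := fun h => hx2 (by rw [← hx1, h, mul_zero])
  rw [arithLog_apply, arithLog_apply, ← hx1]
  have : Complex.log ((x.1 * x.2 : ℕ) : ℂ) = Complex.log x.1 + Complex.log x.2 := by
    rw [Complex.natCast_log.symm, Complex.natCast_log.symm, Complex.natCast_log.symm]
    push_cast
    rw [Real.log_mul (by exact_mod_cast h1) (by exact_mod_cast h2)]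
    push_cast; rfl
  rw [this]; ring

/-- The arithmetic function `n ↦ χ n`. -/
noncomputable def charArith {N : ℕ} (χ : DirichletCharacter ℂ N) : ArithmeticFunction ℂ :=
  toArithmeticFunction (χ ·)

/-- The arithmetic function `n ↦ χ n * Λ n`. -/
noncomputable def charMangoldt {N : ℕ} (χ : DirichletCharacter ℂ N) : ArithmeticFunction ℂ :=
  toArithmeticFunction fun n => χ n * (ArithmeticFunction.vonMangoldt n : ℂ)

theorem charArith_apply {N : ℕ} (χ : DirichletCharacter ℂ N) {n : ℕ} (hn : n ≠ 0) :
    charArith χ n = χ n := by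
  simp [charArith, toArithmeticFunction, hn]

theorem charMangoldt_apply {N : ℕ} (χ : DirichletCharacter ℂ N) (n : ℕ) :
    charMangoldt χ n = χ n * (ArithmeticFunction.vonMangoldt n : ℂ) := by
  rcases eq_or_ne n 0 with rfl | hn
  · simp
  · simp [charMangoldt, toArithmeticFunction, hn]

theorem arithLog_charArith {N : ℕ} (χ : DirichletCharacter ℂ N) :
    arithLog (charArith χ) = charArith χ * charMangoldt χ := by
  ext n
  rcases eq_or_ne n 0 with rfl | hn
  · simp
  have := congrFun (DirichletCharacter.convolution_twist_vonMangoldt χ) n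
  simp only [LSeries.convolution, Pi.mul_apply] at this
  rw [arithLog_apply, charArith_apply _ hn, mul_comm, ← this, mul_comm (charArith χ)]
  rfl

theorem arithLog_zeta :
    arithLog (ArithmeticFunction.zeta : ArithmeticFunction ℂ)
      = (ArithmeticFunction.zeta : ArithmeticFunction ℂ)
        * charMangoldt (1 : DirichletCharacter ℂ 1) := by
  have h := arithLog_charArith (1 : DirichletCharacter ℂ 1)
  have : charArith (1 : DirichletCharacter ℂ 1) = (ArithmeticFunction.zeta : ArithmeticFunction ℂ) := by
    ext n
    rcases eq_or_ne n 0 with rfl | hn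
    · simp
    · rw [charArith_apply _ hn]; simp [ArithmeticFunction.natCoe_apply, hn, Subsingleton.elim (n : ZMod 1) 1]
  rwa [this] at h

theorem nonneg_of_arithLog_eq {r g : ArithmeticFunction ℂ} (h1 : r 1 = 1) (hg : ∀ n, 0 ≤ g n)
    (hg1 : g 1 = 0) (h : arithLog r = r * g) (n : ℕ) : 0 ≤ r n := by
  induction n using Nat.strong_induction_on with
  | _ n ih =>
    rcases Nat.lt_or_ge n 2 with hn | hn
    · interval_cases n
      · simp
      · rw [h1]; exact zero_le_one
    have hlog : 0 < Real.log n := Real.log_pos (by exact_mod_cast hn)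
    have h2 : ((Real.log n : ℝ) : ℂ) * r n = (r * g) n := by
      rw [← h, arithLog_apply, Complex.natCast_log]
    have h3 : 0 ≤ (r * g) n := by
      rw [ArithmeticFunction.mul_apply]
      refine Finset.sum_nonneg fun x hx => ?_
      obtain ⟨hx1, hx2⟩ := Nat.mem_divisorsAntidiagonal.1 hx
      rcases eq_or_ne x.2 1 with he | he
      · rw [he, hg1, mul_zero]
      · refine mul_nonneg (ih _ ?_) (hg _)
        have h1 : x.1 ≠ 0 := fun h => hx2 (by rw [← hx1, h, zero_mul])
        have h2 : x.2 ≠ 0 := fun h => hx2 (by rw [← hx1, h, mul_zero])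
        rw [← hx1]
        exact (Nat.lt_mul_iff_one_lt_right (by omega)).2 (by omega)
    have h4 : r n = (((Real.log n)⁻¹ : ℝ) : ℂ) * (r * g) n := by
      rw [← h2, ← mul_assoc, ← Complex.ofReal_mul, inv_mul_cancel₀ hlog.ne']; simp
    rw [h4]
    exact mul_nonneg (Complex.zero_le_real.2 (inv_nonneg.2 hlog.le)) h3

theorem real_of_sq_eq_one {N : ℕ} {χ : DirichletCharacter ℂ N} (hχ : χ ^ 2 = 1) (a : ZMod N) :
    χ a = 0 ∨ χ a = 1 ∨ χ a = -1 :=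
  MulChar.isQuadratic_iff_sq_eq_one.mpr hχ a

/-- Coefficients of `ζ L(χ) L(ψ) L(χψ)`. -/
noncomputable def fourfold {N : ℕ} (χ ψ : DirichletCharacter ℂ N) : ArithmeticFunction ℂ :=
  χ.zetaMul * (charArith ψ * charArith (χ * ψ))

theorem fourfold_one {N : ℕ} (χ ψ : DirichletCharacter ℂ N) : fourfold χ ψ 1 = 1 := by
  simp only [fourfold, ArithmeticFunction.mul_apply_one, χ.isMultiplicative_zetaMul.map_one,
    charArith_apply _ one_ne_zero]
  simp

theorem fourfold_nonneg {N : ℕ} {χ ψ : DirichletCharacter ℂ N} (hχ : χ ^ 2 = 1) (hψ : ψ ^ 2 = 1)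
    (n : ℕ) : 0 ≤ fourfold χ ψ n := by
  refine nonneg_of_arithLog_eq (fourfold_one χ ψ)
    (g := charMangoldt (1 : DirichletCharacter ℂ 1) + charMangoldt χ
      + (charMangoldt ψ + charMangoldt (χ * ψ))) ?_ ?_ ?_ n
  · intro n
    simp only [ArithmeticFunction.add_apply, charMangoldt_apply]
    have h1 : (1 : DirichletCharacter ℂ 1) (n : ZMod 1) = 1 := by
      rw [Subsingleton.elim (n : ZMod 1) 1, map_one]
    have hL : (0:ℂ) ≤ (ArithmeticFunction.vonMangoldt n : ℂ) :=
      Complex.zero_le_real.2 ArithmeticFunction.vonMangoldt_nonneg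
    rw [h1, MulChar.mul_apply]
    have : (1 : ℂ) * (ArithmeticFunction.vonMangoldt n : ℂ) + χ n * (ArithmeticFunction.vonMangoldt n : ℂ)
        + (ψ n * (ArithmeticFunction.vonMangoldt n : ℂ) + χ n * ψ n * (ArithmeticFunction.vonMangoldt n : ℂ))
        = (1 + χ n) * (1 + ψ n) * (ArithmeticFunction.vonMangoldt n : ℂ) := by ring
    rw [this]
    refine mul_nonneg (mul_nonneg ?_ ?_) hL
    · rcases real_of_sq_eq_one hχ (n : ZMod N) with h | h | h <;> rw [h] <;> norm_num
    · rcases real_of_sq_eq_one hψ (n : ZMod N) with h | h | h <;> rw [h] <;> norm_num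
  · simp [ArithmeticFunction.add_apply, charMangoldt_apply]
  · have hz : arithLog χ.zetaMul = χ.zetaMul * (charMangoldt (1 : DirichletCharacter ℂ 1) + charMangoldt χ) := by
      change arithLog (_ * charArith χ) = (_ * charArith χ) * _
      rw [arithLog_mul, arithLog_zeta, arithLog_charArith]; ring
    rw [fourfold, arithLog_mul, hz, arithLog_mul, arithLog_charArith, arithLog_charArith]
    ring

theorem LSeriesSummable_charArith {N : ℕ} (χ : DirichletCharacter ℂ N) {s : ℂ} (hs : 1 < s.re) :
    LSeriesSummable (charArith χ) s :=
  (LSeriesSummable_congr s fun hn => (charArith_apply χ hn)).2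
    (DirichletCharacter.LSeriesSummable_of_one_lt_re χ hs)

theorem LSeries_charArith {N : ℕ} [NeZero N] (χ : DirichletCharacter ℂ N) {s : ℂ} (hs : 1 < s.re) :
    LSeries (charArith χ) s = DirichletCharacter.LFunction χ s := by
  rw [DirichletCharacter.LFunction_eq_LSeries χ hs]
  exact LSeries_congr (fun hn => charArith_apply χ hn) s

theorem LSeries_zetaMul {N : ℕ} [NeZero N] (χ : DirichletCharacter ℂ N) {s : ℂ} (hs : 1 < s.re) :
    LSeries χ.zetaMul s = riemannZeta s * DirichletCharacter.LFunction χ s := by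
  have h1 : LSeriesSummable (ArithmeticFunction.zeta : ArithmeticFunction ℂ) s :=
    ArithmeticFunction.LSeriesSummable_zeta_iff.mpr hs
  change LSeries ((_ * charArith χ : ArithmeticFunction ℂ)) s = _
  rw [ArithmeticFunction.LSeries_mul' h1 (LSeriesSummable_charArith χ hs), LSeries_charArith χ hs,
    ← ArithmeticFunction.LSeries_zeta_eq_riemannZeta hs]
  rfl

theorem LSeriesSummable_fourfold {N : ℕ} (χ ψ : DirichletCharacter ℂ N) {s : ℂ} (hs : 1 < s.re) :
    LSeriesSummable (fourfold χ ψ) s :=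
  ArithmeticFunction.LSeriesSummable_mul (χ.LSeriesSummable_zetaMul hs)
    (ArithmeticFunction.LSeriesSummable_mul (LSeriesSummable_charArith ψ hs)
      (LSeriesSummable_charArith _ hs))

theorem LSeries_fourfold {N : ℕ} [NeZero N] (χ ψ : DirichletCharacter ℂ N) {s : ℂ}
    (hs : 1 < s.re) :
    LSeries (fourfold χ ψ) s = riemannZeta s * DirichletCharacter.LFunction χ s
      * (DirichletCharacter.LFunction ψ s * DirichletCharacter.LFunction (χ * ψ) s) := by
  rw [fourfold, ArithmeticFunction.LSeries_mul' (χ.LSeriesSummable_zetaMul hs)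
    (ArithmeticFunction.LSeriesSummable_mul (LSeriesSummable_charArith ψ hs)
      (LSeriesSummable_charArith _ hs)),
    ArithmeticFunction.LSeries_mul' (LSeriesSummable_charArith ψ hs)
      (LSeriesSummable_charArith _ hs), LSeries_zetaMul χ hs, LSeries_charArith _ hs,
    LSeries_charArith _ hs]

theorem trivChar₁_eq {s : ℂ} (hs : s ≠ 1) :
    DirichletCharacter.LFunctionTrivChar₁ 1 s = (s - 1) * riemannZeta s := by
  rw [DirichletCharacter.LFunctionTrivChar₁, Function.update_of_ne hs]
  congr 1
  rw [DirichletCharacter.LFunctionTrivChar_eq_mul_riemannZeta hs]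
  simp

theorem trivChar₁_one : DirichletCharacter.LFunctionTrivChar₁ 1 1 = 1 := by
  simp [DirichletCharacter.LFunctionTrivChar₁]

/-- `(s - 1) ζ(s) L(s, χ)`. -/
noncomputable def twofoldL {N : ℕ} [NeZero N] (χ : DirichletCharacter ℂ N) (s : ℂ) : ℂ :=
  DirichletCharacter.LFunctionTrivChar₁ 1 s * DirichletCharacter.LFunction χ s

/-- `(s - 1) ζ(s) L(s, χ) L(s, ψ) L(s, χψ)`. -/
noncomputable def fourfoldL {N : ℕ} [NeZero N] (χ ψ : DirichletCharacter ℂ N) (s : ℂ) : ℂ :=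
  twofoldL χ s * (DirichletCharacter.LFunction ψ s * DirichletCharacter.LFunction (χ * ψ) s)

theorem differentiable_twofoldL {N : ℕ} [NeZero N] {χ : DirichletCharacter ℂ N} (hχ : χ ≠ 1) :
    Differentiable ℂ (twofoldL χ) :=
  (DirichletCharacter.differentiable_LFunctionTrivChar₁ 1).mul
    (DirichletCharacter.differentiable_LFunction hχ)

theorem twofoldL_eq {N : ℕ} [NeZero N] (χ : DirichletCharacter ℂ N) {s : ℂ} (hs : 1 < s.re) :
    twofoldL χ s = (s - 1) * LSeries χ.zetaMul s := by
  have : s ≠ 1 := by rintro rfl; simp at hs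
  rw [twofoldL, trivChar₁_eq this, LSeries_zetaMul χ hs]; ring

theorem fourfoldL_eq {N : ℕ} [NeZero N] (χ ψ : DirichletCharacter ℂ N) {s : ℂ} (hs : 1 < s.re) :
    fourfoldL χ ψ s = (s - 1) * LSeries (fourfold χ ψ) s := by
  have : s ≠ 1 := by rintro rfl; simp at hs
  rw [fourfoldL, twofoldL, trivChar₁_eq this, LSeries_fourfold χ ψ hs]; ring

theorem twofoldL_lower {N : ℕ} [NeZero N] {χ : DirichletCharacter ℂ N} (hχ : χ ≠ 1)
    (hχ2 : χ ^ 2 = 1) {β : ℝ} (hβ : 7 / 8 ≤ β) (hβ1 : β < 1) (hP : 0 ≤ (twofoldL χ β).re) :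
    (1 - β) / 4 * (57600 * (N : ℝ)) ^ (-(4 * (1 - β))) ≤ ‖DirichletCharacter.LFunction χ 1‖ := by
  have hN : (1 : ℝ) ≤ N := by exact_mod_cast NeZero.one_le
  have := estermann_lower_bound (r := χ.zetaMul) (fun n => DirichletCharacter.zetaMul_nonneg hχ2 n)
    (le_of_eq χ.isMultiplicative_zetaMul.map_one.symm)
    (LSeries.abscissaOfAbsConv_le_of_forall_lt_LSeriesSummable fun y hy =>
      χ.LSeriesSummable_zetaMul (by simpa using hy))
    (differentiable_twofoldL hχ) (fun s hs => twofoldL_eq χ hs) (K := 60 * (30 * N)) (by nlinarith)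
    (fun s hs => by
      rw [twofoldL, norm_mul]
      gcongr
      · exact LFunctionTrivChar₁_crude hs
      · exact LFunction_crude hχ hs) hβ hβ1 hP
  rw [show (57600 * (N : ℝ)) = 32 * (60 * (30 * N)) by ring]
  refine this.trans ((Complex.re_le_norm _).trans ?_)
  rw [twofoldL, trivChar₁_one, one_mul]

theorem fourfoldL_lower {N : ℕ} [NeZero N] {χ ψ : DirichletCharacter ℂ N} (hχ : χ ≠ 1)
    (hχ2 : χ ^ 2 = 1) (hψ : ψ ≠ 1) (hψ2 : ψ ^ 2 = 1) (hχψ : χ * ψ ≠ 1)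
    {β : ℝ} (hβ : 7 / 8 ≤ β) (hβ1 : β < 1) (hP : twofoldL χ β = 0) :
    (1 - β) / 4 * (51840000 * (N : ℝ) ^ 3) ^ (-(4 * (1 - β))) ≤
      ‖DirichletCharacter.LFunction χ 1‖ * (‖DirichletCharacter.LFunction ψ 1‖
        * ‖DirichletCharacter.LFunction (χ * ψ) 1‖) := by
  have hN : (1 : ℝ) ≤ N := by exact_mod_cast NeZero.one_le
  have := estermann_lower_bound (r := fourfold χ ψ) (fun n => fourfold_nonneg hχ2 hψ2 n)
    (le_of_eq (fourfold_one χ ψ).symm)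
    (LSeries.abscissaOfAbsConv_le_of_forall_lt_LSeriesSummable fun y hy =>
      LSeriesSummable_fourfold χ ψ (by simpa using hy))
    (P := fourfoldL χ ψ)
    ((differentiable_twofoldL hχ).mul ((DirichletCharacter.differentiable_LFunction hψ).mul
      (DirichletCharacter.differentiable_LFunction hχψ)))
    (fun s hs => fourfoldL_eq χ ψ hs) (K := 60 * (30 * N) * (30 * N * (30 * N)))
    (by
      have : (1:ℝ) ≤ (N:ℝ) ^ 3 := one_le_pow₀ hN
      nlinarith)
    (fun s hs => by
      rw [fourfoldL, twofoldL, norm_mul, norm_mul, norm_mul]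
      gcongr
      · exact LFunctionTrivChar₁_crude hs
      · exact LFunction_crude hχ hs
      · exact LFunction_crude hψ hs
      · exact LFunction_crude hχψ hs) hβ hβ1 (by rw [fourfoldL, hP]; simp)
  rw [show (51840000 * (N : ℝ) ^ 3) = 32 * (60 * (30 * N) * (30 * N * (30 * N))) by ring]
  refine this.trans ((Complex.re_le_norm _).trans ?_)
  rw [fourfoldL, twofoldL, trivChar₁_one, one_mul, norm_mul, norm_mul]

end

section
open scoped ComplexOrder ComplexConjugate
open LSeries

theorem im_eq_zero_of_nonneg_coeff {r : ℕ → ℂ} (h0 : 0 ≤ r) {P : ℂ → ℂ} (hP : Differentiable ℂ P)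
    (hPL : ∀ s : ℂ, 1 < s.re → P s = (s - 1) * LSeries r s) :
    (∀ x : ℝ, (P x).im = 0) ∧ 0 ≤ (P 1).re := by
  have hreal : ∀ x : ℝ, 1 < x → (P x).im = 0 ∧ 0 ≤ (P x).re := by
    intro x hx
    have hL : 0 ≤ LSeries r x := by
      refine tsum_nonneg fun n => ?_
      exact LSeries.term_nonneg (h0 n) x
    have h1 : (0:ℂ) ≤ (x:ℂ) - 1 := by
      have : (0:ℂ) ≤ ((x - 1 : ℝ) : ℂ) := Complex.zero_le_real.2 (by linarith)
      simpa using this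
    have h2 : 0 ≤ P x := by
      rw [hPL x (by simpa using hx)]
      exact mul_nonneg h1 hL
    rw [Complex.le_def] at h2
    exact ⟨by simpa using h2.2.symm, by simpa using h2.1⟩
  constructor
  · have hQ : Differentiable ℂ (fun s => conj (P (conj s))) := fun s =>
      (hP (conj s)).conj_conj (x := conj s) |>.congr_of_eventuallyEq (by rfl) |> fun h => by
        simpa [Function.comp_def] using h
    have heq : P = fun s => conj (P (conj s)) := by
      have hPa : AnalyticOnNhd ℂ P Set.univ := fun z _ => hP.analyticAt z
      have hQa : AnalyticOnNhd ℂ (fun s => conj (P (conj s))) Set.univ := fun z _ => hQ.analyticAt z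
      refine hPa.eq_of_frequently_eq hQa (z₀ := (2:ℂ)) ?_
      have hseq : Filter.Tendsto (fun n : ℕ => ((2 + ((n:ℝ) + 1)⁻¹ : ℝ) : ℂ)) Filter.atTop
          (nhdsWithin (2:ℂ) {2}ᶜ) := by
        rw [tendsto_nhdsWithin_iff]
        constructor
        · have h1 : Filter.Tendsto (fun n : ℕ => (2 + ((n:ℝ) + 1)⁻¹ : ℝ)) Filter.atTop (nhds (2 + 0)) := by
            refine tendsto_const_nhds.add ?_
            simpa using tendsto_one_div_add_atTop_nhds_zero_nat (𝕜 := ℝ)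
          have := (Complex.continuous_ofReal.tendsto (2 + 0)).comp h1
          simpa [Function.comp_def] using this
        · refine Filter.Eventually.of_forall fun n => ?_
          have : (0:ℝ) < ((n:ℝ) + 1)⁻¹ := by positivity
          simp only [Set.mem_compl_iff, Set.mem_singleton_iff]
          intro h
          have := congrArg Complex.re h
          simp only [Complex.ofReal_re, Complex.re_ofNat] at this
          linarith
      refine hseq.frequently (Filter.Frequently.of_forall fun n => ?_)
      have hn : (1:ℝ) < 2 + ((n:ℝ) + 1)⁻¹ := by
        have : (0:ℝ) < ((n:ℝ) + 1)⁻¹ := by positivity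
        linarith
      rw [Complex.conj_ofReal]
      exact (Complex.conj_eq_iff_im.2 (hreal _ hn).1).symm
    intro x
    have := congrFun heq x
    rw [Complex.conj_ofReal] at this
    exact Complex.conj_eq_iff_im.1 this.symm
  · have hc : Continuous fun x : ℝ => (P x).re :=
      Complex.continuous_re.comp (hP.continuous.comp Complex.continuous_ofReal)
    have ht : Filter.Tendsto (fun x : ℝ => (P x).re) (nhdsWithin 1 (Set.Ioi 1)) (nhds (P 1).re) := by
      have := (hc.tendsto 1).mono_left (nhdsWithin_le_nhds (s := Set.Ioi 1))
      simpa using this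
    refine ge_of_tendsto ht ?_
    filter_upwards [self_mem_nhdsWithin] with x hx
    exact (hreal x hx).2

/-- A sign change of `(s-1)ζ(s)L(s,χ)` on the real axis produces a zero. -/
theorem exists_zero_of_neg {N : ℕ} [NeZero N] {χ : DirichletCharacter ℂ N} (hχ : χ ≠ 1)
    (hχ2 : χ ^ 2 = 1) {β : ℝ} (hβ1 : β < 1) (hneg : (twofoldL χ β).re < 0) :
    ∃ β₁ : ℝ, β < β₁ ∧ β₁ < 1 ∧ twofoldL χ β₁ = 0 := by
  obtain ⟨him, h1⟩ := im_eq_zero_of_nonneg_coeff (r := χ.zetaMul)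
    (fun n => DirichletCharacter.zetaMul_nonneg hχ2 n) (differentiable_twofoldL hχ)
    (fun s hs => twofoldL_eq χ hs)
  have hc : Continuous fun x : ℝ => (twofoldL χ x).re :=
    Complex.continuous_re.comp ((differentiable_twofoldL hχ).continuous.comp Complex.continuous_ofReal)
  obtain ⟨b, hb, hb0⟩ := intermediate_value_Icc hβ1.le hc.continuousOn
    (show (0:ℝ) ∈ Set.Icc (twofoldL χ β).re (twofoldL χ (1:ℝ)).re from ⟨hneg.le, by simpa using h1⟩)
  have hb0' : twofoldL χ b = 0 := Complex.ext hb0 (him b)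
  refine ⟨b, lt_of_le_of_ne hb.1 ?_, lt_of_le_of_ne hb.2 ?_, hb0'⟩
  · rintro rfl
    rw [hb0'] at hneg; simp at hneg
  · rintro rfl
    rw [Complex.ofReal_one, twofoldL, trivChar₁_one, one_mul] at hb0'
    exact DirichletCharacter.LFunction_apply_one_ne_zero hχ hb0'

end

theorem prod_one_sub_inv_ge (S : Finset ℕ) (hS : ∀ p ∈ S, 2 ≤ p) :
    1 / ((S.card : ℝ) + 1) ≤ ∏ p ∈ S, (1 - (p : ℝ)⁻¹) := by
  induction S using Finset.induction_on_max with
  | empty => simp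
  | insert a s hmax ih =>
    have has : a ∉ s := fun h => lt_irrefl _ (hmax a h)
    have ih' := ih fun p hp => hS p (Finset.mem_insert_of_mem hp)
    have hcard : (s.card : ℝ) + 2 ≤ a := by
      have h1 : s ⊆ Finset.Ico 2 a := fun p hp =>
        Finset.mem_Ico.2 ⟨hS p (Finset.mem_insert_of_mem hp), hmax p hp⟩
      have h2 := Finset.card_le_card h1
      rw [Nat.card_Ico] at h2
      have h3 := hS a (Finset.mem_insert_self a s)
      have : s.card + 2 ≤ a := by omega
      exact_mod_cast this
    rw [Finset.prod_insert has, Finset.card_insert_of_notMem has]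
    push_cast
    have hs0 : (0:ℝ) ≤ s.card := Nat.cast_nonneg _
    have h4 : ((s.card : ℝ) + 1) / ((s.card : ℝ) + 2) ≤ 1 - (a : ℝ)⁻¹ := by
      have : (a : ℝ)⁻¹ ≤ ((s.card : ℝ) + 2)⁻¹ := inv_anti₀ (by linarith) hcard
      have h5 : ((s.card : ℝ) + 1) / ((s.card : ℝ) + 2) = 1 - ((s.card : ℝ) + 2)⁻¹ := by
        field_simp; ring
      linarith
    calc 1 / ((s.card : ℝ) + 1 + 1)
        = ((s.card : ℝ) + 1) / ((s.card : ℝ) + 2) * (1 / ((s.card : ℝ) + 1)) := by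
          field_simp; ring
      _ ≤ _ := mul_le_mul h4 ih' (by positivity) (le_trans (by positivity) h4)

theorem card_primeFactors_le_log {n : ℕ} (hn : n ≠ 0) :
    (n.primeFactors.card : ℝ) ≤ 2 * Real.log n := by
  have h1 : 2 ^ n.primeFactors.card ≤ n := by
    calc 2 ^ n.primeFactors.card ≤ ∏ p ∈ n.primeFactors, p :=
          Finset.pow_card_le_prod _ _ _ fun p hp => (Nat.prime_of_mem_primeFactors hp).two_le
      _ ≤ n := Nat.le_of_dvd (Nat.pos_of_ne_zero hn) (Nat.prod_primeFactors_dvd n)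
  have h2 : Real.log ((2:ℝ) ^ n.primeFactors.card) ≤ Real.log n :=
    Real.log_le_log (by positivity) (by exact_mod_cast h1)
  rw [Real.log_pow] at h2
  have : (0:ℝ) ≤ n.primeFactors.card := Nat.cast_nonneg _
  nlinarith [Real.log_two_gt_d9]

theorem norm_LFunction_changeLevel_one_le {q N : ℕ} [NeZero q] [NeZero N] (hqN : q ∣ N)
    {χ : DirichletCharacter ℂ q} (hχ : χ ≠ 1) :
    ‖DirichletCharacter.LFunction (DirichletCharacter.changeLevel hqN χ) 1‖ ≤
      (1 + 2 * Real.log N) * ‖DirichletCharacter.LFunction χ 1‖ := by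
  rw [DirichletCharacter.LFunction_changeLevel hqN χ (.inl hχ), norm_mul, mul_comm]
  gcongr
  rw [norm_prod]
  have hlow := prod_one_sub_inv_ge N.primeFactors fun p hp => (Nat.prime_of_mem_primeFactors hp).two_le
  have hc := card_primeFactors_le_log (NeZero.ne N)
  have h1 : ∏ p ∈ N.primeFactors, ‖1 - χ p * (p:ℂ) ^ (-1 : ℂ)‖
      ≤ ∏ p ∈ N.primeFactors, (1 - (p : ℝ)⁻¹)⁻¹ := by
    refine Finset.prod_le_prod (fun p _ => norm_nonneg _) fun p hp => ?_
    have hp2 : (2:ℝ) ≤ p := by exact_mod_cast (Nat.prime_of_mem_primeFactors hp).two_le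
    have hx : (p:ℝ)⁻¹ ≤ 1 / 2 := by
      rw [one_div]; exact inv_anti₀ (by norm_num) hp2
    have hx0 : (0:ℝ) < (p:ℝ)⁻¹ := by positivity
    calc ‖1 - χ p * (p:ℂ) ^ (-1 : ℂ)‖ ≤ 1 + (p:ℝ)⁻¹ := by
          refine (norm_sub_le _ _).trans ?_
          rw [norm_one, norm_mul, Complex.cpow_neg_one, norm_inv, Complex.norm_natCast]
          have := DirichletCharacter.norm_le_one χ (p : ZMod q)
          nlinarith
      _ ≤ _ := by
          rw [← one_div (1 - _), le_div_iff₀ (by linarith)]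
          nlinarith
  refine h1.trans ?_
  rw [Finset.prod_inv_distrib]
  calc (∏ p ∈ N.primeFactors, (1 - (p : ℝ)⁻¹))⁻¹ ≤ (1 / ((N.primeFactors.card : ℝ) + 1))⁻¹ :=
        inv_anti₀ (by positivity) hlow
    _ = N.primeFactors.card + 1 := by simp
    _ ≤ _ := by linarith

theorem one_add_two_log_le {η : ℝ} (hη : 0 < η) {x : ℝ} (hx : 1 ≤ x) :
    1 + 2 * Real.log x ≤ (1 + 2 / η) * x ^ η := by
  have h1 := Real.log_le_rpow_div (by linarith : 0 ≤ x) hη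
  have h2 : 1 ≤ x ^ η := Real.one_le_rpow hx hη.le
  calc 1 + 2 * Real.log x ≤ x ^ η + 2 * (x ^ η / η) := by linarith
    _ = _ := by ring

/-- **Siegel's theorem**. -/
theorem siegel {ε : ℝ} (hε : 0 < ε) : ∃ c > 0, ∀ (q : ℕ) [NeZero q] (χ : DirichletCharacter ℂ q),
    χ ≠ 1 → χ ^ 2 = 1 → c * (q : ℝ) ^ (-ε) ≤ ‖DirichletCharacter.LFunction χ 1‖ := by
  obtain ⟨η, hη0, hη8, hηε⟩ : ∃ η : ℝ, 0 < η ∧ η ≤ 1 / 8 ∧ 20 * η ≤ ε :=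
    ⟨min (1 / 8) (ε / 20), by positivity, min_le_left _ _, by
      have := min_le_right (1 / 8) (ε / 20); linarith⟩
  by_cases hcase : ∃ (q₁ : ℕ) (_ : NeZero q₁) (χ₁ : DirichletCharacter ℂ q₁), χ₁ ≠ 1 ∧ χ₁ ^ 2 = 1 ∧
      (twofoldL χ₁ (1 - η : ℝ)).re < 0
  · obtain ⟨q₁, hq₁, χ₁, hχ₁, hχ₁2, hneg⟩ := hcase
    obtain ⟨β, hβ1, hβ2, hβ0⟩ := exists_zero_of_neg hχ₁ hχ₁2 (by linarith) hneg
    obtain ⟨C, hC0, hC⟩ := regL_upper hη0 (by linarith)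
    have hq1 : (1 : ℝ) ≤ q₁ := by exact_mod_cast NeZero.one_le
    set b := 1 - β with hb
    have hb0 : 0 < b := by linarith
    have hbη : b ≤ η := by linarith
    have hβC : (β : ℂ) ≠ 1 := by exact_mod_cast hβ2.ne
    set C1 := b / 4 * (51840000 : ℝ) ^ (-(4 * b)) with hC1
    have hC1pos : 0 < C1 := by positivity
    set C2 := (1 + 2 / η) with hC2
    set C3 := C * (2:ℝ) ^ (2 * η) with hC3
    have hC3pos : 0 < C3 := by positivity
    refine ⟨C1 / ((1 + C3 ^ 2) * C2) * (q₁ : ℝ) ^ (-(20 * η)), by positivity, ?_⟩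
    intro q hq χ hχ hχ2
    have hqr : (1 : ℝ) ≤ q := by exact_mod_cast NeZero.one_le
    have : NeZero (q₁ * q) := ⟨mul_ne_zero (NeZero.ne _) (NeZero.ne _)⟩
    set N := q₁ * q with hN
    have hNr : (1 : ℝ) ≤ N := by exact_mod_cast NeZero.one_le
    set ψ₁ := DirichletCharacter.changeLevel (dvd_mul_right q₁ q) χ₁ with hψ₁
    set ψ := DirichletCharacter.changeLevel (dvd_mul_left q q₁) χ with hψ
    have hψ₁1 : ψ₁ ≠ 1 := hχ₁ ∘ (DirichletCharacter.changeLevel_eq_one_iff _).mp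
    have hψ1 : ψ ≠ 1 := hχ ∘ (DirichletCharacter.changeLevel_eq_one_iff _).mp
    have hψ₁2 : ψ₁ ^ 2 = 1 := by rw [hψ₁, ← map_pow, hχ₁2, map_one]
    have hψ2 : ψ ^ 2 = 1 := by rw [hψ, ← map_pow, hχ2, map_one]
    have hz : twofoldL ψ₁ β = 0 := by
      rw [twofoldL] at hβ0 ⊢
      rw [hψ₁, DirichletCharacter.LFunction_changeLevel _ _ (.inr hβC), ← mul_assoc, hβ0, zero_mul]
    have hup : ∀ ξ : DirichletCharacter ℂ N, ξ ≠ 1 →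
        ‖DirichletCharacter.LFunction ξ 1‖ ≤ C3 * (N : ℝ) ^ (2 * η) := by
      intro ξ hξ
      have := hC N ξ 1 (by simp; linarith) (by simp)
      rw [regL_of_ne hξ, anCond] at this
      refine this.trans (le_of_eq ?_)
      simp only [Complex.one_im, abs_zero, zero_add]
      rw [Real.mul_rpow (by positivity) (by positivity), hC3]; ring
    -- the key lower bound at level `N`
    have hkey : C1 / (1 + C3 ^ 2) * (N : ℝ) ^ (-(16 * η)) ≤ ‖DirichletCharacter.LFunction ψ 1‖ := by
      by_cases hprod : ψ₁ * ψ = 1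
      · have heq : ψ = ψ₁ := by
          have : ψ₁ * ψ₁ = 1 := by rw [← sq, hψ₁2]
          exact mul_left_cancel (hprod.trans this.symm)
        have hl := twofoldL_lower hψ1 hψ2 (β := β) (by linarith) hβ2 (by rw [heq, hz]; simp)
        refine le_trans ?_ hl
        rw [← hb, Real.mul_rpow (by norm_num) (by positivity), ← mul_assoc]
        gcongr ?_ * ?_
        · have h1 : C1 / (1 + C3 ^ 2) ≤ C1 := div_le_self hC1pos.le (by nlinarith [sq_nonneg C3])
          refine h1.trans ?_
          rw [hC1]
          have : (51840000 : ℝ) ^ (-(4 * b)) ≤ (57600 : ℝ) ^ (-(4 * b)) :=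
            Real.rpow_le_rpow_of_nonpos (by norm_num) (by norm_num) (by linarith)
          gcongr
        · exact Real.rpow_le_rpow_of_exponent_le hNr (by linarith)
      · have hl := fourfoldL_lower hψ₁1 hψ₁2 hψ1 hψ2 hprod (β := β) (by linarith) hβ2 hz
        have h1 := hup ψ₁ hψ₁1
        have h2 := hup _ hprod
        rw [← hb, Real.mul_rpow (by norm_num) (by positivity), ← mul_assoc, ← hC1] at hl
        have hNN : (N : ℝ) ^ (-(12 * η)) ≤ ((N : ℝ) ^ 3) ^ (-(4 * b)) := by
          rw [← Real.rpow_natCast, ← Real.rpow_mul (by positivity)]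
          apply Real.rpow_le_rpow_of_exponent_le hNr
          push_cast; linarith
        have h3 : C1 * (N : ℝ) ^ (-(12 * η)) ≤
            (C3 * (N : ℝ) ^ (2 * η)) * (‖DirichletCharacter.LFunction ψ 1‖ * (C3 * (N : ℝ) ^ (2 * η))) := by
          refine (mul_le_mul_of_nonneg_left hNN hC1pos.le).trans (hl.trans ?_)
          gcongr
        have hp : (0:ℝ) < (N : ℝ) ^ (-(4 * η)) := by positivity
        have h4 : (N : ℝ) ^ (2 * η) * (N : ℝ) ^ (2 * η) * (N : ℝ) ^ (-(4 * η)) = 1 := by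
          rw [← Real.rpow_add (by positivity), ← Real.rpow_add (by positivity)]
          ring_nf; simp
        have h5 : (N : ℝ) ^ (-(16 * η)) = (N : ℝ) ^ (-(12 * η)) * (N : ℝ) ^ (-(4 * η)) := by
          rw [← Real.rpow_add (by positivity)]; ring_nf
        rw [h5, div_mul_eq_mul_div, div_le_iff₀ (by positivity)]
        calc C1 * ((N : ℝ) ^ (-(12 * η)) * (N : ℝ) ^ (-(4 * η)))
            = C1 * (N : ℝ) ^ (-(12 * η)) * (N : ℝ) ^ (-(4 * η)) := by ring
          _ ≤ (C3 * (N : ℝ) ^ (2 * η)) * (‖DirichletCharacter.LFunction ψ 1‖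
                * (C3 * (N : ℝ) ^ (2 * η))) * (N : ℝ) ^ (-(4 * η)) := by gcongr
          _ = ‖DirichletCharacter.LFunction ψ 1‖ * C3 ^ 2
              * ((N : ℝ) ^ (2 * η) * (N : ℝ) ^ (2 * η) * (N : ℝ) ^ (-(4 * η))) := by ring
          _ = ‖DirichletCharacter.LFunction ψ 1‖ * C3 ^ 2 := by rw [h4, mul_one]
          _ ≤ _ := by
              have := norm_nonneg (DirichletCharacter.LFunction ψ 1)
              nlinarith
    have hlev := norm_LFunction_changeLevel_one_le (dvd_mul_left q q₁) hχ
    rw [← hψ] at hlev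
    have hlog := one_add_two_log_le hη0 hNr
    have h6 : C1 / (1 + C3 ^ 2) * (N : ℝ) ^ (-(16 * η)) ≤
        C2 * (N : ℝ) ^ η * ‖DirichletCharacter.LFunction χ 1‖ :=
      hkey.trans (hlev.trans (by gcongr))
    have h7 : C1 / ((1 + C3 ^ 2) * C2) * (N : ℝ) ^ (-(17 * η)) ≤
        ‖DirichletCharacter.LFunction χ 1‖ := by
      have hp : (0:ℝ) < (N : ℝ) ^ η := by positivity
      have h8 : (N : ℝ) ^ (-(16 * η)) = (N : ℝ) ^ (-(17 * η)) * (N : ℝ) ^ η := by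
        rw [← Real.rpow_add (by positivity)]; ring_nf
      rw [h8] at h6
      have hC2pos : 0 < C2 := by positivity
      have : C2 * (N : ℝ) ^ η * (C1 / ((1 + C3 ^ 2) * C2) * (N : ℝ) ^ (-(17 * η))) ≤
          C2 * (N : ℝ) ^ η * ‖DirichletCharacter.LFunction χ 1‖ := by
        refine le_trans (le_of_eq ?_) h6
        field_simp
      exact le_of_mul_le_mul_left this (by positivity)
    refine le_trans ?_ h7
    rw [mul_assoc]
    gcongr
    calc (q₁ : ℝ) ^ (-(20 * η)) * (q : ℝ) ^ (-ε) ≤ (q₁ : ℝ) ^ (-(20 * η)) * (q : ℝ) ^ (-(20 * η)) := by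
          gcongr
      _ = (N : ℝ) ^ (-(20 * η)) := by
          rw [← Real.mul_rpow (by positivity) (by positivity), hN]; push_cast; rfl
      _ ≤ _ := Real.rpow_le_rpow_of_exponent_le hNr (by linarith)
  · push Not at hcase
    refine ⟨η / 4 * (57600 : ℝ) ^ (-(4 * η)), by positivity, ?_⟩
    intro q hq χ hχ hχ2
    have := twofoldL_lower hχ hχ2 (β := 1 - η) (by linarith) (by linarith) (hcase q hq χ hχ hχ2)
    rw [show 1 - (1 - η) = η by ring, Real.mul_rpow (by norm_num) (by positivity), ← mul_assoc] at this
    refine le_trans ?_ this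
    gcongr
    · exact_mod_cast (NeZero.one_le : 1 ≤ q)
    · linarith

theorem anCond_le_of_abs_le {q : ℕ} {s t : ℝ} (h : |s| ≤ |t|) : anCond q s ≤ anCond q t := by
  unfold anCond; gcongr

theorem regL_bounds {ε : ℝ} (hε : 0 < ε) (hε1 : ε ≤ 1 / 2) :
    ∃ C : ℝ, 1 ≤ C ∧ ∀ (q : ℕ) [NeZero q] (χ : DirichletCharacter ℂ q) (s : ℂ),
      1 - ε / 4 ≤ s.re → s.re ≤ 5 / 2 →
      ‖regL χ s‖ ≤ C * anCond q s.im ^ ε ∧ ‖deriv (regL χ) s‖ ≤ C * anCond q s.im ^ ε := by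
  obtain ⟨C, hC0, hC⟩ := regL_upper (ε := ε / 2) (by linarith) (by linarith)
  refine ⟨1 + C + 2 * C / (ε / 4), by
    have : 0 ≤ 2 * C / (ε / 4) := by positivity
    linarith, ?_⟩
  intro q _ χ s hs1 hs2
  have hq : 1 ≤ q := NeZero.one_le
  have hD := two_le_anCond hq s.im
  have hE : 0 < anCond q s.im ^ ε := by positivity
  have hextra : 0 ≤ 2 * C / (ε / 4) := by positivity
  constructor
  · have := hC q χ s (by linarith) (by linarith)
    rw [show 2 * (ε / 2) = ε by ring] at this
    refine this.trans ?_
    gcongr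
    linarith
  · have h1 : ∀ z ∈ Metric.sphere s (ε / 4), ‖regL χ z‖ ≤ 2 * C * anCond q s.im ^ ε := by
      intro z hz
      rw [mem_sphere_iff_norm] at hz
      have hre := (abs_le.1 ((Complex.abs_re_le_norm (z - s)).trans hz.le))
      have him := (abs_le.1 ((Complex.abs_im_le_norm (z - s)).trans hz.le))
      simp only [Complex.sub_re, Complex.sub_im] at hre him
      have := hC q χ z (by linarith) (by linarith)
      rw [show 2 * (ε / 2) = ε by ring] at this
      refine this.trans ?_
      have hz2 : anCond q z.im ≤ 2 * anCond q s.im := by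
        unfold anCond
        have : |z.im| ≤ |s.im| + 1 := by
          have h3 : |z.im| ≤ |s.im| + |z.im - s.im| := by
            have := abs_add_le s.im (z.im - s.im)
            simpa using this
          have h4 : |z.im - s.im| ≤ 1 := abs_le.2 ⟨by linarith, by linarith⟩
          linarith
        have hq0 : (0:ℝ) ≤ q := Nat.cast_nonneg _
        nlinarith [abs_nonneg s.im]
      have hz0 := two_le_anCond hq z.im
      calc C * anCond q z.im ^ ε ≤ C * (2 * anCond q s.im) ^ ε := by gcongr
        _ = C * (2 ^ ε * anCond q s.im ^ ε) := by rw [Real.mul_rpow (by norm_num) (by linarith)]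
        _ ≤ C * (2 * anCond q s.im ^ ε) := by
            gcongr
            calc (2:ℝ) ^ ε ≤ 2 ^ (1:ℝ) := Real.rpow_le_rpow_of_exponent_le (by norm_num) (by linarith)
              _ = 2 := by norm_num
        _ = _ := by ring
    have hdiff : DiffContOnCl ℂ (regL χ) (Metric.ball s (ε / 4)) := by
      refine DifferentiableOn.diffContOnCl fun z hz => ?_
      refine (differentiableAt_regL χ ?_).differentiableWithinAt
      rw [closure_ball s (by positivity), mem_closedBall_iff_norm] at hz
      have hre := (abs_le.1 ((Complex.abs_re_le_norm (z - s)).trans hz))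
      simp only [Complex.sub_re] at hre
      linarith
    have := Complex.norm_deriv_le_of_forall_mem_sphere_norm_le (by positivity) hdiff h1
    refine this.trans ?_
    rw [mul_div_right_comm]
    gcongr
    linarith

theorem norm_regL_sub_le {ε C : ℝ} {q : ℕ} [NeZero q] {χ : DirichletCharacter ℂ q} (hε : 0 < ε)
    (hε1 : ε ≤ 1 / 2) (hC0 : 0 ≤ C)
    (hC : ∀ s : ℂ, 1 - ε / 4 ≤ s.re → s.re ≤ 5 / 2 → ‖deriv (regL χ) s‖ ≤ C * anCond q s.im ^ ε)
    {z w : ℂ} {T : ℝ} (hz1 : 1 - ε / 4 ≤ z.re) (hz2 : z.re ≤ 5 / 2) (hzT : |z.im| ≤ |T|)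
    (hw1 : 1 - ε / 4 ≤ w.re) (hw2 : w.re ≤ 5 / 2) (hwT : |w.im| ≤ |T|) :
    ‖regL χ z - regL χ w‖ ≤ C * anCond q T ^ ε * ‖z - w‖ := by
  have hconv : Convex ℝ (({s : ℂ | 1 - ε / 4 ≤ s.re} ∩ {s | s.re ≤ 5 / 2})
      ∩ ({s : ℂ | -|T| ≤ s.im} ∩ {s | s.im ≤ |T|})) :=
    ((convex_halfSpace_re_ge _).inter (convex_halfSpace_re_le _)).inter
      ((convex_halfSpace_im_ge _).inter (convex_halfSpace_im_le _))
  refine Convex.norm_image_sub_le_of_norm_deriv_le (𝕜 := ℂ) (fun s hs => ?_) (fun s hs => ?_) hconv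
    ⟨⟨hw1, hw2⟩, abs_le.1 hwT⟩ ⟨⟨hz1, hz2⟩, abs_le.1 hzT⟩
  · refine differentiableAt_regL χ ?_
    have : 1 - ε / 4 ≤ s.re := hs.1.1
    linarith
  · refine (hC s hs.1.1 hs.1.2).trans ?_
    have := anCond_le_of_abs_le (q := q) (abs_le.2 hs.2)
    have := two_le_anCond (NeZero.one_le (n := q)) s.im
    gcongr

theorem regL_one_apply_one_ge {ε : ℝ} (hε : 0 < ε) : ∃ c : ℝ, 0 < c ∧ c ≤ 1 ∧
    ∀ (q : ℕ) [NeZero q] (χ : DirichletCharacter ℂ q), χ ^ 2 = 1 →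
      c * (q : ℝ) ^ (-ε) ≤ ‖regL χ 1‖ := by
  obtain ⟨c, hc, h⟩ := siegel hε
  refine ⟨min (min c 1) (1 / (2 * (1 + 2 / ε))), by positivity,
    (min_le_left _ _).trans (min_le_right _ _), ?_⟩
  intro q _ χ hχ2
  have hqr : (1:ℝ) ≤ q := by exact_mod_cast (NeZero.one_le : 1 ≤ q)
  by_cases hχ : χ = 1
  · subst hχ
    have h1 : ‖regL (1 : DirichletCharacter ℂ q) 1‖ = (∏ p ∈ q.primeFactors, (1 - (p:ℝ)⁻¹)) / 2 := by
      have h2 : DirichletCharacter.LFunctionTrivChar₁ q 1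
          = ((∏ p ∈ q.primeFactors, (1 - (p:ℝ)⁻¹) : ℝ) : ℂ) := by
        simp [DirichletCharacter.LFunctionTrivChar₁]
      rw [regL_one, h2, norm_div, Complex.norm_real, Real.norm_of_nonneg]
      · norm_num
      · refine Finset.prod_nonneg fun p hp => ?_
        have : (2:ℝ) ≤ p := by exact_mod_cast (Nat.prime_of_mem_primeFactors hp).two_le
        have : (p:ℝ)⁻¹ ≤ 2⁻¹ := inv_anti₀ (by norm_num) this
        linarith [(by norm_num : (2:ℝ)⁻¹ = 1 / 2)]
    rw [h1]
    have hlow := prod_one_sub_inv_ge q.primeFactors fun p hp => (Nat.prime_of_mem_primeFactors hp).two_le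
    have hc := card_primeFactors_le_log (NeZero.ne q)
    have hl := one_add_two_log_le hε hqr
    calc min (min c 1) (1 / (2 * (1 + 2 / ε))) * (q : ℝ) ^ (-ε)
        ≤ 1 / (2 * (1 + 2 / ε)) * (q : ℝ) ^ (-ε) := by gcongr; exact min_le_right _ _
      _ = 1 / ((1 + 2 / ε) * (q:ℝ) ^ ε) / 2 := by
          rw [Real.rpow_neg (by linarith)]; field_simp
      _ ≤ 1 / ((q.primeFactors.card : ℝ) + 1) / 2 := by
          gcongr; linarith
      _ ≤ _ := by gcongr
  · rw [regL_of_ne hχ]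
    refine le_trans ?_ (h q χ hχ hχ2)
    gcongr
    exact (min_le_left _ _).trans (min_le_left _ _)

theorem norm_LFunction_le_of_regL {q : ℕ} [NeZero q] (χ : DirichletCharacter ℂ q) {s : ℂ} {r B : ℝ}
    (hre : 0 < s.re) (hr : 0 < r) (hr1 : r ≤ 1) (hB : ‖regL χ s‖ ≤ B) (hs : χ ≠ 1 ∨ r ≤ ‖s - 1‖) :
    ‖DirichletCharacter.LFunction χ s‖ ≤ B * (3 / r) := by
  have hB0 : 0 ≤ B := (norm_nonneg _).trans hB
  have h3 : 1 ≤ 3 / r := by rw [le_div_iff₀ hr]; linarith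
  by_cases hχ : χ = 1
  · subst hχ
    have hrs : r ≤ ‖s - 1‖ := hs.resolve_left (by simp)
    have hs1 : s ≠ 1 := by
      rintro rfl
      simp at hrs; linarith
    have hs2 : s + 1 ≠ 0 := by
      intro h
      have := congrArg Complex.re h
      simp at this; linarith
    · have : DirichletCharacter.LFunction (1 : DirichletCharacter ℂ q) s
          = regL (1 : DirichletCharacter ℂ q) s * ((s + 1) / (s - 1)) := by
        rw [regL_one_of_ne (q := q) hs1]
        have : s - 1 ≠ 0 := sub_ne_zero.2 hs1
        field_simp
      rw [this, norm_mul]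
      gcongr
      rw [norm_div, div_le_div_iff₀ (by linarith) hr]
      have h2 : ‖s + 1‖ ≤ ‖s - 1‖ + 2 := by
        have := norm_add_le (s - 1) 2
        rw [show s - 1 + 2 = s + 1 by ring] at this
        simpa using this
      nlinarith
  · rw [regL_of_ne hχ] at hB
    nlinarith

theorem regL_pointwise_lower {ε : ℝ} (hε : 0 < ε) (hε1 : ε ≤ 1 / 2) :
    ∃ c : ℝ, 0 < c ∧ ∀ (q : ℕ) [NeZero q] (χ : DirichletCharacter ℂ q) (y t : ℝ), 0 < y → y ≤ 1 →
      c * y ^ 3 / (anCond q t ^ ε) ^ 4 ≤ ‖regL χ (1 + (y ^ 4 : ℝ) + Complex.I * t)‖ := by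
  obtain ⟨C, hC1, hC⟩ := regL_bounds hε hε1
  obtain ⟨c, hc0, hc1, hc⟩ := regL_one_apply_one_ge hε
  set c1 := c / (2 * C) with hc1def
  have hc1pos : 0 < c1 := by positivity
  have hc1le : c1 ≤ 1 / 2 := by
    rw [hc1def, div_le_div_iff₀ (by positivity) (by norm_num)]; linarith
  set C3 := (9 * C) ^ 3 * (2 * C * (3 / c1)) with hC3
  have hC3one : 1 ≤ C3 := by
    rw [hC3]
    have h1 : 1 ≤ 3 / c1 := by rw [le_div_iff₀ hc1pos]; linarith
    have h2 : 1 ≤ (9 * C) ^ 3 := one_le_pow₀ (by linarith)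
    have h3 : 1 ≤ 2 * C * (3 / c1) := by nlinarith
    nlinarith
  refine ⟨min (c1 / 3 / C3) (c / 2), by positivity, ?_⟩
  intro q _ χ y t hy hy1
  have hqr : (1:ℝ) ≤ q := by exact_mod_cast (NeZero.one_le : 1 ≤ q)
  have hD2 := two_le_anCond (NeZero.one_le (n := q)) t
  set D := anCond q t with hD
  set E := D ^ ε with hE
  have hE1 : 1 ≤ E := Real.one_le_rpow (by linarith) hε.le
  set x : ℝ := y ^ 4 with hx
  have hx0 : 0 < x := by positivity
  have hx1 : x ≤ 1 := pow_le_one₀ hy.le hy1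
  set r := c1 / E ^ 2 with hr
  have hr0 : 0 < r := by positivity
  have hr1 : r ≤ 1 := by
    rw [hr, div_le_one (by positivity)]
    nlinarith
  have hy3 : y ^ 3 ≤ 1 := pow_le_one₀ hy.le hy1
  by_cases hs : χ ^ 2 = 1 ∧ ‖(x : ℂ) + Complex.I * t‖ < r
  · -- near the point `1`
    obtain ⟨hχ2, hsmall⟩ := hs
    have h1 := norm_regL_sub_le (χ := χ) hε hε1 (by linarith) (fun s a b => (hC q χ s a b).2)
      (z := 1 + (x:ℝ) + Complex.I * t) (w := 1) (T := t) (by simp; linarith) (by simp; linarith)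
      (by simp) (by simp; linarith) (by norm_num) (by simp)
    have h2 := hc q χ hχ2
    have h3 : E⁻¹ ≤ (q:ℝ) ^ (-ε) := by
      rw [Real.rpow_neg (by linarith)]
      refine inv_anti₀ (by positivity) ?_
      refine Real.rpow_le_rpow (by linarith) ?_ hε.le
      rw [hD, anCond]; nlinarith [abs_nonneg t]
    have h4 : ‖regL χ (1 + (x:ℝ) + Complex.I * t) - regL χ 1‖ ≤ c / 2 * E⁻¹ := by
      refine h1.trans ?_
      rw [show (1 + (x:ℝ) + Complex.I * t - 1 : ℂ) = (x : ℂ) + Complex.I * t by ring]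
      calc C * E * ‖(x : ℂ) + Complex.I * t‖ ≤ C * E * r := by gcongr
        _ = c / 2 * E⁻¹ := by rw [hr, hc1def]; field_simp
    have h5 : ‖regL χ 1‖ ≤ ‖regL χ (1 + (x:ℝ) + Complex.I * t)‖
        + ‖regL χ (1 + (x:ℝ) + Complex.I * t) - regL χ 1‖ := by
      rw [norm_sub_rev]
      exact norm_le_insert' _ _
    have h6 : c / 2 * E⁻¹ ≤ ‖regL χ (1 + (x:ℝ) + Complex.I * t)‖ := by
      have : c * E⁻¹ ≤ c * (q:ℝ) ^ (-ε) := by gcongr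
      linarith
    refine le_trans ?_ h6
    rw [div_le_iff₀ (by positivity)]
    have hE3 : c / 2 * E⁻¹ * E ^ 4 = c / 2 * E ^ 3 := by field_simp
    rw [hE3]
    calc min (c1 / 3 / C3) (c / 2) * y ^ 3 ≤ c / 2 * 1 := by gcongr; exact min_le_right _ _
      _ ≤ _ := by gcongr; exact one_le_pow₀ hE1
  · -- the inequality `3 + 4 cos θ + cos (2 θ) ≥ 0`
    have h341 := DirichletCharacter.norm_LFunction_product_ge_one χ hx0 t
    rw [norm_mul, norm_mul, norm_pow, norm_pow] at h341
    have hA : ‖DirichletCharacter.LFunctionTrivChar q (1 + x)‖ ≤ C * E * (3 / x) := by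
      refine norm_LFunction_le_of_regL (r := x) (χ := (1 : DirichletCharacter ℂ q)) (by simp; linarith)
        hx0 hx1 ?_ (.inr ?_)
      · refine (hC q 1 (1 + x) (by simp; linarith) (by simp; linarith)).1.trans ?_
        have : anCond q (1 + (x:ℂ)).im ≤ D := anCond_le_of_abs_le (by simp)
        have h0 := two_le_anCond (NeZero.one_le (n := q)) (1 + (x:ℂ)).im
        refine mul_le_mul_of_nonneg_left ?_ (by linarith)
        exact Real.rpow_le_rpow (by linarith) this hε.le
      · simp [abs_of_pos hx0]
    have hdich : χ ^ 2 ≠ 1 ∨ r ≤ ‖(x : ℂ) + Complex.I * t‖ := by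
      by_cases h : χ ^ 2 = 1
      · right; by_contra hh; exact hs ⟨h, not_le.1 hh⟩
      · exact .inl h
    have hnorm2 : ‖(x : ℂ) + Complex.I * t‖ ≤ ‖(x : ℂ) + 2 * Complex.I * t‖ := by
      rw [← sq_le_sq₀ (norm_nonneg _) (norm_nonneg _), Complex.sq_norm, Complex.sq_norm,
        Complex.normSq_apply, Complex.normSq_apply]
      simp
      nlinarith [sq_nonneg t]
    have hB : ‖DirichletCharacter.LFunction (χ ^ 2) (1 + x + 2 * Complex.I * t)‖ ≤
        2 * C * E * (3 / r) := by
      refine norm_LFunction_le_of_regL (χ ^ 2) (s := 1 + x + 2 * Complex.I * t) (by simp; linarith) hr0 hr1 ?_ ?_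
      · refine (hC q (χ ^ 2) _ (by simp; linarith) (by simp; linarith)).1.trans ?_
        set u : ℝ := (1 + (x:ℂ) + 2 * Complex.I * t).im with hu
        have hu' : u = 2 * t := by simp [hu]
        have h1 : anCond q u ≤ 2 * D := by
          rw [hu', hD, anCond, anCond, abs_mul]
          simp only [Nat.abs_ofNat]
          nlinarith [abs_nonneg t]
        have h0 := two_le_anCond (NeZero.one_le (n := q)) u
        calc C * anCond q u ^ ε ≤ C * (2 * D) ^ ε := by gcongr
          _ = C * (2 ^ ε * E) := by rw [Real.mul_rpow (by norm_num) (by linarith)]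
          _ ≤ C * (2 * E) := by
              gcongr
              calc (2:ℝ) ^ ε ≤ 2 ^ (1:ℝ) :=
                    Real.rpow_le_rpow_of_exponent_le (by norm_num) (by linarith)
                _ = 2 := by norm_num
          _ = _ := by ring
      · refine hdich.imp id fun h => h.trans (hnorm2.trans (le_of_eq ?_))
        congr 1; ring
    set l := ‖DirichletCharacter.LFunction χ (1 + x + Complex.I * t)‖ with hl
    have hreg : l ≤ ‖regL χ (1 + x + Complex.I * t)‖ * (3 / r) := by
      refine norm_LFunction_le_of_regL χ (s := 1 + x + Complex.I * t) (by simp; linarith) hr0 hr1 le_rfl ?_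
      rcases hdich with h | h
      · left; rintro rfl; exact h (one_pow 2)
      · right
        refine h.trans (le_of_eq ?_)
        congr 1; ring
    have hl4 : 1 ≤ C3 * E ^ 8 * l ^ 4 / (y ^ 3) ^ 4 := by
      calc (1:ℝ) ≤ _ := h341
        _ ≤ (C * E * (3 / x)) ^ 3 * l ^ 4 * (2 * C * E * (3 / r)) := by gcongr
        _ = (3 * C) ^ 3 * (2 * C * (3 / c1)) * E ^ 6 * l ^ 4 / (y ^ 3) ^ 4 := by
            rw [hr, hx]; field_simp
        _ ≤ _ := by
            rw [hC3]
            have : E ^ 6 ≤ E ^ 8 := pow_le_pow_right₀ hE1 (by norm_num)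
            gcongr
            linarith
    have hl1 : y ^ 3 / (C3 * E ^ 2) ≤ l := by
      by_contra hcon
      push Not at hcon
      have h1 : l ^ 4 < (y ^ 3 / (C3 * E ^ 2)) ^ 4 := by
        gcongr
      rw [le_div_iff₀ (by positivity), one_mul] at hl4
      have h2 : C3 * E ^ 8 * l ^ 4 < C3 * E ^ 8 * (y ^ 3 / (C3 * E ^ 2)) ^ 4 := by gcongr
      have h3 : C3 * E ^ 8 * (y ^ 3 / (C3 * E ^ 2)) ^ 4 = (y ^ 3) ^ 4 / C3 ^ 3 := by
        field_simp
      have h4 : (y ^ 3) ^ 4 / C3 ^ 3 ≤ (y ^ 3) ^ 4 := div_le_self (by positivity) (one_le_pow₀ hC3one)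
      linarith
    have hfin : y ^ 3 / (C3 * E ^ 2) ≤ ‖regL χ (1 + x + Complex.I * t)‖ * (3 / r) := hl1.trans hreg
    rw [hr] at hfin
    have : c1 / 3 / C3 * y ^ 3 / E ^ 4 ≤ ‖regL χ (1 + x + Complex.I * t)‖ := by
      have h1 := mul_le_mul_of_nonneg_right hfin (by positivity : 0 ≤ c1 / (3 * E ^ 2))
      calc c1 / 3 / C3 * y ^ 3 / E ^ 4 = y ^ 3 / (C3 * E ^ 2) * (c1 / (3 * E ^ 2)) := by field_simp
        _ ≤ _ := h1
        _ = _ := by field_simp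
    refine le_trans ?_ this
    gcongr
    exact min_le_left _ _

/-- Lower bound for the regularised `L`-function just to the right of the `1`-line. -/
theorem regL_lower {ε : ℝ} (hε : 0 < ε) :
    ∃ c : ℝ, 0 < c ∧ ∀ (q : ℕ) [NeZero q] (χ : DirichletCharacter ℂ q) (x t : ℝ), 0 ≤ x → x ≤ 1 →
      c * anCond q t ^ (-ε) ≤ ‖regL χ (1 + x + Complex.I * t)‖ := by
  obtain ⟨η, hη0, hη2, hηε⟩ : ∃ η : ℝ, 0 < η ∧ η ≤ 1 / 2 ∧ 20 * η ≤ ε :=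
    ⟨min (1 / 2) (ε / 20), by positivity, min_le_left _ _, by
      have := min_le_right (1 / 2) (ε / 20); linarith⟩
  obtain ⟨C, hC1, hC⟩ := regL_bounds hη0 hη2
  obtain ⟨c', hc0', hc'⟩ := regL_pointwise_lower hη0 hη2
  obtain ⟨c, hc0, hcc', hcC⟩ : ∃ c : ℝ, 0 < c ∧ c ≤ c' ∧ c ≤ 1 :=
    ⟨min c' 1, by positivity, min_le_left _ _, min_le_right _ _⟩
  refine ⟨(c / (2 * C)) ^ 3 * (c / 2), by positivity, ?_⟩
  intro q _ χ x t hx0 hx1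
  have hD2 := two_le_anCond (NeZero.one_le (n := q)) t
  set D := anCond q t with hD
  set E := D ^ η with hE
  have hE1 : 1 ≤ E := Real.one_le_rpow (by linarith) hη0.le
  have hpt : ∀ y : ℝ, 0 < y → y ≤ 1 → c * y ^ 3 / E ^ 4 ≤
      ‖regL χ (1 + (y ^ 4 : ℝ) + Complex.I * t)‖ := fun y hy hy1 => by
    refine le_trans ?_ (hc' q χ y t hy hy1)
    gcongr
  set y₀ := c / (2 * C) / E ^ 5 with hy₀
  have hy₀0 : 0 < y₀ := by positivity
  have hy₀1 : y₀ ≤ 1 := by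
    rw [hy₀]
    refine div_le_one_of_le₀ ?_ (by positivity)
    have h1 : c / (2 * C) ≤ 1 := by rw [div_le_one (by positivity)]; linarith
    exact h1.trans (one_le_pow₀ hE1)
  have hgoal : (c / (2 * C)) ^ 3 * (c / 2) * D ^ (-ε) ≤ c / 2 * y₀ ^ 3 / E ^ 4 := by
    have h1 : D ^ (-ε) ≤ (E ^ 19)⁻¹ := by
      rw [Real.rpow_neg (by linarith)]
      refine inv_anti₀ (by positivity) ?_
      rw [hE, ← Real.rpow_natCast, ← Real.rpow_mul (by linarith)]
      apply Real.rpow_le_rpow_of_exponent_le (by linarith)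
      push_cast; linarith
    calc (c / (2 * C)) ^ 3 * (c / 2) * D ^ (-ε) ≤ (c / (2 * C)) ^ 3 * (c / 2) * (E ^ 19)⁻¹ := by gcongr
      _ = _ := by rw [hy₀]; field_simp
  refine hgoal.trans ?_
  by_cases hx : y₀ ^ 4 ≤ x
  · have hxpos : 0 < x := lt_of_lt_of_le (by positivity) hx
    obtain ⟨y, hy0, hy4⟩ : ∃ y : ℝ, 0 < y ∧ y ^ 4 = x :=
      ⟨x ^ ((1:ℝ) / 4), by positivity, by
        rw [← Real.rpow_natCast, ← Real.rpow_mul hx0]; norm_num⟩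
    have hyy : y₀ ≤ y := by
      rw [← hy4] at hx
      exact (pow_le_pow_iff_left₀ hy₀0.le hy0.le (by norm_num)).1 hx
    have hy1 : y ≤ 1 := by
      rw [← hy4] at hx1
      exact (pow_le_one_iff_of_nonneg hy0.le (by norm_num)).1 hx1
    have := hpt y hy0 hy1
    rw [hy4] at this
    refine le_trans ?_ this
    gcongr
    linarith
  · push Not at hx
    have h1 := hpt y₀ hy₀0 hy₀1
    have hy4 : y₀ ^ 4 ≤ 1 := pow_le_one₀ hy₀0.le hy₀1
    have hy4p : 0 < y₀ ^ 4 := by positivity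
    have h2 := norm_regL_sub_le (χ := χ) hη0 hη2 (by linarith) (fun s a b => (hC q χ s a b).2)
      (z := 1 + (y₀ ^ 4 : ℝ) + Complex.I * t) (w := 1 + x + Complex.I * t) (T := t)
      (by simp only [Complex.add_re, Complex.one_re, Complex.ofReal_re, Complex.mul_re, Complex.I_re,
            Complex.I_im, Complex.ofReal_im]; linarith)
      (by simp only [Complex.add_re, Complex.one_re, Complex.ofReal_re, Complex.mul_re, Complex.I_re,
            Complex.I_im, Complex.ofReal_im]; linarith)
      (by simp only [Complex.add_im, Complex.one_im, Complex.ofReal_im, Complex.mul_im, Complex.I_re,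
            Complex.I_im, Complex.ofReal_re]; simp) (by simp; linarith) (by simp; linarith) (by simp)
    have h3 : ‖(1 + (y₀ ^ 4 : ℝ) + Complex.I * t : ℂ) - (1 + x + Complex.I * t)‖ ≤ y₀ ^ 4 := by
      have : (1 + (y₀ ^ 4 : ℝ) + Complex.I * t : ℂ) - (1 + x + Complex.I * t)
          = ((y₀ ^ 4 - x : ℝ) : ℂ) := by push_cast; ring
      rw [this, Complex.norm_real, Real.norm_of_nonneg (by linarith)]
      linarith
    have h4 : ‖regL χ (1 + (y₀ ^ 4 : ℝ) + Complex.I * t) - regL χ (1 + x + Complex.I * t)‖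
        ≤ c / 2 * y₀ ^ 3 / E ^ 4 := by
      refine h2.trans ?_
      calc C * E * _ ≤ C * E * y₀ ^ 4 := by gcongr
        _ = C * E * y₀ * y₀ ^ 3 := by ring
        _ = c / 2 * y₀ ^ 3 / E ^ 4 := by
            have : C * E * y₀ = c / 2 / E ^ 4 := by rw [hy₀]; field_simp
            rw [this]; ring
    have h5 : ‖regL χ (1 + (y₀ ^ 4 : ℝ) + Complex.I * t)‖ ≤ ‖regL χ (1 + x + Complex.I * t)‖
        + ‖regL χ (1 + (y₀ ^ 4 : ℝ) + Complex.I * t) - regL χ (1 + x + Complex.I * t)‖ :=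
      norm_le_insert' _ _
    have h6 : c * y₀ ^ 3 / E ^ 4 = c / 2 * y₀ ^ 3 / E ^ 4 + c / 2 * y₀ ^ 3 / E ^ 4 := by ring
    linarith

/-- A zero-free region for the regularised `L`-function, with a bound for its logarithmic
derivative. -/
theorem regL_logDeriv_bound {ε : ℝ} (hε : 0 < ε) (hε1 : ε ≤ 1) :
    ∃ c : ℝ, 0 < c ∧ c ≤ 1 / 2 ∧ ∃ C : ℝ, 1 ≤ C ∧
      ∀ (q : ℕ) [NeZero q] (χ : DirichletCharacter ℂ q) (s : ℂ),
        1 - c * anCond q s.im ^ (-ε) ≤ s.re → s.re ≤ 2 →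
        regL χ s ≠ 0 ∧ ‖deriv (regL χ) s / regL χ s‖ ≤ C * anCond q s.im ^ ε := by
  set η := ε / 2 with hη
  have hη0 : 0 < η := by positivity
  have hη2 : η ≤ 1 / 2 := by linarith
  obtain ⟨C, hC1, hC⟩ := regL_bounds hη0 hη2
  obtain ⟨c₀, hc₀, hlow⟩ := regL_lower hη0
  obtain ⟨c, hc, hc1, hc2⟩ : ∃ c : ℝ, 0 < c ∧ c ≤ c₀ / (2 * C) ∧ c ≤ η / 4 :=
    ⟨min (c₀ / (2 * C)) (η / 4), by positivity, min_le_left _ _, min_le_right _ _⟩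
  refine ⟨c, hc, by linarith, 1 + C / (c₀ / 2), ?_, ?_⟩
  · have : 0 ≤ C / (c₀ / 2) := by positivity
    linarith
  intro q _ χ s hs1 hs2
  have hD2 := two_le_anCond (NeZero.one_le (n := q)) s.im
  set D := anCond q s.im with hD
  set E := D ^ η with hE
  have hE1 : 1 ≤ E := Real.one_le_rpow (by linarith) hη0.le
  have hDη : D ^ (-η) = E⁻¹ := by rw [Real.rpow_neg (by linarith)]
  have hDε : D ^ ε = E ^ 2 := by
    rw [hE, ← Real.rpow_natCast, ← Real.rpow_mul (by linarith)]; congr 1; push_cast; linarith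
  have hDε' : D ^ (-ε) = (E ^ 2)⁻¹ := by rw [Real.rpow_neg (by linarith), hDε]
  have hDle : D ^ (-ε) ≤ 1 := Real.rpow_le_one_of_one_le_of_nonpos (by linarith) (by linarith)
  have hs3 : 1 - η / 4 ≤ s.re := by nlinarith
  have hmain : c₀ / 2 * E⁻¹ ≤ ‖regL χ s‖ := by
    by_cases h1 : 1 ≤ s.re
    · have := hlow q χ (s.re - 1) s.im (by linarith) (by linarith)
      have hs : (1 + ((s.re - 1 : ℝ) : ℂ) + Complex.I * s.im) = s := by
        rw [mul_comm]; push_cast; rw [add_sub_cancel]; exact Complex.re_add_im s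
      rw [hs, ← hD, hDη] at this
      refine le_trans ?_ this
      gcongr
      linarith
    · push Not at h1
      have h2 := hlow q χ 0 s.im le_rfl zero_le_one
      rw [← hD, hDη] at h2
      have h3 := norm_regL_sub_le (χ := χ) hη0 hη2 (by linarith) (fun s a b => (hC q χ s a b).2)
        (z := 1 + (0:ℝ) + Complex.I * s.im) (w := s) (T := s.im) (by simp; linarith)
        (by simp; norm_num) (by simp) hs3 (by linarith) le_rfl
      have h4 : ‖(1 + (0:ℝ) + Complex.I * s.im : ℂ) - s‖ = 1 - s.re := by
        have : (1 + (0:ℝ) + Complex.I * s.im : ℂ) - s = ((1 - s.re : ℝ) : ℂ) := by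
          apply Complex.ext <;> simp
        rw [this, Complex.norm_real, Real.norm_of_nonneg (by linarith)]
      rw [h4, ← hD, ← hE] at h3
      have h5 : C * E * (1 - s.re) ≤ c₀ / 2 * E⁻¹ := by
        calc C * E * (1 - s.re) ≤ C * E * (c₀ / (2 * C) * D ^ (-ε)) := by
              gcongr
              have : c * D ^ (-ε) ≤ c₀ / (2 * C) * D ^ (-ε) := by gcongr
              linarith
          _ = c₀ / 2 * E⁻¹ := by rw [hDε']; field_simp
      have h6 := norm_le_insert' (regL χ (1 + (0:ℝ) + Complex.I * s.im)) (regL χ s)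
      have h7 : c₀ * E⁻¹ = c₀ / 2 * E⁻¹ + c₀ / 2 * E⁻¹ := by ring
      linarith
  have hpos : 0 < ‖regL χ s‖ := lt_of_lt_of_le (by positivity) hmain
  refine ⟨norm_pos_iff.1 hpos, ?_⟩
  rw [norm_div, div_le_iff₀ hpos]
  calc ‖deriv (regL χ) s‖ ≤ C * E := (hC q χ s hs3 (by linarith)).2
    _ = C / (c₀ / 2) * E ^ 2 * (c₀ / 2 * E⁻¹) := by field_simp
    _ ≤ (1 + C / (c₀ / 2)) * D ^ ε * ‖regL χ s‖ := by
        rw [hDε]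
        gcongr
        linarith

section
open MeasureTheory FourierTransform

/-- The line `Re s = a`, parametrised by frequency. -/
noncomputable def vline (a w : ℝ) : ℂ := a + (2 * Real.pi * w : ℝ) * Complex.I

@[simp] theorem vline_re (a w : ℝ) : (vline a w).re = a := by simp [vline]

@[simp] theorem vline_im (a w : ℝ) : (vline a w).im = 2 * Real.pi * w := by simp [vline]

theorem vline_add_one (a w : ℝ) : vline a w + 1 = vline (a + 1) w := by
  simp [vline]; ring

theorem vline_ne_zero {a : ℝ} (ha : 0 < a) (w : ℝ) : vline a w ≠ 0 := by
  intro h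
  have := congrArg Complex.re h
  simp at this; linarith

theorem continuous_vline (a : ℝ) : Continuous (vline a) := by
  unfold vline; fun_prop

theorem sq_norm_vline (a w : ℝ) : ‖vline a w‖ ^ 2 = a ^ 2 + (2 * Real.pi * w) ^ 2 := by
  rw [Complex.sq_norm, Complex.normSq_apply, vline_re, vline_im]; ring

theorem min_sq_mul_le_norm_vline_mul {a : ℝ} (ha : 0 < a) (w : ℝ) :
    min (a ^ 2) 1 * (1 + w ^ 2) ≤ ‖vline a w * (vline a w + 1)‖ := by
  have h1 := sq_norm_vline a w
  have h2 : ‖vline a w‖ ≤ ‖vline a w + 1‖ := by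
    rw [vline_add_one, ← sq_le_sq₀ (norm_nonneg _) (norm_nonneg _), h1, sq_norm_vline]
    nlinarith
  rw [norm_mul]
  have h3 : min (a ^ 2) 1 * (1 + w ^ 2) ≤ ‖vline a w‖ ^ 2 := by
    rw [h1]
    have h4 := min_le_left (a ^ 2) 1
    have h5 := min_le_right (a ^ 2) 1
    have h6 : w ^ 2 ≤ (2 * Real.pi * w) ^ 2 := by
      rw [mul_pow]
      have : 1 ≤ (2 * Real.pi) ^ 2 := one_le_pow₀ (by linarith [Real.pi_gt_three])
      nlinarith [sq_nonneg w]
    nlinarith [sq_nonneg w]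
  refine h3.trans ?_
  rw [sq]
  gcongr

theorem integrable_inv_vline {a : ℝ} (ha : 0 < a) :
    Integrable fun w : ℝ => (vline a w * (vline a w + 1))⁻¹ := by
  have hm : 0 < min (a ^ 2) 1 := by positivity
  refine (integrable_inv_one_add_sq.const_mul (min (a ^ 2) 1)⁻¹).mono'
    (Continuous.aestronglyMeasurable ?_) (.of_forall fun w => ?_)
  · refine Continuous.inv₀ ?_ fun w => ?_
    · have := continuous_vline a
      fun_prop
    · rw [vline_add_one]
      exact mul_ne_zero (vline_ne_zero ha w) (vline_ne_zero (by linarith) w)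
  · rw [norm_inv, ← mul_inv]
    exact inv_anti₀ (by positivity) (min_sq_mul_le_norm_vline_mul ha w)

/-- The inverse transform of `1 / (s (s + 1))` on the line `Re s = a`. -/
noncomputable def smoothStep (a v : ℝ) : ℝ :=
  if 0 ≤ v then Real.exp (-a * v) * (1 - Real.exp (-v)) else 0

theorem continuous_smoothStep (a : ℝ) : Continuous (smoothStep a) := by
  unfold smoothStep
  refine Continuous.if_le (by fun_prop) (by fun_prop) continuous_const continuous_id ?_
  rintro v rfl
  simp

theorem smoothStep_eq_indicator (a v : ℝ) : (smoothStep a v : ℂ) =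
    (Set.Ioi (0:ℝ)).indicator (fun v : ℝ => Complex.exp (-(a : ℂ) * v) - Complex.exp (-(a + 1 : ℂ) * v)) v := by
  rcases lt_trichotomy v 0 with h | h | h
  · rw [Set.indicator_of_notMem (by simpa using h.le), smoothStep, if_neg (by linarith)]; simp
  · subst h; simp [smoothStep]
  · rw [Set.indicator_of_mem (by simpa using h), smoothStep, if_pos h.le]
    push_cast
    rw [mul_sub, ← Complex.exp_add]
    congr 2
    · ring
    · ring_nf

theorem integrable_smoothStep {a : ℝ} (ha : 0 < a) :
    Integrable fun v => (smoothStep a v : ℂ) := by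
  simp_rw [smoothStep_eq_indicator]
  rw [integrable_indicator_iff measurableSet_Ioi]
  refine (integrableOn_exp_mul_complex_Ioi ?_ 0).sub (integrableOn_exp_mul_complex_Ioi ?_ 0)
  · simpa using ha
  · simp; linarith

theorem fourier_smoothStep {a : ℝ} (ha : 0 < a) (w : ℝ) :
    𝓕 (fun v => (smoothStep a v : ℂ)) w = (vline a w * (vline a w + 1))⁻¹ := by
  rw [Real.fourier_eq']
  have h1 : ∀ v : ℝ, Complex.exp (↑(-2 * Real.pi * inner ℝ v w) * Complex.I) • (smoothStep a v : ℂ)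
      = (Set.Ioi (0:ℝ)).indicator (fun v : ℝ => Complex.exp (-vline a w * v)
        - Complex.exp (-vline (a + 1) w * v)) v := by
    intro v
    rw [smoothStep_eq_indicator, smul_eq_mul]
    simp only [Set.indicator]
    split_ifs
    · rw [mul_sub, ← Complex.exp_add, ← Complex.exp_add]
      congr 2
      · simp [vline]; ring
      · simp [vline]; ring
    · simp
  simp_rw [h1]
  rw [integral_indicator measurableSet_Ioi, integral_sub, integral_exp_mul_complex_Ioi,
    integral_exp_mul_complex_Ioi]
  · have h2 := vline_ne_zero ha w
    have h3 := vline_ne_zero (a := a + 1) (by linarith) w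
    rw [← vline_add_one] at h3 ⊢
    simp only [Complex.ofReal_zero, mul_zero, Complex.exp_zero, neg_div_neg_eq]
    field_simp
    ring
  · simp; linarith
  · simpa using ha
  · exact integrableOn_exp_mul_complex_Ioi (by simpa using ha) 0
  · exact integrableOn_exp_mul_complex_Ioi (by simp; linarith) 0

theorem integral_e_mul_inv_vline {a : ℝ} (ha : 0 < a) (v : ℝ) :
    ∫ w : ℝ, e (v * w) * (vline a w * (vline a w + 1))⁻¹ = smoothStep a v := by
  have h := Continuous.fourierInv_fourier_eq (f := fun v => (smoothStep a v : ℂ))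
    (Complex.continuous_ofReal.comp (continuous_smoothStep a)) (integrable_smoothStep ha) (by
      rw [funext fun w => fourier_smoothStep ha w]; exact integrable_inv_vline ha)
  have h2 := congrFun h v
  rw [Real.fourierInv_eq'] at h2
  rw [← h2]
  refine integral_congr_ae (.of_forall fun w => ?_)
  simp only
  rw [fourier_smoothStep ha, smul_eq_mul]
  congr 1
  unfold e
  congr 1
  simp
  ring

end

section
open MeasureTheory

/-- Minus the logarithmic derivative of an `L`-function, with the pole at `1` removed. -/
noncomputable def regLogDeriv {q : ℕ} [NeZero q] (χ : DirichletCharacter ℂ q) (s : ℂ) : ℂ :=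
  -(deriv (regL χ) s / regL χ s) - (if χ = 1 then (s + 1)⁻¹ else 0)

open Classical in
theorem regLogDeriv_eq {q : ℕ} [NeZero q] (χ : DirichletCharacter ℂ q) {s : ℂ} (hs : 1 < s.re) :
    regLogDeriv χ s = LSeries ((fun n : ℕ => χ n) * fun n : ℕ => (ArithmeticFunction.vonMangoldt n : ℂ)) s
      - (if χ = 1 then (s - 1)⁻¹ else 0) := by
  rw [DirichletCharacter.LSeries_twist_vonMangoldt_eq χ hs,
    ← DirichletCharacter.deriv_LFunction_eq_deriv_LSeries χ hs,
    ← DirichletCharacter.LFunction_eq_LSeries χ hs, regLogDeriv]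
  by_cases hχ : χ = 1
  · subst hχ
    simp only [if_true]
    have hs1 : s ≠ 1 := by rintro rfl; simp at hs
    have hs1' : s - 1 ≠ 0 := sub_ne_zero.2 hs1
    have hs2 : s + 1 ≠ 0 := by
      intro h
      have := congrArg Complex.re h
      simp at this; linarith
    have hL : DirichletCharacter.LFunction (1 : DirichletCharacter ℂ q) s ≠ 0 :=
      DirichletCharacter.LFunction_ne_zero_of_one_le_re _ (.inr hs1) hs.le
    have hev : regL (1 : DirichletCharacter ℂ q) =ᶠ[nhds s] fun z => (z - 1) / (z + 1) *
        DirichletCharacter.LFunction (1 : DirichletCharacter ℂ q) z := by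
      filter_upwards [isOpen_ne.mem_nhds hs1] with z hz using regL_one_of_ne hz
    rw [hev.deriv_eq, regL_one_of_ne hs1]
    have hd1 : HasDerivAt (fun z : ℂ => (z - 1) / (z + 1)) (2 / (s + 1) ^ 2) s := by
      have := ((hasDerivAt_id s).sub_const 1).div ((hasDerivAt_id s).add_const 1) hs2
      refine this.congr_deriv ?_
      simp only [id]
      congr 1; ring
    have hd2 := (DirichletCharacter.differentiableAt_LFunction (1 : DirichletCharacter ℂ q) s
      (.inl hs1)).hasDerivAt
    rw [(hd1.fun_mul hd2).deriv]
    field_simp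
    ring
  · simp only [if_neg hχ, sub_zero]
    rw [neg_div, show regL χ = DirichletCharacter.LFunction χ from funext fun z => regL_of_ne hχ z]

theorem term_vline {f : ℕ → ℂ} {a w : ℝ} {n : ℕ} (hn : n ≠ 0) :
    LSeries.term f (vline a w) n = f n * ((n:ℝ) ^ (-a) : ℝ) * e (-(Real.log n) * w) := by
  have hn0 : (n:ℂ) ≠ 0 := by exact_mod_cast hn
  have hnr : (0:ℝ) < n := by exact_mod_cast Nat.pos_of_ne_zero hn
  rw [LSeries.term_of_ne_zero hn, div_eq_mul_inv, ← Complex.cpow_neg, mul_assoc]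
  congr 1
  rw [Complex.ofReal_cpow hnr.le]
  rw [Complex.cpow_def_of_ne_zero hn0, Complex.cpow_def_of_ne_zero (by simpa using hn0), e,
    ← Complex.exp_add]
  congr 1
  rw [← Complex.ofReal_natCast n, ← Complex.ofReal_log hnr.le]
  simp [vline]
  ring

theorem rpow_mul_smoothStep {a x : ℝ} (hx : 1 ≤ x) {n : ℕ} (hn : n ≠ 0) :
    (n:ℝ) ^ (-a) * smoothStep a (Real.log x - Real.log n) =
      x ^ (-a - 1) * (if n ≤ ⌊x⌋₊ then x - n else 0) := by
  have hnr : (0:ℝ) < n := by exact_mod_cast Nat.pos_of_ne_zero hn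
  have hx0 : 0 < x := by linarith
  have hiff : 0 ≤ Real.log x - Real.log n ↔ n ≤ ⌊x⌋₊ := by
    rw [sub_nonneg, Real.log_le_log_iff hnr hx0, Nat.le_floor_iff hx0.le]
  unfold smoothStep
  by_cases h : n ≤ ⌊x⌋₊
  · rw [if_pos (hiff.2 h), if_pos h, Real.rpow_def_of_pos hnr, Real.rpow_sub_one hx0.ne',
      Real.rpow_def_of_pos hx0, ← mul_assoc, ← Real.exp_add, neg_sub, Real.exp_sub, Real.exp_log hnr,
      Real.exp_log hx0]
    have : Real.log n * -a + -a * (Real.log x - Real.log n) = Real.log x * -a := by ring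
    rw [this]
    field_simp
  · rw [if_neg (mt hiff.1 h), if_neg h]; simp

open Classical in
theorem integral_e_mul_regLogDeriv {q : ℕ} [NeZero q] (χ : DirichletCharacter ℂ q) {a x : ℝ}
    (ha : 1 < a) (hx : 1 ≤ x) :
    ∫ w : ℝ, e (Real.log x * w) * (regLogDeriv χ (vline a w) / (vline a w * (vline a w + 1))) =
      ((x ^ (-a - 1) : ℝ) : ℂ) * ((∑ n ∈ Ioc 0 ⌊x⌋₊,
        χ n * ArithmeticFunction.vonMangoldt n * ((x - n : ℝ) : ℂ)) -
          (if χ = 1 then (((x - 1) ^ 2 / 2 : ℝ) : ℂ) else 0)) := by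
  have ha0 : 0 < a := by linarith
  have hx0 : 0 < x := by linarith
  set f : ℕ → ℂ := (fun n : ℕ => χ n) * fun n : ℕ => (ArithmeticFunction.vonMangoldt n : ℂ) with hf
  set k : ℝ → ℂ := fun w => (vline a w * (vline a w + 1))⁻¹ with hk
  have hkint : Integrable k := integrable_inv_vline ha0
  set F : ℕ → ℝ → ℂ := fun n w => e (Real.log x * w) * (LSeries.term f (vline a w) n * k w) with hF
  have hecont : ∀ v : ℝ, Continuous fun w : ℝ => e (v * w) := fun v =>
    continuous_e.comp (by fun_prop)
  have hebdd : ∀ v : ℝ, ∀ g : ℝ → ℂ, Integrable g → Integrable fun w => e (v * w) * g w := by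
    intro v g hg
    exact hg.bdd_mul (c := 1) (hecont v).aestronglyMeasurable (.of_forall fun w => (norm_e _).le)
  have hFeq : ∀ n ≠ 0, F n = fun w => (f n * ((n:ℝ) ^ (-a) : ℝ)) *
      (e ((Real.log x - Real.log n) * w) * k w) := by
    intro n hn
    funext w
    simp only [hF]
    rw [term_vline hn, sub_mul, sub_eq_add_neg, e_add, neg_mul]
    ring
  have hF0 : F 0 = 0 := by funext w; simp [hF]
  have hFint : ∀ n, Integrable (F n) := by
    intro n
    by_cases hn : n = 0
    · rw [hn, hF0]; exact integrable_zero _ _ _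
    · rw [hFeq n hn]; exact (hebdd _ _ hkint).const_mul _
  have hsum : Summable fun n => ∫ w, ‖F n w‖ := by
    have h1 := (DirichletCharacter.LSeriesSummable_twist_vonMangoldt χ (s := a) (by simpa using ha)).norm
    refine (h1.mul_right (∫ w, ‖k w‖)).congr fun n => ?_
    rw [← integral_const_mul]
    refine integral_congr_ae (.of_forall fun w => ?_)
    simp only [hF, norm_mul, norm_e, one_mul]
    congr 1
    rw [LSeries.norm_term_eq, LSeries.norm_term_eq, vline_re, Complex.ofReal_re]
  have hval : ∀ n, ∫ w, F n w = if n ∈ Ioc 0 ⌊x⌋₊ then ((x ^ (-a - 1) : ℝ) : ℂ) *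
      (χ n * ArithmeticFunction.vonMangoldt n * ((x - n : ℝ) : ℂ)) else 0 := by
    intro n
    by_cases hn : n = 0
    · simp [hn, hF0]
    · rw [hFeq n hn, integral_const_mul, integral_e_mul_inv_vline ha0, mul_assoc, ← Complex.ofReal_mul,
        rpow_mul_smoothStep hx hn]
      have : n ∈ Ioc 0 ⌊x⌋₊ ↔ n ≤ ⌊x⌋₊ := by
        rw [mem_Ioc]; exact ⟨fun h => h.2, fun h => ⟨Nat.pos_of_ne_zero hn, h⟩⟩
      simp only [this]
      split_ifs
      · simp only [hf, Pi.mul_apply]; push_cast; ring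
      · simp
  have hLint : ∫ w, e (Real.log x * w) * (LSeries f (vline a w) * k w) =
      ((x ^ (-a - 1) : ℝ) : ℂ) * ∑ n ∈ Ioc 0 ⌊x⌋₊,
        χ n * ArithmeticFunction.vonMangoldt n * ((x - n : ℝ) : ℂ) := by
    have h1 := integral_tsum_of_summable_integral_norm hFint hsum
    have h2 : ∀ w, ∑' n, F n w = e (Real.log x * w) * (LSeries f (vline a w) * k w) := by
      intro w
      simp only [hF]
      rw [tsum_mul_left, tsum_mul_right, LSeries]
    simp_rw [h2] at h1
    rw [← h1]
    simp_rw [hval]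
    rw [tsum_eq_sum (s := Ioc 0 ⌊x⌋₊) (fun n hn => if_neg hn), mul_sum]
    exact sum_congr rfl fun n hn => if_pos hn
  have hLsumm : Integrable fun w => e (Real.log x * w) * (LSeries f (vline a w) * k w) := by
    refine hebdd _ _ ?_
    have h1 := (DirichletCharacter.LSeriesSummable_twist_vonMangoldt χ (s := a) (by simpa using ha)).norm
    have hb : ∀ n w, ‖LSeries.term f (vline a w) n‖ ≤ ‖LSeries.term f a n‖ := fun n w => by
      rw [LSeries.norm_term_eq, LSeries.norm_term_eq]; simp
    refine hkint.bdd_mul (c := ∑' n, ‖LSeries.term f a n‖) (Continuous.aestronglyMeasurable ?_)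
      (.of_forall fun w => ?_)
    · refine continuous_tsum (u := fun n => ‖LSeries.term f a n‖) (fun n => ?_) h1 hb
      by_cases hn : n = 0
      · simp only [hn, LSeries.term_zero]; exact continuous_const
      · simp_rw [term_vline hn]
        exact continuous_const.mul (hecont _)
    · exact tsum_of_norm_bounded h1.hasSum fun n => hb n w
  have hmain : ∀ w, e (Real.log x * w) * ((vline a w - 1)⁻¹ * k w) =
      (1 / 2 : ℂ) * (e (Real.log x * w) * (vline (a - 1) w * (vline (a - 1) w + 1))⁻¹ -
        e (Real.log x * w) * k w) := by
    intro w
    have h1 : vline a w = vline (a - 1) w + 1 := by rw [vline_add_one]; congr 1; ring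
    have h2 := vline_ne_zero (a := a - 1) (by linarith) w
    have h3 := vline_ne_zero ha0 w
    have h4 := vline_ne_zero (a := a + 1) (by linarith) w
    rw [← vline_add_one] at h4
    simp only [hk]
    rw [h1] at h3 h4 ⊢
    rw [add_sub_cancel_right]
    field_simp
    ring
  have hpole : ∫ w, e (Real.log x * w) * ((vline a w - 1)⁻¹ * k w) =
      ((x ^ (-a - 1) : ℝ) : ℂ) * (((x - 1) ^ 2 / 2 : ℝ) : ℂ) := by
    simp_rw [hmain]
    rw [integral_const_mul, integral_sub (hebdd _ _ (integrable_inv_vline (by linarith))) (hebdd _ _ hkint),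
      integral_e_mul_inv_vline (by linarith), integral_e_mul_inv_vline ha0]
    have hl := Real.log_nonneg hx
    have h1 : (1 / 2) * (smoothStep (a - 1) (Real.log x) - smoothStep a (Real.log x)) =
        x ^ (-a - 1) * ((x - 1) ^ 2 / 2) := by
      unfold smoothStep
      rw [if_pos hl, if_pos hl, Real.rpow_sub_one hx0.ne', Real.exp_neg, Real.exp_log hx0,
        show -(a - 1) * Real.log x = Real.log x * (-a) + Real.log x by ring, Real.exp_add,
        Real.exp_log hx0, Real.rpow_def_of_pos hx0, mul_comm (-a) (Real.log x)]
      field_simp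
    rw [← Complex.ofReal_mul, ← h1]
    push_cast
    ring
  have hpoleint : Integrable fun w => e (Real.log x * w) * ((vline a w - 1)⁻¹ * k w) := by
    simp_rw [hmain]
    exact ((hebdd _ _ (integrable_inv_vline (by linarith))).sub (hebdd _ _ hkint)).const_mul _
  have hsplit : ∀ w, e (Real.log x * w) * (regLogDeriv χ (vline a w) / (vline a w * (vline a w + 1))) =
      e (Real.log x * w) * (LSeries f (vline a w) * k w) -
      (if χ = 1 then e (Real.log x * w) * ((vline a w - 1)⁻¹ * k w) else 0) := by
    intro w
    rw [regLogDeriv_eq χ (by simpa using ha)]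
    split_ifs
    · simp only [hk]; ring
    · simp only [hk]; ring
  simp_rw [hsplit]
  by_cases hχ : χ = 1
  · simp only [if_pos hχ]
    rw [integral_sub hLsumm hpoleint, hLint, hpole]; ring
  · simp only [if_neg hχ, sub_zero]
    exact hLint

end

section
open MeasureTheory

/-- The integrand of the smoothed explicit formula. -/
noncomputable def explicitKernel {q : ℕ} [NeZero q] (χ : DirichletCharacter ℂ q) (s : ℂ) : ℂ :=
  regLogDeriv χ s / (s * (s + 1))

theorem differentiableAt_explicitKernel {q : ℕ} [NeZero q] {χ : DirichletCharacter ℂ q} {s : ℂ}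
    (hs : 0 < s.re) (h : regL χ s ≠ 0) : DifferentiableAt ℂ (explicitKernel χ) s := by
  have han : AnalyticAt ℂ (regL χ) s := by
    refine DifferentiableOn.analyticAt (s := {z | 0 < z.re}) (fun z hz =>
      (differentiableAt_regL χ hz).differentiableWithinAt) ?_
    exact (isOpen_lt continuous_const Complex.continuous_re).mem_nhds hs
  have h1 : s ≠ 0 := by rintro rfl; simp at hs
  have h2 : s + 1 ≠ 0 := by
    intro h
    have := congrArg Complex.re h
    simp at this; linarith
  unfold explicitKernel regLogDeriv
  refine DifferentiableAt.div (DifferentiableAt.sub ?_ ?_) (by fun_prop) (mul_ne_zero h1 h2)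
  · exact (han.deriv.differentiableAt.div han.differentiableAt h).neg
  · split_ifs
    · exact (differentiableAt_id.add_const 1).inv h2
    · exact differentiableAt_const _

set_option maxHeartbeats 800000 in
theorem iteratedDeriv_explicitKernel_bound (k : ℕ) {ε : ℝ} (hε : 0 < ε) :
    ∃ K : ℝ, 0 < K ∧ ∀ (q : ℕ) [NeZero q] (χ : DirichletCharacter ℂ q) (a w : ℝ),
      1 < a → a ≤ 3 / 2 → AnalyticAt ℂ (explicitKernel χ) (vline a w) ∧ ∀ j ≤ k,
        ‖iteratedDeriv j (explicitKernel χ) (vline a w)‖ ≤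
          K * (q : ℝ) ^ ε * (1 + ‖w‖) ^ (-(3 / 2) : ℝ) := by
  obtain ⟨ε₂, hε₂, hε₂a, hε₂b⟩ : ∃ ε₂ : ℝ, 0 < ε₂ ∧ ε₂ ≤ ε ∧ ε₂ ≤ 1 / 2 :=
    ⟨min ε (1 / 2), by positivity, min_le_left _ _, min_le_right _ _⟩
  set ε₁ := ε₂ / (k + 1) with hε₁
  have hε₁0 : 0 < ε₁ := by positivity
  have hk1 : (1:ℝ) ≤ k + 1 := by
    have : (0:ℝ) ≤ k := Nat.cast_nonneg _
    linarith
  have hε₁1 : ε₁ ≤ 1 := (div_le_self hε₂.le hk1).trans (by linarith)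
  obtain ⟨c, hc0, hc2, C, hC1, hC⟩ := regL_logDeriv_bound hε₁0 hε₁1
  set M := 4 * (2 * C + 1) with hM
  have hM0 : 0 < M := by positivity
  refine ⟨k.factorial * M * (2 / c) ^ k * 7, by positivity, ?_⟩
  intro q _ χ a w ha1 ha2
  set s := vline a w with hs
  have hqr : (1:ℝ) ≤ q := by exact_mod_cast (NeZero.one_le : 1 ≤ q)
  have hD2 := two_le_anCond (NeZero.one_le (n := q)) s.im
  set D := anCond q s.im with hD
  set E := D ^ ε₁ with hE
  have hE1 : 1 ≤ E := Real.one_le_rpow (by linarith) hε₁0.le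
  set r := c / 2 / E with hr
  have hr0 : 0 < r := by positivity
  have hr4 : r ≤ 1 / 4 := by
    rw [hr]; refine (div_le_self (by positivity) hE1).trans ?_; linarith
  have h2E : (2 * D) ^ ε₁ ≤ 2 * E := by
    rw [Real.mul_rpow (by norm_num) (by linarith)]
    gcongr
    calc (2:ℝ) ^ ε₁ ≤ 2 ^ (1:ℝ) := Real.rpow_le_rpow_of_exponent_le (by norm_num) hε₁1
      _ = 2 := by norm_num
  have hball : ∀ z : ℂ, ‖z - s‖ ≤ r → 3 / 4 ≤ z.re ∧ regL χ z ≠ 0 ∧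
      ‖explicitKernel χ z‖ ≤ M * E / (1 + ‖w‖) ^ 2 := by
    intro z hz
    have hre := (abs_le.1 ((Complex.abs_re_le_norm (z - s)).trans hz))
    have him := (abs_le.1 ((Complex.abs_im_le_norm (z - s)).trans hz))
    simp only [Complex.sub_re, Complex.sub_im] at hre him
    have hsre : s.re = a := vline_re a w
    have hzD : anCond q z.im ≤ 2 * D := by
      have : |z.im| ≤ |s.im| + 1 := by
        have h3 : |z.im| ≤ |s.im| + |z.im - s.im| := by
          have := abs_add_le s.im (z.im - s.im)
          simpa using this
        have h4 : |z.im - s.im| ≤ 1 := abs_le.2 ⟨by linarith, by linarith⟩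
        linarith
      rw [hD]; unfold anCond
      nlinarith [abs_nonneg s.im]
    have hz2 := two_le_anCond (NeZero.one_le (n := q)) z.im
    have hzE : anCond q z.im ^ ε₁ ≤ 2 * E :=
      (Real.rpow_le_rpow (by linarith) hzD hε₁0.le).trans h2E
    have hzE' : r ≤ c * anCond q z.im ^ (-ε₁) := by
      rw [Real.rpow_neg (by linarith), hr, div_div, div_eq_mul_inv]
      gcongr
    obtain ⟨hne, hb⟩ := hC q χ z (by linarith) (by linarith)
    refine ⟨by linarith, hne, ?_⟩
    have hnum : ‖regLogDeriv χ z‖ ≤ (2 * C + 1) * E := by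
      unfold regLogDeriv
      have h1 : ‖(if χ = 1 then (z + 1)⁻¹ else 0 : ℂ)‖ ≤ 1 := by
        split_ifs
        · rw [norm_inv]
          refine inv_le_one_of_one_le₀ ?_
          refine le_trans ?_ ((le_abs_self _).trans (Complex.abs_re_le_norm (z + 1)))
          simp; linarith
        · simp
      refine (norm_sub_le _ _).trans ?_
      rw [norm_neg]
      have : C * anCond q z.im ^ ε₁ ≤ C * (2 * E) := by gcongr
      linarith
    have hden : (1 + ‖w‖) ^ 2 / 4 ≤ ‖z * (z + 1)‖ := by
      have hs2 : (1 + ‖w‖) ^ 2 / 2 ≤ ‖s‖ ^ 2 := by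
        rw [hs, sq_norm_vline]
        have h6 : ‖w‖ ^ 2 ≤ (2 * Real.pi * w) ^ 2 := by
          rw [mul_pow, Real.norm_eq_abs, sq_abs]
          have : 1 ≤ (2 * Real.pi) ^ 2 := one_le_pow₀ (by linarith [Real.pi_gt_three])
          nlinarith [sq_nonneg w]
        nlinarith [sq_nonneg (1 - ‖w‖)]
      have hs1 : 1 ≤ ‖s‖ := by
        refine le_trans ?_ ((le_abs_self _).trans (Complex.abs_re_le_norm s))
        linarith
      have hzs : 3 / 4 * ‖s‖ ≤ ‖z‖ := by
        have := norm_le_insert' s z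
        rw [norm_sub_rev] at this
        linarith
      have hz1 : ‖z‖ ≤ ‖z + 1‖ := by
        rw [← sq_le_sq₀ (norm_nonneg _) (norm_nonneg _), Complex.sq_norm, Complex.sq_norm,
          Complex.normSq_apply, Complex.normSq_apply]
        simp
        nlinarith
      rw [norm_mul]
      have h5 : (3 / 4 * ‖s‖) ^ 2 ≤ ‖z‖ ^ 2 := by gcongr
      have h6 : ‖z‖ ^ 2 ≤ ‖z‖ * ‖z + 1‖ := by rw [sq]; gcongr
      linarith [sq_nonneg (1 + ‖w‖)]
    have hpos : (0:ℝ) < (1 + ‖w‖) ^ 2 / 4 := by positivity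
    unfold explicitKernel
    rw [norm_div]
    calc ‖regLogDeriv χ z‖ / ‖z * (z + 1)‖ ≤ (2 * C + 1) * E / ((1 + ‖w‖) ^ 2 / 4) := by gcongr
      _ = _ := by rw [hM]; field_simp
  have hdiff : ∀ z ∈ Metric.closedBall s r, DifferentiableAt ℂ (explicitKernel χ) z := by
    intro z hz
    obtain ⟨h1, h2, -⟩ := hball z (by rwa [mem_closedBall_iff_norm] at hz)
    exact differentiableAt_explicitKernel (by linarith) h2
  refine ⟨?_, fun j hj => ?_⟩
  · exact DifferentiableOn.analyticAt (s := Metric.closedBall s r)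
      (fun z hz => (hdiff z hz).differentiableWithinAt) (Metric.closedBall_mem_nhds s hr0)
  · have hcont : DiffContOnCl ℂ (explicitKernel χ) (Metric.ball s r) := by
      refine DifferentiableOn.diffContOnCl fun z hz => ?_
      rw [closure_ball s hr0.ne'] at hz
      exact (hdiff z hz).differentiableWithinAt
    have hcauchy := Complex.norm_iteratedDeriv_le_of_forall_mem_sphere_norm_le j hr0 hcont
      (C := M * E / (1 + ‖w‖) ^ 2) (fun z hz => (hball z (by
        rw [mem_sphere_iff_norm] at hz; exact hz.le)).2.2)
    have hD7 : D ≤ 7 * (q * (1 + ‖w‖)) := by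
      rw [hD, anCond, hs, vline_im, abs_mul, abs_of_pos Real.two_pi_pos, Real.norm_eq_abs]
      have : 2 * Real.pi ≤ 7 := by linarith [Real.pi_lt_d2]
      have h3 : 2 * Real.pi * |w| ≤ 7 * |w| := by gcongr
      nlinarith
    have hEk : E ^ (k + 1) ≤ 7 * ((q:ℝ) ^ ε * (1 + ‖w‖) ^ (1 / 2 : ℝ)) := by
      have h1w : 1 ≤ 1 + ‖w‖ := by linarith [norm_nonneg w]
      have h1 : E ^ (k + 1) = D ^ ε₂ := by
        rw [hE, ← Real.rpow_natCast, ← Real.rpow_mul (by linarith)]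
        congr 1
        rw [hε₁]; push_cast; field_simp
      rw [h1]
      calc D ^ ε₂ ≤ (7 * (q * (1 + ‖w‖))) ^ ε₂ := Real.rpow_le_rpow (by linarith) hD7 hε₂.le
        _ = 7 ^ ε₂ * ((q:ℝ) ^ ε₂ * (1 + ‖w‖) ^ ε₂) := by
            rw [Real.mul_rpow (by norm_num) (by positivity), Real.mul_rpow (by positivity) (by positivity)]
        _ ≤ 7 ^ (1:ℝ) * ((q:ℝ) ^ ε * (1 + ‖w‖) ^ (1 / 2 : ℝ)) := by
            gcongr
            · norm_num
            · linarith
        _ = _ := by norm_num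
    have hrj : E / r ^ j ≤ (2 / c) ^ k * E ^ (k + 1) := by
      have h1 : 1 / r = 2 / c * E := by rw [hr]; field_simp
      have h2 : E / r ^ j = E * (2 / c * E) ^ j := by
        rw [← h1, one_div, inv_pow, div_eq_mul_inv]
      have h3 : 1 ≤ 2 / c := by rw [le_div_iff₀ hc0]; linarith
      have h4 : 1 ≤ 2 / c * E := by nlinarith
      rw [h2]
      calc E * (2 / c * E) ^ j ≤ E * (2 / c * E) ^ k := by gcongr
        _ = _ := by rw [mul_pow, pow_succ]; ring
    have hw : (1 + ‖w‖) ^ (1 / 2 : ℝ) / (1 + ‖w‖) ^ 2 = (1 + ‖w‖) ^ (-(3 / 2) : ℝ) := by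
      have : 0 < 1 + ‖w‖ := by linarith [norm_nonneg w]
      rw [← Real.rpow_natCast (1 + ‖w‖) 2, ← Real.rpow_sub this]
      norm_num
    refine hcauchy.trans ?_
    calc (j.factorial : ℝ) * (M * E / (1 + ‖w‖) ^ 2) / r ^ j
        = j.factorial * M * (E / r ^ j) / (1 + ‖w‖) ^ 2 := by ring
      _ ≤ k.factorial * M * ((2 / c) ^ k * (7 * ((q:ℝ) ^ ε * (1 + ‖w‖) ^ (1 / 2 : ℝ)))) /
          (1 + ‖w‖) ^ 2 := by
          have hf : (j.factorial : ℝ) ≤ k.factorial := by exact_mod_cast Nat.factorial_le hj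
          have := hrj.trans (mul_le_mul_of_nonneg_left hEk (by positivity))
          gcongr
      _ = k.factorial * M * (2 / c) ^ k * 7 * (q:ℝ) ^ ε *
          ((1 + ‖w‖) ^ (1 / 2 : ℝ) / (1 + ‖w‖) ^ 2) := by ring
      _ = _ := by rw [hw]

theorem integrable_weight : Integrable fun w : ℝ => (1 + ‖w‖) ^ (-(3 / 2) : ℝ) :=
  integrable_one_add_norm (by simp; norm_num)

theorem hasDerivAt_vline (a w : ℝ) : HasDerivAt (vline a) (2 * Real.pi * Complex.I) w := by
  have h : HasDerivAt (fun w : ℝ => ((2 * Real.pi * w : ℝ) : ℂ)) ((2 * Real.pi * 1 : ℝ) : ℂ) w :=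
    ((hasDerivAt_id w).const_mul (2 * Real.pi)).ofReal_comp
  refine ((h.mul_const Complex.I).const_add (a : ℂ)).congr_deriv ?_
  push_cast; ring

theorem integral_explicitKernel_bound (k : ℕ) {ε : ℝ} (hε : 0 < ε) :
    ∃ K : ℝ, 0 < K ∧ ∀ (q : ℕ) [NeZero q] (χ : DirichletCharacter ℂ q) (a v : ℝ),
      1 < a → a ≤ 3 / 2 →
        |v| ^ k * ‖∫ w : ℝ, e (v * w) * explicitKernel χ (vline a w)‖ ≤ K * (q : ℝ) ^ ε := by
  obtain ⟨K, hK0, hK⟩ := iteratedDeriv_explicitKernel_bound k hε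
  set W := ∫ w : ℝ, (1 + ‖w‖) ^ (-(3 / 2) : ℝ) with hW
  have hW0 : 0 ≤ W := integral_nonneg fun w => by positivity
  refine ⟨K * (W + 1), by positivity, ?_⟩
  intro q _ χ a v ha1 ha2
  set g : ℕ → ℝ → ℂ := fun j w => iteratedDeriv j (explicitKernel χ) (vline a w) with hg
  have hderiv : ∀ j w, HasDerivAt (g j) (2 * Real.pi * Complex.I * g (j + 1) w) w := by
    intro j w
    have h1 := (hK q χ a w ha1 ha2).1.iterated_deriv j
    rw [← iteratedDeriv_eq_iterate] at h1
    have h2 := HasDerivAt.scomp w (h1.differentiableAt.hasDerivAt) (hasDerivAt_vline a w)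
    refine h2.congr_deriv ?_
    simp only [hg]
    rw [iteratedDeriv_succ, smul_eq_mul]
  have hcont : ∀ j, Continuous (g j) := fun j =>
    continuous_iff_continuousAt.2 fun w => (hderiv j w).continuousAt
  have hbd : ∀ j ≤ k, ∀ w, ‖g j w‖ ≤ K * (q : ℝ) ^ ε * (1 + ‖w‖) ^ (-(3 / 2) : ℝ) :=
    fun j hj w => (hK q χ a w ha1 ha2).2 j hj
  have hinteg : ∀ j ≤ k, Integrable (g j) := fun j hj =>
    (integrable_weight.const_mul _).mono' (hcont j).aestronglyMeasurable (.of_forall (hbd j hj))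
  have heint : ∀ j ≤ k, Integrable fun w => e (v * w) * g j w := fun j hj =>
    (hinteg j hj).bdd_mul (c := 1) (continuous_e.comp (by fun_prop)).aestronglyMeasurable
      (.of_forall fun w => (norm_e _).le)
  have hpi : (2 * Real.pi * Complex.I : ℂ) ≠ 0 := Complex.two_pi_I_ne_zero
  have hstep : ∀ j, j + 1 ≤ k → ∫ w, e (v * w) * g (j + 1) w = -v * ∫ w, e (v * w) * g j w := by
    intro j hj
    have h := integral_mul_deriv_eq_deriv_mul_of_integrable (u := fun w => e (v * w)) (v := g j)
      (fun w _ => hasDerivAt_e v w) (fun w _ => hderiv j w) ?_ ?_ (heint j (by omega))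
    · have h1 : ∀ w, e (v * w) * (2 * Real.pi * Complex.I * g (j + 1) w) =
          (2 * Real.pi * Complex.I) * (e (v * w) * g (j + 1) w) := fun w => by ring
      have h2 : ∀ w, 2 * Real.pi * Complex.I * v * e (v * w) * g j w =
          (2 * Real.pi * Complex.I * v) * (e (v * w) * g j w) := fun w => by ring
      simp_rw [h1, h2] at h
      rw [integral_const_mul, integral_const_mul] at h
      apply mul_left_cancel₀ hpi
      rw [h]; ring
    · refine ((heint (j + 1) hj).const_mul (2 * Real.pi * Complex.I)).congr (.of_forall fun w => ?_)
      simp only [Pi.mul_apply]; ring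
    · refine ((heint j (by omega)).const_mul (2 * Real.pi * Complex.I * v)).congr
        (.of_forall fun w => ?_)
      simp only [Pi.mul_apply]; ring
  have hind : ∀ j ≤ k, ∫ w, e (v * w) * g j w = (-v) ^ j * ∫ w, e (v * w) * g 0 w := by
    intro j
    induction j with
    | zero => intro _; simp
    | succ j ih =>
      intro hj
      rw [hstep j hj, ih (by omega), pow_succ]; ring
  have h0 : ∀ w, g 0 w = explicitKernel χ (vline a w) := fun w => by simp [hg]
  have hfin := hind k le_rfl
  simp_rw [h0] at hfin
  have hnorm : |v| ^ k * ‖∫ w : ℝ, e (v * w) * explicitKernel χ (vline a w)‖ =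
      ‖∫ w, e (v * w) * g k w‖ := by
    rw [hfin, norm_mul, norm_pow]
    congr 2
    simp
  rw [hnorm]
  calc ‖∫ w, e (v * w) * g k w‖ ≤ ∫ w, K * (q : ℝ) ^ ε * (1 + ‖w‖) ^ (-(3 / 2) : ℝ) := by
        refine norm_integral_le_of_norm_le (integrable_weight.const_mul _) (.of_forall fun w => ?_)
        rw [norm_mul, norm_e, one_mul]
        exact hbd k le_rfl w
    _ = K * (q : ℝ) ^ ε * W := by rw [integral_const_mul]
    _ ≤ K * (W + 1) * (q : ℝ) ^ ε := by
        have : 0 ≤ K * (q : ℝ) ^ ε := by positivity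
        nlinarith

open Classical in
/-- Smoothed prime number theorem for characters, with polynomial dependence on the modulus. -/
theorem char_psi_one_bound (k : ℕ) {ε : ℝ} (hε : 0 < ε) :
    ∃ K : ℝ, 0 < K ∧ ∀ (q : ℕ) [NeZero q] (χ : DirichletCharacter ℂ q) (x : ℝ), 8 ≤ x →
      ‖(∑ n ∈ Ioc 0 ⌊x⌋₊, χ n * ArithmeticFunction.vonMangoldt n * ((x - n : ℝ) : ℂ)) -
        (if χ = 1 then (((x - 1) ^ 2 / 2 : ℝ) : ℂ) else 0)‖ ≤
        K * (q : ℝ) ^ ε * x ^ 2 / Real.log x ^ k := by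
  obtain ⟨K, hK0, hK⟩ := integral_explicitKernel_bound k hε
  refine ⟨K * Real.exp 1, by positivity, ?_⟩
  intro q _ χ x hx
  have hx0 : 0 < x := by linarith
  have hlog : 2 ≤ Real.log x := by
    rw [Real.le_log_iff_exp_le hx0]
    have : Real.exp 2 = Real.exp 1 ^ 2 := by rw [← Real.exp_nat_mul]; norm_num
    rw [this]
    have := Real.exp_one_lt_d9
    have := Real.exp_pos 1
    nlinarith
  set a := 1 + 1 / Real.log x with ha
  have ha1 : 1 < a := by
    have : 0 < 1 / Real.log x := by positivity
    linarith
  have ha2 : a ≤ 3 / 2 := by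
    have : 1 / Real.log x ≤ 1 / 2 := by gcongr
    linarith
  have h := hK q χ a (Real.log x) ha1 ha2
  have h2 := integral_e_mul_regLogDeriv χ ha1 (x := x) (by linarith)
  simp only [explicitKernel] at h
  rw [h2, norm_mul, Complex.norm_real, Real.norm_of_nonneg (by positivity),
    abs_of_pos (by linarith)] at h
  have hxa : x ^ (-a - 1) = (x ^ 2 * Real.exp 1)⁻¹ := by
    rw [ha, show -(1 + 1 / Real.log x) - 1 = -(2 + 1 / Real.log x) by ring, Real.rpow_neg hx0.le,
      Real.rpow_add hx0, Real.rpow_two, Real.rpow_def_of_pos hx0]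
    congr 3
    field_simp
  rw [hxa] at h
  rw [le_div_iff₀ (by positivity)]
  set Z := ‖(∑ n ∈ Ioc 0 ⌊x⌋₊, χ n * ArithmeticFunction.vonMangoldt n * ((x - n : ℝ) : ℂ)) -
        (if χ = 1 then (((x - 1) ^ 2 / 2 : ℝ) : ℂ) else 0)‖ with hZ
  have hpos : 0 < x ^ 2 * Real.exp 1 := by positivity
  have h3 := mul_le_mul_of_nonneg_right h hpos.le
  calc Z * Real.log x ^ k = Real.log x ^ k * ((x ^ 2 * Real.exp 1)⁻¹ * Z) * (x ^ 2 * Real.exp 1) := by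
        field_simp
    _ ≤ _ := h3
    _ = _ := by ring

end

open ArithmeticFunction in
/-- Chebyshev's function of an arithmetic progression. -/
noncomputable def psiAP {q : ℕ} (a : ZMod q) (x : ℝ) : ℝ :=
  ∑ n ∈ Ioc 0 ⌊x⌋₊, vonMangoldt.residueClass a n

open ArithmeticFunction in
/-- The integral of Chebyshev's function of an arithmetic progression. -/
noncomputable def psiOneAP {q : ℕ} (a : ZMod q) (x : ℝ) : ℝ :=
  ∑ n ∈ Ioc 0 ⌊x⌋₊, vonMangoldt.residueClass a n * (x - n)

open ArithmeticFunction in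
theorem psiOneAP_sub_psiOneAP_le {q : ℕ} (a : ZMod q) {x y : ℝ} (hx : 0 ≤ x) (hxy : x ≤ y) :
    psiOneAP a y - psiOneAP a x ≤ psiAP a y * (y - x) ∧
      psiAP a x * (y - x) ≤ psiOneAP a y - psiOneAP a x := by
  have hsub : Ioc 0 ⌊x⌋₊ ⊆ Ioc 0 ⌊y⌋₊ := Ioc_subset_Ioc_right (Nat.floor_mono hxy)
  have hr : ∀ n, 0 ≤ vonMangoldt.residueClass a n := fun n => vonMangoldt.residueClass_nonneg a n
  have hext : ∀ f : ℕ → ℝ, ∑ n ∈ Ioc 0 ⌊x⌋₊, f n =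
      ∑ n ∈ Ioc 0 ⌊y⌋₊, if ((n : ℕ) : ℝ) ≤ x then f n else 0 := by
    intro f
    rw [← sum_subset hsub (f := fun n : ℕ => if (n:ℝ) ≤ x then f n else 0)]
    · refine sum_congr rfl fun n hn => ?_
      rw [if_pos ((Nat.le_floor_iff hx).1 (mem_Ioc.1 hn).2)]
    · intro n hn hn'
      rw [if_neg]
      intro h
      exact hn' (mem_Ioc.2 ⟨(mem_Ioc.1 hn).1, Nat.le_floor h⟩)
  unfold psiOneAP psiAP
  rw [hext, hext, ← sum_sub_distrib, sum_mul, sum_mul]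
  constructor
  · refine sum_le_sum fun n hn => ?_
    have hny : (n:ℝ) ≤ y := (Nat.le_floor_iff (hx.trans hxy)).1 (mem_Ioc.1 hn).2
    have := hr n
    split_ifs with h
    · apply le_of_eq; ring
    · push Not at h; nlinarith
  · refine sum_le_sum fun n hn => ?_
    have hny : (n:ℝ) ≤ y := (Nat.le_floor_iff (hx.trans hxy)).1 (mem_Ioc.1 hn).2
    have := hr n
    split_ifs with h
    · apply le_of_eq; ring
    · rw [zero_mul, sub_zero]; exact mul_nonneg this (by linarith)

open ArithmeticFunction in
theorem psiOneAP_bound (k : ℕ) : ∃ K : ℝ, 0 < K ∧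
    ∀ (q : ℕ) [NeZero q] (a : ZMod q) (x : ℝ), IsUnit a → 8 ≤ x →
      |psiOneAP a x - (x - 1) ^ 2 / 2 / q.totient| ≤ K * q * x ^ 2 / Real.log x ^ k := by
  classical
  obtain ⟨K, hK0, hK⟩ := char_psi_one_bound k one_pos
  refine ⟨K, hK0, ?_⟩
  intro q _ a x ha hx
  have hφ : (0:ℝ) < q.totient := by exact_mod_cast Nat.totient_pos.2 (NeZero.pos q)
  have hφ' : (q.totient : ℂ) ≠ 0 := by
    intro h; rw [Nat.cast_eq_zero] at h; rw [h] at hφ; simp at hφ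
  set S : DirichletCharacter ℂ q → ℂ := fun χ =>
    ∑ n ∈ Ioc 0 ⌊x⌋₊, χ n * vonMangoldt n * ((x - n : ℝ) : ℂ) with hS
  have h1 : ((psiOneAP a x : ℝ) : ℂ) = (q.totient : ℂ)⁻¹ * ∑ χ : DirichletCharacter ℂ q, χ a⁻¹ * S χ := by
    unfold psiOneAP
    push_cast
    simp_rw [vonMangoldt.residueClass_apply ha]
    simp_rw [hS, mul_sum, sum_mul]
    rw [sum_comm]
    refine sum_congr rfl fun χ _ => sum_congr rfl fun n _ => ?_
    push_cast; ring
  have hunit : IsUnit a⁻¹ := by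
    exact IsUnit.of_mul_eq_one _ (ZMod.inv_mul_of_unit a ha)
  have h2 : (((x - 1) ^ 2 / 2 / q.totient : ℝ) : ℂ) = (q.totient : ℂ)⁻¹ *
      ∑ χ : DirichletCharacter ℂ q, χ a⁻¹ * (if χ = 1 then (((x - 1) ^ 2 / 2 : ℝ) : ℂ) else 0) := by
    rw [sum_eq_single_of_mem 1 (mem_univ _)]
    · rw [if_pos rfl, MulChar.one_apply hunit]
      push_cast; ring
    · intro χ _ hχ
      rw [if_neg hχ, mul_zero]
  rw [← Real.norm_eq_abs, ← Complex.norm_real, Complex.ofReal_sub, h1, h2, ← mul_sub,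
    ← sum_sub_distrib, norm_mul]
  simp_rw [← mul_sub]
  have hcard : Fintype.card (DirichletCharacter ℂ q) = q.totient := by
    rw [← Nat.card_eq_fintype_card, DirichletCharacter.card_eq_totient_of_hasEnoughRootsOfUnity]
  calc ‖(q.totient : ℂ)⁻¹‖ * ‖∑ χ : DirichletCharacter ℂ q, χ a⁻¹ *
        (S χ - if χ = 1 then (((x - 1) ^ 2 / 2 : ℝ) : ℂ) else 0)‖
      ≤ ‖(q.totient : ℂ)⁻¹‖ * ∑ χ : DirichletCharacter ℂ q, K * q * x ^ 2 / Real.log x ^ k := by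
        gcongr
        refine norm_sum_le_of_le _ fun χ _ => ?_
        rw [norm_mul]
        have h3 := hK q χ x hx
        rw [Real.rpow_one] at h3
        have h4 : ‖χ a⁻¹‖ ≤ 1 := DirichletCharacter.norm_le_one χ _
        exact (mul_le_of_le_one_left (norm_nonneg _) h4).trans h3
    _ = _ := by
        rw [sum_const, card_univ, hcard, nsmul_eq_mul, norm_inv, Complex.norm_natCast]
        field_simp

/-- **Siegel–Walfisz theorem**. -/
theorem siegel_walfisz (A B : ℕ) : ∃ K : ℝ, 0 < K ∧
    ∀ (q : ℕ) [NeZero q] (a : ZMod q) (x : ℝ), IsUnit a → 16 ≤ x → (q:ℝ) ≤ Real.log x ^ B →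
      |psiAP a x - x / q.totient| ≤ K * x / Real.log x ^ A := by
  obtain ⟨K, hK0, hK⟩ := psiOneAP_bound (B + 2 * A)
  set k := B + 2 * A with hk
  refine ⟨1 + A.factorial + 16 * K * 2 ^ k, by positivity, ?_⟩
  intro q _ a x ha hx hq
  have hx0 : 0 < x := by linarith
  set L := Real.log x with hL
  have hL1 : 1 ≤ L := by
    rw [hL, Real.le_log_iff_exp_le hx0]
    linarith [Real.exp_one_lt_d9]
  have hφ1 : (1:ℝ) ≤ q.totient := by exact_mod_cast Nat.totient_pos.2 (NeZero.pos q)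
  set φ : ℝ := (q.totient : ℝ) with hφ
  have hLA : 1 ≤ L ^ A := one_le_pow₀ hL1
  set h := x / (2 * L ^ A) with hh
  have hh0 : 0 < h := by positivity
  have hhx : h ≤ x / 2 := by
    rw [hh]; gcongr; linarith
  have hLk : L ^ k = L ^ B * (L ^ A * L ^ A) := by rw [hk, pow_add, two_mul, pow_add]
  set E := 4 * K * 2 ^ k * h * (x / L ^ A) * 2 with hEdef
  have hE : ∀ y, x / 2 ≤ y → y ≤ 2 * x → |psiOneAP a y - (y - 1) ^ 2 / 2 / φ| ≤ E := by
    intro y hy1 hy2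
    refine (hK q a y ha (by linarith)).trans ?_
    have hlog : L / 2 ≤ Real.log y := by
      rw [hL, div_eq_inv_mul, ← Real.log_rpow hx0]
      apply Real.log_le_log (by positivity)
      refine le_trans ?_ hy1
      rw [show (2:ℝ)⁻¹ = 1 / 2 by norm_num, ← Real.sqrt_eq_rpow, Real.sqrt_le_left (by positivity)]
      nlinarith
    calc K * q * y ^ 2 / Real.log y ^ k ≤ K * L ^ B * (2 * x) ^ 2 / (L / 2) ^ k := by
          gcongr
          linarith
      _ = E := by
          rw [hEdef, div_pow, hLk, hh]
          field_simp
          ring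
  have hEh : E = 8 * K * 2 ^ k * (x / L ^ A) * h := by rw [hEdef]; ring
  have hone : 1 ≤ A.factorial * (x / L ^ A) := by
    have := Real.pow_div_factorial_le_exp L (by linarith) A
    rw [hL, Real.exp_log hx0, ← hL] at this
    rw [div_le_iff₀ (by positivity)] at this
    rw [← mul_div_assoc, le_div_iff₀ (by positivity)]
    linarith
  have hh2 : h / 2 ≤ x / L ^ A := by
    rw [hh, div_div]; gcongr; nlinarith
  have hup := (psiOneAP_sub_psiOneAP_le a hx0.le (show x ≤ x + h by linarith)).2
  have hlo := (psiOneAP_sub_psiOneAP_le a (show 0 ≤ x - h by linarith)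
    (show x - h ≤ x by linarith)).1
  have e0 := abs_le.1 (hE x (by linarith) (by linarith))
  have e1 := abs_le.1 (hE (x + h) (by linarith) (by linarith))
  have e2 := abs_le.1 (hE (x - h) (by linarith) (by linarith))
  have hφh : h / φ ≤ h := div_le_self hh0.le hφ1
  have hφ2 : 1 / φ ≤ 1 := by rw [div_le_one (by linarith)]; exact hφ1
  rw [mul_div_assoc, abs_le]
  have hs1 : (x + h - 1) ^ 2 / 2 / φ - (x - 1) ^ 2 / 2 / φ =
      (x / φ - 1 / φ + h / φ / 2) * h := by field_simp; ring
  have hs2 : (x - 1) ^ 2 / 2 / φ - (x - h - 1) ^ 2 / 2 / φ =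
      (x / φ - 1 / φ - h / φ / 2) * h := by field_simp; ring
  have hφ0 : 0 < 1 / φ := by positivity
  constructor
  · have : (x / φ - 1 / φ - h / φ / 2 - 16 * K * 2 ^ k * (x / L ^ A)) * h ≤ psiAP a x * h := by
      rw [show x - (x - h) = h by ring] at hlo
      rw [sub_mul _ (16 * K * 2 ^ k * (x / L ^ A)), ← hs2]
      linarith [e0.1, e2.2]
    have := le_of_mul_le_mul_right this hh0
    nlinarith
  · have : psiAP a x * h ≤ (x / φ - 1 / φ + h / φ / 2 + 16 * K * 2 ^ k * (x / L ^ A)) * h := by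
      rw [show x + h - x = h by ring] at hup
      rw [add_mul _ (16 * K * 2 ^ k * (x / L ^ A)), ← hs1]
      linarith [e0.1, e1.2]
    have := le_of_mul_le_mul_right this hh0
    nlinarith

/-- The residues `1 ≤ b ≤ d` coprime to `d`. -/
def reduced (d : ℕ) : Finset ℕ := (Icc 1 d).filter (fun b => Nat.Coprime b d)

theorem sum_Icc_eq_sum_divisors {M : Type*} [AddCommMonoid M] {q : ℕ} (hq : 0 < q) (f : ℕ → M) :
    ∑ b ∈ Icc 1 q, f b = ∑ d ∈ q.divisors, ∑ b ∈ reduced d, f (q / d * b) := by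
  rw [sum_sigma']
  symm
  refine sum_nbij' (fun x => q / x.1 * x.2)
    (fun b => ⟨q / q.gcd b, b / q.gcd b⟩) ?_ ?_ ?_ ?_ ?_
  · rintro ⟨d, b⟩ h
    simp only [reduced, mem_sigma, Nat.mem_divisors, mem_filter, mem_Icc] at h ⊢
    obtain ⟨⟨⟨k, rfl⟩, -⟩, ⟨h1, h2⟩, -⟩ := h
    have hd : 0 < d := by lia
    rw [Nat.mul_div_cancel_left _ hd]
    have hk : 0 < k := Nat.pos_of_mul_pos_left hq
    constructor
    · exact Nat.mul_pos hk h1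
    · rw [mul_comm d]; exact Nat.mul_le_mul_left _ h2
  · intro b h
    simp only [reduced, mem_sigma, Nat.mem_divisors, mem_filter, mem_Icc] at h ⊢
    have hg : 0 < q.gcd b := Nat.gcd_pos_of_pos_left _ hq
    refine ⟨⟨Nat.div_dvd_of_dvd (Nat.gcd_dvd_left _ _), hq.ne'⟩, ⟨?_, ?_⟩, ?_⟩
    · exact Nat.div_pos (Nat.le_of_dvd h.1 (Nat.gcd_dvd_right _ _)) hg
    · exact Nat.div_le_div_right h.2
    · exact (Nat.coprime_div_gcd_div_gcd hg).symm
  · rintro ⟨d, b⟩ h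
    simp only [reduced, mem_sigma, Nat.mem_divisors, mem_filter, mem_Icc] at h ⊢
    obtain ⟨⟨⟨k, rfl⟩, -⟩, ⟨h1, h2⟩, h3⟩ := h
    have hd : 0 < d := by lia
    have hk : 0 < k := Nat.pos_of_mul_pos_left hq
    rw [Nat.mul_div_cancel_left _ hd, mul_comm d k, Nat.gcd_mul_left, h3.symm, mul_one,
      Nat.mul_div_cancel_left _ hk, Nat.mul_div_cancel_left _ hk]
  · intro b h
    simp only
    rw [Nat.div_div_self (Nat.gcd_dvd_left _ _) hq.ne', Nat.mul_div_cancel' (Nat.gcd_dvd_right _ _)]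
  · rintro ⟨d, b⟩ h
    rfl

theorem sum_Icc_natCast_zmod {M : Type*} [AddCommMonoid M] {q : ℕ} [NeZero q] (f : ZMod q → M) :
    ∑ b ∈ Icc 1 q, f b = ∑ z, f z := by
  have hq : 0 < q := NeZero.pos q
  refine sum_nbij' (fun b => (b : ZMod q)) (fun z => if z = 0 then q else z.val) ?_ ?_ ?_ ?_ ?_
  · simp
  · intro z _
    split_ifs with h
    · simp; lia
    · rw [mem_Icc]
      exact ⟨Nat.pos_of_ne_zero (by rwa [Ne, ZMod.val_eq_zero]), z.val_lt.le⟩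
  · intro b hb
    rw [mem_Icc] at hb
    rcases hb.2.eq_or_lt with h | h
    · simp [h]
    · rw [if_neg, ZMod.val_natCast_of_lt h]
      rw [ZMod.natCast_eq_zero_iff]
      intro h'
      have := Nat.le_of_dvd hb.1 h'
      lia
  · intro z _
    split_ifs with h
    · simp [h]
    · simp
  · simp

theorem sum_reduced_natCast_zmod {M : Type*} [AddCommMonoid M] {q : ℕ} [NeZero q] (f : ZMod q → M) :
    ∑ b ∈ reduced q, f b = ∑ u : (ZMod q)ˣ, f u := by
  classical
  have h1 : ∑ b ∈ reduced q, f b = ∑ b ∈ Icc 1 q, (fun z : ZMod q => if IsUnit z then f z else 0) b := by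
    rw [reduced, sum_filter]
    simp_rw [ZMod.isUnit_iff_coprime]
  rw [h1, sum_Icc_natCast_zmod (fun z : ZMod q => if IsUnit z then f z else 0), ← sum_filter]
  symm
  refine sum_bij (fun u _ => (u : ZMod q)) ?_ ?_ ?_ ?_
  · simp
  · intro a _ b _ h; exact Units.ext h
  · intro z hz
    obtain ⟨u, hu⟩ := (mem_filter.1 hz).2
    exact ⟨u, mem_univ _, hu⟩
  · simp

theorem card_reduced (d : ℕ) [NeZero d] : (reduced d).card = d.totient := by
  have h := sum_reduced_natCast_zmod (q := d) (fun _ => (1 : ℕ))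
  simpa [ZMod.card_units_eq_totient] using h

theorem stdAddChar_natCast_mul_natCast {q : ℕ} [NeZero q] (n b : ℕ) :
    ZMod.stdAddChar ((n : ZMod q) * (b : ZMod q)) = e ((n:ℝ) * ((b:ℝ) / q)) := by
  have := ZMod.stdAddChar_coe (N := q) ((n * b : ℕ) : ℤ)
  push_cast at this
  rw [this, e]
  push_cast
  ring_nf

theorem sum_norm_sq_stdAddChar {q : ℕ} [NeZero q] (f : ZMod q → ℂ) :
    ∑ k : ZMod q, ‖∑ j : ZMod q, ZMod.stdAddChar (j * k) * f j‖ ^ 2 = q * ∑ j, ‖f j‖ ^ 2 := by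
  have key : ((∑ k : ZMod q, ‖∑ j : ZMod q, ZMod.stdAddChar (j * k) * f j‖ ^ 2 : ℝ) : ℂ) =
      ((q * ∑ j, ‖f j‖ ^ 2 : ℝ) : ℂ) := by
    push_cast
    simp_rw [← Complex.mul_conj', map_sum, map_mul, sum_mul_sum]
    rw [sum_comm]
    rw [mul_sum]
    refine sum_congr rfl fun j _ => ?_
    rw [sum_comm, sum_eq_single_of_mem j (mem_univ _)]
    · have : ∀ k : ZMod q, ZMod.stdAddChar (j * k) * (starRingEnd ℂ) (ZMod.stdAddChar (j * k)) = 1 := by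
        intro k
        rw [← AddChar.map_neg_eq_conj, ← AddChar.map_add_eq_mul, add_neg_cancel, AddChar.map_zero_eq_one]
      calc _ = ∑ k : ZMod q, (f j * (starRingEnd ℂ) (f j)) := by
            refine sum_congr rfl fun k _ => ?_
            linear_combination (f j * (starRingEnd ℂ) (f j)) * this k
        _ = _ := by rw [sum_const, card_univ, ZMod.card, nsmul_eq_mul]
    · intro j' _ hj'
      have h2 := AddChar.sum_mulShift (ψ := ZMod.stdAddChar (N := q)) (j - j')
        (ZMod.isPrimitive_stdAddChar q)
      rw [if_neg (sub_ne_zero.2 hj'.symm)] at h2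
      calc _ = (∑ k : ZMod q, ZMod.stdAddChar (k * (j - j'))) * (f j * (starRingEnd ℂ) (f j')) := by
            rw [sum_mul]
            refine sum_congr rfl fun k _ => ?_
            rw [show k * (j - j') = j * k + -(j' * k) by ring, AddChar.map_add_eq_mul,
              AddChar.map_neg_eq_conj]
            ring
        _ = 0 := by rw [h2]; simp
  exact_mod_cast key

/-- The average of `e(ub/q)` over the units `u` modulo `q`. -/
noncomputable def unitAvg {q : ℕ} [NeZero q] (b : ZMod q) : ℂ :=
  (q.totient : ℂ)⁻¹ * ∑ u : (ZMod q)ˣ, ZMod.stdAddChar ((u : ZMod q) * b)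

theorem sum_norm_sq_progression_le {q : ℕ} [NeZero q] (s : Finset ℕ) (g : ℕ → ℂ) (I : ℂ) :
    ∑ a ∈ reduced q, ‖(∑ n ∈ s, if (n : ZMod q) = (a : ZMod q) then g n else 0) -
        (1 / (q.totient : ℂ)) * I‖ ^ 2 ≤
      (1 / (q:ℝ)) * ∑ b ∈ Icc 1 q, ‖expSum s g ((b:ℝ) / q) - I * unitAvg (b : ZMod q)‖ ^ 2 := by
  classical
  have hq : (0:ℝ) < q := by exact_mod_cast NeZero.pos q
  set F : ZMod q → ℂ := fun z => (∑ n ∈ s, if (n : ZMod q) = z then g n else 0) -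
    (if IsUnit z then (1 / (q.totient : ℂ)) * I else 0) with hF
  have hhat : ∀ b : ℕ, ∑ j : ZMod q, ZMod.stdAddChar (j * (b : ZMod q)) * F j =
      expSum s g ((b:ℝ) / q) - I * unitAvg (b : ZMod q) := by
    intro b
    simp_rw [hF, mul_sub, sum_sub_distrib]
    congr 1
    · simp_rw [mul_sum]
      rw [sum_comm, expSum]
      refine sum_congr rfl fun n _ => ?_
      rw [sum_eq_single_of_mem (n : ZMod q) (mem_univ _)]
      · rw [if_pos rfl, stdAddChar_natCast_mul_natCast, mul_comm]
      · intro z _ hz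
        rw [if_neg hz.symm, mul_zero]
    · rw [unitAvg, ← sum_reduced_natCast_zmod (fun z => ZMod.stdAddChar (z * (b : ZMod q))),
        ← sum_Icc_natCast_zmod (fun z => ZMod.stdAddChar (z * (b : ZMod q)) *
          (if IsUnit z then (1 / (q.totient : ℂ)) * I else 0)), reduced, sum_filter, mul_sum, mul_sum]
      refine sum_congr rfl fun n _ => ?_
      simp_rw [ZMod.isUnit_iff_coprime]
      split_ifs <;> ring
  have hP := sum_norm_sq_stdAddChar F
  have h1 : ∑ b ∈ Icc 1 q, ‖expSum s g ((b:ℝ) / q) - I * unitAvg (b : ZMod q)‖ ^ 2 =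
      q * ∑ j, ‖F j‖ ^ 2 := by
    rw [← hP]
    have := sum_Icc_natCast_zmod (q := q)
      (fun z => ‖∑ j : ZMod q, ZMod.stdAddChar (j * z) * F j‖ ^ 2)
    simp_rw [hhat] at this
    exact this
  have hcancel : (1 / (q:ℝ)) * (q * ∑ j, ‖F j‖ ^ 2) = ∑ j, ‖F j‖ ^ 2 := by field_simp
  rw [h1, hcancel]
  rw [← sum_Icc_natCast_zmod (q := q) (fun z => ‖F z‖ ^ 2)]
  calc _ = ∑ a ∈ reduced q, ‖F a‖ ^ 2 := by
        refine sum_congr rfl fun a ha => ?_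
        rw [hF]
        simp only
        rw [if_pos ((ZMod.isUnit_iff_coprime a q).2 (mem_filter.1 ha).2)]
    _ ≤ _ := sum_le_sum_of_subset_of_nonneg (filter_subset _ _) fun _ _ _ => by positivity

/-- The average of `e(ab/d)` over the residues `a` coprime to `d`. -/
noncomputable def reducedAvg (d b : ℕ) : ℂ :=
  (d.totient : ℂ)⁻¹ * ∑ a ∈ reduced d, e ((a:ℝ) * ((b:ℝ) / d))

theorem unitAvg_natCast {d : ℕ} [NeZero d] (b : ℕ) : unitAvg (b : ZMod d) = reducedAvg d b := by
  rw [unitAvg, reducedAvg,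
    ← sum_reduced_natCast_zmod (fun z => ZMod.stdAddChar (z * (b : ZMod d)))]
  simp_rw [stdAddChar_natCast_mul_natCast]

theorem norm_unitAvg_le_one {q : ℕ} [NeZero q] (b : ZMod q) : ‖unitAvg b‖ ≤ 1 := by
  have hφ : (0:ℝ) < q.totient := by exact_mod_cast Nat.totient_pos.2 (NeZero.pos q)
  rw [unitAvg, norm_mul, norm_inv, Complex.norm_natCast]
  rw [inv_mul_le_iff₀ hφ, mul_one]
  refine (norm_sum_le_of_le _ (fun u _ => (AddChar.norm_apply _ _).le)).trans ?_
  rw [sum_const, card_univ, ZMod.card_units_eq_totient, nsmul_one]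

theorem sum_units_stdAddChar (d : ℕ) [NeZero d] :
    ∑ u : (ZMod d)ˣ, ZMod.stdAddChar (u : ZMod d) = (ArithmeticFunction.moebius d : ℂ) := by
  set c : ℕ → ℂ := fun m => ∑ b ∈ reduced m, e ((b:ℝ) / m) with hc
  have h1 : ∀ n : ℕ, 0 < n → ∑ m ∈ n.divisors, c m = if n = 1 then 1 else 0 := by
    intro n hn
    have : NeZero n := ⟨hn.ne'⟩
    have h2 := sum_Icc_eq_sum_divisors hn (fun b => e ((b:ℝ) / n))
    have h3 := sum_Icc_natCast_zmod (q := n) (fun z => ZMod.stdAddChar z)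
    have h4 : ∀ b : ℕ, ZMod.stdAddChar (b : ZMod n) = e ((b:ℝ) / n) := by
      intro b
      have := stdAddChar_natCast_mul_natCast (q := n) 1 b
      simpa using this
    simp_rw [h4] at h3
    have h5 : ∑ z : ZMod n, ZMod.stdAddChar z = if n = 1 then 1 else 0 := by
      have h6 := AddChar.sum_mulShift (ψ := ZMod.stdAddChar (N := n)) 1 (ZMod.isPrimitive_stdAddChar n)
      simp_rw [mul_one] at h6
      rw [h6]
      rcases eq_or_ne n 1 with rfl | h
      · simp [Subsingleton.elim (1 : ZMod 1) 0]
      · have : Fact (1 < n) := ⟨by lia⟩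
        simp [h]
    rw [← h5, ← h3, h2]
    refine sum_congr rfl fun m hm => sum_congr rfl fun b _ => ?_
    obtain ⟨k, rfl⟩ := (Nat.mem_divisors.1 hm).1
    have hm0 : 0 < m := Nat.pos_of_mul_pos_right hn
    have hk0 : 0 < k := Nat.pos_of_mul_pos_left hn
    rw [Nat.mul_div_cancel_left _ hm0]
    congr 1
    push_cast
    field_simp
  have h2 := (ArithmeticFunction.sum_eq_iff_sum_mul_moebius_eq (R := ℂ)
    (f := c) (g := fun n => if n = 1 then 1 else 0)).1 h1 d (NeZero.pos d)
  rw [sum_eq_single_of_mem (d, 1) (by simp [NeZero.ne d])] at h2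
  · have h3 := sum_reduced_natCast_zmod (q := d) (fun z => ZMod.stdAddChar z)
    rw [← h3]
    simp only [if_true, mul_one] at h2
    rw [h2, hc]
    refine sum_congr rfl fun b _ => ?_
    simpa using stdAddChar_natCast_mul_natCast (q := d) 1 b
  · rintro ⟨x, y⟩ hxy hne
    rw [Nat.mem_divisorsAntidiagonal] at hxy
    rw [if_neg, mul_zero]
    rintro rfl
    apply hne
    simp at hxy
    simp [hxy.1]

theorem norm_unitAvg_le_inv_totient {d : ℕ} [NeZero d] {b : ZMod d} (hb : IsUnit b) :
    ‖unitAvg b‖ ≤ 1 / d.totient := by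
  obtain ⟨v, rfl⟩ := hb
  have h : ∑ u : (ZMod d)ˣ, ZMod.stdAddChar ((u : ZMod d) * (v : ZMod d)) =
      ∑ u : (ZMod d)ˣ, ZMod.stdAddChar (u : ZMod d) := by
    refine Fintype.sum_equiv (Equiv.mulRight v) _ _ fun u => ?_
    simp
  rw [unitAvg, h, sum_units_stdAddChar, norm_mul, norm_inv, Complex.norm_natCast, one_div]
  refine mul_le_of_le_one_right (by positivity) ?_
  rw [Complex.norm_intCast]
  exact_mod_cast ArithmeticFunction.abs_moebius_le_one

theorem unitAvg_mul_natCast {d k : ℕ} [NeZero d] [NeZero (k * d)] (b : ℕ) :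
    unitAvg ((k * b : ℕ) : ZMod (k * d)) = unitAvg (b : ZMod d) := by
  classical
  have hd0 : 0 < d := NeZero.pos d
  have hk0 : 0 < k := Nat.pos_of_mul_pos_right (NeZero.pos (k * d))
  set π := ZMod.unitsMap (show d ∣ k * d from Dvd.intro_left _ rfl) with hπ
  have hsurj : Function.Surjective π := ZMod.unitsMap_surjective _
  have h1 : ∀ u : (ZMod (k * d))ˣ, ZMod.stdAddChar ((u : ZMod (k * d)) * ((k * b : ℕ) : ZMod (k * d))) =
      ZMod.stdAddChar ((π u : ZMod d) * (b : ZMod d)) := by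
    intro u
    obtain ⟨n, hn⟩ : ∃ n : ℕ, (n : ZMod (k * d)) = u := ⟨(u : ZMod (k * d)).val, by simp⟩
    have h2 : (π u : ZMod d) = (n : ZMod d) := by
      rw [hπ, ZMod.unitsMap_val, ← hn, ZMod.cast_natCast (Dvd.intro_left _ rfl)]
    rw [h2, ← hn, stdAddChar_natCast_mul_natCast, stdAddChar_natCast_mul_natCast]
    congr 1
    push_cast
    field_simp
  set m := Nat.card π.ker with hm
  have hfib : ∀ v : (ZMod d)ˣ, (univ.filter fun u => π u = v).card = m := by
    intro v
    obtain ⟨u₀, rfl⟩ := hsurj v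
    rw [hm, Nat.card_eq_fintype_card, ← Fintype.card_subtype]
    refine Fintype.card_congr
      ⟨fun u => ⟨u.1 * u₀⁻¹, by simp [MonoidHom.mem_ker, u.2]⟩,
        fun w => ⟨w.1 * u₀, by have := w.2; rw [MonoidHom.mem_ker] at this; simp [this]⟩,
        fun u => by simp, fun w => by simp⟩
  have hsum : ∀ f : (ZMod d)ˣ → ℂ, ∑ u, f (π u) = m * ∑ v, f v := by
    intro f
    rw [← sum_fiberwise (s := univ) (g := π), mul_sum]
    refine sum_congr rfl fun v _ => ?_
    rw [sum_congr rfl (g := fun _ => f v) (fun u hu => by rw [(mem_filter.1 hu).2]), sum_const,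
      hfib, nsmul_eq_mul]
  have hcard := hsum (fun _ => 1)
  rw [sum_const, sum_const, card_univ, card_univ, ZMod.card_units_eq_totient,
    ZMod.card_units_eq_totient, nsmul_one, nsmul_one] at hcard
  have hφ : ((k * d).totient : ℂ) ≠ 0 := by
    exact_mod_cast (Nat.totient_pos.2 (NeZero.pos (k * d))).ne'
  rw [unitAvg, unitAvg, sum_congr rfl (fun u _ => h1 u),
    hsum (fun v => ZMod.stdAddChar ((v : ZMod d) * (b : ZMod d))), hcard]
  rw [hcard] at hφ
  have hm0 : (m : ℂ) ≠ 0 := left_ne_zero_of_mul hφ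
  have hd' : (d.totient : ℂ) ≠ 0 := right_ne_zero_of_mul hφ
  field_simp

theorem sum_Icc_sum_divisors {M : Type*} [AddCommMonoid M] (N : ℕ) (F : ℕ → ℕ → M) :
    ∑ q ∈ Icc 1 N, ∑ d ∈ q.divisors, F (q / d) d = ∑ k ∈ Icc 1 N, ∑ d ∈ Icc 1 (N / k), F k d := by
  rw [sum_sigma', sum_sigma']
  refine sum_nbij' (fun x => ⟨x.1 / x.2, x.2⟩) (fun x => ⟨x.1 * x.2, x.2⟩) ?_ ?_ ?_ ?_ ?_
  · rintro ⟨q, d⟩ h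
    simp only [mem_sigma, mem_Icc, Nat.mem_divisors] at h ⊢
    obtain ⟨⟨h1, h2⟩, ⟨k, rfl⟩, -⟩ := h
    have hd : 0 < d := Nat.pos_of_mul_pos_right h1
    have hk : 0 < k := Nat.pos_of_mul_pos_left h1
    rw [Nat.mul_div_cancel_left _ hd, Nat.le_div_iff_mul_le hk]
    refine ⟨⟨hk, ?_⟩, hd, h2⟩
    nlinarith
  · rintro ⟨k, d⟩ h
    simp only [mem_sigma, mem_Icc, Nat.mem_divisors] at h ⊢
    obtain ⟨⟨h1, h2⟩, h3, h4⟩ := h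
    rw [Nat.le_div_iff_mul_le h1] at h4
    have := Nat.mul_pos h1 h3
    exact ⟨⟨this, by rwa [mul_comm]⟩, Dvd.intro_left _ rfl, this.ne'⟩
  · rintro ⟨q, d⟩ h
    simp only [mem_sigma, mem_Icc, Nat.mem_divisors] at h ⊢
    rw [Nat.div_mul_cancel h.2.1]
  · rintro ⟨k, d⟩ h
    simp only [mem_sigma, mem_Icc] at h ⊢
    rw [Nat.mul_div_cancel _ h.2.1]
  · rintro ⟨q, d⟩ h
    rfl

/-- The defect of `∑ g(n) e(nb/d)` from its expected value. -/
noncomputable def expDefect (s : Finset ℕ) (g : ℕ → ℂ) (I : ℂ) (d b : ℕ) : ℂ :=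
  expSum s g ((b:ℝ) / d) - I * reducedAvg d b

theorem sum_progressions_le (N : ℕ) (s : Finset ℕ) (g : ℕ → ℂ) (I : ℂ) :
    ∑ q ∈ Icc 1 N, ∑ a ∈ reduced q, ‖(∑ n ∈ s, if (n : ZMod q) = (a : ZMod q) then g n else 0) -
        (1 / (q.totient : ℂ)) * I‖ ^ 2 ≤
      ∑ k ∈ Icc 1 N, (1 / (k:ℝ)) * ∑ d ∈ Icc 1 (N / k), (1 / (d:ℝ)) *
        ∑ b ∈ reduced d, ‖expDefect s g I d b‖ ^ 2 := by
  simp_rw [mul_sum (s := Icc 1 (N / _))]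
  rw [← sum_Icc_sum_divisors N
    (fun k d => (1 / (k:ℝ)) * ((1 / (d:ℝ)) * ∑ b ∈ reduced d, ‖expDefect s g I d b‖ ^ 2))]
  refine sum_le_sum fun q hq => ?_
  have hq0 : 0 < q := (mem_Icc.1 hq).1
  have : NeZero q := ⟨hq0.ne'⟩
  refine (sum_norm_sq_progression_le s g I).trans (le_of_eq ?_)
  rw [sum_Icc_eq_sum_divisors hq0, mul_sum]
  refine sum_congr rfl fun d hd => ?_
  obtain ⟨k, rfl⟩ := exists_eq_mul_left_of_dvd (Nat.mem_divisors.1 hd).1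
  have hd0 : 0 < d := Nat.pos_of_mul_pos_left hq0
  have hk0 : 0 < k := Nat.pos_of_mul_pos_right hq0
  rw [Nat.mul_div_cancel _ hd0]
  have : NeZero d := ⟨hd0.ne'⟩
  rw [← mul_assoc]
  congr 1
  · push_cast; field_simp
  · refine sum_congr rfl fun b _ => ?_
    rw [expDefect, ← unitAvg_natCast]
    rw [← unitAvg_mul_natCast (d := d) (k := k)]
    congr 4
    push_cast; field_simp

theorem sum_Ioc_div_eq (f : ℕ → ℝ) {R D : ℕ} (h : R ≤ D) :
    ∑ d ∈ Ioc R D, 1 / (d:ℝ) * f d =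
      ∑ m ∈ Ioc R D, (∑ d ∈ Ioc R m, f d) / ((m:ℝ) * (m + 1)) + (∑ d ∈ Ioc R D, f d) / (D + 1) := by
  induction D, h using Nat.le_induction with
  | base => simp
  | succ D h ih =>
    have h' : R < D + 1 := by lia
    rw [← insert_Ioc_right_eq_Ioc_add_one h, sum_insert (by simp), ih, sum_insert (by simp),
      insert_Ioc_right_eq_Ioc_add_one h, ← insert_Ioc_right_eq_Ioc_add_one h, sum_insert (by simp)]
    push_cast
    field_simp
    ring

theorem sum_Ioc_inv_mul_succ_le {R D : ℕ} (h : R ≤ D) :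
    ∑ m ∈ Ioc R D, 1 / ((m:ℝ) * (m + 1)) = 1 / (R + 1) - 1 / (D + 1) := by
  induction D, h using Nat.le_induction with
  | base => simp
  | succ D h ih =>
    rw [← insert_Ioc_right_eq_Ioc_add_one h, sum_insert (by simp), ih]
    push_cast
    field_simp
    ring

/-- A weighted large sieve for denominators larger than `R`. -/
theorem large_sieve_weighted {R D N : ℕ} (h : R ≤ D) (s : Finset ℕ) (hs : ∀ n ∈ s, n ≤ N)
    (hN : 1 ≤ N) (g : ℕ → ℂ) :
    ∑ d ∈ Ioc R D, 1 / (d:ℝ) * ∑ b ∈ reduced d, ‖expSum s g ((b:ℝ) / d)‖ ^ 2 ≤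
      100 * (2 * D + N / (R + 1)) * ∑ n ∈ s, ‖g n‖ ^ 2 := by
  set Z := ∑ n ∈ s, ‖g n‖ ^ 2 with hZ
  have hZ0 : 0 ≤ Z := sum_nonneg fun _ _ => by positivity
  set f : ℕ → ℝ := fun d => ∑ b ∈ reduced d, ‖expSum s g ((b:ℝ) / d)‖ ^ 2 with hf
  have hB : ∀ m, ∑ d ∈ Ioc R m, f d ≤ 100 * ((m:ℝ) ^ 2 + N) * Z := by
    intro m
    refine le_trans ?_ (large_sieve_farey m N s hs hN g)
    calc ∑ d ∈ Ioc R m, f d ≤ ∑ d ∈ Icc 1 m, f d := by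
          refine sum_le_sum_of_subset_of_nonneg ?_ fun _ _ _ => sum_nonneg fun _ _ => by positivity
          intro x hx
          rw [mem_Ioc] at hx
          rw [mem_Icc]; lia
      _ = ∑ p ∈ fareyPairs m, ‖expSum s g ((p.2:ℝ) / p.1)‖ ^ 2 := by
          rw [hf, sum_sigma']
          refine sum_nbij' (fun x => (x.1, x.2)) (fun p => ⟨p.1, p.2⟩) ?_ ?_ ?_ ?_ ?_
          · rintro ⟨d, b⟩ h
            simp only [fareyPairs, reduced, mem_sigma, mem_filter, mem_product, mem_Icc] at h ⊢
            exact ⟨⟨h.1, h.2.1.1, by lia⟩, h.2.1.2, h.2.2⟩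
          · rintro ⟨d, b⟩ h
            simp only [fareyPairs, reduced, mem_sigma, mem_filter, mem_product, mem_Icc] at h ⊢
            exact ⟨h.1.1, ⟨h.1.2.1, h.2.1⟩, h.2.2⟩
          · rintro ⟨d, b⟩ h; rfl
          · rintro ⟨d, b⟩ h; rfl
          · rintro ⟨d, b⟩ h; rfl
  rw [sum_Ioc_div_eq f h]
  have hD : (0:ℝ) < D + 1 := by positivity
  calc ∑ m ∈ Ioc R D, (∑ d ∈ Ioc R m, f d) / ((m:ℝ) * (m + 1)) + (∑ d ∈ Ioc R D, f d) / (D + 1)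
      ≤ ∑ m ∈ Ioc R D, (100 * Z + 100 * N * Z * (1 / ((m:ℝ) * (m + 1)))) +
        (100 * Z * D + 100 * N * Z * (1 / (D + 1))) := by
        gcongr with m hm
        · have hm0 : (0:ℝ) < m := by exact_mod_cast (Nat.zero_le _).trans_lt (mem_Ioc.1 hm).1
          rw [div_le_iff₀ (by positivity)]
          refine (hB m).trans ?_
          rw [add_mul, mul_assoc (100 * (N:ℝ) * Z), one_div_mul_cancel (by positivity)]
          nlinarith [mul_nonneg hm0.le hZ0]
        · rw [div_le_iff₀ hD]
          refine (hB D).trans ?_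
          rw [add_mul, mul_assoc (100 * (N:ℝ) * Z), one_div_mul_cancel (by positivity)]
          nlinarith [mul_nonneg (Nat.cast_nonneg (α := ℝ) D) hZ0]
    _ ≤ _ := by
        rw [sum_add_distrib, sum_const, ← mul_sum, sum_Ioc_inv_mul_succ_le h, Nat.card_Ioc,
          nsmul_eq_mul]
        have : ((D - R : ℕ) : ℝ) ≤ D := by exact_mod_cast Nat.sub_le _ _
        have h3 := mul_le_mul_of_nonneg_right this hZ0
        rw [div_eq_mul_one_div (N:ℝ)]
        nlinarith

theorem le_totient_mul_log {d : ℕ} (hd : d ≠ 0) : (d:ℝ) ≤ d.totient * (1 + 2 * Real.log d) := by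
  have hlow := prod_one_sub_inv_ge d.primeFactors fun p hp => (Nat.prime_of_mem_primeFactors hp).two_le
  have hc := card_primeFactors_le_log hd
  have h1 : (d.totient : ℝ) = d * ∏ p ∈ d.primeFactors, (1 - (p:ℝ)⁻¹) := by
    have := Nat.totient_eq_mul_prod_factors d
    have h2 : ((d.totient : ℚ) : ℝ) = ((d * ∏ p ∈ d.primeFactors, (1 - (p:ℚ)⁻¹) : ℚ) : ℝ) := by
      rw [this]
    push_cast at h2
    exact h2
  have hd0 : (0:ℝ) < d := by exact_mod_cast Nat.pos_of_ne_zero hd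
  have h0 : (0:ℝ) < (d.primeFactors.card : ℝ) + 1 := by positivity
  have h3 : 1 ≤ (∏ p ∈ d.primeFactors, (1 - (p:ℝ)⁻¹)) * (1 + 2 * Real.log d) := by
    calc (1:ℝ) = 1 / ((d.primeFactors.card : ℝ) + 1) * ((d.primeFactors.card : ℝ) + 1) := by field_simp
      _ ≤ _ := by
        apply mul_le_mul hlow (by linarith) h0.le
        exact (by positivity : (0:ℝ) ≤ 1 / ((d.primeFactors.card : ℝ) + 1)).trans hlow
  rw [h1, mul_assoc]
  exact le_mul_of_one_le_right hd0.le h3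

theorem norm_reducedAvg_le_inv_totient {d b : ℕ} (hb : b ∈ reduced d) :
    ‖reducedAvg d b‖ ≤ 1 / d.totient := by
  simp only [reduced, mem_filter, mem_Icc] at hb
  have : NeZero d := ⟨by lia⟩
  rw [← unitAvg_natCast]
  exact norm_unitAvg_le_inv_totient ((ZMod.isUnit_iff_coprime b d).2 hb.2)

theorem sum_Ioc_inv_sq_le {R D : ℕ} (hR : 1 ≤ R) : ∑ d ∈ Ioc R D, 1 / (d:ℝ) ^ 2 ≤ 2 / (R:ℝ) := by
  have hR0 : (0:ℝ) < R := by exact_mod_cast hR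
  rcases le_or_gt R D with h | h
  · calc ∑ d ∈ Ioc R D, 1 / (d:ℝ) ^ 2 ≤ ∑ d ∈ Ioc R D, 2 * (1 / ((d:ℝ) * (d + 1))) := by
          refine sum_le_sum fun d hd => ?_
          have h1 : (1:ℝ) ≤ d := by exact_mod_cast (by have := (mem_Ioc.1 hd).1; lia : 1 ≤ d)
          rw [mul_one_div, div_le_div_iff₀ (by positivity) (by positivity)]
          nlinarith
      _ ≤ 2 * (1 / R) := by
          rw [← mul_sum, sum_Ioc_inv_mul_succ_le h]
          have h1 : (1:ℝ) / (R + 1) ≤ 1 / R := by gcongr; linarith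
          have h2 : (0:ℝ) ≤ 1 / (D + 1) := by positivity
          linarith
      _ = 2 / R := by ring
  · rw [Ioc_eq_empty (by lia)]
    simp only [sum_empty]
    positivity

theorem sum_inv_Icc_le (N : ℕ) : ∑ k ∈ Icc 1 N, 1 / (k:ℝ) ≤ 1 + Real.log N := by
  have := harmonic_le_one_add_log N
  rw [harmonic_eq_sum_Icc] at this
  push_cast at this
  simpa only [one_div] using this

theorem sum_expDefect_small_le {M : ℝ} {D : ℕ} (s : Finset ℕ) (g : ℕ → ℂ) (I : ℂ)
    (h : ∀ d b, d ∈ Icc 1 D → b ∈ reduced d → ‖expDefect s g I d b‖ ≤ M) :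
    ∑ d ∈ Icc 1 D, (1 / (d:ℝ)) * ∑ b ∈ reduced d, ‖expDefect s g I d b‖ ^ 2 ≤ D * M ^ 2 := by
  calc _ ≤ ∑ d ∈ Icc 1 D, M ^ 2 := by
        refine sum_le_sum fun d hd => ?_
        have hd0 : 0 < d := (mem_Icc.1 hd).1
        have : NeZero d := ⟨hd0.ne'⟩
        have hd1 : (0:ℝ) < d := by exact_mod_cast hd0
        rw [one_div_mul_eq_div, div_le_iff₀ hd1]
        calc ∑ b ∈ reduced d, ‖expDefect s g I d b‖ ^ 2 ≤ ∑ b ∈ reduced d, M ^ 2 := by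
              gcongr with b hb; exact h d b hd hb
          _ = d.totient * M ^ 2 := by rw [sum_const, card_reduced, nsmul_eq_mul]
          _ ≤ d * M ^ 2 := by gcongr; exact_mod_cast Nat.totient_le d
          _ = _ := mul_comm _ _
    _ = _ := by rw [sum_const, Nat.card_Icc, nsmul_eq_mul]; simp

theorem sum_expDefect_large_le {R D N X : ℕ} {J : ℝ} (hR : 1 ≤ R) (hD : D ≤ X) (s : Finset ℕ)
    (hs : ∀ n ∈ s, n ≤ N) (hN : 1 ≤ N) (g : ℕ → ℂ) (I : ℂ) (hI : ‖I‖ ≤ J) :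
    ∑ d ∈ Ioc R D, (1 / (d:ℝ)) * ∑ b ∈ reduced d, ‖expDefect s g I d b‖ ^ 2 ≤
      200 * (2 * D + N / R) * ∑ n ∈ s, ‖g n‖ ^ 2 + 4 * J ^ 2 * (1 + 2 * Real.log X) / R := by
  have hR0 : (0:ℝ) < R := by exact_mod_cast hR
  have hZ0 : 0 ≤ ∑ n ∈ s, ‖g n‖ ^ 2 := sum_nonneg fun _ _ => by positivity
  have hlX : 0 ≤ Real.log X := Real.log_natCast_nonneg X
  have hJ0 : 0 ≤ J := (norm_nonneg _).trans hI
  rcases le_or_gt R D with h | h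
  swap
  · rw [Ioc_eq_empty (by lia), sum_empty]
    positivity
  have h1 : ∀ d ∈ Ioc R D, (1 / (d:ℝ)) * ∑ b ∈ reduced d, ‖expDefect s g I d b‖ ^ 2 ≤
      2 * (1 / (d:ℝ) * ∑ b ∈ reduced d, ‖expSum s g ((b:ℝ) / d)‖ ^ 2) +
        2 * J ^ 2 * (1 + 2 * Real.log X) * (1 / (d:ℝ) ^ 2) := by
    intro d hd
    have hd0 : 0 < d := (Nat.zero_le _).trans_lt (mem_Ioc.1 hd).1
    have : NeZero d := ⟨hd0.ne'⟩
    have hd1 : (0:ℝ) < d := by exact_mod_cast hd0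
    have hφ : (0:ℝ) < d.totient := by exact_mod_cast Nat.totient_pos.2 hd0
    have h2 : ∑ b ∈ reduced d, ‖expDefect s g I d b‖ ^ 2 ≤
        2 * (∑ b ∈ reduced d, ‖expSum s g ((b:ℝ) / d)‖ ^ 2) + 2 * J ^ 2 / d.totient := by
      calc _ ≤ ∑ b ∈ reduced d, (2 * ‖expSum s g ((b:ℝ) / d)‖ ^ 2 + 2 * J ^ 2 / d.totient ^ 2) := by
            refine sum_le_sum fun b hb => ?_
            have h3 := norm_reducedAvg_le_inv_totient hb
            have h4 : ‖I * reducedAvg d b‖ ≤ J / d.totient := by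
              rw [norm_mul, div_eq_mul_one_div]
              gcongr
            have h5 : ‖expDefect s g I d b‖ ≤ ‖expSum s g ((b:ℝ) / d)‖ + J / d.totient :=
              (norm_sub_le _ _).trans (by gcongr)
            calc _ ≤ (‖expSum s g ((b:ℝ) / d)‖ + J / d.totient) ^ 2 := by gcongr
              _ ≤ 2 * ‖expSum s g ((b:ℝ) / d)‖ ^ 2 + 2 * (J / d.totient) ^ 2 := by
                nlinarith [sq_nonneg (‖expSum s g ((b:ℝ) / d)‖ - J / d.totient)]
              _ = _ := by rw [div_pow]; ring
        _ = _ := by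
            rw [sum_add_distrib, ← mul_sum, sum_const, card_reduced, nsmul_eq_mul]
            field_simp
    have h3 : 1 / (d.totient : ℝ) ≤ (1 + 2 * Real.log X) / d := by
      rw [div_le_div_iff₀ hφ hd1, one_mul]
      refine (le_totient_mul_log hd0.ne').trans ?_
      rw [mul_comm]
      gcongr
      exact (mem_Ioc.1 hd).2.trans hD
    calc _ ≤ 1 / (d:ℝ) * (2 * (∑ b ∈ reduced d, ‖expSum s g ((b:ℝ) / d)‖ ^ 2) +
          2 * J ^ 2 * (1 / d.totient)) := by
          rw [mul_one_div]; gcongr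
      _ ≤ 1 / (d:ℝ) * (2 * (∑ b ∈ reduced d, ‖expSum s g ((b:ℝ) / d)‖ ^ 2) +
          2 * J ^ 2 * ((1 + 2 * Real.log X) / d)) := by gcongr
      _ = _ := by field_simp
  refine (sum_le_sum h1).trans ?_
  rw [sum_add_distrib, ← mul_sum, ← mul_sum]
  have h2 := large_sieve_weighted h s hs hN g
  have h3 := sum_Ioc_inv_sq_le (D := D) hR
  calc _ ≤ 2 * (100 * (2 * D + N / R) * ∑ n ∈ s, ‖g n‖ ^ 2) +
        2 * J ^ 2 * (1 + 2 * Real.log X) * (2 / R) := by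
        gcongr
        refine h2.trans ?_
        gcongr
        linarith
    _ = _ := by ring

/-- The variance in progressions reduces to the exponential sums near fractions with small
denominators. -/
theorem variance_le {R N X : ℕ} {J M : ℝ} (hR : 1 ≤ R) (s : Finset ℕ)
    (hs : ∀ n ∈ s, n ≤ N) (hN : 1 ≤ N) (g : ℕ → ℂ) (I : ℂ) (hI : ‖I‖ ≤ J)
    (hM : ∀ d b, d ∈ Icc 1 R → b ∈ reduced d → ‖expDefect s g I d b‖ ≤ M) :
    ∑ q ∈ Icc 1 X, ∑ a ∈ reduced q, ‖(∑ n ∈ s, if (n : ZMod q) = (a : ZMod q) then g n else 0) -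
        (1 / (q.totient : ℂ)) * I‖ ^ 2 ≤
      (800 * X + 200 * (N / R) * (1 + Real.log X)) * (∑ n ∈ s, ‖g n‖ ^ 2) +
        (1 + Real.log X) * (4 * J ^ 2 * (1 + 2 * Real.log X) / R + R * M ^ 2) := by
  refine (sum_progressions_le X s g I).trans ?_
  set Z := ∑ n ∈ s, ‖g n‖ ^ 2 with hZ
  have hZ0 : 0 ≤ Z := sum_nonneg fun _ _ => by positivity
  have hR0 : (0:ℝ) < R := by exact_mod_cast hR
  have hlX : 0 ≤ Real.log X := Real.log_natCast_nonneg X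
  set f : ℕ → ℝ := fun d => (1 / (d:ℝ)) * ∑ b ∈ reduced d, ‖expDefect s g I d b‖ ^ 2 with hf
  have hf0 : ∀ d, 0 ≤ f d := fun d => by
    have : 0 ≤ ∑ b ∈ reduced d, ‖expDefect s g I d b‖ ^ 2 := sum_nonneg fun _ _ => by positivity
    positivity
  set W := 4 * J ^ 2 * (1 + 2 * Real.log X) / R + R * M ^ 2 with hW
  have hW0 : 0 ≤ W := by positivity
  have hk : ∀ k ∈ Icc 1 X, (1 / (k:ℝ)) * ∑ d ∈ Icc 1 (X / k), f d ≤
      400 * X * Z * (1 / (k:ℝ) ^ 2) + (200 * (N / R) * Z + W) * (1 / k) := by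
    intro k hk
    have hk0 : 0 < k := (mem_Icc.1 hk).1
    have hk1 : (0:ℝ) < k := by exact_mod_cast hk0
    have h1 : ∑ d ∈ Icc 1 (X / k), f d ≤ ∑ d ∈ Icc 1 R, f d + ∑ d ∈ Ioc R (X / k), f d := by
      rw [← sum_union (by
        rw [disjoint_left]; intro x hx hx'; rw [mem_Icc] at hx; rw [mem_Ioc] at hx'; lia)]
      refine sum_le_sum_of_subset_of_nonneg (fun x hx => ?_) fun d _ _ => hf0 d
      rw [mem_Icc] at hx
      rw [mem_union, mem_Icc, mem_Ioc]; lia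
    have h2 := sum_expDefect_small_le s g I hM
    have h3 := sum_expDefect_large_le hR (Nat.div_le_self X k) s hs hN g I hI
    have h4 : ((X / k : ℕ) : ℝ) ≤ X / k := Nat.cast_div_le
    calc _ ≤ (1 / (k:ℝ)) * (R * M ^ 2 + (200 * (2 * (X / k) + N / R) * Z +
          4 * J ^ 2 * (1 + 2 * Real.log X) / R)) := by
          gcongr
          refine h1.trans ?_
          gcongr
          refine h3.trans ?_
          gcongr
      _ = _ := by rw [hW]; field_simp; ring
  refine (sum_le_sum hk).trans ?_
  rw [sum_add_distrib, ← mul_sum, ← mul_sum]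
  have h5 : ∑ k ∈ Icc 1 X, 1 / (k:ℝ) ^ 2 ≤ 2 := by
    rcases Nat.eq_zero_or_pos X with rfl | hX
    · simp
    have := sum_Ioc_inv_mul_succ_le (R := 0) (D := X) (Nat.zero_le _)
    calc _ ≤ ∑ m ∈ Ioc 0 X, 2 * (1 / ((m:ℝ) * (m + 1))) := by
          refine sum_le_sum fun d hd => ?_
          have h1 : (1:ℝ) ≤ d := by exact_mod_cast (mem_Icc.1 hd).1
          rw [mul_one_div, div_le_div_iff₀ (by positivity) (by positivity)]
          nlinarith
      _ ≤ 2 := by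
          rw [← mul_sum, this]
          have : (0:ℝ) ≤ 1 / (X + 1) := by positivity
          simp only [Nat.cast_zero, zero_add, div_one]
          linarith
  have h6 := sum_inv_Icc_le X
  calc _ ≤ 400 * X * Z * 2 + (200 * (N / R) * Z + W) * (1 + Real.log X) := by gcongr
    _ = _ := by ring

theorem hasDerivAt_e_rpow (t c : ℝ) {y : ℝ} (hy : 0 < y) :
    HasDerivAt (fun y : ℝ => e (t * y ^ c))
      (2 * Real.pi * Complex.I * t * ((c * y ^ (c - 1) : ℝ) : ℂ) * e (t * y ^ c)) y := by
  have h1 : HasDerivAt (fun y : ℝ => y ^ c) (c * y ^ (c - 1)) y :=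
    Real.hasDerivAt_rpow_const (.inl hy.ne')
  have h2 := (hasDerivAt_e t (y ^ c)).scomp y h1
  convert! h2 using 1
  rw [Complex.real_smul]
  ring

theorem continuousOn_e_rpow_deriv (t c : ℝ) : ContinuousOn (fun y : ℝ =>
    2 * Real.pi * Complex.I * t * ((c * y ^ (c - 1) : ℝ) : ℂ) * e (t * y ^ c)) (Set.Ioi 0) := by
  have h1 : ∀ k : ℝ, ContinuousOn (fun y : ℝ => y ^ k) (Set.Ioi 0) := fun k =>
    continuousOn_id.rpow_const fun y hy => .inl (ne_of_gt hy)
  refine ContinuousOn.mul ?_ (continuous_e.comp_continuousOn (continuousOn_const.mul (h1 c)))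
  exact continuousOn_const.mul (Complex.continuous_ofReal.comp_continuousOn
    (continuousOn_const.mul (h1 (c - 1))))

theorem norm_e_rpow_deriv_le {t c y b : ℝ} (hc : 1 ≤ c) (hy : 0 < y) (hyb : y ≤ b) :
    ‖2 * Real.pi * Complex.I * t * ((c * y ^ (c - 1) : ℝ) : ℂ) * e (t * y ^ c)‖ ≤
      2 * Real.pi * c * |t| * b ^ (c - 1) := by
  rw [norm_mul, norm_e, mul_one, norm_mul, norm_mul, norm_mul, norm_mul, Complex.norm_I,
    Complex.norm_real, Complex.norm_real, Complex.norm_real, Real.norm_of_nonneg Real.pi_pos.le,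
    Real.norm_of_nonneg (by positivity : 0 ≤ c * y ^ (c - 1)), Real.norm_eq_abs, Complex.norm_ofNat]
  have : y ^ (c - 1) ≤ b ^ (c - 1) := by gcongr
  calc _ = 2 * Real.pi * c * |t| * y ^ (c - 1) := by ring
    _ ≤ _ := by gcongr

/-- Partial summation against `e(ty^c)`. -/
theorem sum_mul_e_sub_integral_le {t c a b E : ℝ} {ρ : ℂ} (hc : 1 ≤ c) (ha : 0 < a) (hab : a ≤ b)
    (r : ℕ → ℂ) (hr0 : r 0 = 0)
    (hr : ∀ x, a ≤ x → x ≤ b → ‖(∑ n ∈ Ioc 0 ⌊x⌋₊, r n) - x * ρ‖ ≤ E) :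
    ‖(∑ n ∈ Ioc ⌊a⌋₊ ⌊b⌋₊, r n * e (t * (n:ℝ) ^ c)) - ρ * ∫ y in a..b, e (t * y ^ c)‖ ≤
      E * (2 + 2 * Real.pi * c * (|t| * b ^ c)) := by
  set f : ℝ → ℂ := fun y => e (t * y ^ c) with hf
  set f' : ℝ → ℂ := fun y =>
    2 * Real.pi * Complex.I * t * ((c * y ^ (c - 1) : ℝ) : ℂ) * e (t * y ^ c) with hf'
  have hb : 0 < b := ha.trans_le hab
  have hder : ∀ y, 0 < y → HasDerivAt f (f' y) y := fun y hy => hasDerivAt_e_rpow t c hy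
  have hsub : Set.Icc a b ⊆ Set.Ioi 0 := fun y hy => ha.trans_le hy.1
  have hcont' : ContinuousOn f' (Set.Icc a b) := (continuousOn_e_rpow_deriv t c).mono hsub
  have hinteg' : MeasureTheory.IntegrableOn f' (Set.Icc a b) := hcont'.integrableOn_Icc
  have hdf : ∀ y ∈ Set.Icc a b, deriv f y = f' y := fun y hy => (hder y (hsub hy)).deriv
  have hinteg : MeasureTheory.IntegrableOn (deriv f) (Set.Icc a b) :=
    hinteg'.congr_fun (fun y hy => (hdf y hy).symm) measurableSet_Icc
  have hE0 : 0 ≤ E := (norm_nonneg _).trans (hr a le_rfl hab)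
  set ψ : ℝ → ℂ := fun x => ∑ k ∈ Icc 0 ⌊x⌋₊, r k with hψ
  have hΔ : ∀ x, a ≤ x → x ≤ b → ‖ψ x - x * ρ‖ ≤ E := by
    intro x h1 h2
    have h3 : ψ x = ∑ n ∈ Ioc 0 ⌊x⌋₊, r n := by
      rw [hψ]
      simp only
      rw [Finset.Icc_eq_cons_Ioc (Nat.zero_le _), sum_cons, hr0, zero_add]
    rw [h3]
    exact hr x h1 h2
  have hsum := sum_mul_eq_sub_sub_integral_mul r ha.le hab
    (fun y hy => (hder y (hsub hy)).differentiableAt) hinteg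
  have hparts : ∫ y in a..b, ((1:ℂ) * f y + (y:ℂ) * f' y) = b * f b - a * f a := by
    refine intervalIntegral.integral_deriv_mul_eq_sub_of_hasDerivAt (u := fun y : ℝ => (y:ℂ))
      (u' := fun _ => 1) ?_ ?_ ?_ ?_ ?_ ?_
    · exact Complex.continuous_ofReal.continuousOn
    · rw [Set.uIcc_of_le hab]
      exact fun y hy => (hder y (hsub hy)).continuousAt.continuousWithinAt
    · intro x _
      exact (hasDerivAt_id x).ofReal_comp
    · intro x hx
      rw [min_eq_left hab] at hx
      exact hder x (ha.trans hx.1)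
    · exact intervalIntegrable_const
    · rw [intervalIntegrable_iff_integrableOn_Icc_of_le hab]; exact hinteg'
  have hif : IntervalIntegrable (fun y => (1:ℂ) * f y) MeasureTheory.volume a b := by
    apply ContinuousOn.intervalIntegrable
    rw [Set.uIcc_of_le hab]
    exact continuousOn_const.mul fun y hy => (hder y (hsub hy)).continuousAt.continuousWithinAt
  have hcy : ContinuousOn (fun y : ℝ => (y:ℂ) * f' y) (Set.Icc a b) :=
    Complex.continuous_ofReal.continuousOn.mul hcont'
  have hiy : IntervalIntegrable (fun y : ℝ => (y:ℂ) * f' y) MeasureTheory.volume a b := by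
    apply ContinuousOn.intervalIntegrable
    rwa [Set.uIcc_of_le hab]
  rw [intervalIntegral.integral_add hif hiy] at hparts
  simp only [one_mul] at hparts
  have hI : ∫ y in a..b, f y = b * f b - a * f a - ∫ y in a..b, (y:ℂ) * f' y := by
    rw [← hparts]; ring
  have hψint : MeasureTheory.IntegrableOn (fun y => f' y * ψ y) (Set.Icc a b) :=
    integrableOn_mul_sum_Icc r ha.le hinteg'
  have e1 : ∫ y in Set.Ioc a b, deriv f y * ψ y = ∫ y in Set.Ioc a b, f' y * ψ y :=
    MeasureTheory.setIntegral_congr_fun measurableSet_Ioc fun y hy => by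
      rw [hdf y (Set.Ioc_subset_Icc_self hy)]
  have e2 : (∫ y in Set.Ioc a b, f' y * ψ y) - ρ * ∫ y in a..b, (y:ℂ) * f' y =
      ∫ y in Set.Ioc a b, f' y * (ψ y - y * ρ) := by
    rw [intervalIntegral.integral_of_le hab, ← MeasureTheory.integral_const_mul,
      ← MeasureTheory.integral_sub (hψint.mono_set Set.Ioc_subset_Icc_self)
        ((hcy.integrableOn_Icc.mono_set Set.Ioc_subset_Icc_self).const_mul _)]
    congr 1
    ext y
    ring
  have hmain : (∑ n ∈ Ioc ⌊a⌋₊ ⌊b⌋₊, r n * f n) - ρ * ∫ y in a..b, f y =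
      f b * (ψ b - b * ρ) - f a * (ψ a - a * ρ) - ∫ y in Set.Ioc a b, f' y * (ψ y - y * ρ) := by
    rw [← e2, hI, ← e1]
    simp_rw [mul_comm (r _)]
    rw [hsum]
    ring
  rw [hmain]
  have hbc : b ^ c = b ^ (c - 1) * b := by
    rw [← Real.rpow_add_one hb.ne']; ring_nf
  have e3 : ‖∫ y in Set.Ioc a b, f' y * (ψ y - y * ρ)‖ ≤
      (2 * Real.pi * c * |t| * b ^ (c - 1) * E) * b := by
    refine (MeasureTheory.norm_setIntegral_le_of_norm_le_const
      (C := 2 * Real.pi * c * |t| * b ^ (c - 1) * E) (by simp) fun y hy => ?_).trans ?_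
    · rw [norm_mul]
      exact mul_le_mul (norm_e_rpow_deriv_le hc (ha.trans hy.1) hy.2) (hΔ y hy.1.le hy.2)
        (norm_nonneg _) (by positivity)
    · rw [MeasureTheory.measureReal_def, Real.volume_Ioc, ENNReal.toReal_ofReal (by linarith)]
      gcongr
      linarith
  have e4 : ∀ x, a ≤ x → x ≤ b → ‖f x * (ψ x - x * ρ)‖ ≤ E := by
    intro x h1 h2
    rw [norm_mul, hf]
    simp only
    rw [norm_e, one_mul]
    exact hΔ x h1 h2
  calc _ ≤ ‖f b * (ψ b - b * ρ)‖ + ‖f a * (ψ a - a * ρ)‖ +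
        ‖∫ y in Set.Ioc a b, f' y * (ψ y - y * ρ)‖ :=
      (norm_sub_le _ _).trans (by gcongr; exact norm_sub_le _ _)
    _ ≤ E + E + (2 * Real.pi * c * |t| * b ^ (c - 1) * E) * b :=
      add_le_add (add_le_add (e4 b hab le_rfl) (e4 a le_rfl hab)) e3
    _ = _ := by rw [hbc]; ring

/-- The first derivative bound for `∫ e(ty^c)`. -/
theorem norm_integral_e_rpow_le {t c a b : ℝ} (hc : 1 ≤ c) (ha : 0 < a) (hab : a ≤ b)
    (ht : t ≠ 0) :
    ‖∫ y in a..b, e (t * y ^ c)‖ ≤ (a ^ (1 - c) / |t|) * (1 + b / a) := by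
  set f : ℝ → ℂ := fun y => e (t * y ^ c) with hf
  set f' : ℝ → ℂ := fun y =>
    2 * Real.pi * Complex.I * t * ((c * y ^ (c - 1) : ℝ) : ℂ) * e (t * y ^ c) with hf'
  have hb : 0 < b := ha.trans_le hab
  have hsub : Set.Icc a b ⊆ Set.Ioi 0 := fun y hy => ha.trans_le hy.1
  have hder : ∀ y, 0 < y → HasDerivAt f (f' y) y := fun y hy => hasDerivAt_e_rpow t c hy
  have hcont' : ContinuousOn f' (Set.Icc a b) := (continuousOn_e_rpow_deriv t c).mono hsub
  have hfc : ContinuousOn f (Set.Icc a b) :=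
    fun y hy => (hder y (hsub hy)).continuousAt.continuousWithinAt
  set κ : ℂ := (2 * Real.pi * Complex.I * t * c)⁻¹ with hκ
  have hκ0 : (2 * Real.pi * Complex.I * t * c : ℂ) ≠ 0 := by
    simp [Real.pi_ne_zero, ht, show c ≠ 0 by linarith]
  have hκn : ‖κ‖ = 1 / (2 * Real.pi * |t| * c) := by
    rw [hκ, norm_inv]
    simp [abs_of_pos Real.pi_pos, abs_of_pos (show 0 < c by linarith)]
  set u : ℝ → ℂ := fun y => κ * ((y ^ (1 - c) : ℝ) : ℂ) with hu
  set u' : ℝ → ℂ := fun y => κ * (((1 - c) * y ^ (1 - c - 1) : ℝ) : ℂ) with hu'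
  have huder : ∀ y, 0 < y → HasDerivAt u (u' y) y := fun y hy =>
    ((Real.hasDerivAt_rpow_const (p := 1 - c) (.inl hy.ne')).ofReal_comp).const_mul κ
  have hu'c : ContinuousOn u' (Set.Icc a b) := by
    refine continuousOn_const.mul (Complex.continuous_ofReal.comp_continuousOn
      (continuousOn_const.mul ?_))
    exact continuousOn_id.rpow_const fun y hy => .inl (ne_of_gt (hsub hy))
  have huc : ContinuousOn u (Set.Icc a b) :=
    fun y hy => (huder y (hsub hy)).continuousAt.continuousWithinAt
  have hii : ∀ {g : ℝ → ℂ}, ContinuousOn g (Set.Icc a b) →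
      IntervalIntegrable g MeasureTheory.volume a b := by
    intro g hg
    apply ContinuousOn.intervalIntegrable
    rwa [Set.uIcc_of_le hab]
  have hparts : ∫ y in a..b, (u' y * f y + u y * f' y) = u b * f b - u a * f a := by
    refine intervalIntegral.integral_deriv_mul_eq_sub_of_hasDerivAt ?_ ?_ ?_ ?_ ?_ ?_
    · rwa [Set.uIcc_of_le hab]
    · rwa [Set.uIcc_of_le hab]
    · intro x hx
      rw [min_eq_left hab] at hx
      exact huder x (ha.trans hx.1)
    · intro x hx
      rw [min_eq_left hab] at hx
      exact hder x (ha.trans hx.1)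
    · exact hii hu'c
    · exact hii hcont'
  rw [intervalIntegral.integral_add (show IntervalIntegrable (fun y => u' y * f y)
    MeasureTheory.volume a b from hii (hu'c.mul hfc))
    (show IntervalIntegrable (fun y => u y * f' y) MeasureTheory.volume a b from
      hii (huc.mul hcont'))] at hparts
  have hfe : ∫ y in a..b, f y = ∫ y in a..b, u y * f' y := by
    refine intervalIntegral.integral_congr fun y hy => ?_
    rw [Set.uIcc_of_le hab] at hy
    have hy0 : 0 < y := hsub hy
    have h1 : ((y ^ (1 - c) : ℝ) : ℂ) * ((y ^ (c - 1) : ℝ) : ℂ) = 1 := by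
      rw [← Complex.ofReal_mul, ← Real.rpow_add hy0]
      simp
    rw [hu, hf']
    simp only
    push_cast at h1 ⊢
    calc f y = (κ * (2 * Real.pi * Complex.I * t * c)) * 1 * f y := by
          rw [hκ, inv_mul_cancel₀ hκ0]; ring
      _ = _ := by rw [← h1, hf]; ring
  rw [hfe, eq_sub_of_add_eq' hparts]
  have hle : ∀ y, a ≤ y → ‖u y * f y‖ ≤ ‖κ‖ * a ^ (1 - c) := by
    intro y hy
    have hy0 : 0 < y := ha.trans_le hy
    rw [norm_mul, hf, hu]
    simp only
    rw [norm_e, mul_one, norm_mul, Complex.norm_real, Real.norm_of_nonneg (by positivity)]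
    gcongr ?_ * ?_
    exact Real.rpow_le_rpow_of_nonpos ha hy (by linarith)
  have hinteg : ‖∫ y in a..b, u' y * f y‖ ≤ ‖κ‖ * (c - 1) * a ^ (1 - c) * (b / a) := by
    refine (intervalIntegral.norm_integral_le_of_norm_le_const
      (C := ‖κ‖ * (c - 1) * a ^ (1 - c - 1)) fun y hy => ?_).trans ?_
    · rw [Set.uIoc_of_le hab] at hy
      have hy0 : 0 < y := ha.trans hy.1
      rw [norm_mul, hf, hu']
      simp only
      rw [norm_e, mul_one, norm_mul, Complex.norm_real, Real.norm_eq_abs, abs_mul,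
        abs_of_nonpos (by linarith : 1 - c ≤ 0), abs_of_nonneg (by positivity), mul_assoc, neg_sub]
      gcongr ?_ * (_ * ?_)
      exact Real.rpow_le_rpow_of_nonpos ha hy.1.le (by linarith)
    · rw [abs_of_nonneg (by linarith), Real.rpow_sub_one ha.ne']
      have : b - a ≤ b := by linarith
      have hc1 : 0 ≤ c - 1 := by linarith
      calc _ ≤ ‖κ‖ * (c - 1) * (a ^ (1 - c) / a) * b := by gcongr
        _ = _ := by ring
  have hA : 0 < a ^ (1 - c) := by positivity
  have hk2 : ‖κ‖ * 2 ≤ 1 / |t| := by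
    rw [hκn, div_mul_eq_mul_div, div_le_div_iff₀ (by positivity) (by positivity)]
    have : 0 < |t| := abs_pos.2 ht
    nlinarith [Real.pi_gt_three, mul_pos this Real.pi_pos, mul_nonneg this.le (sub_nonneg.2 hc)]
  have hk3 : ‖κ‖ * (c - 1) ≤ 1 / |t| := by
    rw [hκn, div_mul_eq_mul_div, div_le_div_iff₀ (by positivity) (by positivity)]
    have : 0 < |t| := abs_pos.2 ht
    have h6 : 6 * (|t| * c) ≤ 2 * Real.pi * |t| * c := by
      nlinarith [Real.pi_gt_three, mul_pos this (show 0 < c by linarith)]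
    nlinarith
  calc _ ≤ ‖u b * f b‖ + ‖u a * f a‖ + ‖∫ y in a..b, u' y * f y‖ :=
      (norm_sub_le _ _).trans (by gcongr; exact norm_sub_le _ _)
    _ ≤ ‖κ‖ * a ^ (1 - c) + ‖κ‖ * a ^ (1 - c) + ‖κ‖ * (c - 1) * a ^ (1 - c) * (b / a) :=
      add_le_add (add_le_add (hle b hab) (hle a le_rfl)) hinteg
    _ = (‖κ‖ * 2) * a ^ (1 - c) + (‖κ‖ * (c - 1)) * (a ^ (1 - c) * (b / a)) := by ring
    _ ≤ 1 / |t| * a ^ (1 - c) + 1 / |t| * (a ^ (1 - c) * (b / a)) := by gcongr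
    _ = _ := by ring

theorem sum_vonMangoldt_mul_eq {q : ℕ} [NeZero q] (F : ZMod q → ℂ) (x : ℝ) :
    ∑ n ∈ Ioc 0 ⌊x⌋₊, (ArithmeticFunction.vonMangoldt n : ℂ) * F (n : ZMod q) =
      ∑ a, F a * (psiAP a x : ℂ) := by
  have hres : ∀ (a : ZMod q) (n : ℕ), ArithmeticFunction.vonMangoldt.residueClass a n =
      if (n : ZMod q) = a then ArithmeticFunction.vonMangoldt n else 0 :=
    fun a n => Set.indicator_apply _ _ _
  unfold psiAP
  simp_rw [hres]
  push_cast
  simp_rw [mul_sum]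
  rw [sum_comm]
  refine sum_congr rfl fun n _ => ?_
  rw [sum_eq_single (n : ZMod q)]
  · rw [if_pos rfl, mul_comm]
  · intro a _ ha
    rw [if_neg ha.symm, Complex.ofReal_zero, mul_zero]
  · simp

theorem psiAP_nonneg {q : ℕ} (a : ZMod q) (x : ℝ) : 0 ≤ psiAP a x :=
  sum_nonneg fun n _ => ArithmeticFunction.vonMangoldt.residueClass_nonneg a n

theorem psiAP_one_eq_sum {q : ℕ} [NeZero q] (x : ℝ) :
    psiAP (1 : ZMod 1) x = ∑ a : ZMod q, psiAP a x := by
  have h1 := sum_vonMangoldt_mul_eq (q := q) (fun _ => 1) x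
  have h2 := sum_vonMangoldt_mul_eq (q := 1) (fun _ => 1) x
  rw [h1] at h2
  have h3 : (∑ a : ZMod q, (psiAP a x : ℂ)) = ∑ a : ZMod 1, (psiAP a x : ℂ) := by
    simpa using h2
  rw [Fintype.sum_subsingleton _ (1 : ZMod 1)] at h3
  exact_mod_cast h3.symm

theorem norm_sum_vonMangoldt_mul_sub_le {q : ℕ} [NeZero q] {F : ZMod q → ℂ} (hF : ∀ a, ‖F a‖ ≤ 1)
    {x E : ℝ} (h1 : |psiAP (1 : ZMod 1) x - x| ≤ E)
    (hE : ∀ a : ZMod q, IsUnit a → |psiAP a x - x / q.totient| ≤ E) :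
    ‖∑ n ∈ Ioc 0 ⌊x⌋₊, (ArithmeticFunction.vonMangoldt n : ℂ) * F (n : ZMod q) -
      x * ((q.totient : ℂ)⁻¹ * ∑ u : (ZMod q)ˣ, F u)‖ ≤ E * (1 + 2 * q.totient) := by
  classical
  have hφ : (0:ℝ) < q.totient := by exact_mod_cast Nat.totient_pos.2 (NeZero.pos q)
  set U : Finset (ZMod q) := univ.filter IsUnit with hU
  have hunits : ∑ u : (ZMod q)ˣ, F u = ∑ a ∈ U, F a := by
    refine sum_nbij (fun u : (ZMod q)ˣ => (u : ZMod q)) (fun u _ => by simp [hU])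
      (fun u _ v _ h => Units.ext h) (fun a ha => ?_) fun _ _ => rfl
    obtain ⟨u, rfl⟩ := (mem_filter.1 ha).2
    exact ⟨u, by simp, rfl⟩
  have hcard : (U.card : ℝ) = q.totient := by
    rw [← ZMod.card_units_eq_totient, ← card_univ]
    congr 1
    symm
    refine card_nbij (fun u : (ZMod q)ˣ => (u : ZMod q)) (fun u _ => by simp [hU])
      (fun u _ v _ h => Units.ext h) (fun a ha => ?_)
    obtain ⟨u, rfl⟩ := (mem_filter.1 ha).2
    exact ⟨u, by simp, rfl⟩
  have hsplit : ∀ {M : Type} [AddCommMonoid M] (G : ZMod q → M),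
      ∑ a, G a = ∑ a ∈ U, G a + ∑ a ∈ univ.filter (fun a => ¬ IsUnit a), G a := fun G =>
    (sum_filter_add_sum_filter_not _ _ _).symm
  have hdef : ∑ a ∈ univ.filter (fun a : ZMod q => ¬ IsUnit a), psiAP a x ≤
      E * (1 + q.totient) := by
    have h2 := psiAP_one_eq_sum (q := q) x
    rw [hsplit] at h2
    have h3 : x - ∑ a ∈ U, psiAP a x ≤ q.totient * E := by
      calc x - ∑ a ∈ U, psiAP a x = ∑ a ∈ U, (x / q.totient - psiAP a x) := by
            rw [sum_sub_distrib, sum_const, nsmul_eq_mul, hcard]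
            field_simp
        _ ≤ ∑ a ∈ U, E := sum_le_sum fun a ha => by
            linarith [(abs_le.1 (hE a (mem_filter.1 ha).2)).1]
        _ = _ := by rw [sum_const, nsmul_eq_mul, hcard]
    linarith [(abs_le.1 h1).2]
  rw [sum_vonMangoldt_mul_eq, hunits, hsplit]
  have hre : ∑ a ∈ U, F a * (psiAP a x : ℂ) + ∑ a ∈ univ.filter (fun a => ¬ IsUnit a),
        F a * (psiAP a x : ℂ) - x * ((q.totient : ℂ)⁻¹ * ∑ a ∈ U, F a) =
      ∑ a ∈ U, F a * ((psiAP a x - x / q.totient : ℝ) : ℂ) +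
        ∑ a ∈ univ.filter (fun a => ¬ IsUnit a), F a * (psiAP a x : ℂ) := by
    have : ∑ a ∈ U, F a * ((psiAP a x - x / q.totient : ℝ) : ℂ) =
        ∑ a ∈ U, F a * (psiAP a x : ℂ) - x * ((q.totient : ℂ)⁻¹ * ∑ a ∈ U, F a) := by
      rw [mul_sum, mul_sum, ← sum_sub_distrib]
      refine sum_congr rfl fun a _ => ?_
      push_cast
      ring
    rw [this]
    ring
  rw [hre]
  calc _ ≤ ∑ a ∈ U, ‖F a * ((psiAP a x - x / q.totient : ℝ) : ℂ)‖ +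
        ∑ a ∈ univ.filter (fun a => ¬ IsUnit a), ‖F a * (psiAP a x : ℂ)‖ :=
      (norm_add_le _ _).trans (add_le_add (norm_sum_le _ _) (norm_sum_le _ _))
    _ ≤ ∑ a ∈ U, E + ∑ a ∈ univ.filter (fun a : ZMod q => ¬ IsUnit a), psiAP a x := by
      refine add_le_add (sum_le_sum fun a ha => ?_) (sum_le_sum fun a _ => ?_)
      · rw [norm_mul, Complex.norm_real, Real.norm_eq_abs, ← one_mul E]
        exact mul_le_mul (hF a) (hE a (mem_filter.1 ha).2) (abs_nonneg _) zero_le_one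
      · rw [norm_mul, Complex.norm_real, Real.norm_of_nonneg (psiAP_nonneg a x)]
        exact mul_le_of_le_one_left (psiAP_nonneg a x) (hF a)
    _ ≤ q.totient * E + E * (1 + q.totient) := by
      rw [sum_const, nsmul_eq_mul, hcard]
      gcongr
    _ = _ := by ring

/-- The Siegel–Walfisz theorem for additive twists. -/
theorem norm_sum_vonMangoldt_mul_e_sub_le (A B : ℕ) : ∃ K, 0 < K ∧ ∀ (d b : ℕ) (x : ℝ), 1 ≤ d →
    16 ≤ x → (d:ℝ) ≤ Real.log x ^ B →
    ‖∑ n ∈ Ioc 0 ⌊x⌋₊, (ArithmeticFunction.vonMangoldt n : ℂ) * e ((n:ℝ) * ((b:ℝ) / d)) -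
      x * reducedAvg d b‖ ≤ K * x / Real.log x ^ A := by
  obtain ⟨K, hK0, hK⟩ := siegel_walfisz (A + B) B
  refine ⟨3 * K, by positivity, fun d b x hd hx hdB => ?_⟩
  have : NeZero d := ⟨by lia⟩
  have hlog : 0 < Real.log x := Real.log_pos (by linarith)
  have hd1 : (1:ℝ) ≤ d := by exact_mod_cast hd
  have h := norm_sum_vonMangoldt_mul_sub_le (q := d)
    (F := fun a => (ZMod.stdAddChar (a * (b : ZMod d)) : ℂ)) (fun a => by simp)
    (by simpa using hK 1 1 x isUnit_one hx (by simpa using hd1.trans hdB))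
    (fun a ha => hK d a x ha hx hdB)
  rw [← sum_reduced_natCast_zmod (fun a => (ZMod.stdAddChar (a * (b : ZMod d)) : ℂ))] at h
  simp only [stdAddChar_natCast_mul_natCast] at h
  refine h.trans ?_
  have hφ : (d.totient : ℝ) ≤ Real.log x ^ B :=
    (by exact_mod_cast Nat.totient_le d : (d.totient : ℝ) ≤ d).trans hdB
  calc _ ≤ K * x / Real.log x ^ (A + B) * (3 * Real.log x ^ B) := by
        gcongr
        linarith
    _ = _ := by
        rw [pow_add]
        field_simp

theorem norm_reducedAvg_le_one {d : ℕ} (b : ℕ) (hd : 1 ≤ d) : ‖reducedAvg d b‖ ≤ 1 := by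
  have : NeZero d := ⟨by lia⟩
  rw [← unitAvg_natCast]
  exact norm_unitAvg_le_one _

/-- The defect of the twisted prime sum on `(μX, X]` at `b / d`. -/
noncomputable def primeDefect (c μ X t : ℝ) (d b : ℕ) : ℂ :=
  expDefect (Ioc ⌊μ * X⌋₊ ⌊X⌋₊) (fun n => (ArithmeticFunction.vonMangoldt n : ℂ) * e (t * (n:ℝ) ^ c))
    (∫ y in (μ * X)..X, e (t * y ^ c)) d b

theorem primeDefect_le_of_small {c μ : ℝ} (hc : 1 ≤ c) (hμ0 : 0 < μ) (hμ1 : μ < 1) (A B : ℕ) :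
    ∃ K, 0 < K ∧ ∀ (X t : ℝ) (d b : ℕ), 16 ≤ μ * X → 1 ≤ d → (d:ℝ) ≤ Real.log (μ * X) ^ B →
      |t| * X ^ c ≤ Real.log (μ * X) ^ B →
      ‖primeDefect c μ X t d b‖ ≤ K * X / Real.log (μ * X) ^ A := by
  obtain ⟨K, hK0, hK⟩ := norm_sum_vonMangoldt_mul_e_sub_le (A + B) B
  refine ⟨K * (2 + 2 * Real.pi * c), by positivity, fun X t d b hX hd hdB ht => ?_⟩
  have hX0 : 0 < X := pos_of_mul_pos_right (by linarith) hμ0.le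
  have hab : μ * X ≤ X := by nlinarith
  set ℓ := Real.log (μ * X) with hℓ
  have hℓ1 : 1 ≤ ℓ := by
    rw [hℓ, Real.le_log_iff_exp_le (by linarith)]
    linarith [Real.exp_one_lt_d9]
  have h := sum_mul_e_sub_integral_le (t := t) (ρ := reducedAvg d b) (E := K * X / ℓ ^ (A + B)) hc
    (by linarith) hab
    (fun n => (ArithmeticFunction.vonMangoldt n : ℂ) * e ((n:ℝ) * ((b:ℝ) / d))) (by simp)
    fun x h1 h2 => by
      have h3 : ℓ ≤ Real.log x := Real.log_le_log (by linarith) h1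
      refine (hK d b x hd (by linarith) (hdB.trans (by gcongr))).trans ?_
      gcongr
  have heq : primeDefect c μ X t d b = (∑ n ∈ Ioc ⌊μ * X⌋₊ ⌊X⌋₊,
      ((ArithmeticFunction.vonMangoldt n : ℂ) * e ((n:ℝ) * ((b:ℝ) / d))) * e (t * (n:ℝ) ^ c)) -
        reducedAvg d b * ∫ y in (μ * X)..X, e (t * y ^ c) := by
    rw [primeDefect, expDefect, expSum, mul_comm (∫ y in (μ * X)..X, e (t * y ^ c))]
    congr 1
    exact sum_congr rfl fun n _ => by ring
  rw [heq]
  have hone : 1 ≤ ℓ ^ B := one_le_pow₀ hℓ1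
  calc _ ≤ K * X / ℓ ^ (A + B) * (2 + 2 * Real.pi * c * (|t| * X ^ c)) := h
    _ ≤ K * X / ℓ ^ (A + B) * (2 * ℓ ^ B + 2 * Real.pi * c * ℓ ^ B) := by
      gcongr
      linarith
    _ = _ := by
      rw [pow_add]
      field_simp

theorem eventually_rpow_mul_log_pow_le {μ : ℝ} (hμ0 : 0 < μ) (hμ1 : μ < 1) (n : ℕ) :
    ∀ᶠ X : ℝ in Filter.atTop, X ^ (2 / 3 : ℝ) * Real.log (μ * X) ^ n ≤ μ * X / 2 := by
  have h := (isLittleO_log_rpow_rpow_atTop (n : ℝ) (show (0:ℝ) < 1 / 3 by norm_num)).bound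
    (show 0 < μ / 2 by positivity)
  filter_upwards [h, Filter.eventually_ge_atTop (1 / μ)] with X h1 h2
  have hX1 : 1 ≤ μ * X := by rwa [div_le_iff₀' hμ0] at h2
  have hX0 : 0 < X := pos_of_mul_pos_right (by linarith) hμ0.le
  have hab : μ * X ≤ X := by nlinarith
  have h3 : Real.log (μ * X) ^ n ≤ Real.log X ^ n := by
    have := Real.log_nonneg hX1
    gcongr
  rw [Real.rpow_natCast, Real.norm_of_nonneg (pow_nonneg (Real.log_nonneg (hX1.trans hab)) _),
    Real.norm_of_nonneg (by positivity)] at h1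
  have h4 : X ^ (2 / 3 : ℝ) * X ^ (1 / 3 : ℝ) = X := by
    rw [← Real.rpow_add hX0]
    norm_num
  calc _ ≤ X ^ (2 / 3 : ℝ) * (μ / 2 * X ^ (1 / 3 : ℝ)) := by
        gcongr
        exact h3.trans h1
    _ = μ / 2 * (X ^ (2 / 3 : ℝ) * X ^ (1 / 3 : ℝ)) := by ring
    _ = _ := by rw [h4]; ring

theorem norm_integral_e_rpow_le_of_large {c μ X t ℓ : ℝ} (hc : 1 ≤ c) (hμ0 : 0 < μ) (hμ1 : μ < 1)
    (hX : 0 < X) (hℓ : 0 < ℓ) (ht : ℓ ≤ |t| * X ^ c) :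
    ‖∫ y in (μ * X)..X, e (t * y ^ c)‖ ≤ μ ^ (1 - c) * (1 + 1 / μ) * X / ℓ := by
  have ht0 : 0 < |t| := by
    rcases (abs_nonneg t).lt_or_eq with h | h
    · exact h
    · rw [← h, zero_mul] at ht; linarith
  refine (norm_integral_e_rpow_le hc (by positivity) (by nlinarith) (abs_pos.1 ht0)).trans ?_
  have h1 : (μ * X) ^ (1 - c) = μ ^ (1 - c) * (X / X ^ c) := by
    rw [Real.mul_rpow hμ0.le hX.le, Real.rpow_sub hX, Real.rpow_one]
  have hXc : 0 < X ^ c := by positivity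
  calc _ = μ ^ (1 - c) * (1 + 1 / μ) * X / (|t| * X ^ c) := by
        rw [h1]
        field_simp
    _ ≤ _ := by gcongr

theorem primeDefect_le_of_large {c μ : ℝ} (hc1 : 1 < c) (hc3 : c < 3) (hμ0 : 0 < μ) (hμ1 : μ < 1)
    (A : ℕ) : ∃ K, 0 < K ∧ ∃ X₀ : ℝ, ∀ X, X₀ ≤ X → ∀ t : ℝ, |t| * X ^ c ≤ X ^ (2 / 3 : ℝ) →
      Real.log (μ * X) ^ (12 * A + 25) ≤ |t| * X ^ c → ∀ d b : ℕ, 1 ≤ d →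
      ‖primeDefect c μ X t d b‖ ≤ K * X / Real.log (μ * X) ^ A := by
  have hR : 1 ≤ 2 / μ := by rw [le_div_iff₀ hμ0]; linarith
  obtain ⟨C, hC0, hC⟩ := prime_exp_sum_bound hc1 hc3 hR
  refine ⟨18 * C + μ ^ (1 - c) * (1 + 1 / μ), by positivity, ?_⟩
  have hloglim : Filter.Tendsto (fun X : ℝ => Real.log (μ * X)) Filter.atTop Filter.atTop :=
    Real.tendsto_log_atTop.comp (Filter.tendsto_id.const_mul_atTop hμ0)
  have hev : ∀ᶠ X : ℝ in Filter.atTop, ∀ t : ℝ, |t| * X ^ c ≤ X ^ (2 / 3 : ℝ) →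
      Real.log (μ * X) ^ (12 * A + 25) ≤ |t| * X ^ c → ∀ d b : ℕ, 1 ≤ d →
      ‖primeDefect c μ X t d b‖ ≤
        (18 * C + μ ^ (1 - c) * (1 + 1 / μ)) * X / Real.log (μ * X) ^ A := by
    filter_upwards [eventually_rpow_mul_log_pow_le hμ0 hμ1 (12 * A + 24),
      Filter.eventually_ge_atTop (16 / μ ^ 2), Filter.eventually_ge_atTop (2 / (1 - μ)),
      hloglim.eventually_ge_atTop ((2 / μ) ^ c)] with X h1 h2 h3 h4 t ht1 ht2 d b hd
    set ℓ := Real.log (μ * X) with hℓ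
    rw [div_le_iff₀ (by positivity)] at h2
    rw [div_le_iff₀ (by linarith)] at h3
    have hX0 : 0 < X := by
      by_contra! h
      nlinarith [sq_nonneg μ]
    have hμX : 16 ≤ μ * X := by nlinarith [mul_pos hμ0 hX0]
    have hab : μ * X ≤ X := by nlinarith
    have hℓ1 : 1 ≤ ℓ := by
      rw [hℓ, Real.le_log_iff_exp_le (by linarith)]
      linarith [Real.exp_one_lt_d9]
    have hlogX : Real.log X ≤ 2 * ℓ := by
      rw [hℓ, ← Real.log_rpow (by linarith)]
      refine Real.log_le_log hX0 ?_
      rw [Real.rpow_two]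
      nlinarith
    have hXc : 0 < X ^ c := by positivity
    have ht0 : 0 < |t| := by
      rcases (abs_nonneg t).lt_or_eq with h | h
      · exact h
      · rw [← h, zero_mul] at ht2
        linarith [one_le_pow₀ hℓ1 (n := 12 * A + 25)]
    set N₀ := ⌊μ * X⌋₊ with hN₀
    set N₁ := ⌊X⌋₊ with hN₁
    have hN0a : (N₀:ℝ) ≤ μ * X := Nat.floor_le (by linarith)
    have hN0b : μ * X / 2 ≤ N₀ := by linarith [Nat.lt_floor_add_one (μ * X)]
    have hN1a : (N₁:ℝ) ≤ X := Nat.floor_le hX0.le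
    have hlt : N₀ < N₁ := by
      have : (N₀:ℝ) < N₁ := by linarith [Nat.lt_floor_add_one X]
      exact_mod_cast this
    set k := A + 2 with hk
    have hp1 : 1 ≤ ℓ ^ (2 * k) := one_le_pow₀ hℓ1
    set U := ⌊ℓ ^ (2 * k)⌋₊ with hU
    have hU1 : 1 ≤ U := Nat.le_floor (by simpa using hp1)
    have hUa : (U:ℝ) ≤ ℓ ^ (2 * k) := Nat.floor_le (by positivity)
    have hUb : ℓ ^ (2 * k) / 2 ≤ U := by
      have : (1:ℝ) ≤ U := by exact_mod_cast hU1
      linarith [Nat.lt_floor_add_one (ℓ ^ (2 * k))]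
    have hU6 : (U:ℝ) ^ 6 ≤ ℓ ^ (12 * A + 24) := by
      calc (U:ℝ) ^ 6 ≤ (ℓ ^ (2 * k)) ^ 6 := by gcongr
        _ = _ := by rw [← pow_mul, hk]; ring_nf
    have hb := hC t ((b:ℝ) / d) N₀ N₁ U (abs_pos.1 ht0) hU1 hlt
      (by
        refine le_trans ?_ hN0b
        have : μ * (8 / μ) ≤ μ * X / 2 := by
          rw [mul_div_cancel₀ _ hμ0.ne']
          linarith
        have h5 : 8 / μ ≤ μ * X / 2 := by
          rw [div_le_iff₀ hμ0]; nlinarith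
        linarith [show 4 * (2 / μ) = 8 / μ by ring])
      (by
        calc (N₁:ℝ) ≤ 2 / μ * (μ * X / 2) := by
              rw [show 2 / μ * (μ * X / 2) = X by field_simp]; exact hN1a
          _ ≤ _ := by gcongr)
      (by
        have h5 : X ^ c = (2 / μ) ^ c * (μ * X / 2) ^ c := by
          rw [← Real.mul_rpow (by positivity) (by positivity)]
          congr 1
          field_simp
        have h6 : ℓ ^ (12 * A + 24) * (2 / μ) ^ c ≤ (|t| * (μ * X / 2) ^ c) * (2 / μ) ^ c := by
          calc _ ≤ ℓ ^ (12 * A + 24) * ℓ := by gcongr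
            _ = ℓ ^ (12 * A + 25) := (pow_succ _ _).symm
            _ ≤ |t| * X ^ c := ht2
            _ = _ := by rw [h5]; ring
        calc (U:ℝ) ^ 6 ≤ ℓ ^ (12 * A + 24) := hU6
          _ ≤ |t| * (μ * X / 2) ^ c := le_of_mul_le_mul_right h6 (by positivity)
          _ ≤ _ := by gcongr)
      (by
        calc |t| * (N₀:ℝ) ^ c * (U:ℝ) ^ 6 ≤ |t| * X ^ c * ℓ ^ (12 * A + 24) := by
              gcongr
              linarith
          _ ≤ X ^ (2 / 3 : ℝ) * ℓ ^ (12 * A + 24) := by gcongr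
          _ ≤ N₀ := h1.trans hN0b)
    have hsum : expSum (Ioc N₀ N₁) (fun n => (ArithmeticFunction.vonMangoldt n : ℂ) *
        e (t * (n:ℝ) ^ c)) ((b:ℝ) / d) = ∑ n ∈ Ioc N₀ N₁,
          (ArithmeticFunction.vonMangoldt n : ℂ) * e (t * (n:ℝ) ^ c + (b:ℝ) / d * n) := by
      refine sum_congr rfl fun n _ => ?_
      rw [e_add, mul_assoc, mul_comm ((b:ℝ) / d)]
    have hsqrt : ℓ ^ k / 2 ≤ √U := by
      refine Real.le_sqrt_of_sq_le ?_
      calc (ℓ ^ k / 2) ^ 2 = ℓ ^ (2 * k) / 4 := by rw [div_pow, ← pow_mul, mul_comm k]; norm_num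
        _ ≤ _ := by linarith
    have hmain : ‖expSum (Ioc N₀ N₁) (fun n => (ArithmeticFunction.vonMangoldt n : ℂ) *
        e (t * (n:ℝ) ^ c)) ((b:ℝ) / d)‖ ≤ 18 * C * X / ℓ ^ A := by
      rw [hsum]
      refine hb.trans ?_
      have hl0 : 0 ≤ Real.log N₁ := Real.log_natCast_nonneg _
      have hl1 : 1 + Real.log N₁ ≤ 3 * ℓ := by
        have : Real.log N₁ ≤ Real.log X :=
          Real.log_le_log (by exact_mod_cast (Nat.zero_le _).trans_lt hlt) hN1a
        linarith
      calc _ ≤ C * (3 * ℓ) ^ 2 * X / (ℓ ^ k / 2) := by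
            gcongr
            linarith
        _ = _ := by
            rw [hk, pow_add]
            field_simp
            norm_num
    have hinteg : ‖(∫ y in (μ * X)..X, e (t * y ^ c)) * reducedAvg d b‖ ≤
        μ ^ (1 - c) * (1 + 1 / μ) * X / ℓ ^ A := by
      rw [norm_mul]
      calc _ ≤ (μ ^ (1 - c) * (1 + 1 / μ) * X / ℓ ^ A) * 1 :=
            mul_le_mul (norm_integral_e_rpow_le_of_large hc1.le hμ0 hμ1 hX0 (by positivity)
              ((pow_le_pow_right₀ hℓ1 (by lia)).trans ht2)) (norm_reducedAvg_le_one b hd)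
              (norm_nonneg _) (by positivity)
        _ = _ := mul_one _
    rw [primeDefect, expDefect]
    refine (norm_sub_le _ _).trans ((add_le_add hmain hinteg).trans_eq ?_)
    ring
  obtain ⟨X₀, hX₀⟩ := Filter.eventually_atTop.1 hev
  exact ⟨X₀, hX₀⟩

/-- The defect of the twisted prime sum saves an arbitrary power of the logarithm. -/
theorem primeDefect_le {c μ : ℝ} (hc1 : 1 < c) (hc3 : c < 3) (hμ0 : 0 < μ) (hμ1 : μ < 1)
    (A B : ℕ) : ∃ K, 0 < K ∧ ∃ X₀ : ℝ, ∀ X, X₀ ≤ X → ∀ t : ℝ, |t| * X ^ c ≤ X ^ (2 / 3 : ℝ) →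
      ∀ d b : ℕ, 1 ≤ d → (d:ℝ) ≤ Real.log (μ * X) ^ B →
      ‖primeDefect c μ X t d b‖ ≤ K * X / Real.log (μ * X) ^ A := by
  obtain ⟨K₁, hK₁, h₁⟩ := primeDefect_le_of_small hc1.le hμ0 hμ1 A (12 * A + 25 + B)
  obtain ⟨K₂, hK₂, X₂, h₂⟩ := primeDefect_le_of_large hc1 hc3 hμ0 hμ1 A
  refine ⟨max K₁ K₂, lt_max_of_lt_left hK₁, max (16 / μ) X₂, fun X hX t ht d b hd hdB => ?_⟩
  have hμX : 16 ≤ μ * X := by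
    have := (le_max_left _ _).trans hX
    rwa [div_le_iff₀' hμ0] at this
  have hX0 : 0 < X := pos_of_mul_pos_right (by linarith) hμ0.le
  have hℓ1 : 1 ≤ Real.log (μ * X) := by
    rw [Real.le_log_iff_exp_le (by linarith)]
    linarith [Real.exp_one_lt_d9]
  rcases le_total (Real.log (μ * X) ^ (12 * A + 25)) (|t| * X ^ c) with h | h
  · refine (h₂ X ((le_max_right _ _).trans hX) t ht h d b hd).trans ?_
    gcongr
    exact le_max_right _ _
  · refine (h₁ X t d b hμX hd (hdB.trans (pow_le_pow_right₀ hℓ1 (by lia)))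
      (h.trans (pow_le_pow_right₀ hℓ1 (by lia)))).trans ?_
    gcongr
    exact le_max_left _ _

theorem sum_norm_sq_vonMangoldt_le {X : ℝ} (hX : 1 ≤ X) (s : Finset ℕ) (hs : s ⊆ Ioc 0 ⌊X⌋₊)
    (θ : ℕ → ℝ) :
    ∑ n ∈ s, ‖(ArithmeticFunction.vonMangoldt n : ℂ) * e (θ n)‖ ^ 2 ≤
      (Real.log 4 + 4) * X * Real.log X := by
  have hlog : 0 ≤ Real.log X := Real.log_nonneg hX
  calc _ ≤ ∑ n ∈ s, Real.log X * ArithmeticFunction.vonMangoldt n := by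
        refine sum_le_sum fun n hn => ?_
        have hn' := mem_Ioc.1 (hs hn)
        rw [norm_mul, norm_e, mul_one, Complex.norm_real,
          Real.norm_of_nonneg ArithmeticFunction.vonMangoldt_nonneg, sq]
        gcongr
        refine ArithmeticFunction.vonMangoldt_le_log.trans ?_
        exact Real.log_le_log (by exact_mod_cast hn'.1)
          ((Nat.le_floor_iff (by linarith)).1 hn'.2)
    _ ≤ ∑ n ∈ Ioc 0 ⌊X⌋₊, Real.log X * ArithmeticFunction.vonMangoldt n :=
      sum_le_sum_of_subset_of_nonneg hs fun n _ _ =>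
        mul_nonneg hlog ArithmeticFunction.vonMangoldt_nonneg
    _ = Real.log X * Chebyshev.psi X := by rw [← mul_sum, Chebyshev.psi]
    _ ≤ Real.log X * ((Real.log 4 + 4) * X) := by
      gcongr
      exact Chebyshev.psi_le_const_mul_self (by linarith)
    _ = _ := by ring

theorem variance_bound_le {ℓ L X Q W P N R Z M C₀ K lP : ℝ} {k : ℕ} (hℓ1 : 1 ≤ ℓ) (hℓL : ℓ ≤ L)
    (hX : 0 < X) (hW : 0 ≤ W)
    (hQ : X ≤ Q * (W * ℓ ^ k)) (hQ0 : 0 ≤ Q) (hPQ : P ≤ Q) (hN : N ≤ X)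
    (hR1 : ℓ ^ (k + 3) / 2 ≤ R) (hR2 : R ≤ ℓ ^ (k + 3)) (hlP0 : 0 ≤ lP) (hlP : lP ≤ 2 * ℓ)
    (hZ0 : 0 ≤ Z) (hZ : Z ≤ C₀ * X * L) (hM0 : 0 ≤ M) (hM : M ≤ K * X / ℓ ^ (k + 3)) :
    (800 * P + 200 * (N / R) * (1 + lP)) * Z +
        (1 + lP) * (4 * X ^ 2 * (1 + 2 * lP) / R + R * M ^ 2) ≤
      (800 * C₀ + 1200 * W * C₀ + 120 * W + 3 * K ^ 2 * W) * (X * Q * L) := by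
  have hℓ0 : 0 < ℓ := by linarith
  have hL1 : 1 ≤ L := hℓ1.trans hℓL
  have hR0 : 0 < R := lt_of_lt_of_le (by positivity) hR1
  have hXR : X / R ≤ 2 * (Q * W) / ℓ ^ 3 := by
    calc X / R ≤ Q * (W * ℓ ^ k) / (ℓ ^ (k + 3) / 2) := by gcongr
      _ = _ := by
        rw [pow_add]
        field_simp
  have h1l : 1 + lP ≤ 3 * ℓ := by linarith
  have h2l : 1 + 2 * lP ≤ 5 * ℓ := by linarith
  have t2 : N / R * (1 + lP) ≤ 6 * (Q * W) := by
    calc _ ≤ X / R * (1 + lP) := by gcongr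
      _ ≤ 2 * (Q * W) / ℓ ^ 3 * (3 * ℓ) := by gcongr
      _ = 6 * (Q * W) / ℓ ^ 2 := by field_simp; ring
      _ ≤ _ := div_le_self (by positivity) (one_le_pow₀ hℓ1)
  have t3 : (1 + lP) * (4 * X ^ 2 * (1 + 2 * lP) / R) ≤ 120 * W * (X * Q) := by
    calc _ = X / R * (4 * X * (1 + 2 * lP) * (1 + lP)) := by field_simp
      _ ≤ 2 * (Q * W) / ℓ ^ 3 * (4 * X * (5 * ℓ) * (3 * ℓ)) := by gcongr
      _ = 120 * W * (X * Q) / ℓ := by field_simp; ring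
      _ ≤ _ := div_le_self (by positivity) hℓ1
  have t4 : (1 + lP) * (R * M ^ 2) ≤ 3 * K ^ 2 * W * (X * Q) := by
    calc _ ≤ 3 * ℓ * (ℓ ^ (k + 3) * (K * X / ℓ ^ (k + 3)) ^ 2) := by gcongr
      _ = 3 * K ^ 2 * X * X / (ℓ ^ k * ℓ ^ 2) := by
        rw [pow_add]
        field_simp
      _ ≤ 3 * K ^ 2 * X * (Q * (W * ℓ ^ k)) / (ℓ ^ k * ℓ ^ 2) := by gcongr
      _ = 3 * K ^ 2 * W * (X * Q) / ℓ ^ 2 := by field_simp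
      _ ≤ _ := div_le_self (by positivity) (one_le_pow₀ hℓ1)
  calc _ = (800 * P + 200 * (N / R * (1 + lP))) * Z +
        ((1 + lP) * (4 * X ^ 2 * (1 + 2 * lP) / R) + (1 + lP) * (R * M ^ 2)) := by ring
    _ ≤ (800 * Q + 200 * (6 * (Q * W))) * (C₀ * X * L) +
        (120 * W * (X * Q) + 3 * K ^ 2 * W * (X * Q)) := by
      refine add_le_add ?_ (add_le_add t3 t4)
      refine mul_le_mul ?_ hZ hZ0 (by positivity)
      gcongr
    _ = (800 * C₀ + 1200 * W * C₀) * (X * Q * L) +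
        (120 * W + 3 * K ^ 2 * W) * (X * Q) * 1 := by ring
    _ ≤ (800 * C₀ + 1200 * W * C₀) * (X * Q * L) +
        (120 * W + 3 * K ^ 2 * W) * (X * Q) * L := by gcongr
    _ = _ := by ring

/-- Barban–Davenport–Halberstam type theorem for exponential sums over primes. -/
theorem bdh_exponential_sums_primes (c μ A : ℝ) (hc1 : 1 < c) (hc3 : c < 3)
    (hc2 : c ≠ 2) (hμ0 : 0 < μ) (hμ1 : μ < 1) (hA : 0 < A) :
    ∃ δ₀ > 0, ∀ δ : ℝ, 0 < δ → δ ≤ δ₀ →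
      ∃ C > 0, ∃ X₀ : ℝ, ∀ X : ℝ, X₀ ≤ X →
        ∀ t : ℝ, |t| ≤ X ^ (2 / 3 - c - δ) →
          ∀ Q : ℝ, X / Real.log X ^ A ≤ Q → Q ≤ X →
            ∑ q ∈ Icc 1 ⌊Q⌋₊, ∑ a ∈ (Icc 1 q).filter (fun a => Nat.Coprime a q),
                ‖(∑ n ∈ Ioc ⌊μ * X⌋₊ ⌊X⌋₊,
                      if (n : ZMod q) = (a : ZMod q) then
                        (ArithmeticFunction.vonMangoldt n : ℂ) * e (t * (n : ℝ) ^ c)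
                      else 0)
                    - (1 / (Nat.totient q : ℂ)) * ∫ y in (μ * X)..X, e (t * y ^ c)‖ ^ 2
              ≤ C * (X * Q * Real.log X) := by
  refine ⟨1, one_pos, fun δ hδ _ => ?_⟩
  set k := ⌈A⌉₊ with hk
  obtain ⟨K, hK0, X₁, hK⟩ := primeDefect_le hc1 hc3 hμ0 hμ1 (k + 3) (k + 3)
  have hC₀ : 0 < Real.log 4 + 4 := by
    have := Real.log_nonneg (show (1:ℝ) ≤ 4 by norm_num)
    linarith
  refine ⟨800 * (Real.log 4 + 4) + 1200 * 2 ^ k * (Real.log 4 + 4) + 120 * 2 ^ k +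
    3 * K ^ 2 * 2 ^ k, by positivity, max (16 / μ ^ 2) X₁, fun X hX t ht Q hXQ hQX => ?_⟩
  have hX2 := (le_max_left _ _).trans hX
  rw [div_le_iff₀ (by positivity)] at hX2
  have hX0 : 0 < X := by
    by_contra! h
    nlinarith [sq_nonneg μ]
  have hμX : 16 ≤ μ * X := by nlinarith [mul_pos hμ0 hX0]
  have hab : μ * X ≤ X := by nlinarith
  set ℓ := Real.log (μ * X) with hℓ
  set L := Real.log X with hL
  have hℓ1 : 1 ≤ ℓ := by
    rw [hℓ, Real.le_log_iff_exp_le (by linarith)]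
    linarith [Real.exp_one_lt_d9]
  have hℓL : ℓ ≤ L := Real.log_le_log (by linarith) hab
  have hL2 : L ≤ 2 * ℓ := by
    rw [hℓ, ← Real.log_rpow (by linarith)]
    refine Real.log_le_log hX0 ?_
    rw [Real.rpow_two]
    nlinarith
  have hL1 : 1 ≤ L := hℓ1.trans hℓL
  have hQ0 : 0 ≤ Q := le_trans (by positivity) hXQ
  have htX : |t| * X ^ c ≤ X ^ (2 / 3 : ℝ) := by
    calc _ ≤ X ^ (2 / 3 - c - δ) * X ^ c := by gcongr
      _ = X ^ (2 / 3 - δ) := by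
        rw [← Real.rpow_add hX0]
        ring_nf
      _ ≤ _ := Real.rpow_le_rpow_of_exponent_le (by linarith) (by linarith)
  have hXW : X ≤ Q * (2 ^ k * ℓ ^ k) := by
    rw [div_le_iff₀ (by positivity)] at hXQ
    refine hXQ.trans ?_
    gcongr
    calc L ^ A ≤ L ^ (k : ℝ) := Real.rpow_le_rpow_of_exponent_le hL1 (Nat.le_ceil A)
      _ = L ^ k := Real.rpow_natCast _ _
      _ ≤ (2 * ℓ) ^ k := by gcongr
      _ = _ := mul_pow _ _ _
  have hp1 : 1 ≤ ℓ ^ (k + 3) := one_le_pow₀ hℓ1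
  set R := ⌊ℓ ^ (k + 3)⌋₊ with hR
  have hR1 : 1 ≤ R := Nat.le_floor (by simpa using hp1)
  have hRa : (R:ℝ) ≤ ℓ ^ (k + 3) := Nat.floor_le (by positivity)
  have hRb : ℓ ^ (k + 3) / 2 ≤ R := by
    have : (1:ℝ) ≤ R := by exact_mod_cast hR1
    linarith [Nat.lt_floor_add_one (ℓ ^ (k + 3))]
  have hI : ‖∫ y in (μ * X)..X, e (t * y ^ c)‖ ≤ X := by
    refine (intervalIntegral.norm_integral_le_of_norm_le_const (C := 1)
      fun y _ => (norm_e _).le).trans ?_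
    rw [abs_of_nonneg (by linarith)]
    linarith [mul_pos hμ0 hX0]
  have hP : ((⌊Q⌋₊ : ℕ) : ℝ) ≤ Q := Nat.floor_le hQ0
  have hlP : Real.log ⌊Q⌋₊ ≤ 2 * ℓ := by
    rcases Nat.eq_zero_or_pos ⌊Q⌋₊ with h | h
    · rw [h, Nat.cast_zero, Real.log_zero]
      linarith
    · exact (Real.log_le_log (by exact_mod_cast h) (hP.trans hQX)).trans hL2
  have hv := variance_le (R := R) (N := ⌊X⌋₊) (X := ⌊Q⌋₊) (J := X)
    (M := K * X / ℓ ^ (k + 3)) hR1 (Ioc ⌊μ * X⌋₊ ⌊X⌋₊) (fun n hn => (mem_Ioc.1 hn).2)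
    (Nat.le_floor (by norm_num; linarith))
    (fun n => (ArithmeticFunction.vonMangoldt n : ℂ) * e (t * (n : ℝ) ^ c))
    (∫ y in (μ * X)..X, e (t * y ^ c)) hI fun d b hd _ => by
      have hd' := mem_Icc.1 hd
      exact hK X ((le_max_right _ _).trans hX) t htX d b hd'.1
        ((by exact_mod_cast hd'.2 : (d:ℝ) ≤ R).trans hRa)
  refine hv.trans (variance_bound_le hℓ1 hℓL hX0 (by positivity) hXW hQ0
    hP (Nat.floor_le hX0.le) hRb hRa (Real.log_natCast_nonneg _) hlP
    (sum_nonneg fun _ _ => by positivity)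
    (sum_norm_sq_vonMangoldt_le (by linarith) _ (Ioc_subset_Ioc_left (Nat.zero_le _)) _)
    (by positivity) le_rfl)
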